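/- (L³ ε-regularity) For each q ∈ (5,6] and C̄ > 0 there exists ε̄_q ∈ (0,1), depending only on q and C̄, such that for every z̄ = (x̄,t̄) ∈ ℝ³×ℝ the following holds uniformly in ρ̄ ∈ (0,1]: if (u,d,p) satisfies the Q₁(z̄)-hypotheses with constants C̄, ρ̄, and if E_{3,q} := ∫∫_{Q₁(z̄)} (|u|³+|∇d|³+|p|^{3/2}+|d|^q|∇d|^{3(1−q/6)}) dz ≤ ε̄_q, then u and ∇d are essentially bounded on Q_{1/2}(z̄) with ‖u‖_{L^∞(Q_{1/2}(z̄))} ≤ ε̄_q^{2/9} and ‖∇d‖_{L^∞(Q_{1/2}(z̄))} ≤ ε̄_q^{2/9}. -/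

import Mathlib

open MeasureTheory Set Filter
open scoped ENNReal NNReal

noncomputable section

abbrev E3 : Type := EuclideanSpace ℝ (Fin 3)

/-- Space-time `ℝ³ × ℝ`. -/
abbrev SpT : Type := E3 × ℝ

/-- Spatial partial derivative `∂_j` of a function on space-time. -/
def sderiv (j : Fin 3) (ψ : SpT → ℝ) (z : SpT) : ℝ :=
  fderiv ℝ ψ z ((EuclideanSpace.single j 1 : E3), (0 : ℝ))

/-- Time derivative `∂_t` of a function on space-time. -/
def tderiv (ψ : SpT → ℝ) (z : SpT) : ℝ :=
  fderiv ℝ ψ z ((0 : E3), (1 : ℝ))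

/-- Spatial Laplacian of a function on space-time. -/
def sLap (ψ : SpT → ℝ) (z : SpT) : ℝ := ∑ j, sderiv j (sderiv j ψ) z

/-- `ψ ∈ C_c^∞(U)`. -/
def IsTestOn (U : Set SpT) (ψ : SpT → ℝ) : Prop :=
  ContDiff ℝ (⊤ : ℕ∞) ψ ∧ HasCompactSupport ψ ∧ tsupport ψ ⊆ U

/-- `g` is the weak spatial gradient of `f` on `U`. -/
def WeakSGrad (U : Set SpT) (f : SpT → ℝ) (g : Fin 3 → SpT → ℝ) : Prop :=
  ∀ (j : Fin 3) (ψ : SpT → ℝ), IsTestOn U ψ →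
    ∫ z in U, f z * sderiv j ψ z = - ∫ z in U, g j z * ψ z

/-- Squared Frobenius norm of a `3×3` array, e.g. `|∇v|² = Σ_{i,j} (∂_j v_i)²`. -/
def nsq2 (M : Fin 3 → Fin 3 → ℝ) : ℝ := ∑ i, ∑ j, (M i j) ^ 2

/-- Squared norm of a `3×3×3` array, e.g. `|∇²d|² = Σ_{i,j,k} (∂_j ∂_k d_i)²`. -/
def nsq3 (A : Fin 3 → Fin 3 → Fin 3 → ℝ) : ℝ := ∑ i, ∑ j, ∑ k, (A i j k) ^ 2

/-- Open Euclidean ball in `ℝ³`. -/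
def ball3 (x : E3) (r : ℝ) : Set E3 := Metric.ball x r

/-- Parabolic cylinder `Q_r(z₀) = B_r(x₀) × (t₀ - r², t₀)`. -/
def Qcyl (z : SpT) (r : ℝ) : Set SpT := ball3 z.1 r ×ˢ Ioo (z.2 - r ^ 2) z.2

/-- Centered parabolic cylinder `Q*_r(z₀) = B_r(x₀) × (t₀ - (7/8)r², t₀ + (1/8)r²)`. -/
def Qstar (z : SpT) (r : ℝ) : Set SpT :=
  ball3 z.1 r ×ˢ Ioo (z.2 - 7 / 8 * r ^ 2) (z.2 + 1 / 8 * r ^ 2)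

/-- The time interval `I*_r(t₀) = (t₀ - (7/8)r², t₀ + (1/8)r²)`. -/
def Istar (t₀ r : ℝ) : Set ℝ := Ioo (t₀ - 7 / 8 * r ^ 2) (t₀ + 1 / 8 * r ^ 2)

/-- `u` is weakly divergence free on `U`. -/
def DivFreeOn (U : Set SpT) (u : SpT → E3) : Prop :=
  ∀ ψ : SpT → ℝ, IsTestOn U ψ → ∫ z in U, ∑ j, u z j * sderiv j ψ z = 0

/-- The weak pressure equation `-Δp = ∇·(∇ᵀ·(u⊗u + ∇d⊙∇d))` on `U`. -/
def PressureEqOn (U : Set SpT) (u : SpT → E3) (p : SpT → ℝ)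
    (Dd : SpT → Fin 3 → Fin 3 → ℝ) : Prop :=
  ∀ ψ : SpT → ℝ, IsTestOn U ψ →
    -∫ z in U, p z * sLap ψ z =
      ∫ z in U, ∑ i, ∑ j, (u z i * u z j + ∑ k, Dd z k i * Dd z k j) *
        sderiv i (sderiv j ψ) z

/-- The `Q₁(z̄)`-regularity of `(u,d,p)`, with weak spatial gradients `Du`, `Dd`, `D2d`
(`Du z i j = ∂_j u_i`, `Dd z i j = ∂_j d_i`, `D2d z i j k = ∂_j ∂_k d_i`). -/
structure QReg (xb : E3) (tb : ℝ) (u d : SpT → E3) (p : SpT → ℝ)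
    (Du Dd : SpT → Fin 3 → Fin 3 → ℝ) (D2d : SpT → Fin 3 → Fin 3 → Fin 3 → ℝ) : Prop where
  meas_u : Measurable u
  meas_d : Measurable d
  meas_p : Measurable p
  meas_Du : Measurable Du
  meas_Dd : Measurable Dd
  meas_D2d : Measurable D2d
  grad_u : ∀ i : Fin 3, WeakSGrad (Qcyl (xb, tb) 1) (fun z => u z i) (fun j z => Du z i j)
  grad_d : ∀ i : Fin 3, WeakSGrad (Qcyl (xb, tb) 1) (fun z => d z i) (fun j z => Dd z i j)
  grad_Dd : ∀ i k : Fin 3,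
    WeakSGrad (Qcyl (xb, tb) 1) (fun z => Dd z i k) (fun j z => D2d z i j k)
  linf_u : ∃ M : ℝ, ∀ᵐ t ∂(volume.restrict (Ioo (tb - 1) tb)),
    ∫ x in ball3 xb 1, ‖u (x, t)‖ ^ 2 ≤ M
  linf_d : ∃ M : ℝ, ∀ᵐ t ∂(volume.restrict (Ioo (tb - 1) tb)),
    ∫ x in ball3 xb 1, ‖d (x, t)‖ ^ 2 ≤ M
  linf_Dd : ∃ M : ℝ, ∀ᵐ t ∂(volume.restrict (Ioo (tb - 1) tb)),
    ∫ x in ball3 xb 1, nsq2 (Dd (x, t)) ≤ M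
  l2_Du : IntegrableOn (fun z => nsq2 (Du z)) (Qcyl (xb, tb) 1)
  l2_Dd : IntegrableOn (fun z => nsq2 (Dd z)) (Qcyl (xb, tb) 1)
  l2_D2d : IntegrableOn (fun z => nsq3 (D2d z)) (Qcyl (xb, tb) 1)
  l32_p : IntegrableOn (fun z => |p z| ^ ((3 : ℝ) / 2)) (Qcyl (xb, tb) 1)

/-- The local energy inequality on `Q₁(z̄)` with constants `Cb` and `ρb`. -/
def LocalEnergyQ (xb : E3) (tb Cb ρb : ℝ) (u d : SpT → E3) (p : SpT → ℝ)
    (Du Dd : SpT → Fin 3 → Fin 3 → ℝ) (D2d : SpT → Fin 3 → Fin 3 → Fin 3 → ℝ) : Prop :=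
  ∀ᵐ t ∂(volume.restrict (Ioo (tb - 1) tb)), ∀ φ : SpT → ℝ,
    ContDiff ℝ (⊤ : ℕ∞) φ → HasCompactSupport φ →
    tsupport φ ⊆ ball3 xb 1 ×ˢ Ioi (tb - 1) → (∀ z, 0 ≤ φ z) →
    (∫ x in ball3 xb 1, (‖u (x, t)‖ ^ 2 + nsq2 (Dd (x, t))) * φ (x, t)) +
      (∫ τ in Ioo (tb - 1) t, ∫ x in ball3 xb 1,
        (nsq2 (Du (x, τ)) + nsq3 (D2d (x, τ))) * φ (x, τ)) ≤
    Cb * ∫ τ in Ioo (tb - 1) t,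
      ((∫ x in ball3 xb 1, ((‖u (x, τ)‖ ^ 2 + nsq2 (Dd (x, τ))) *
            |tderiv φ (x, τ) + sLap φ (x, τ)| +
          (‖u (x, τ)‖ ^ 3 + Real.sqrt (nsq2 (Dd (x, τ))) ^ 3) *
            Real.sqrt (∑ j, (sderiv j φ (x, τ)) ^ 2) +
          ρb * ‖d (x, τ)‖ ^ 2 * nsq2 (Dd (x, τ)) * φ (x, τ))) +
        abs (∫ x in ball3 xb 1, p (x, τ) * ∑ j, u (x, τ) j * sderiv j φ (x, τ)))

/-- `E_{3,q} = ∫∫_{Q₁(z̄)} (|u|³ + |∇d|³ + |p|^{3/2} + |d|^q |∇d|^{3(1−q/6)}) dz`. -/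
def E3q (xb : E3) (tb : ℝ) (u d : SpT → E3) (p : SpT → ℝ)
    (Dd : SpT → Fin 3 → Fin 3 → ℝ) (q : ℝ) : ℝ≥0∞ :=
  ∫⁻ z in Qcyl (xb, tb) 1, ENNReal.ofReal (‖u z‖ ^ 3 + Real.sqrt (nsq2 (Dd z)) ^ 3 +
    |p z| ^ ((3 : ℝ) / 2) + ‖d z‖ ^ q * Real.sqrt (nsq2 (Dd z)) ^ (3 * (1 - q / 6)))

/-- Partial derivative `∂_j` of a function on `ℝ³`. -/
def pd (j : Fin 3) (b : E3 → ℝ) (x : E3) : ℝ := fderiv ℝ b x (EuclideanSpace.single j 1)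

lemma measurableSet_ball3 (x : E3) (r : ℝ) : MeasurableSet (ball3 x r) :=
  Metric.isOpen_ball.measurableSet

/-- `b ∈ C_c^∞(U)` for a subset `U` of `ℝ³`. -/
def IsTest3 (U : Set E3) (b : E3 → ℝ) : Prop :=
  ContDiff ℝ (⊤ : ℕ∞) b ∧ HasCompactSupport b ∧ tsupport b ⊆ U

/-- Weakly divergence free fields on `U ⊆ ℝ³`. -/
def SliceDiv (U : Set E3) (v : E3 → E3) : Prop :=
  ∀ b, IsTest3 U b → ∫ x in U, ∑ j, v x j * pd j b x = 0

/-- Weak gradients on `U ⊆ ℝ³`. -/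
def SliceGrad (U : Set E3) (f : E3 → ℝ) (g : Fin 3 → E3 → ℝ) : Prop :=
  ∀ j b, IsTest3 U b → ∫ x in U, f x * pd j b x = - ∫ x in U, g j x * b x

/-- The weak equation `-Δp = ∂_i ∂_j F_{ij}` on `U ⊆ ℝ³`. -/
def SlicePress (U : Set E3) (F : Fin 3 → Fin 3 → E3 → ℝ) (p : E3 → ℝ) : Prop :=
  ∀ b, IsTest3 U b → -∫ x in U, p x * ∑ j, pd j (pd j b) x =
    ∫ x in U, ∑ i, ∑ j, F i j x * pd i (pd j b) x

lemma contDiff_pd {b : E3 → ℝ} (hb : ContDiff ℝ (⊤ : ℕ∞) b) (j : Fin 3) :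
    ContDiff ℝ (⊤ : ℕ∞) (pd j b) := by
  have : ContDiff ℝ (⊤ : ℕ∞) (fderiv ℝ b) := hb.fderiv_right (by norm_cast)
  exact this.clm_apply contDiff_const

lemma tsupport_pd_subset (b : E3 → ℝ) (j : Fin 3) : tsupport (pd j b) ⊆ tsupport b :=
  tsupport_fderiv_apply_subset ℝ _

lemma hasCompactSupport_pd {b : E3 → ℝ} (hb : HasCompactSupport b) (j : Fin 3) :
    HasCompactSupport (pd j b) :=
  hb.fderiv_apply ℝ _

lemma IsTest3.pd {U : Set E3} {b : E3 → ℝ} (hb : IsTest3 U b) (j : Fin 3) :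
    IsTest3 U (pd j b) :=
  ⟨contDiff_pd hb.1 j, hasCompactSupport_pd hb.2.1 j, (tsupport_pd_subset b j).trans hb.2.2⟩

lemma sderiv_mul_time {a : ℝ → ℝ} (ha : ContDiff ℝ (⊤ : ℕ∞) a) {b : E3 → ℝ}
    (hb : ContDiff ℝ (⊤ : ℕ∞) b) (j : Fin 3) :
    sderiv j (fun z : SpT => b z.1 * a z.2) = fun z => pd j b z.1 * a z.2 := by
  funext z
  have hb' : HasFDerivAt (fun z : SpT => b z.1)
      ((fderiv ℝ b z.1).comp (ContinuousLinearMap.fst ℝ E3 ℝ)) z :=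
    ((hb.differentiable (by norm_num)).differentiableAt.hasFDerivAt).comp z hasFDerivAt_fst
  have ha' : HasFDerivAt (fun z : SpT => a z.2)
      ((fderiv ℝ a z.2).comp (ContinuousLinearMap.snd ℝ E3 ℝ)) z :=
    ((ha.differentiable (by norm_num)).differentiableAt.hasFDerivAt).comp z hasFDerivAt_snd
  have hm : HasFDerivAt (fun z : SpT => b z.1 * a z.2) _ z := hb'.mul ha'
  simp only [sderiv, hm.fderiv, pd]
  simp
  ring

lemma isTestOn_mul_time {U : Set E3} {J : Set ℝ} {a : ℝ → ℝ} {b : E3 → ℝ}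
    (ha : ContDiff ℝ (⊤ : ℕ∞) a) (ha' : HasCompactSupport a) (haJ : tsupport a ⊆ J)
    (hb : IsTest3 U b) : IsTestOn (U ×ˢ J) (fun z : SpT => b z.1 * a z.2) := by
  have hsub : tsupport (fun z : SpT => b z.1 * a z.2) ⊆ tsupport b ×ˢ tsupport a := by
    refine closure_minimal ?_ ((isClosed_tsupport b).prod (isClosed_tsupport a))
    intro z hz
    simp only [Function.mem_support, ne_eq, mul_eq_zero, not_or] at hz
    exact ⟨subset_closure hz.1, subset_closure hz.2⟩
  refine ⟨(hb.1.comp contDiff_fst).mul (ha.comp contDiff_snd), ?_, ?_⟩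
  · exact (IsCompact.of_isClosed_subset (hb.2.1.prod ha') (isClosed_tsupport _) hsub)
  · exact hsub.trans (prod_mono hb.2.2 haJ)

lemma ae_slice {ι : Type*} [Fintype ι] (x0 : E3) (R : ℝ) (J : Set ℝ) (hJ : IsOpen J)
    (G : ι → SpT → ℝ) (hG : ∀ m, IntegrableOn (G m) (ball3 x0 R ×ˢ J))
    (S : Set (E3 → ι → ℝ)) (hS : ∀ Φ ∈ S, Continuous Φ)
    (h : ∀ Φ ∈ S, ∀ a : ℝ → ℝ, ContDiff ℝ (⊤ : ℕ∞) a → HasCompactSupport a → tsupport a ⊆ J →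
      ∫ z in ball3 x0 R ×ˢ J, (∑ m, G m z * Φ z.1 m) * a z.2 = 0) :
    ∀ᵐ t ∂(volume.restrict J), ∀ Φ ∈ S,
      ∫ x in ball3 x0 R, ∑ m, G m (x, t) * Φ x m = 0 := by
  classical
  set B := ball3 x0 R with hB
  have hJm : MeasurableSet J := hJ.measurableSet
  have hBm : MeasurableSet B := measurableSet_ball
  let K : Set E3 := Metric.closedBall x0 R
  have hBK : B ⊆ K := Metric.ball_subset_closedBall
  have : CompactSpace K := isCompact_iff_compactSpace.mp (isCompact_closedBall x0 R)
  have hprod : (volume : Measure SpT).restrict (B ×ˢ J) =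
      (volume.restrict B).prod (volume.restrict J) := by
    rw [Measure.prod_restrict]; rfl
  have hbdd : ∀ Φ ∈ S, ∃ C, ∀ x ∈ B, ∀ m, ‖Φ x m‖ ≤ C := by
    intro Φ hΦ
    obtain ⟨C, hC⟩ := (isCompact_closedBall x0 R).exists_bound_of_continuousOn
      (hS Φ hΦ).continuousOn
    exact ⟨C, fun x hx m => (norm_le_pi_norm (Φ x) m).trans (hC x (hBK hx))⟩
  have h_intg : ∀ Φ ∈ S, Integrable (fun z : SpT => ∑ m, G m z * Φ z.1 m)
      ((volume.restrict B).prod (volume.restrict J)) := by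
    intro Φ hΦ
    obtain ⟨C, hC⟩ := hbdd Φ hΦ
    rw [← hprod]
    refine integrable_finsetSum _ fun m _ => ?_
    refine (hG m).mul_bdd (c := C) ?_ ?_
    · exact ((((continuous_apply m).comp (hS Φ hΦ)).comp continuous_fst)).aestronglyMeasurable
    · filter_upwards [ae_restrict_mem (hBm.prod hJm)] with z hz
      exact hC z.1 hz.1 m
  have key : ∀ Φ ∈ S, ∀ᵐ t ∂(volume.restrict J), ∫ x in B, ∑ m, G m (x, t) * Φ x m = 0 := by
    intro Φ hΦ
    have hi := (h_intg Φ hΦ).integral_prod_right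
    rw [ae_restrict_iff' hJm]
    refine hJ.ae_eq_zero_of_integral_contDiff_smul_eq_zero (IntegrableOn.locallyIntegrableOn hi) ?_
    intro a ha ha' haJ
    have h1 := h Φ hΦ a ha ha' haJ
    rw [hprod] at h1
    obtain ⟨C, hC⟩ := ha'.exists_bound_of_continuous ha.continuous
    rw [integral_prod_symm] at h1
    · rw [← setIntegral_eq_integral_of_forall_compl_eq_zero (s := J)]
      · rw [← h1]
        refine integral_congr_ae (Eventually.of_forall fun t => ?_)
        simp only [smul_eq_mul]
        rw [integral_mul_const, mul_comm]
      · intro t ht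
        have : a t = 0 := by
          by_contra h0
          exact ht (haJ (subset_closure h0))
        simp [this]
    · refine (h_intg Φ hΦ).mul_bdd (c := C) ?_ ?_
      · exact (ha.continuous.comp continuous_snd).aestronglyMeasurable
      · exact Eventually.of_forall fun z => hC z.2
  let ρ : S → C(K, ι → ℝ) := fun Φ => ⟨fun x => Φ.1 x, (hS Φ.1 Φ.2).comp continuous_subtype_val⟩
  obtain ⟨D, hDs, hDc, hDd⟩ :=
    (TopologicalSpace.IsSeparable.of_separableSpace (range ρ)).exists_countable_dense_subset
  have hch : ∀ f : D, ∃ Φ : S, ρ Φ = f.1 := fun f => hDs f.2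
  choose σ hσ using hch
  have := hDc.to_subtype
  have hall : ∀ᵐ t ∂(volume.restrict J), ∀ f : D,
      ∫ x in B, ∑ m, G m (x, t) * (σ f).1 x m = 0 :=
    ae_all_iff.mpr fun f => key _ (σ f).2
  have hslice : ∀ᵐ t ∂(volume.restrict J), ∀ m, Integrable (fun x => G m (x, t))
      (volume.restrict B) := by
    refine ae_all_iff.mpr fun m => ?_
    have := hG m
    rw [IntegrableOn, hprod] at this
    exact this.prod_left_ae
  filter_upwards [hall, hslice] with t h1 h2 Φ hΦ
  have hmul : ∀ Ψ ∈ S, ∀ m, Integrable (fun x => G m (x, t) * Ψ x m) (volume.restrict B) := by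
    intro Ψ hΨ m
    obtain ⟨C, hC⟩ := hbdd Ψ hΨ
    refine (h2 m).mul_bdd (c := C) ?_ ?_
    · exact ((continuous_apply m).comp (hS Ψ hΨ)).aestronglyMeasurable
    · filter_upwards [ae_restrict_mem hBm] with x hx
      exact hC x hx m
  rw [← norm_le_zero_iff]
  set L := ∑ m, ∫ x in B, ‖G m (x, t)‖ with hL
  have hL0 : 0 ≤ L := Finset.sum_nonneg fun m _ => integral_nonneg fun x => norm_nonneg _
  refine le_of_forall_pos_le_add fun ε hε => ?_
  have hmem : ρ ⟨Φ, hΦ⟩ ∈ closure D := hDd ⟨_, rfl⟩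
  obtain ⟨f, hfD, hf⟩ := Metric.mem_closure_iff.mp hmem (ε / (L + 1)) (by positivity)
  set Ψ := σ ⟨f, hfD⟩ with hΨ
  have hclose : ∀ x ∈ B, ∀ m, ‖Φ x m - Ψ.1 x m‖ ≤ ε / (L + 1) := by
    intro x hx m
    have h3 : dist (ρ ⟨Φ, hΦ⟩ ⟨x, hBK hx⟩) (ρ Ψ ⟨x, hBK hx⟩) ≤ ε / (L + 1) := by
      refine (ContinuousMap.dist_apply_le_dist _).trans ?_
      rw [hΨ, hσ]
      exact hf.le
    exact (dist_eq_norm (Φ x m) (Ψ.1 x m)) ▸ (dist_le_pi_dist (Φ x) (Ψ.1 x) m).trans h3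
  have h4 : ∫ x in B, ∑ m, G m (x, t) * Φ x m =
      ∫ x in B, ∑ m, G m (x, t) * (Φ x m - Ψ.1 x m) := by
    have h5 := h1 ⟨f, hfD⟩
    rw [← sub_zero (∫ x in B, ∑ m, G m (x, t) * Φ x m), ← h5, ← integral_sub]
    · refine integral_congr_ae (Eventually.of_forall fun x => ?_)
      simp only [← Finset.sum_sub_distrib, mul_sub]
      rfl
    · exact integrable_finsetSum _ fun m _ => hmul Φ hΦ m
    · exact integrable_finsetSum _ fun m _ => hmul _ (σ ⟨f, hfD⟩).2 m
  rw [h4, zero_add, integral_finsetSum]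
  swap
  · intro m _
    simp only [mul_sub]
    exact (hmul Φ hΦ m).sub (hmul _ Ψ.2 m)
  calc ‖∑ m, ∫ x in B, G m (x, t) * (Φ x m - Ψ.1 x m)‖
      ≤ ∑ m, ∫ x in B, ‖G m (x, t)‖ * (ε / (L + 1)) := by
        refine (norm_sum_le _ _).trans (Finset.sum_le_sum fun m _ => ?_)
        refine (norm_integral_le_integral_norm _).trans ?_
        refine setIntegral_mono_on ?_ ?_ hBm fun x hx => ?_
        · have := ((hmul Φ hΦ m).sub (hmul _ Ψ.2 m)).norm
          simp only [mul_sub]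
          exact this
        · exact (h2 m).norm.mul_const _
        · rw [norm_mul]
          exact mul_le_mul_of_nonneg_left (hclose x hx m) (norm_nonneg _)
    _ = L * (ε / (L + 1)) := by
        rw [hL, Finset.sum_mul]
        exact Finset.sum_congr rfl fun m _ => integral_mul_const _ _
    _ ≤ ε := by
        rw [mul_div_assoc', div_le_iff₀ (by positivity)]
        nlinarith

lemma Qcyl_one (xb : E3) (tb : ℝ) : Qcyl (xb, tb) 1 = ball3 xb 1 ×ˢ Ioo (tb - 1) tb := by
  simp [Qcyl]

lemma ae_sliceDiv {xb : E3} {tb : ℝ} {u : SpT → E3}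
    (hu : ∀ j, IntegrableOn (fun z => u z j) (Qcyl (xb, tb) 1))
    (h : DivFreeOn (Qcyl (xb, tb) 1) u) :
    ∀ᵐ t ∂(volume.restrict (Ioo (tb - 1) tb)),
      SliceDiv (ball3 xb 1) (fun x => u (x, t)) := by
  rw [Qcyl_one] at h
  simp only [Qcyl_one] at hu
  have := ae_slice xb 1 (Ioo (tb - 1) tb) isOpen_Ioo (fun (j : Fin 3) z => u z j) hu
    {Φ | ∃ b, IsTest3 (ball3 xb 1) b ∧ Φ = fun x j => pd j b x} ?_ ?_
  · filter_upwards [this] with t ht b hb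
    exact ht _ ⟨b, hb, rfl⟩
  · rintro Φ ⟨b, hb, rfl⟩
    exact continuous_pi fun j => (contDiff_pd hb.1 j).continuous
  · rintro Φ ⟨b, hb, rfl⟩ a ha ha' haJ
    rw [← h _ (isTestOn_mul_time ha ha' haJ hb)]
    refine integral_congr_ae (Eventually.of_forall fun z => ?_)
    simp only [sderiv_mul_time ha hb.1, Finset.sum_mul]
    exact Finset.sum_congr rfl fun j _ => by ring

lemma ae_sliceGrad {xb : E3} {tb : ℝ} {f : SpT → ℝ} {g : Fin 3 → SpT → ℝ}
    (hf : IntegrableOn f (Qcyl (xb, tb) 1)) (hg : ∀ j, IntegrableOn (g j) (Qcyl (xb, tb) 1))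
    (h : WeakSGrad (Qcyl (xb, tb) 1) f g) :
    ∀ᵐ t ∂(volume.restrict (Ioo (tb - 1) tb)),
      SliceGrad (ball3 xb 1) (fun x => f (x, t)) (fun j x => g j (x, t)) := by
  rw [Qcyl_one] at h hf
  simp only [Qcyl_one] at hg
  have hJ : MeasurableSet (Ioo (tb - 1) tb) := measurableSet_Ioo
  have hprod : (volume : Measure SpT).restrict (ball3 xb 1 ×ˢ Ioo (tb - 1) tb) =
      (volume.restrict (ball3 xb 1)).prod (volume.restrict (Ioo (tb - 1) tb)) := by
    rw [Measure.prod_restrict]; rfl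
  have hfs : ∀ᵐ t ∂(volume.restrict (Ioo (tb - 1) tb)),
      IntegrableOn (fun x => f (x, t)) (ball3 xb 1) := by
    rw [IntegrableOn, hprod] at hf
    exact hf.prod_left_ae
  have hgs : ∀ᵐ t ∂(volume.restrict (Ioo (tb - 1) tb)), ∀ j,
      IntegrableOn (fun x => g j (x, t)) (ball3 xb 1) := by
    refine ae_all_iff.mpr fun j => ?_
    have := hg j
    rw [IntegrableOn, hprod] at this
    exact this.prod_left_ae
  have key : ∀ᵐ t ∂(volume.restrict (Ioo (tb - 1) tb)), ∀ j, ∀ Φ ∈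
      {Φ : E3 → Bool → ℝ | ∃ b, IsTest3 (ball3 xb 1) b ∧
        Φ = fun x i => bif i then pd j b x else b x},
      ∫ x in ball3 xb 1, ∑ m : Bool, (bif m then f else g j) (x, t) * Φ x m = 0 := by
    refine ae_all_iff.mpr fun j => ?_
    refine ae_slice xb 1 (Ioo (tb - 1) tb) isOpen_Ioo (fun (i : Bool) => bif i then f else g j)
      ?_ _ ?_ ?_
    · rintro (_ | _)
      · exact hg j
      · exact hf
    · rintro Φ ⟨b, hb, rfl⟩
      refine continuous_pi fun i => ?_
      cases i
      · exact hb.1.continuous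
      · exact (contDiff_pd hb.1 j).continuous
    · rintro Φ ⟨b, hb, rfl⟩ a ha ha' haJ
      have h1 := h j _ (isTestOn_mul_time ha ha' haJ hb)
      have ht := isTestOn_mul_time ha ha' haJ hb
      obtain ⟨C, hC⟩ := ht.2.1.exists_bound_of_continuous ht.1.continuous
      have htd := isTestOn_mul_time ha ha' haJ (hb.pd j)
      obtain ⟨C', hC'⟩ := htd.2.1.exists_bound_of_continuous htd.1.continuous
      simp only [sderiv_mul_time ha hb.1] at h1
      have e : ∀ z : SpT, (∑ m : Bool, (bif m then f else g j) z *
          (bif m then pd j b z.1 else b z.1)) * a z.2 =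
          f z * (pd j b z.1 * a z.2) + g j z * (b z.1 * a z.2) := by
        intro z
        simp only [Fintype.sum_bool, cond_true, cond_false]
        ring
      simp only [e]
      rw [integral_add, h1, neg_add_cancel]
      · exact hf.mul_bdd (c := C') htd.1.continuous.aestronglyMeasurable
          (Eventually.of_forall fun z => hC' z)
      · exact (hg j).mul_bdd (c := C) ht.1.continuous.aestronglyMeasurable
          (Eventually.of_forall fun z => hC z)
  filter_upwards [key, hfs, hgs] with t ht h1 h2 j b hb
  have h3 := ht j _ ⟨b, hb, rfl⟩
  simp only [Fintype.sum_bool, cond_true, cond_false] at h3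
  obtain ⟨C, hC⟩ := hb.2.1.exists_bound_of_continuous hb.1.continuous
  obtain ⟨C', hC'⟩ := (hb.pd j).2.1.exists_bound_of_continuous (hb.pd j).1.continuous
  rw [integral_add] at h3
  · linarith
  · exact h1.mul_bdd (c := C') (hb.pd j).1.continuous.aestronglyMeasurable
          (Eventually.of_forall fun z => hC' z)
  · exact (h2 j).mul_bdd (c := C) hb.1.continuous.aestronglyMeasurable
          (Eventually.of_forall fun z => hC z)

lemma ae_slicePress {xb : E3} {tb : ℝ} {u : SpT → E3} {p : SpT → ℝ}
    {Dd : SpT → Fin 3 → Fin 3 → ℝ}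
    (hp : IntegrableOn p (Qcyl (xb, tb) 1))
    (hF : ∀ i j, IntegrableOn (fun z => u z i * u z j + ∑ k, Dd z k i * Dd z k j)
      (Qcyl (xb, tb) 1))
    (h : PressureEqOn (Qcyl (xb, tb) 1) u p Dd) :
    ∀ᵐ t ∂(volume.restrict (Ioo (tb - 1) tb)),
      SlicePress (ball3 xb 1)
        (fun i j x => u (x, t) i * u (x, t) j + ∑ k, Dd (x, t) k i * Dd (x, t) k j)
        (fun x => p (x, t)) := by
  rw [Qcyl_one] at h hp
  simp only [Qcyl_one] at hF
  set F : Fin 3 → Fin 3 → SpT → ℝ :=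
    fun i j z => u z i * u z j + ∑ k, Dd z k i * Dd z k j with hFdef
  have hprod : (volume : Measure SpT).restrict (ball3 xb 1 ×ˢ Ioo (tb - 1) tb) =
      (volume.restrict (ball3 xb 1)).prod (volume.restrict (Ioo (tb - 1) tb)) := by
    rw [Measure.prod_restrict]; rfl
  have hps : ∀ᵐ t ∂(volume.restrict (Ioo (tb - 1) tb)),
      IntegrableOn (fun x => p (x, t)) (ball3 xb 1) := by
    rw [IntegrableOn, hprod] at hp
    exact hp.prod_left_ae
  have hFs : ∀ᵐ t ∂(volume.restrict (Ioo (tb - 1) tb)), ∀ i j,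
      IntegrableOn (fun x => F i j (x, t)) (ball3 xb 1) := by
    refine ae_all_iff.mpr fun i => ae_all_iff.mpr fun j => ?_
    have := hF i j
    rw [IntegrableOn, hprod] at this
    exact this.prod_left_ae
  let G : Option (Fin 3 × Fin 3) → SpT → ℝ := fun m => m.elim p (fun ij => F ij.1 ij.2)
  let L : (E3 → ℝ) → E3 → Option (Fin 3 × Fin 3) → ℝ := fun b x m =>
    m.elim (∑ j, pd j (pd j b) x) (fun ij => pd ij.1 (pd ij.2 b) x)
  have hsum : ∀ (b : E3 → ℝ) (x : E3) (z : SpT), ∑ m, G m z * L b x m =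
      p z * (∑ j, pd j (pd j b) x) + ∑ i, ∑ j, F i j z * pd i (pd j b) x := by
    intro b x z
    rw [Fintype.sum_option, Fintype.sum_prod_type]
    rfl
  have key := ae_slice xb 1 (Ioo (tb - 1) tb) isOpen_Ioo G ?_
    {Φ | ∃ b, IsTest3 (ball3 xb 1) b ∧ Φ = L b} ?_ ?_
  · filter_upwards [key, hps, hFs] with t ht h1 h2 b hb
    have h3 := ht _ ⟨b, hb, rfl⟩
    simp only [hsum] at h3
    have hb2 : ∀ i j, ∃ C, ∀ x, ‖pd i (pd j b) x‖ ≤ C := fun i j =>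
      ((hb.pd j).pd i).2.1.exists_bound_of_continuous ((hb.pd j).pd i).1.continuous
    choose C hC using hb2
    have hc : ∀ i j, Continuous (pd i (pd j b)) := fun i j => ((hb.pd j).pd i).1.continuous
    rw [integral_add] at h3
    · linarith
    · refine h1.mul_bdd (c := ∑ j, C j j) ?_ (Eventually.of_forall fun x => ?_)
      · exact (continuous_finsetSum _ fun j _ => hc j j).aestronglyMeasurable
      · exact (norm_sum_le _ _).trans (Finset.sum_le_sum fun j _ => hC j j x)
    · refine integrable_finsetSum _ fun i _ => integrable_finsetSum _ fun j _ => ?_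
      exact (h2 i j).mul_bdd (c := C i j) (hc i j).aestronglyMeasurable
          (Eventually.of_forall fun z => hC i j z)
  · rintro (_ | ⟨i, j⟩)
    · exact hp
    · exact hF i j
  · rintro Φ ⟨b, hb, rfl⟩
    refine continuous_pi fun m => ?_
    rcases m with (_ | ⟨i, j⟩)
    · exact continuous_finsetSum _ fun j _ => ((hb.pd j).pd j).1.continuous
    · exact ((hb.pd j).pd i).1.continuous
  · rintro Φ ⟨b, hb, rfl⟩ a ha ha' haJ
    have h1 := h _ (isTestOn_mul_time ha ha' haJ hb)
    have hbb : ∀ i j, ∃ C, ∀ z : SpT, ‖pd i (pd j b) z.1 * a z.2‖ ≤ C := fun i j => by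
      have ht := isTestOn_mul_time ha ha' haJ ((hb.pd j).pd i)
      exact ht.2.1.exists_bound_of_continuous ht.1.continuous
    choose C hC using hbb
    have hc : ∀ i j, Continuous (fun z : SpT => pd i (pd j b) z.1 * a z.2) := fun i j =>
      (isTestOn_mul_time ha ha' haJ ((hb.pd j).pd i)).1.continuous
    simp only [sLap, sderiv_mul_time ha hb.1, sderiv_mul_time ha (hb.pd _).1] at h1
    have e : ∀ z : SpT, (∑ m, G m z * L b z.1 m) * a z.2 =
        p z * (∑ j, pd j (pd j b) z.1 * a z.2) +
          ∑ i, ∑ j, F i j z * (pd i (pd j b) z.1 * a z.2) := by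
      intro z
      simp only [hsum, add_mul, Finset.sum_mul, Finset.mul_sum, mul_assoc]
    simp only [e]
    rw [integral_add]
    · linarith
    · refine hp.mul_bdd (c := ∑ j, C j j) ?_ (Eventually.of_forall fun x => ?_)
      · exact (continuous_finsetSum _ fun j _ => hc j j).aestronglyMeasurable
      · exact (norm_sum_le _ _).trans (Finset.sum_le_sum fun j _ => hC j j x)
    · refine integrable_finsetSum _ fun i _ => integrable_finsetSum _ fun j _ => ?_
      exact (hF i j).mul_bdd (c := C i j) (hc i j).aestronglyMeasurable
          (Eventually.of_forall fun z => hC i j z)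

lemma pd_comm {b : E3 → ℝ} (hb : ContDiff ℝ (⊤ : ℕ∞) b) (i j : Fin 3) :
    pd i (pd j b) = pd j (pd i b) := by
  funext x
  have hd : ContDiff ℝ (⊤ : ℕ∞) (fderiv ℝ b) := hb.fderiv_right (by norm_cast)
  have h1 : ∀ v w : E3, fderiv ℝ (fun y => fderiv ℝ b y v) x w = fderiv ℝ (fderiv ℝ b) x w v := by
    intro v w
    rw [fderiv_clm_apply (hd.differentiable (by norm_num)).differentiableAt
      (differentiableAt_const v)]
    simp
  have hs : IsSymmSndFDerivAt ℝ b x := hb.contDiffAt.isSymmSndFDerivAt (by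
    simp only [minSmoothness_of_isRCLikeNormedField]
    exact WithTop.coe_le_coe.2 (le_top : (2 : ℕ∞) ≤ ⊤))
  change fderiv ℝ (fun y => fderiv ℝ b y _) x _ = fderiv ℝ (fun y => fderiv ℝ b y _) x _
  rw [h1, h1, hs.eq]

lemma integral_mul_pd {f g : E3 → ℝ} (hf : ContDiff ℝ (⊤ : ℕ∞) f)
    (hg : ContDiff ℝ (⊤ : ℕ∞) g) (hgc : HasCompactSupport g) (j : Fin 3) :
    ∫ x, f x * pd j g x = - ∫ x, pd j f x * g x := by
  refine integral_mul_fderiv_eq_neg_fderiv_mul_of_integrable ?_ ?_ ?_ ?_ ?_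
  · exact ((contDiff_pd hf j).continuous.mul hg.continuous).integrable_of_hasCompactSupport
      hgc.mul_left
  · exact (hf.continuous.mul (contDiff_pd hg j).continuous).integrable_of_hasCompactSupport
      (hasCompactSupport_pd hgc j).mul_left
  · exact (hf.continuous.mul hg.continuous).integrable_of_hasCompactSupport hgc.mul_left
  · exact fun x _ => (hf.differentiable (by norm_num)).differentiableAt
  · exact fun x _ => (hg.differentiable (by norm_num)).differentiableAt

lemma integral_hessian_sq {b : E3 → ℝ} (hb : ContDiff ℝ (⊤ : ℕ∞) b)
    (hbc : HasCompactSupport b) :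
    ∫ x, ∑ i, ∑ j, pd i (pd j b) x ^ 2 = ∫ x, (∑ j, pd j (pd j b) x) ^ 2 := by
  have hc : ∀ i j, ContDiff ℝ (⊤ : ℕ∞) (pd i (pd j b)) := fun i j =>
    contDiff_pd (contDiff_pd hb j) i
  have hs : ∀ i j, HasCompactSupport (pd i (pd j b)) := fun i j =>
    hasCompactSupport_pd (hasCompactSupport_pd hbc j) i
  have hi : ∀ i j k l, Integrable (fun x => pd i (pd j b) x * pd k (pd l b) x) := fun i j k l =>
    ((hc i j).continuous.mul (hc k l).continuous).integrable_of_hasCompactSupport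
      (hs k l).mul_left
  have key : ∀ i j, ∫ x, pd i (pd j b) x * pd i (pd j b) x =
      ∫ x, pd i (pd i b) x * pd j (pd j b) x := by
    intro i j
    rw [integral_mul_pd (hc i j) (contDiff_pd hb j) (hasCompactSupport_pd hbc j) i]
    have e : pd i (pd i (pd j b)) = pd j (pd i (pd i b)) := by
      rw [pd_comm hb i j, pd_comm (contDiff_pd hb i) i j]
    rw [e, ← integral_mul_pd (hc i i) (contDiff_pd hb j) (hasCompactSupport_pd hbc j) j]
  simp only [sq, Finset.sum_mul_sum]
  rw [integral_finsetSum _ fun i _ => integrable_finsetSum _ fun j _ => hi i j i j,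
    integral_finsetSum _ fun i _ => integrable_finsetSum _ fun j _ => hi i i j j]
  refine Finset.sum_congr rfl fun i _ => ?_
  rw [integral_finsetSum _ fun j _ => hi i j i j, integral_finsetSum _ fun j _ => hi i i j j]
  exact Finset.sum_congr rfl fun j _ => key i j

lemma exists_riesz_of_bound {V H : Type*} [AddCommGroup V] [Module ℝ V] [NormedAddCommGroup H]
    [InnerProductSpace ℝ H] [CompleteSpace H] (A : V →ₗ[ℝ] H) (l : V →ₗ[ℝ] ℝ) (M : ℝ)
    (hM : 0 ≤ M) (h : ∀ x, |l x| ≤ M * ‖A x‖) :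
    ∃ p : H, ‖p‖ ≤ M ∧ ∀ x, inner ℝ p (A x) = l x := by
  have hker : LinearMap.ker A ≤ LinearMap.ker l := by
    intro x hx
    have := h x
    rw [LinearMap.mem_ker] at hx ⊢
    rw [hx, norm_zero, mul_zero] at this
    exact abs_eq_zero.mp (le_antisymm this (abs_nonneg _))
  let l' : LinearMap.range A →ₗ[ℝ] ℝ :=
    ((LinearMap.ker A).liftQ l hker).comp (A.quotKerEquivRange.symm : _ →ₗ[ℝ] _)
  have hl' : ∀ x, l' ⟨A x, LinearMap.mem_range_self A x⟩ = l x := by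
    intro x
    have : A.quotKerEquivRange.symm ⟨A x, LinearMap.mem_range_self A x⟩ =
        (LinearMap.ker A).mkQ x := by
      rw [LinearEquiv.symm_apply_eq]
      rfl
    simp only [l', LinearMap.comp_apply, LinearEquiv.coe_coe, this]
    simp
  let L : StrongDual ℝ (LinearMap.range A) := l'.mkContinuous M (by
    rintro ⟨_, x, rfl⟩
    rw [hl']
    exact h x)
  obtain ⟨g, hg, hgn⟩ := exists_extension_norm_eq (LinearMap.range A) L
  refine ⟨(InnerProductSpace.toDual ℝ H).symm g, ?_, fun x => ?_⟩
  · rw [LinearIsometryEquiv.norm_map, hgn]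
    exact l'.mkContinuous_norm_le hM _
  · rw [InnerProductSpace.toDual_symm_apply, ← hl' x]
    exact hg ⟨A x, LinearMap.mem_range_self A x⟩

lemma exists_double_divergence_potential (F : Fin 3 → Fin 3 → E3 → ℝ)
    (hF : ∀ i j, MemLp (F i j) 2) :
    ∃ p : E3 → ℝ, MemLp p 2 ∧ ∫ x, p x ^ 2 ≤ ∫ x, ∑ i, ∑ j, F i j x ^ 2 ∧
      ∀ b, IsTest3 univ b →
        ∫ x, p x * ∑ j, pd j (pd j b) x = ∫ x, ∑ i, ∑ j, F i j x * pd i (pd j b) x := by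
  have pd_add : ∀ (j : Fin 3) {f g : E3 → ℝ}, ContDiff ℝ (⊤ : ℕ∞) f → ContDiff ℝ (⊤ : ℕ∞) g →
      pd j (f + g) = pd j f + pd j g := by
    intro j f g hf hg
    funext x
    simp only [pd, Pi.add_apply]
    rw [fderiv_add (hf.differentiable (by norm_num)).differentiableAt
      (hg.differentiable (by norm_num)).differentiableAt]
    rfl
  have pd_smul : ∀ (j : Fin 3) (c : ℝ) {f : E3 → ℝ}, ContDiff ℝ (⊤ : ℕ∞) f →
      pd j (c • f) = c • pd j f := by
    intro j c f hf
    funext x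
    simp only [pd, Pi.smul_apply]
    rw [fderiv_const_smul (hf.differentiable (by norm_num)).differentiableAt]
    rfl
  let V : Submodule ℝ (E3 → ℝ) :=
    { carrier := {b | ContDiff ℝ (⊤ : ℕ∞) b ∧ HasCompactSupport b}
      add_mem' := fun ha hb => ⟨ha.1.add hb.1, ha.2.add hb.2⟩
      zero_mem' := ⟨contDiff_const, HasCompactSupport.zero⟩
      smul_mem' := fun c b hb => ⟨contDiff_const.smul hb.1, hb.2.smul_left (f := fun _ => c)⟩ }
  have hc : ∀ (b : V) i j, ContDiff ℝ (⊤ : ℕ∞) (pd i (pd j b.1)) := fun b i j =>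
    contDiff_pd (contDiff_pd b.2.1 j) i
  have hs : ∀ (b : V) i j, HasCompactSupport (pd i (pd j b.1)) := fun b i j =>
    hasCompactSupport_pd (hasCompactSupport_pd b.2.2 j) i
  have hL : ∀ (b : V) i j, MemLp (pd i (pd j b.1)) 2 := fun b i j =>
    (hc b i j).continuous.memLp_of_hasCompactSupport (hs b i j)
  have hLap : ∀ b : V, MemLp (fun x => ∑ j, pd j (pd j b.1) x) 2 := fun b =>
    memLp_finsetSum _ fun j _ => hL b j j
  have hpdadd : ∀ (a b : V) i j, pd i (pd j (a + b : V).1) = pd i (pd j a.1) + pd i (pd j b.1) := by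
    intro a b i j
    have : (a + b : V).1 = a.1 + b.1 := rfl
    rw [this, pd_add j a.2.1 b.2.1, pd_add i (contDiff_pd a.2.1 j) (contDiff_pd b.2.1 j)]
  have hpdsmul : ∀ (c : ℝ) (b : V) i j, pd i (pd j (c • b : V).1) = c • pd i (pd j b.1) := by
    intro c b i j
    have : (c • b : V).1 = c • b.1 := rfl
    rw [this, pd_smul j c b.2.1, pd_smul i c (contDiff_pd b.2.1 j)]
  have hFD : ∀ (b : V) i j, Integrable (fun x => F i j x * pd i (pd j b.1) x) := fun b i j =>
    (hF i j).integrable_mul (hL b i j)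
  have hFDs : ∀ (b : V), Integrable (fun x => ∑ i, ∑ j, F i j x * pd i (pd j b.1) x) := fun b =>
    integrable_finsetSum _ fun i _ => integrable_finsetSum _ fun j _ => hFD b i j
  let A : V →ₗ[ℝ] Lp ℝ 2 (volume : Measure E3) :=
    { toFun := fun b => (hLap b).toLp
      map_add' := by
        intro a b
        rw [← MemLp.toLp_add]
        refine MemLp.toLp_congr _ _ (Eventually.of_forall fun x => ?_)
        simp only [hpdadd, Pi.add_apply, Finset.sum_add_distrib]
      map_smul' := by
        intro c b
        rw [RingHom.id_apply, ← MemLp.toLp_const_smul]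
        refine MemLp.toLp_congr _ _ (Eventually.of_forall fun x => ?_)
        simp only [hpdsmul, Pi.smul_apply, smul_eq_mul, Finset.mul_sum] }
  let l : V →ₗ[ℝ] ℝ :=
    { toFun := fun b => ∫ x, ∑ i, ∑ j, F i j x * pd i (pd j b.1) x
      map_add' := by
        intro a b
        rw [← integral_add (hFDs a) (hFDs b)]
        simp only [hpdadd, Pi.add_apply, mul_add, Finset.sum_add_distrib]
      map_smul' := by
        intro c b
        rw [RingHom.id_apply, smul_eq_mul, ← integral_const_mul]
        simp only [hpdsmul, Pi.smul_apply, smul_eq_mul, Finset.mul_sum]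
        refine integral_congr_ae (Eventually.of_forall fun x => ?_)
        exact Finset.sum_congr rfl fun i _ => Finset.sum_congr rfl fun j _ => by ring }
  have hnorm : ∀ f : Lp ℝ 2 (volume : Measure E3), ‖f‖ ^ 2 = ∫ x, f x ^ 2 := by
    intro f
    rw [← real_inner_self_eq_norm_sq, L2.inner_def]
    refine integral_congr_ae (Eventually.of_forall fun x => ?_)
    simp [sq]
  set m2 : ℝ := ∫ x, ∑ i, ∑ j, F i j x ^ 2 with hm2
  have hm0 : 0 ≤ m2 := integral_nonneg fun x =>
    Finset.sum_nonneg fun i _ => Finset.sum_nonneg fun j _ => sq_nonneg _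
  have hbound : ∀ b, |l b| ≤ Real.sqrt m2 * ‖A b‖ := by
    intro b
    have hA : ‖A b‖ ^ 2 = ∫ x, ∑ i, ∑ j, pd i (pd j b.1) x ^ 2 := by
      rw [hnorm, integral_hessian_sq b.2.1 b.2.2]
      refine integral_congr_ae ?_
      filter_upwards [(hLap b).coeFn_toLp] with x hx
      change ((hLap b).toLp : E3 → ℝ) x ^ 2 = _
      rw [hx]
    have hq : ∀ s : ℝ, 0 ≤ ‖A b‖ ^ 2 * (s * s) + (-2 * l b) * s + m2 := by
      intro s
      have h1 : ‖A b‖ ^ 2 * (s * s) + (-2 * l b) * s + m2 =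
          ∫ x, ∑ i, ∑ j, (F i j x - s * pd i (pd j b.1) x) ^ 2 := by
        have i1 : Integrable fun x => ∑ i, ∑ j, F i j x ^ 2 :=
          integrable_finsetSum _ fun i _ => integrable_finsetSum _ fun j _ => (hF i j).integrable_sq
        have i2 : Integrable fun x => ∑ i, ∑ j, pd i (pd j b.1) x ^ 2 :=
          integrable_finsetSum _ fun i _ => integrable_finsetSum _ fun j _ =>
            (hL b i j).integrable_sq
        have e : ∀ x, ∑ i, ∑ j, (F i j x - s * pd i (pd j b.1) x) ^ 2 =
            (s * s) * (∑ i, ∑ j, pd i (pd j b.1) x ^ 2) +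
            (-2 * s) * (∑ i, ∑ j, F i j x * pd i (pd j b.1) x) + ∑ i, ∑ j, F i j x ^ 2 := by
          intro x
          simp only [Finset.mul_sum, ← Finset.sum_add_distrib]
          exact Finset.sum_congr rfl fun i _ => Finset.sum_congr rfl fun j _ => by ring
        simp only [e]
        have i3 : Integrable fun x => (s * s) * (∑ i, ∑ j, pd i (pd j b.1) x ^ 2) +
            (-2 * s) * (∑ i, ∑ j, F i j x * pd i (pd j b.1) x) :=
          (i2.const_mul _).add ((hFDs b).const_mul _)
        rw [integral_add i3 i1,
          integral_add (i2.const_mul _) ((hFDs b).const_mul _), integral_const_mul,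
          integral_const_mul, ← hA]
        change _ = s * s * ‖A b‖ ^ 2 + -2 * s * l b + m2
        ring
      rw [h1]
      exact integral_nonneg fun x =>
        Finset.sum_nonneg fun i _ => Finset.sum_nonneg fun j _ => sq_nonneg _
    have hd := discrim_le_zero hq
    rw [discrim] at hd
    rw [← Real.sqrt_sq (norm_nonneg (A b)), ← Real.sqrt_mul hm0]
    refine Real.le_sqrt_of_sq_le ?_
    rw [sq_abs]
    nlinarith
  obtain ⟨p, hp, hpl⟩ := exists_riesz_of_bound A l (Real.sqrt m2) (Real.sqrt_nonneg _) hbound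
  refine ⟨p, Lp.memLp p, ?_, fun b hb => ?_⟩
  · rw [← hnorm, ← Real.sq_sqrt hm0]
    exact pow_le_pow_left₀ (norm_nonneg _) hp 2
  · have h1 := hpl ⟨b, hb.1, hb.2.1⟩
    change inner ℝ p _ = ∫ x, ∑ i, ∑ j, F i j x * pd i (pd j b) x at h1
    rw [← h1, L2.inner_def]
    refine integral_congr_ae ?_
    filter_upwards [(hLap ⟨b, hb.1, hb.2.1⟩).coeFn_toLp] with x hx
    change _ = inner ℝ (p x) (((hLap ⟨b, hb.1, hb.2.1⟩).toLp : E3 → ℝ) x)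
    rw [hx]
    simp [mul_comm]

lemma pd_mul {f g : E3 → ℝ} (hf : Differentiable ℝ f) (hg : Differentiable ℝ g) (j : Fin 3) :
    pd j (fun x => f x * g x) = fun x => pd j f x * g x + f x * pd j g x := by
  funext x
  have := ((hf x).hasFDerivAt.mul (hg x).hasFDerivAt).fderiv
  simp only [pd, Pi.mul_def] at this ⊢
  rw [this]
  simp
  ring

lemma hasFDerivAt_coord (j : Fin 3) (x : E3) :
    HasFDerivAt (fun y : E3 => y j) (EuclideanSpace.proj j : E3 →L[ℝ] ℝ) x :=
  (EuclideanSpace.proj j : E3 →L[ℝ] ℝ).hasFDerivAt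

lemma pd_rpow_normSq (δ : ℝ) (hδ : 0 < δ) (a : ℝ) (j : Fin 3) :
    pd j (fun w : E3 => (‖w‖ ^ 2 + δ ^ 2) ^ a) =
      fun w => 2 * a * (w j * (‖w‖ ^ 2 + δ ^ 2) ^ (a - 1)) := by
  funext w
  have hs : 0 < ‖w‖ ^ 2 + δ ^ 2 := by positivity
  have h1 := ((hasStrictFDerivAt_norm_sq w).hasFDerivAt.add_const (δ ^ 2)).rpow_const
    (p := a) (Or.inl hs.ne')
  simp only [pd]
  rw [h1.fderiv]
  simp [EuclideanSpace.inner_single_right]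
  ring

lemma contDiff_rpow_normSq (δ : ℝ) (hδ : 0 < δ) (a : ℝ) :
    ContDiff ℝ (⊤ : ℕ∞) (fun w : E3 => (‖w‖ ^ 2 + δ ^ 2) ^ a) := by
  refine ContDiff.rpow_const_of_ne ((contDiff_norm_sq ℝ).add contDiff_const) fun w => ?_
  positivity

lemma laplacian_newton (δ : ℝ) (hδ : 0 < δ) (w : E3) :
    ∑ j, pd j (pd j fun w : E3 => (‖w‖ ^ 2 + δ ^ 2) ^ (-(1 / 2) : ℝ)) w =
      -3 * δ ^ 2 * (‖w‖ ^ 2 + δ ^ 2) ^ (-(5 / 2) : ℝ) := by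
  have hs : 0 < ‖w‖ ^ 2 + δ ^ 2 := by positivity
  have e : ∀ j, pd j (pd j fun w : E3 => (‖w‖ ^ 2 + δ ^ 2) ^ (-(1 / 2) : ℝ)) w =
      -(‖w‖ ^ 2 + δ ^ 2) ^ (-(3 / 2) : ℝ) +
        3 * (w j) ^ 2 * (‖w‖ ^ 2 + δ ^ 2) ^ (-(5 / 2) : ℝ) := by
    intro j
    rw [pd_rpow_normSq δ hδ]
    have h0 : (fun w : E3 => 2 * (-(1 / 2) : ℝ) * (w j * (‖w‖ ^ 2 + δ ^ 2) ^ (-(1 / 2) - 1 : ℝ))) =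
        fun w : E3 => (-w j) * (‖w‖ ^ 2 + δ ^ 2) ^ (-(3 / 2) : ℝ) := by
      funext w
      norm_num
    rw [h0, pd_mul (f := fun y : E3 => -y j)
      (fun x => (hasFDerivAt_coord j x).fun_neg.differentiableAt)
      ((contDiff_rpow_normSq δ hδ _).differentiable (by norm_num)), pd_rpow_normSq δ hδ]
    have h1 : pd j (fun y : E3 => -y j) w = -1 := by
      simp [pd, (hasFDerivAt_coord j w).fun_neg.fderiv]
    simp only [h1]
    norm_num
    ring
  have hn : ‖w‖ ^ 2 = ∑ j, w j ^ 2 := by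
    rw [EuclideanSpace.norm_sq_eq]
    simp
  simp only [e, Finset.sum_add_distrib]
  rw [← Finset.sum_mul, ← Finset.mul_sum, ← hn]
  have h2 : (‖w‖ ^ 2 + δ ^ 2) ^ (-(3 / 2) : ℝ) =
      (‖w‖ ^ 2 + δ ^ 2) * (‖w‖ ^ 2 + δ ^ 2) ^ (-(5 / 2) : ℝ) := by
    rw [← Real.rpow_one_add' hs.le (by norm_num)]
    norm_num
  simp only [h2, Finset.sum_const, Finset.card_univ, Fintype.card_fin]
  simp
  ring

lemma laplacian_mul {f g : E3 → ℝ} (hf : ContDiff ℝ (⊤ : ℕ∞) f) (hg : ContDiff ℝ (⊤ : ℕ∞) g)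
    (w : E3) : ∑ j, pd j (pd j fun x => f x * g x) w =
      (∑ j, pd j (pd j f) w) * g w + 2 * (∑ j, pd j f w * pd j g w) +
        f w * ∑ j, pd j (pd j g) w := by
  have hd : ∀ {k : E3 → ℝ}, ContDiff ℝ (⊤ : ℕ∞) k → Differentiable ℝ k := fun h =>
    h.differentiable (by norm_num)
  have e : ∀ j, pd j (pd j fun x => f x * g x) w =
      pd j (pd j f) w * g w + 2 * (pd j f w * pd j g w) + f w * pd j (pd j g) w := by
    intro j
    rw [pd_mul (hd hf) (hd hg)]
    have h1 : pd j (fun x => pd j f x * g x + f x * pd j g x) w =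
        pd j (fun x => pd j f x * g x) w + pd j (fun x => f x * pd j g x) w := by
      simp only [pd]
      rw [← add_apply, ← fderiv_fun_add]
      · exact ((hd (contDiff_pd hf j)).mul (hd hg)) w
      · exact ((hd hf).mul (hd (contDiff_pd hg j))) w
    rw [h1, pd_mul (hd (contDiff_pd hf j)) (hd hg), pd_mul (hd hf) (hd (contDiff_pd hg j))]
    ring
  simp only [e, Finset.sum_add_distrib, Finset.sum_mul, Finset.mul_sum]

/-- A fixed cut-off function at unit scale. -/
def cutBump : ContDiffBump (0 : E3) := ⟨1 / 8, 1 / 4, by norm_num, by norm_num⟩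

lemma contDiff_cutBump : ContDiff ℝ (⊤ : ℕ∞) (cutBump : E3 → ℝ) := cutBump.contDiff

lemma cutBump_eventuallyEq_one {w : E3} (hw : ‖w‖ < 1 / 8) :
    (cutBump : E3 → ℝ) =ᶠ[nhds w] fun _ => 1 := by
  have : Metric.ball (0 : E3) (1 / 8) ∈ nhds w :=
    Metric.isOpen_ball.mem_nhds (by simpa using hw)
  filter_upwards [this] with y hy
  exact cutBump.one_of_mem_closedBall (Metric.ball_subset_closedBall hy)

lemma pd_congr {f g : E3 → ℝ} {w : E3} (h : f =ᶠ[nhds w] g) (j : Fin 3) :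
    pd j f =ᶠ[nhds w] pd j g := by
  filter_upwards [h.fderiv (𝕜 := ℝ)] with y hy
  simp only [pd, hy]

lemma pd_const (c : ℝ) (j : Fin 3) : pd j (fun _ : E3 => c) = fun _ => 0 := by
  funext x
  simp [pd]

/-- `ΔG - χ ΔN` for `G = χ N`, `N = (|w|² + δ²)^{-1/2}`. -/
def cutKer (δ : ℝ) (w : E3) : ℝ :=
  (∑ j, pd j (pd j cutBump) w) * (‖w‖ ^ 2 + δ ^ 2) ^ (-(1 / 2) : ℝ) +
    2 * ∑ j, pd j cutBump w * (-(w j * (‖w‖ ^ 2 + δ ^ 2) ^ (-(3 / 2) : ℝ)))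

lemma cutKer_eq_zero_of_lt {w : E3} (hw : ‖w‖ < 1 / 8) (δ : ℝ) : cutKer δ w = 0 := by
  have h1 : ∀ j, pd j cutBump =ᶠ[nhds w] fun _ => 0 := fun j => by
    simpa [pd_const] using pd_congr (cutBump_eventuallyEq_one hw) j
  have h2 : ∀ j, pd j (pd j cutBump) w = 0 := fun j => by
    simpa [pd_const] using (pd_congr (h1 j) j).self_of_nhds
  simp [cutKer, h2, fun j => (h1 j).self_of_nhds]

lemma cutKer_eq_zero_of_gt {w : E3} (hw : 1 / 4 < ‖w‖) (δ : ℝ) : cutKer δ w = 0 := by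
  have hs : w ∉ tsupport (cutBump : E3 → ℝ) := by
    rw [cutBump.tsupport_eq]
    simpa [cutBump] using hw
  have h1 : ∀ j, pd j cutBump w = 0 := fun j =>
    image_eq_zero_of_notMem_tsupport fun h => hs (tsupport_pd_subset _ j h)
  have h2 : ∀ j, pd j (pd j cutBump) w = 0 := fun j =>
    image_eq_zero_of_notMem_tsupport fun h =>
      hs (tsupport_pd_subset _ j (tsupport_pd_subset _ j h))
  simp [cutKer, h1, h2]

lemma contDiff_cutKer : ContDiff ℝ (⊤ : ℕ∞) (fun z : E3 × ℝ => cutKer z.2 z.1) := by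
  rw [contDiff_iff_contDiffAt]
  rintro ⟨w, δ⟩
  rcases lt_or_ge ‖w‖ (1 / 8) with hw | hw
  · have : (fun z : E3 × ℝ => cutKer z.2 z.1) =ᶠ[nhds (w, δ)] fun _ => 0 := by
      have h : {z : E3 × ℝ | ‖z.1‖ < 1 / 8} ∈ nhds (w, δ) :=
        (isOpen_lt (by fun_prop) (by fun_prop)).mem_nhds hw
      filter_upwards [h] with z hz
      exact cutKer_eq_zero_of_lt hz _
    exact contDiffAt_const.congr_of_eventuallyEq this
  · have hne : ‖w‖ ^ 2 + δ ^ 2 ≠ 0 := by positivity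
    have hs : ContDiffAt ℝ (⊤ : ℕ∞) (fun z : E3 × ℝ => ‖z.1‖ ^ 2 + z.2 ^ 2) (w, δ) :=
      ((contDiff_norm_sq ℝ).comp contDiff_fst).contDiffAt.add
        (contDiff_snd.pow 2).contDiffAt
    have hp : ∀ a : ℝ, ContDiffAt ℝ (⊤ : ℕ∞)
        (fun z : E3 × ℝ => (‖z.1‖ ^ 2 + z.2 ^ 2) ^ a) (w, δ) := fun a =>
      hs.rpow_const_of_ne hne
    have hc : ∀ {f : E3 → ℝ}, ContDiff ℝ (⊤ : ℕ∞) f →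
        ContDiffAt ℝ (⊤ : ℕ∞) (fun z : E3 × ℝ => f z.1) (w, δ) := fun hf =>
      (hf.comp contDiff_fst).contDiffAt
    unfold cutKer
    refine ContDiffAt.add (ContDiffAt.mul ?_ (hp _)) (contDiffAt_const.mul ?_)
    · exact ContDiffAt.sum fun j _ => hc (contDiff_pd (contDiff_pd contDiff_cutBump j) j)
    · refine ContDiffAt.sum fun j _ => (hc (contDiff_pd contDiff_cutBump j)).mul
        (ContDiffAt.mul ?_ (hp _)).neg
      exact hc (f := fun y : E3 => y j) (EuclideanSpace.proj j : E3 →L[ℝ] ℝ).contDiff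

lemma continuous_cutKer (δ : ℝ) : Continuous (cutKer δ) :=
  contDiff_cutKer.continuous.comp (by fun_prop : Continuous fun w : E3 => (w, δ))

lemma hasCompactSupport_cutKer (δ : ℝ) : HasCompactSupport (cutKer δ) := by
  refine HasCompactSupport.intro (isCompact_closedBall (0 : E3) (1 / 4)) fun w hw => ?_
  exact cutKer_eq_zero_of_gt (by simpa using hw) δ

lemma exists_bound_cutKer : ∃ M : ℝ, ∀ δ ∈ Icc (0 : ℝ) 1, ∀ w, |cutKer δ w| ≤ M := by
  obtain ⟨M, hM⟩ := ((isCompact_closedBall (0 : E3) (1 / 4)).prod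
    (isCompact_Icc (a := (0 : ℝ)) (b := 1))).exists_bound_of_continuousOn
    contDiff_cutKer.continuous.continuousOn
  refine ⟨max M 0, fun δ hδ w => ?_⟩
  by_cases hw : 1 / 4 < ‖w‖
  · simp [cutKer_eq_zero_of_gt hw]
  · exact (hM (w, δ) ⟨by simpa using hw, hδ⟩).trans (le_max_left _ _)

lemma exists_lipschitz_cutKer : ∃ L : ℝ≥0, LipschitzWith L (cutKer 0) := by
  have h : ContDiff ℝ (⊤ : ℕ∞) (cutKer 0) :=
    contDiff_cutKer.comp (contDiff_id.prodMk contDiff_const)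
  exact ContDiff.lipschitzWith_of_hasCompactSupport (hasCompactSupport_cutKer 0) h (by simp)

lemma laplacian_cut_newton (δ : ℝ) (hδ : 0 < δ) (w : E3) :
    ∑ j, pd j (pd j fun w : E3 => cutBump w * (‖w‖ ^ 2 + δ ^ 2) ^ (-(1 / 2) : ℝ)) w =
      cutKer δ w - cutBump w * (3 * δ ^ 2 * (‖w‖ ^ 2 + δ ^ 2) ^ (-(5 / 2) : ℝ)) := by
  rw [laplacian_mul contDiff_cutBump (contDiff_rpow_normSq δ hδ _), laplacian_newton δ hδ,
    cutKer]
  have : ∀ j, pd j (fun w : E3 => (‖w‖ ^ 2 + δ ^ 2) ^ (-(1 / 2) : ℝ)) w =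
      -(w j * (‖w‖ ^ 2 + δ ^ 2) ^ (-(3 / 2) : ℝ)) := by
    intro j
    rw [pd_rpow_normSq δ hδ]
    norm_num
  simp only [this]
  ring

lemma pd_comp_const_sub {f : E3 → ℝ} (hf : Differentiable ℝ f) (x : E3) (j : Fin 3) :
    pd j (fun y => f (x - y)) = fun y => -pd j f (x - y) := by
  funext y
  have h1 : HasFDerivAt (fun y : E3 => x - y) (-ContinuousLinearMap.id ℝ E3) y :=
    (hasFDerivAt_id y).const_sub x
  have := ((hf (x - y)).hasFDerivAt.comp y h1).fderiv
  simp only [Function.comp_def] at this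
  simp [pd, this]

lemma laplacian_comp_const_sub {f : E3 → ℝ} (hf : ContDiff ℝ (⊤ : ℕ∞) f) (x y : E3) :
    ∑ j, pd j (pd j fun y => f (x - y)) y = ∑ j, pd j (pd j f) (x - y) := by
  refine Finset.sum_congr rfl fun j _ => ?_
  rw [pd_comp_const_sub (hf.differentiable (by norm_num))]
  have h := pd_comp_const_sub (f := fun z => -pd j f z)
    ((contDiff_pd hf j).neg.differentiable (by norm_num)) x j
  have h2 : pd j (fun z => -pd j f z) = fun z => -pd j (pd j f) z := by
    funext z
    simp only [pd]
    rw [fderiv_fun_neg]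
    rfl
  simp only [h, h2, neg_neg]

lemma integral_conv_swap {ψ H k : E3 → ℝ} (hψ : Continuous ψ) (hψc : HasCompactSupport ψ)
    (hH : Integrable H) (hk : Continuous k) (hkc : HasCompactSupport k) :
    ∫ x, ψ x * ∫ y, H y * k (x - y) = ∫ w, k w * ∫ z, ψ (w + z) * H z := by
  obtain ⟨Mk, hMk⟩ := hk.bounded_above_of_compact_support hkc
  obtain ⟨Mψ, hMψ⟩ := hψ.bounded_above_of_compact_support hψc
  have hψi := hψ.integrable_of_hasCompactSupport hψc (μ := volume)
  have hki := hk.integrable_of_hasCompactSupport hkc (μ := volume)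
  have i1 : Integrable (Function.uncurry fun x y : E3 => ψ x * (H y * k (x - y)))
      (volume.prod volume) := by
    have := (hψi.mul_prod hH).mul_bdd (c := Mk)
      ((hk.comp (continuous_fst.sub continuous_snd)).aestronglyMeasurable)
      (Eventually.of_forall fun z => hMk (z.1 - z.2))
    refine this.congr (Eventually.of_forall fun z => ?_)
    simp only [Function.comp_apply, Function.uncurry, Pi.sub_apply]
    ring
  have i2 : Integrable (Function.uncurry fun x y : E3 => k x * (ψ (x + y) * H y))
      (volume.prod volume) := by
    have := (hki.mul_prod hH).mul_bdd (c := Mψ)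
      ((hψ.comp (continuous_fst.add continuous_snd)).aestronglyMeasurable)
      (Eventually.of_forall fun z => hMψ (z.1 + z.2))
    refine this.congr (Eventually.of_forall fun z => ?_)
    simp only [Function.comp_apply, Function.uncurry, Pi.add_apply]
    ring
  simp_rw [← integral_const_mul]
  rw [integral_integral_swap i1, integral_integral_swap i2]
  refine integral_congr_ae (Eventually.of_forall fun y => ?_)
  simp only
  rw [← integral_add_right_eq_self _ y]
  refine integral_congr_ae (Eventually.of_forall fun w => ?_)
  simp only [add_sub_cancel_right]
  ring

/-- The profile `3 (1 + |x|²)^{-5/2}` of the regularized Newtonian kernel's Laplacian. -/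
def peakKer (x : E3) : ℝ := 3 * ((1 : ℝ) + ‖x‖ ^ 2) ^ (-(5 / 2) : ℝ)

lemma integrable_peakKer : Integrable peakKer := by
  have : Integrable fun x : E3 => ((1 : ℝ) + ‖x‖ ^ 2) ^ (-(5 : ℝ) / 2) :=
    integrable_rpow_neg_one_add_norm_sq (by simp; norm_num)
  refine (this.const_mul 3).congr (Eventually.of_forall fun x => ?_)
  simp only [peakKer, neg_div]

lemma peakKer_pos (x : E3) : 0 < peakKer x := by
  unfold peakKer
  positivity

lemma continuous_peakKer : Continuous peakKer := by
  refine continuous_const.mul (Continuous.rpow_const (by fun_prop) fun x => Or.inl ?_)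
  positivity

lemma tendsto_peakKer : Tendsto (fun x : E3 => ‖x‖ ^ Module.finrank ℝ E3 * peakKer x)
    (Bornology.cobounded E3) (nhds 0) := by
  have h1 : Tendsto (fun x : E3 => 3 * ‖x‖⁻¹) (Bornology.cobounded E3) (nhds 0) := by
    simpa using (tendsto_inv_atTop_zero.comp tendsto_norm_cobounded_atTop).const_mul (3 : ℝ)
  refine squeeze_zero' (Eventually.of_forall fun x => ?_) ?_ h1
  · have := (peakKer_pos x).le
    positivity
  · filter_upwards [tendsto_norm_cobounded_atTop.eventually_ge_atTop (1 : ℝ)] with x hx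
    have hx0 : 0 < ‖x‖ := by linarith
    have h2 : ((1 : ℝ) + ‖x‖ ^ 2) ^ (-(5 / 2) : ℝ) ≤ (‖x‖ ^ 2) ^ (-(5 / 2) : ℝ) :=
      Real.rpow_le_rpow_of_nonpos (by positivity) (by linarith) (by norm_num)
    have h3 : (‖x‖ ^ 2) ^ (-(5 / 2) : ℝ) = (‖x‖ ^ 5)⁻¹ := by
      rw [← Real.rpow_natCast ‖x‖ 2, ← Real.rpow_mul hx0.le, ← Real.rpow_natCast ‖x‖ 5,
        ← Real.rpow_neg hx0.le]
      norm_num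
    rw [h3] at h2
    have h4 : ‖x‖ ^ 3 * peakKer x ≤ ‖x‖ ^ 3 * (3 * (‖x‖ ^ 5)⁻¹) :=
      mul_le_mul_of_nonneg_left (mul_le_mul_of_nonneg_left h2 (by norm_num)) (by positivity)
    rw [finrank_euclideanSpace_fin]
    refine h4.trans ?_
    have h5 : ‖x‖ ^ 3 * (3 * (‖x‖ ^ 5)⁻¹) = 3 * (‖x‖⁻¹ * ‖x‖⁻¹) := by
      field_simp
    rw [h5]
    have : ‖x‖⁻¹ ≤ 1 := inv_le_one_of_one_le₀ hx
    have h6 : 0 < ‖x‖⁻¹ := by positivity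
    nlinarith

lemma peakKer_smul {c : ℝ} (hc : 0 < c) (w : E3) :
    3 * c⁻¹ ^ 2 * (‖w‖ ^ 2 + c⁻¹ ^ 2) ^ (-(5 / 2) : ℝ) = c ^ 3 * peakKer (c • w) := by
  have e1 : ‖w‖ ^ 2 + c⁻¹ ^ 2 = c⁻¹ ^ 2 * (1 + ‖c • w‖ ^ 2) := by
    rw [norm_smul, Real.norm_eq_abs, abs_of_pos hc]
    field_simp
    ring
  have e2 : (c⁻¹ ^ 2) ^ (-(5 / 2) : ℝ) = c ^ 5 := by
    rw [← Real.rpow_natCast c⁻¹ 2, ← Real.rpow_mul (by positivity), Real.inv_rpow hc.le,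
      ← Real.rpow_neg hc.le, ← Real.rpow_natCast c 5]
    norm_num
  rw [e1, Real.mul_rpow (by positivity) (by positivity), e2, peakKer]
  field_simp

set_option maxHeartbeats 1000000 in
lemma exists_harmonic_lipschitz : ∃ C : ℝ, 0 ≤ C ∧ ∀ h : E3 → ℝ,
    IntegrableOn h (ball3 0 1) →
    (∀ b, IsTest3 (ball3 0 1) b → ∫ x in ball3 0 1, h x * ∑ j, pd j (pd j b) x = 0) →
    ∃ g : E3 → ℝ, (∀ x y, |g x - g y| ≤ C * (∫ y in ball3 0 1, |h y|) * ‖x - y‖) ∧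
      ∀ᵐ x ∂(volume.restrict (ball3 0 (1 / 2))), h x = g x := by
  obtain ⟨L, hL⟩ := exists_lipschitz_cutKer
  obtain ⟨M, hM⟩ := exists_bound_cutKer
  set η : E3 → ℝ := peakKer with hη
  have hηi : Integrable η := integrable_peakKer
  have hη0 : ∀ x, 0 < η x := peakKer_pos
  have hηc : Continuous η := continuous_peakKer
  set c0 : ℝ := ∫ x, η x with hc0
  have hc0p : 0 < c0 := integral_pos_of_integrable_nonneg_nonzero (x := 0) hηc hηi
    (fun x => (hη0 x).le) (hη0 0).ne'
  refine ⟨c0⁻¹ * L, by positivity, fun h hh hharm => ?_⟩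
  set H : E3 → ℝ := (ball3 0 1).indicator h with hHdef
  have hb1 : MeasurableSet (ball3 0 1) := Metric.isOpen_ball.measurableSet
  have hH : Integrable H := hh.integrable_indicator hb1
  have hHk : ∀ k : E3 → ℝ, Continuous k → HasCompactSupport k → ∀ x,
      Integrable fun y => H y * k (x - y) := by
    intro k hk hkc x
    obtain ⟨Mk, hMk⟩ := hk.bounded_above_of_compact_support hkc
    exact hH.mul_bdd (c := Mk) (by fun_prop) (Eventually.of_forall fun y => hMk _)
  refine ⟨fun x => c0⁻¹ * ∫ y, H y * cutKer 0 (x - y), fun x y => ?_, ?_⟩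
  · rw [← mul_sub, ← integral_sub (hHk _ (continuous_cutKer 0) (hasCompactSupport_cutKer 0) x)
      (hHk _ (continuous_cutKer 0) (hasCompactSupport_cutKer 0) y), abs_mul,
      abs_of_pos (inv_pos.2 hc0p), mul_assoc, mul_assoc]
    refine mul_le_mul_of_nonneg_left ?_ (inv_pos.2 hc0p).le
    have e : ∫ y in ball3 0 1, |h y| = ∫ y, |H y| := by
      rw [← integral_indicator hb1]
      refine integral_congr_ae (Eventually.of_forall fun z => ?_)
      simp only [hHdef, indicator]
      split_ifs <;> simp
    rw [e, ← mul_assoc, mul_right_comm, ← integral_const_mul, ← Real.norm_eq_abs]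
    refine norm_integral_le_of_norm_le (hH.abs.const_mul _) (Eventually.of_forall fun z => ?_)
    rw [← mul_sub, norm_mul, Real.norm_eq_abs, mul_comm]
    refine mul_le_mul_of_nonneg_right ?_ (abs_nonneg _)
    have := hL.dist_le_mul (x - z) (y - z)
    rwa [dist_sub_right, dist_eq_norm, dist_eq_norm] at this
  · have key : ∀ ψ : E3 → ℝ, IsTest3 (ball3 0 (1 / 2)) ψ →
        c0 * ∫ x, ψ x * H x = ∫ x, ψ x * ∫ y, H y * cutKer 0 (x - y) := by
      rintro ψ ⟨hψ, hψc, hψs⟩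
      obtain ⟨Mψ, hMψ⟩ := hψ.continuous.bounded_above_of_compact_support hψc
      set Ψ : E3 → ℝ := fun w => ∫ z, ψ (w + z) * H z with hΨ
      have hΨc : Continuous Ψ := by
        refine continuous_of_dominated (bound := fun z => Mψ * |H z|) (fun w => ?_) (fun w => ?_)
          (hH.abs.const_mul _) (Eventually.of_forall fun z => ?_)
        · exact (hψ.continuous.comp (by fun_prop)).aestronglyMeasurable.mul hH.1
        · refine Eventually.of_forall fun z => ?_
          rw [norm_mul]
          exact mul_le_mul_of_nonneg_right (hMψ _) (abs_nonneg _)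
        · exact (hψ.continuous.comp (by fun_prop)).mul continuous_const
      have hΨ0 : Ψ 0 = ∫ x, ψ x * H x := by simp [hΨ]
      have h_intg : ∀ k : E3 → ℝ, Continuous k → HasCompactSupport k →
          Integrable fun w => k w * Ψ w := fun k hk hkc =>
        (hk.mul hΨc).integrable_of_hasCompactSupport hkc.mul_right
      have hcut : HasCompactSupport (cutBump : E3 → ℝ) := cutBump.hasCompactSupport
      have hintm : ∀ m : E3 → ℝ, Continuous m →
          Integrable fun w => m w • (cutBump w * Ψ w) := by
        intro m hm
        have h1 : HasCompactSupport fun w => m w * (cutBump w * Ψ w) :=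
          (hcut.mul_right (f' := Ψ)).mul_left
        exact (hm.mul (contDiff_cutBump.continuous.mul hΨc)).integrable_of_hasCompactSupport h1
      have hid : ∀ δ : ℝ, 0 < δ → ∫ w, cutKer δ w * Ψ w =
          ∫ w, (3 * δ ^ 2 * (‖w‖ ^ 2 + δ ^ 2) ^ (-(5 / 2) : ℝ)) • (cutBump w * Ψ w) := by
        intro δ hδ
        set G : E3 → ℝ := fun w => cutBump w * (‖w‖ ^ 2 + δ ^ 2) ^ (-(1 / 2) : ℝ) with hG
        have hGs : ContDiff ℝ (⊤ : ℕ∞) G := contDiff_cutBump.mul (contDiff_rpow_normSq δ hδ _)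
        have hGc : HasCompactSupport G := hcut.mul_right
        set k : E3 → ℝ := fun w => ∑ j, pd j (pd j G) w with hk
        have hkc : Continuous k := continuous_finsetSum _ fun j _ =>
          (contDiff_pd (contDiff_pd hGs j) j).continuous
        have hke : ∀ w, k w = cutKer δ w -
            cutBump w * (3 * δ ^ 2 * (‖w‖ ^ 2 + δ ^ 2) ^ (-(5 / 2) : ℝ)) :=
          laplacian_cut_newton δ hδ
        have hkcs : HasCompactSupport k := by
          have : k = fun w => cutKer δ w -
            cutBump w * (3 * δ ^ 2 * (‖w‖ ^ 2 + δ ^ 2) ^ (-(5 / 2) : ℝ)) := funext hke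
          rw [this]
          exact (hasCompactSupport_cutKer δ).sub hcut.mul_right
        have h0 : ∫ x, ψ x * ∫ y, H y * k (x - y) = 0 := by
          rw [← integral_zero E3 ℝ]
          refine integral_congr_ae (Eventually.of_forall fun x => ?_)
          by_cases hx : ψ x = 0
          · simp [hx]
          have hxb : x ∈ ball3 0 (1 / 2) := hψs (subset_tsupport _ hx)
          have ht : IsTest3 (ball3 0 1) fun y => G (x - y) := by
            have hsub : ∀ y, G (x - y) ≠ 0 → y ∈ Metric.closedBall x (1 / 4) := by
              intro y hy
              have h1 : (cutBump : E3 → ℝ) (x - y) ≠ 0 := left_ne_zero_of_mul hy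
              have h2 : x - y ∈ Function.support (cutBump : E3 → ℝ) := h1
              rw [cutBump.support_eq] at h2
              have h3 : dist x y < 1 / 4 := by simpa [cutBump, dist_eq_norm] using h2
              rw [Metric.mem_closedBall, dist_comm]
              exact h3.le
            have hts : tsupport (fun y => G (x - y)) ⊆ Metric.closedBall x (1 / 4) :=
              closure_minimal hsub Metric.isClosed_closedBall
            refine ⟨hGs.comp (contDiff_const.sub contDiff_id), ?_, hts.trans ?_⟩
            · exact HasCompactSupport.of_support_subset_isCompact
                (isCompact_closedBall x (1 / 4)) hsub
            · have : dist x 0 < 1 / 2 := hxb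
              exact Metric.closedBall_subset_ball' (by linarith)
          have := hharm _ ht
          simp only [laplacian_comp_const_sub hGs] at this
          have e : ∫ y, H y * k (x - y) = ∫ y in ball3 0 1, h y * ∑ j, pd j (pd j G) (x - y) := by
            rw [← integral_indicator hb1]
            refine integral_congr_ae (Eventually.of_forall fun y => ?_)
            simp only [hHdef, indicator]
            split_ifs <;> simp [hk]
          simp only [e, this, mul_zero]
        rw [integral_conv_swap hψ.continuous hψc hH hkc hkcs] at h0
        have hA := h_intg _ (continuous_cutKer δ) (hasCompactSupport_cutKer δ)
        have hB : Integrable fun w =>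
            (3 * δ ^ 2 * (‖w‖ ^ 2 + δ ^ 2) ^ (-(5 / 2) : ℝ)) • (cutBump w * Ψ w) := by
          exact hintm _ (continuous_const.mul (contDiff_rpow_normSq δ hδ _).continuous)
        rw [← sub_eq_zero, ← integral_sub hA hB, ← h0]
        refine integral_congr_ae (Eventually.of_forall fun w => ?_)
        simp only [hke, smul_eq_mul]
        ring
      have hφ1 : ∫ x, c0⁻¹ * η x = 1 := by
        rw [integral_const_mul]
        exact inv_mul_cancel₀ hc0p.ne'
      have hdecay : Tendsto (fun x : E3 => ‖x‖ ^ Module.finrank ℝ E3 * (c0⁻¹ * η x))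
          (Bornology.cobounded E3) (nhds 0) := by
        simpa only [mul_zero, mul_left_comm] using tendsto_peakKer.const_mul c0⁻¹
      have hpeak := tendsto_integral_comp_smul_smul_of_integrable (μ := volume) (fun x =>
        mul_nonneg (inv_pos.2 hc0p).le (hη0 x).le) hφ1 hdecay
        (h_intg _ contDiff_cutBump.continuous hcut)
        (contDiff_cutBump.continuous.mul hΨc).continuousAt
      have hone : (cutBump : E3 → ℝ) 0 = 1 := cutBump.one_of_mem_closedBall (by simp [cutBump])
      have hpeak' : Tendsto (fun c : ℝ => ∫ w, cutKer c⁻¹ w * Ψ w) atTop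
          (nhds (c0 * ∫ x, ψ x * H x)) := by
        have h1 := hpeak.const_mul c0
        simp only [hone, one_mul, hΨ0] at h1
        refine h1.congr' ?_
        filter_upwards [eventually_gt_atTop (0 : ℝ)] with c hc
        rw [hid c⁻¹ (inv_pos.2 hc), ← integral_const_mul]
        refine integral_congr_ae (Eventually.of_forall fun w => ?_)
        simp only [smul_eq_mul, finrank_euclideanSpace_fin]
        rw [peakKer_smul hc w]
        field_simp
        ring
      have hlim : Tendsto (fun c : ℝ => ∫ w, cutKer c⁻¹ w * Ψ w) atTop
          (nhds (∫ w, cutKer 0 w * Ψ w)) := by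
        refine tendsto_integral_filter_of_dominated_convergence
          (fun w => (Metric.closedBall (0 : E3) (1 / 4)).indicator (fun w => M * |Ψ w|) w)
          (Eventually.of_forall fun c =>
            ((continuous_cutKer _).mul hΨc).aestronglyMeasurable) ?_ ?_ ?_
        · filter_upwards [eventually_ge_atTop (1 : ℝ)] with c hc
          refine Eventually.of_forall fun w => ?_
          by_cases hw : w ∈ Metric.closedBall (0 : E3) (1 / 4)
          · rw [indicator_of_mem hw, norm_mul]
            refine mul_le_mul_of_nonneg_right (hM _ ⟨?_, inv_le_one_of_one_le₀ hc⟩ w) (abs_nonneg _)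
            positivity
          · rw [indicator_of_notMem hw, cutKer_eq_zero_of_gt (by simpa using hw)]
            simp
        · rw [integrable_indicator_iff Metric.isClosed_closedBall.measurableSet]
          exact (continuous_const.mul hΨc.abs).continuousOn.integrableOn_compact
            (isCompact_closedBall _ _)
        · refine Eventually.of_forall fun w => Tendsto.mul_const _ ?_
          have hcont : Continuous fun δ : ℝ => cutKer δ w :=
            contDiff_cutKer.continuous.comp (by fun_prop : Continuous fun δ : ℝ => (w, δ))
          exact (hcont.tendsto 0).comp tendsto_inv_atTop_zero
      rw [integral_conv_swap hψ.continuous hψc hH (continuous_cutKer 0)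
        (hasCompactSupport_cutKer 0)]
      exact tendsto_nhds_unique hpeak' hlim
    have hgc : Continuous fun x => ∫ y, H y * cutKer 0 (x - y) := by
      refine continuous_of_dominated (bound := fun z => |H z| * M) (fun w => ?_) (fun w => ?_)
          (hH.abs.mul_const _) (Eventually.of_forall fun z => ?_)
      · exact (hHk _ (continuous_cutKer 0) (hasCompactSupport_cutKer 0) w).1
      · refine Eventually.of_forall fun z => ?_
        rw [norm_mul]
        exact mul_le_mul_of_nonneg_left (hM 0 ⟨le_rfl, zero_le_one⟩ _) (abs_nonneg _)
      · exact continuous_const.mul ((continuous_cutKer 0).comp (by fun_prop))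
    have hae : ∀ᵐ x, x ∈ ball3 0 (1 / 2) → H x - c0⁻¹ * ∫ y, H y * cutKer 0 (x - y) = 0 := by
      refine IsOpen.ae_eq_zero_of_integral_contDiff_smul_eq_zero Metric.isOpen_ball ?_ ?_
      · exact (hH.locallyIntegrable.sub
          (continuous_const.mul hgc).locallyIntegrable).locallyIntegrableOn _
      · intro ψ h1 h2 h3
        have hk := key ψ ⟨h1, h2, h3⟩
        obtain ⟨Mψ, hMψ⟩ := h1.continuous.bounded_above_of_compact_support h2
        have i1 : Integrable fun x => ψ x * H x :=
          hH.bdd_mul (c := Mψ) h1.continuous.aestronglyMeasurable (Eventually.of_forall hMψ)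
        have i2 : Integrable fun x => c0⁻¹ * (ψ x * ∫ y, H y * cutKer 0 (x - y)) :=
          ((h1.continuous.mul hgc).integrable_of_hasCompactSupport h2.mul_right).const_mul _
        have e : ∀ x, ψ x • (H x - c0⁻¹ * ∫ y, H y * cutKer 0 (x - y)) =
            ψ x * H x - c0⁻¹ * (ψ x * ∫ y, H y * cutKer 0 (x - y)) := by
          intro x
          rw [smul_eq_mul]
          ring
        simp only [e]
        rw [integral_sub i1 i2, integral_const_mul, ← hk]
        field_simp
        ring
    rw [ae_restrict_iff' (measurableSet_ball3 _ _)]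
    filter_upwards [hae] with x hx hxb
    have h1 := hx hxb
    have h2 : H x = h x := indicator_of_mem (Metric.ball_subset_ball (by norm_num) hxb) _
    rw [← h2]
    exact sub_eq_zero.1 h1

/-- The affine rescaling `y ↦ x₀ + r y`. -/
def affE (x0 : E3) (r : ℝ) (hr : r ≠ 0) : E3 ≃ᵐ E3 :=
  ((Homeomorph.smulOfNeZero r hr).trans (Homeomorph.addLeft x0)).toMeasurableEquiv

lemma affE_apply (x0 : E3) (r : ℝ) (hr : r ≠ 0) (y : E3) : affE x0 r hr y = x0 + r • y := rfl

lemma affE_preimage_ball (x0 : E3) {r : ℝ} (hr : 0 < r) (s : ℝ) :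
    affE x0 r hr.ne' ⁻¹' ball3 x0 (r * s) = ball3 0 s := by
  ext y
  simp [ball3, affE_apply, norm_smul, abs_of_pos hr, hr]

lemma map_affE (x0 : E3) {r : ℝ} (hr : 0 < r) (s : ℝ) :
    (volume.restrict (ball3 0 s)).map (affE x0 r hr.ne') =
      ENNReal.ofReal (r ^ 3)⁻¹ • volume.restrict (ball3 x0 (r * s)) := by
  rw [← affE_preimage_ball x0 hr, ← MeasurableEquiv.restrict_map]
  have : (volume : Measure E3).map (affE x0 r hr.ne') = ENNReal.ofReal (r ^ 3)⁻¹ • volume := by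
    have h1 : (affE x0 r hr.ne' : E3 → E3) = (fun y => x0 + y) ∘ (fun y => r • y) := rfl
    rw [h1, ← Measure.map_map (by fun_prop) (by fun_prop),
      Measure.map_addHaar_smul _ hr.ne', Measure.map_smul, map_add_left_eq_self,
      finrank_euclideanSpace_fin, abs_of_pos (by positivity)]
  rw [this, Measure.restrict_smul]

lemma integral_affE (x0 : E3) {r : ℝ} (hr : 0 < r) (s : ℝ) (f : E3 → ℝ) :
    ∫ y in ball3 0 s, f (x0 + r • y) = (r ^ 3)⁻¹ * ∫ x in ball3 x0 (r * s), f x := by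
  have h : ENNReal.toReal (ENNReal.ofReal (r ^ 3)⁻¹) = (r ^ 3)⁻¹ :=
    ENNReal.toReal_ofReal (by positivity)
  rw [← smul_eq_mul, ← h, ← integral_smul_measure, ← map_affE x0 hr, integral_map_equiv]
  rfl

lemma integrableOn_affE (x0 : E3) {r : ℝ} (hr : 0 < r) (s : ℝ) (f : E3 → ℝ) :
    IntegrableOn (fun y => f (x0 + r • y)) (ball3 0 s) ↔ IntegrableOn f (ball3 x0 (r * s)) := by
  have h0 : ENNReal.ofReal (r ^ 3)⁻¹ ≠ 0 := by
    rw [Ne, ENNReal.ofReal_eq_zero, not_le]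
    positivity
  rw [IntegrableOn, IntegrableOn, 
    ← integrable_smul_measure (μ := volume.restrict (ball3 x0 (r * s))) h0 ENNReal.ofReal_ne_top,
    ← map_affE x0 hr, integrable_map_equiv]
  rfl

lemma ae_affE (x0 : E3) {r : ℝ} (hr : 0 < r) (s : ℝ) {P : E3 → Prop} :
    (∀ᵐ y ∂(volume.restrict (ball3 0 s)), P (x0 + r • y)) ↔
      ∀ᵐ x ∂(volume.restrict (ball3 x0 (r * s))), P x := by
  have h0 : ENNReal.ofReal (r ^ 3)⁻¹ ≠ 0 := by
    rw [Ne, ENNReal.ofReal_eq_zero, not_le]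
    positivity
  rw [← Measure.ae_ennreal_smul_measure_iff (μ := volume.restrict (ball3 x0 (r * s))) h0,
    ← map_affE x0 hr]
  change (∀ᵐ y ∂_, P (affE x0 r hr.ne' y)) ↔ _
  rw [Filter.Eventually, Filter.Eventually, ← MeasurableEquiv.map_ae]
  rfl

/-- Pull-back of a test function at unit scale. -/
lemma pd_comp_inv_aff {b : E3 → ℝ} (hb : Differentiable ℝ b) (x0 : E3) (r : ℝ) (j : Fin 3) :
    pd j (fun x => b (r⁻¹ • (x - x0))) = fun x => r⁻¹ * pd j b (r⁻¹ • (x - x0)) := by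
  funext x
  have h1 : HasFDerivAt (fun x : E3 => r⁻¹ • (x - x0)) (r⁻¹ • ContinuousLinearMap.id ℝ E3) x :=
    ((hasFDerivAt_id x).sub_const x0).const_smul r⁻¹
  have := ((hb (r⁻¹ • (x - x0))).hasFDerivAt.comp x h1).fderiv
  simp only [Function.comp_def] at this
  simp [pd, this]

lemma isTest3_comp_inv_aff {b : E3 → ℝ} {s : ℝ} (hb : IsTest3 (ball3 0 s) b) (x0 : E3) {r : ℝ}
    (hr : 0 < r) : IsTest3 (ball3 x0 (r * s)) (fun x => b (r⁻¹ • (x - x0))) := by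
  have e : (fun x => b (r⁻¹ • (x - x0))) =
      b ∘ ((Homeomorph.addRight (-x0)).trans (Homeomorph.smulOfNeZero r⁻¹ (inv_ne_zero hr.ne'))) := by
    funext x
    simp [sub_eq_add_neg]
  refine ⟨hb.1.comp ((contDiff_id.sub contDiff_const).const_smul r⁻¹), ?_, ?_⟩
  · rw [e]
    exact hb.2.1.comp_homeomorph _
  · rw [e, tsupport_comp_eq_preimage]
    intro x hx
    have h1 := hb.2.2 hx
    have h2 : ‖r⁻¹ • (x + -x0)‖ < s := by simpa [ball3] using h1
    rw [norm_smul, Real.norm_eq_abs, abs_of_pos (inv_pos.2 hr), inv_mul_lt_iff₀ hr,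
      ← sub_eq_add_neg] at h2
    rwa [ball3, Metric.mem_ball, dist_eq_norm]

lemma laplacian_comp_inv_aff {b : E3 → ℝ} (hb : ContDiff ℝ (⊤ : ℕ∞) b) (x0 : E3) (r : ℝ)
    (x : E3) : ∑ j, pd j (pd j fun x => b (r⁻¹ • (x - x0))) x =
      r⁻¹ ^ 2 * ∑ j, pd j (pd j b) (r⁻¹ • (x - x0)) := by
  rw [Finset.mul_sum]
  refine Finset.sum_congr rfl fun j _ => ?_
  rw [pd_comp_inv_aff (hb.differentiable (by norm_num))]
  have h1 : pd j (fun x => r⁻¹ * pd j b (r⁻¹ • (x - x0))) x =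
      r⁻¹ * pd j (fun x => pd j b (r⁻¹ • (x - x0))) x := by
    have hd : DifferentiableAt ℝ (fun x => pd j b (r⁻¹ • (x - x0))) x :=
      (((contDiff_pd hb j).comp ((contDiff_id.sub contDiff_const).const_smul r⁻¹)).differentiable
        (by norm_num)) x
    simp only [pd] at hd ⊢
    rw [fderiv_const_mul hd]
    rfl
  rw [h1, pd_comp_inv_aff ((contDiff_pd hb j).differentiable (by norm_num))]
  ring

lemma exists_harmonic_osc : ∃ C : ℝ, 0 ≤ C ∧ ∀ (x0 : E3) (r : ℝ), 0 < r → ∀ h : E3 → ℝ,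
    IntegrableOn h (ball3 x0 r) →
    (∀ b, IsTest3 (ball3 x0 r) b → ∫ x in ball3 x0 r, h x * ∑ j, pd j (pd j b) x = 0) →
    ∃ c : ℝ, ∀ᵐ x ∂(volume.restrict (ball3 x0 (r / 2))),
      |h x - c| ≤ C * (r ^ 4)⁻¹ * (∫ y in ball3 x0 r, |h y|) * ‖x - x0‖ := by
  obtain ⟨C, hC, H⟩ := exists_harmonic_lipschitz
  refine ⟨C, hC, fun x0 r hr h hh hharm => ?_⟩
  have hi : IntegrableOn (fun y => h (x0 + r • y)) (ball3 0 1) :=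
    (integrableOn_affE x0 hr 1 h).2 (by rwa [mul_one])
  obtain ⟨g, hg, hae⟩ := H (fun y => h (x0 + r • y)) hi (by
    intro b hb
    have hb' := isTest3_comp_inv_aff hb x0 hr
    rw [mul_one] at hb'
    have h1 := hharm _ hb'
    simp only [laplacian_comp_inv_aff hb.1] at h1
    have h2 := integral_affE x0 hr 1
      (fun x => h x * (r⁻¹ ^ 2 * ∑ j, pd j (pd j b) (r⁻¹ • (x - x0))))
    rw [mul_one, h1, mul_zero] at h2
    have e : ∀ y : E3, r⁻¹ • (x0 + r • y - x0) = y := fun y => by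
      rw [add_sub_cancel_left, smul_smul, inv_mul_cancel₀ hr.ne', one_smul]
    simp only [e] at h2
    have h3 : ∫ y in ball3 0 1, h (x0 + r • y) * (r⁻¹ ^ 2 * ∑ j, pd j (pd j b) y) =
        r⁻¹ ^ 2 * ∫ y in ball3 0 1, h (x0 + r • y) * ∑ j, pd j (pd j b) y := by
      rw [← integral_const_mul]
      exact integral_congr_ae (Eventually.of_forall fun y => by ring)
    rw [h3] at h2
    exact (mul_eq_zero.1 h2).resolve_left (by positivity))
  refine ⟨g 0, ?_⟩
  have hr2 : r / 2 = r * (1 / 2) := by ring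
  rw [hr2, ← ae_affE x0 hr (1 / 2)]
  filter_upwards [hae] with y hy
  rw [hy]
  refine (hg y 0).trans (le_of_eq ?_)
  have h2 := integral_affE x0 hr 1 (fun x => |h x|)
  rw [mul_one] at h2
  rw [h2, add_sub_cancel_left, sub_zero, norm_smul, Real.norm_eq_abs, abs_of_pos hr]
  field_simp

lemma exists_pressure_split : ∃ C : ℝ, 0 ≤ C ∧ ∀ (x0 : E3) (r : ℝ), 0 < r →
    ∀ (F : Fin 3 → Fin 3 → E3 → ℝ) (p : E3 → ℝ) (c : ℝ),
    (∀ i j, MemLp (F i j) 2 (volume.restrict (ball3 x0 r))) → IntegrableOn p (ball3 x0 r) →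
    SlicePress (ball3 x0 r) F p →
    ∃ (c' : ℝ) (p1 : E3 → ℝ), MemLp p1 2 ∧
      ∫ x, p1 x ^ 2 ≤ ∫ x in ball3 x0 r, ∑ i, ∑ j, F i j x ^ 2 ∧
      ∀ᵐ x ∂(volume.restrict (ball3 x0 (r / 2))), |p x - c'| ≤ |p1 x| + C * (r ^ 4)⁻¹ *
        ((∫ y in ball3 x0 r, |p y - c|) + ∫ y in ball3 x0 r, |p1 y|) * ‖x - x0‖ := by
  obtain ⟨C, hC, H⟩ := exists_harmonic_osc
  refine ⟨C, hC, fun x0 r hr F p c hF hp hpress => ?_⟩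
  have hB := measurableSet_ball3 x0 r
  obtain ⟨p1, hp1, hp1n, hp1e⟩ := exists_double_divergence_potential
    (fun i j => (ball3 x0 r).indicator (F i j)) (fun i j => (memLp_indicator_iff_restrict hB).2
      (hF i j))
  have hfin : IsFiniteMeasure (volume.restrict (ball3 x0 r)) :=
    ⟨by rw [Measure.restrict_apply_univ]; exact measure_ball_lt_top⟩
  have hp1i : IntegrableOn p1 (ball3 x0 r) := (hp1.restrict _).integrable (by norm_num)
  have h_intg : IntegrableOn (fun x => (p x - c) + p1 x) (ball3 x0 r) :=
    (hp.sub (integrable_const c)).add hp1i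
  obtain ⟨c', hc'⟩ := H x0 r hr (fun x => (p x - c) + p1 x) h_intg (by
    intro b hb
    have hbl : Continuous fun x => ∑ j, pd j (pd j b) x := continuous_finsetSum _ fun j _ =>
      (contDiff_pd (contDiff_pd hb.1 j) j).continuous
    have hblc : HasCompactSupport fun x => ∑ j, pd j (pd j b) x := by
      have hs : ∀ j, ∀ x ∉ tsupport b, pd j (pd j b) x = 0 := fun j x hx =>
        image_eq_zero_of_notMem_tsupport fun h =>
          hx (tsupport_pd_subset _ j (tsupport_pd_subset _ j h))
      exact HasCompactSupport.intro hb.2.1 fun x hx => Finset.sum_eq_zero fun j _ => hs j x hx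
    obtain ⟨M, hM⟩ := hbl.bounded_above_of_compact_support hblc
    have hout : ∀ i j, ∀ x ∉ ball3 x0 r, pd i (pd j b) x = 0 := fun i j x hx =>
      image_eq_zero_of_notMem_tsupport fun h =>
        hx (hb.2.2 (tsupport_pd_subset _ j (tsupport_pd_subset _ i h)))
    have hmul : ∀ f : E3 → ℝ, IntegrableOn f (ball3 x0 r) →
        IntegrableOn (fun x => f x * ∑ j, pd j (pd j b) x) (ball3 x0 r) := fun f hf =>
      hf.mul_bdd (c := M) hbl.aestronglyMeasurable (Eventually.of_forall hM)
    have h1 := hpress b hb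
    have h2 := hp1e b ⟨hb.1, hb.2.1, subset_univ _⟩
    have h3 : ∫ x, p1 x * ∑ j, pd j (pd j b) x =
        ∫ x in ball3 x0 r, p1 x * ∑ j, pd j (pd j b) x := by
      rw [← integral_indicator hB]
      refine integral_congr_ae (Eventually.of_forall fun x => ?_)
      by_cases hx : x ∈ ball3 x0 r
      · simp [hx]
      · simp [hx, fun j => hout j j x hx]
    have h4 : ∫ x, ∑ i, ∑ j, (ball3 x0 r).indicator (F i j) x * pd i (pd j b) x =
        ∫ x in ball3 x0 r, ∑ i, ∑ j, F i j x * pd i (pd j b) x := by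
      rw [← integral_indicator hB]
      refine integral_congr_ae (Eventually.of_forall fun x => ?_)
      by_cases hx : x ∈ ball3 x0 r
      · simp [hx]
      · simp [hx]
    rw [h3, h4, ← h1] at h2
    have hconst : ∫ x in ball3 x0 r, c * ∑ j, pd j (pd j b) x = 0 := by
      have e : ∫ x in ball3 x0 r, c * ∑ j, pd j (pd j b) x =
          ∫ x, c * ∑ j, pd j (pd j b) x := by
        rw [← integral_indicator hB]
        refine integral_congr_ae (Eventually.of_forall fun x => ?_)
        by_cases hx : x ∈ ball3 x0 r
        · simp [hx]
        · simp [hx, fun j => hout j j x hx]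
      have hz : ∀ j, ∫ x, pd j (pd j b) x = 0 := fun j => by
        have := integral_mul_pd (f := fun _ => (1 : ℝ)) contDiff_const (contDiff_pd hb.1 j)
          (hasCompactSupport_pd hb.2.1 j) j
        simpa [pd_const] using this
      rw [e, integral_const_mul, integral_finsetSum _ fun j _ =>
        (contDiff_pd (contDiff_pd hb.1 j) j).continuous.integrable_of_hasCompactSupport
          (hasCompactSupport_pd (hasCompactSupport_pd hb.2.1 j) j)]
      simp [hz]
    have e : ∀ x, ((p x - c) + p1 x) * ∑ j, pd j (pd j b) x =
        (p x * ∑ j, pd j (pd j b) x - c * ∑ j, pd j (pd j b) x) +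
          p1 x * ∑ j, pd j (pd j b) x := fun x => by ring
    have hc := hmul (fun _ => c) (integrable_const c)
    have i5 : IntegrableOn (fun x => p x * ∑ j, pd j (pd j b) x - c * ∑ j, pd j (pd j b) x)
      (ball3 x0 r) := (hmul p hp).sub hc
    simp only [e]
    rw [integral_add i5 (hmul p1 hp1i), integral_sub (hmul p hp) hc, hconst, h2]
    ring)
  refine ⟨c + c', p1, hp1, ?_, ?_⟩
  · refine hp1n.trans (le_of_eq ?_)
    rw [← integral_indicator hB]
    refine integral_congr_ae (Eventually.of_forall fun x => ?_)
    by_cases hx : x ∈ ball3 x0 r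
    · simp [hx]
    · simp [hx]
  · filter_upwards [hc'] with x hx
    have h1 : |p x - (c + c')| ≤ |p1 x| + |p x - c + p1 x - c'| := by
      have := abs_sub (p x - c + p1 x - c') (p1 x)
      have e : p x - (c + c') = p x - c + p1 x - c' - p1 x := by ring
      rw [e]
      linarith
    refine h1.trans (add_le_add_right (hx.trans ?_) _)
    refine mul_le_mul_of_nonneg_right ?_ (norm_nonneg _)
    refine mul_le_mul_of_nonneg_left ?_ (by positivity)
    have i6 : IntegrableOn (fun y => |p y - c|) (ball3 x0 r) := (hp.sub (integrable_const c)).abs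
    have i7 : IntegrableOn (fun y => |p1 y|) (ball3 x0 r) := hp1i.abs
    rw [← integral_add i6 i7]
    exact integral_mono h_intg.abs (i6.add i7) fun y => abs_add_le _ _

lemma volume_ball3_le (x : E3) {s : ℝ} (hs : 0 ≤ s) :
    volume (ball3 x s) ≤ ENNReal.ofReal (9 * s ^ 3) := by
  unfold ball3
  rw [EuclideanSpace.volume_ball_fin_three, ← ENNReal.ofReal_pow hs,
    ← ENNReal.ofReal_mul (by positivity)]
  refine ENNReal.ofReal_le_ofReal ?_
  have := Real.pi_lt_d2
  nlinarith [pow_nonneg hs 3]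

lemma volume_ball3_sqrt_le (x : E3) {s : ℝ} (hs : 0 ≤ s) :
    volume (ball3 x s) ^ (1 / 2 : ℝ) ≤ ENNReal.ofReal (3 * s ^ (3 / 2 : ℝ)) := by
  refine (ENNReal.rpow_le_rpow (volume_ball3_le x hs) (by norm_num)).trans (le_of_eq ?_)
  rw [ENNReal.ofReal_rpow_of_nonneg (by positivity) (by norm_num),
    Real.mul_rpow (by norm_num) (by positivity), ← Real.rpow_natCast s 3, ← Real.rpow_mul hs]
  congr 2
  · rw [← Real.sqrt_eq_rpow, show (9 : ℝ) = 3 ^ 2 by norm_num, Real.sqrt_sq (by norm_num)]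
  · norm_num

lemma lintegral_ball3_le_L2 (x : E3) {s : ℝ} (hs : 0 ≤ s) {f : E3 → ℝ≥0∞}
    (hf : AEMeasurable f (volume.restrict (ball3 x s))) :
    ∫⁻ y in ball3 x s, f y ≤
      ENNReal.ofReal (3 * s ^ (3 / 2 : ℝ)) * (∫⁻ y in ball3 x s, f y ^ (2 : ℝ)) ^ (1 / 2 : ℝ) := by
  have h := ENNReal.lintegral_mul_le_Lp_mul_Lq (volume.restrict (ball3 x s))
    (Real.HolderConjugate.two_two) (aemeasurable_const (b := (1 : ℝ≥0∞))) hf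
  simp only [Pi.mul_apply, one_mul, ENNReal.one_rpow, lintegral_const, Measure.restrict_apply_univ]
    at h
  exact h.trans (mul_le_mul_left (volume_ball3_sqrt_le x hs) _)

lemma pressure_step_bound {C θ r : ℝ} (hC : 0 ≤ C) (hθ : 0 < θ) (hr : 0 < r) (A S : ℝ≥0∞) :
    S + ENNReal.ofReal (C * (r ^ 4)⁻¹ * (θ * r)) *
        (ENNReal.ofReal (r ^ 3) * A + ENNReal.ofReal (3 * r ^ (3 / 2 : ℝ)) * S) *
        ENNReal.ofReal (3 * (θ * r) ^ (3 / 2 : ℝ)) =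
      ENNReal.ofReal ((θ * r) ^ (3 / 2 : ℝ)) *
        (ENNReal.ofReal (3 * C * θ) * A +
          ENNReal.ofReal ((θ ^ (-(3 / 2) : ℝ) + 9 * C * θ) * r ^ (-(3 / 2) : ℝ)) * S) := by
  have e1 : (θ * r) ^ (3 / 2 : ℝ) * θ ^ (-(3 / 2) : ℝ) * r ^ (-(3 / 2) : ℝ) = 1 := by
    rw [Real.mul_rpow hθ.le hr.le, Real.rpow_neg hθ.le, Real.rpow_neg hr.le]
    have := Real.rpow_pos_of_pos hθ (3 / 2)
    have := Real.rpow_pos_of_pos hr (3 / 2)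
    field_simp
  have e2 : r ^ (-(3 / 2) : ℝ) = r ^ (3 / 2 : ℝ) * (r ^ 3)⁻¹ := by
    rw [← Real.rpow_natCast r 3, ← Real.rpow_neg hr.le, ← Real.rpow_add hr]
    norm_num
  have e3 : (r ^ 4)⁻¹ * r = (r ^ 3)⁻¹ := by field_simp
  have hR := Real.rpow_pos_of_pos hr (3 / 2)
  have hR' := Real.rpow_pos_of_pos hr (-(3 / 2))
  have hT := Real.rpow_pos_of_pos hθ (-(3 / 2))
  have hTR := Real.rpow_pos_of_pos (mul_pos hθ hr) (3 / 2)
  have cA : ENNReal.ofReal (C * (r ^ 4)⁻¹ * (θ * r)) * ENNReal.ofReal (r ^ 3) *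
      ENNReal.ofReal (3 * (θ * r) ^ (3 / 2 : ℝ)) =
      ENNReal.ofReal ((θ * r) ^ (3 / 2 : ℝ)) * ENNReal.ofReal (3 * C * θ) := by
    rw [← ENNReal.ofReal_mul (by positivity), ← ENNReal.ofReal_mul (by positivity),
      ← ENNReal.ofReal_mul (by positivity)]
    congr 1
    field_simp
  have cS : 1 + ENNReal.ofReal (C * (r ^ 4)⁻¹ * (θ * r)) * ENNReal.ofReal (3 * r ^ (3 / 2 : ℝ)) *
      ENNReal.ofReal (3 * (θ * r) ^ (3 / 2 : ℝ)) =
      ENNReal.ofReal ((θ * r) ^ (3 / 2 : ℝ)) *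
        ENNReal.ofReal ((θ ^ (-(3 / 2) : ℝ) + 9 * C * θ) * r ^ (-(3 / 2) : ℝ)) := by
    rw [← ENNReal.ofReal_mul (by positivity), ← ENNReal.ofReal_mul (by positivity),
      ← ENNReal.ofReal_mul (by positivity), ← ENNReal.ofReal_one,
      ← ENNReal.ofReal_add zero_le_one (by positivity)]
    congr 1
    rw [← e1]
    have : C * (r ^ 4)⁻¹ * (θ * r) = C * θ * (r ^ 3)⁻¹ := by rw [← e3]; ring
    rw [this]
    linear_combination (-9 * C * θ * (θ * r) ^ (3 / 2 : ℝ)) * e2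
  calc _ = (1 + ENNReal.ofReal (C * (r ^ 4)⁻¹ * (θ * r)) * ENNReal.ofReal (3 * r ^ (3 / 2 : ℝ)) *
      ENNReal.ofReal (3 * (θ * r) ^ (3 / 2 : ℝ))) * S + (ENNReal.ofReal (C * (r ^ 4)⁻¹ * (θ * r)) *
      ENNReal.ofReal (r ^ 3) * ENNReal.ofReal (3 * (θ * r) ^ (3 / 2 : ℝ))) * A := by ring
    _ = _ := by rw [cA, cS]; ring

/-- Decay of the pressure oscillation between concentric balls. -/
lemma exists_pressure_step : ∃ C1 : ℝ, 0 < C1 ∧ ∀ θ : ℝ, 0 < θ → θ ≤ 1 / 2 → ∃ C2 : ℝ, 0 < C2 ∧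
    ∀ (x0 : E3) (r : ℝ), 0 < r → ∀ (F : Fin 3 → Fin 3 → E3 → ℝ) (p : E3 → ℝ) (c : ℝ) (A : ℝ≥0∞),
    (∀ i j, MemLp (F i j) 2 (volume.restrict (ball3 x0 r))) → IntegrableOn p (ball3 x0 r) →
    SlicePress (ball3 x0 r) F p →
    ∫⁻ x in ball3 x0 r, ‖p x - c‖ₑ ≤ ENNReal.ofReal (r ^ 3) * A →
    ∃ c' : ℝ,
      (∫⁻ x in ball3 x0 (θ * r), ‖p x - c'‖ₑ ^ (2 : ℝ)) ^ (1 / 2 : ℝ) ≤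
        ENNReal.ofReal ((θ * r) ^ (3 / 2 : ℝ)) * (ENNReal.ofReal (C1 * θ) * A +
          ENNReal.ofReal (C2 * r ^ (-(3 / 2) : ℝ)) *
            (∫⁻ x in ball3 x0 r, ENNReal.ofReal (∑ i, ∑ j, F i j x ^ 2)) ^ (1 / 2 : ℝ)) ∧
      ∫⁻ x in ball3 x0 (θ * r), ‖p x - c'‖ₑ ≤
        ENNReal.ofReal ((θ * r) ^ 3) * (ENNReal.ofReal (C1 * θ) * A +
          ENNReal.ofReal (C2 * r ^ (-(3 / 2) : ℝ)) *
            (∫⁻ x in ball3 x0 r, ENNReal.ofReal (∑ i, ∑ j, F i j x ^ 2)) ^ (1 / 2 : ℝ)) := by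
  obtain ⟨C, hC, H⟩ := exists_pressure_split
  refine ⟨9 * C + 1, by positivity, fun θ hθ hθ2 => ⟨3 * (θ ^ (-(3 / 2) : ℝ) + 9 * C * θ), ?_, ?_⟩⟩
  · have := Real.rpow_pos_of_pos hθ (-(3 / 2))
    positivity
  intro x0 r hr F p c A hF hp hpress hA
  obtain ⟨c', p1, hp1, hp1n, hc'⟩ := H x0 r hr F p c hF hp hpress
  set S : ℝ≥0∞ := (∫⁻ x in ball3 x0 r, ENNReal.ofReal (∑ i, ∑ j, F i j x ^ 2)) ^ (1 / 2 : ℝ) with hS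
  have hθr : 0 < θ * r := mul_pos hθ hr
  have hsub : ball3 x0 (θ * r) ⊆ ball3 x0 (r / 2) := Metric.ball_subset_ball (by nlinarith)
  have hsub' : ball3 x0 (θ * r) ⊆ ball3 x0 r := Metric.ball_subset_ball (by nlinarith)
  have hfin : IsFiniteMeasure (volume.restrict (ball3 x0 r)) :=
    ⟨by rw [Measure.restrict_apply_univ]; exact Metric.isBounded_ball.measure_lt_top⟩
  have hS1 : (∫⁻ x, ‖p1 x‖ₑ ^ (2 : ℝ)) ^ (1 / 2 : ℝ) ≤ S := by
    refine ENNReal.rpow_le_rpow ?_ (by norm_num)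
    have i1 : Integrable (fun x => p1 x ^ 2) := hp1.integrable_sq
    have i2 : IntegrableOn (fun x => ∑ i, ∑ j, F i j x ^ 2) (ball3 x0 r) :=
      integrable_finsetSum _ fun i _ => integrable_finsetSum _ fun j _ => (hF i j).integrable_sq
    have e1 : ∫⁻ x, ‖p1 x‖ₑ ^ (2 : ℝ) = ENNReal.ofReal (∫ x, p1 x ^ 2) := by
      rw [ofReal_integral_eq_lintegral_ofReal i1 (Eventually.of_forall fun x => sq_nonneg _)]
      refine lintegral_congr fun x => ?_
      rw [Real.enorm_eq_ofReal_abs, ENNReal.ofReal_rpow_of_nonneg (abs_nonneg _) (by norm_num)]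
      congr 1
      rw [Real.rpow_two, sq_abs]
    rw [e1, ← ofReal_integral_eq_lintegral_ofReal i2 (Eventually.of_forall fun x => by
      exact Finset.sum_nonneg fun i _ => Finset.sum_nonneg fun j _ => sq_nonneg _)]
    exact ENNReal.ofReal_le_ofReal hp1n
  have hp1i : IntegrableOn p1 (ball3 x0 r) := (hp1.restrict _).integrable (by norm_num)
  have hJ : ∫⁻ y in ball3 x0 r, ‖p1 y‖ₑ ≤ ENNReal.ofReal (3 * r ^ (3 / 2 : ℝ)) * S := by
    refine (lintegral_ball3_le_L2 x0 hr.le hp1i.1.enorm).trans ?_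
    refine mul_le_mul_right (le_trans ?_ hS1) _
    exact ENNReal.rpow_le_rpow (lintegral_mono' Measure.restrict_le_self le_rfl) (by norm_num)
  have hK : ENNReal.ofReal ((∫ y in ball3 x0 r, |p y - c|) + ∫ y in ball3 x0 r, |p1 y|) ≤
      ENNReal.ofReal (r ^ 3) * A + ENNReal.ofReal (3 * r ^ (3 / 2 : ℝ)) * S := by
    refine ENNReal.ofReal_add_le.trans (add_le_add (le_trans (le_of_eq ?_) hA)
      (le_trans (le_of_eq ?_) hJ))
    · have := ofReal_integral_norm_eq_lintegral_enorm (hp.sub (integrable_const c))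
      simpa using this
    · have := ofReal_integral_norm_eq_lintegral_enorm hp1i
      simpa using this
  set K : ℝ≥0∞ := ENNReal.ofReal (C * (r ^ 4)⁻¹ * (θ * r)) *
    (ENNReal.ofReal (r ^ 3) * A + ENNReal.ofReal (3 * r ^ (3 / 2 : ℝ)) * S) with hKdef
  have hpt : ∀ᵐ x ∂(volume.restrict (ball3 x0 (θ * r))), ‖p x - c'‖ₑ ≤ ‖p1 x‖ₑ + K := by
    filter_upwards [ae_restrict_of_ae_restrict_of_subset hsub hc',
      ae_restrict_mem (measurableSet_ball3 x0 (θ * r))] with x hx hxm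
    have hxn : ‖x - x0‖ ≤ θ * r := by
      have : dist x x0 < θ * r := hxm
      rw [dist_eq_norm] at this
      exact this.le
    have hI : 0 ≤ (∫ y in ball3 x0 r, |p y - c|) + ∫ y in ball3 x0 r, |p1 y| := by positivity
    have h1 : |p x - c'| ≤ |p1 x| + C * (r ^ 4)⁻¹ * (θ * r) *
        ((∫ y in ball3 x0 r, |p y - c|) + ∫ y in ball3 x0 r, |p1 y|) := by
      refine hx.trans (add_le_add_right ?_ _)
      calc _ ≤ C * (r ^ 4)⁻¹ * ((∫ y in ball3 x0 r, |p y - c|) + ∫ y in ball3 x0 r, |p1 y|) *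
          (θ * r) := mul_le_mul_of_nonneg_left hxn (by positivity)
        _ = _ := by ring
    rw [Real.enorm_eq_ofReal_abs, Real.enorm_eq_ofReal_abs]
    refine (ENNReal.ofReal_le_ofReal h1).trans (ENNReal.ofReal_add_le.trans
      (add_le_add_right ?_ _))
    rw [ENNReal.ofReal_mul (by positivity)]
    exact mul_le_mul_right hK _
  have hL2 : (∫⁻ x in ball3 x0 (θ * r), ‖p x - c'‖ₑ ^ (2 : ℝ)) ^ (1 / 2 : ℝ) ≤
      ENNReal.ofReal ((θ * r) ^ (3 / 2 : ℝ)) *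
        (ENNReal.ofReal (3 * C * θ) * A +
          ENNReal.ofReal ((θ ^ (-(3 / 2) : ℝ) + 9 * C * θ) * r ^ (-(3 / 2) : ℝ)) * S) := by
    rw [← pressure_step_bound hC hθ hr A S]
    calc _ ≤ (∫⁻ x in ball3 x0 (θ * r), (‖p1 x‖ₑ + K) ^ (2 : ℝ)) ^ (1 / 2 : ℝ) :=
          ENNReal.rpow_le_rpow (lintegral_mono_ae (hpt.mono fun x hx =>
            ENNReal.rpow_le_rpow hx (by norm_num))) (by norm_num)
      _ ≤ (∫⁻ x in ball3 x0 (θ * r), ‖p1 x‖ₑ ^ (2 : ℝ)) ^ (1 / 2 : ℝ) +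
          (∫⁻ x in ball3 x0 (θ * r), K ^ (2 : ℝ)) ^ (1 / 2 : ℝ) :=
          ENNReal.lintegral_Lp_add_le (hp1i.mono_set hsub').1.enorm aemeasurable_const one_le_two
      _ ≤ _ := by
          refine add_le_add (le_trans (ENNReal.rpow_le_rpow (lintegral_mono'
            Measure.restrict_le_self le_rfl) (by norm_num)) hS1) ?_
          rw [lintegral_const, Measure.restrict_apply_univ, ENNReal.mul_rpow_of_nonneg _ _
            (by norm_num), ← ENNReal.rpow_mul, show (2 : ℝ) * (1 / 2) = 1 by norm_num,
            ENNReal.rpow_one]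
          exact mul_le_mul_right (volume_ball3_sqrt_le x0 hθr.le) _
  have hle : 3 * (ENNReal.ofReal (3 * C * θ) * A +
      ENNReal.ofReal ((θ ^ (-(3 / 2) : ℝ) + 9 * C * θ) * r ^ (-(3 / 2) : ℝ)) * S) ≤
      ENNReal.ofReal ((9 * C + 1) * θ) * A +
        ENNReal.ofReal (3 * (θ ^ (-(3 / 2) : ℝ) + 9 * C * θ) * r ^ (-(3 / 2) : ℝ)) * S := by
    have h3 : (3 : ℝ≥0∞) = ENNReal.ofReal 3 := by simp
    rw [mul_add, ← mul_assoc, ← mul_assoc, h3, ← ENNReal.ofReal_mul (by norm_num),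
      ← ENNReal.ofReal_mul (by norm_num)]
    refine add_le_add (mul_le_mul_left (ENNReal.ofReal_le_ofReal ?_) _)
      (mul_le_mul_left (ENNReal.ofReal_le_ofReal ?_) _) <;> nlinarith
  refine ⟨c', hL2.trans (mul_le_mul_right (le_trans ?_ hle) _), ?_⟩
  · nth_rewrite 1 [← one_mul (ENNReal.ofReal (3 * C * θ) * A + _)]
    exact mul_le_mul_left (by norm_num) _
  · refine (lintegral_ball3_le_L2 x0 hθr.le (AEMeasurable.enorm
      ((hp.mono_set hsub').aemeasurable.sub aemeasurable_const))).trans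
      ((mul_le_mul_right hL2 _).trans ?_)
    refine le_trans (le_of_eq ?_) (mul_le_mul_right hle _)
    have e : ENNReal.ofReal (3 * (θ * r) ^ (3 / 2 : ℝ)) * ENNReal.ofReal ((θ * r) ^ (3 / 2 : ℝ)) =
        ENNReal.ofReal ((θ * r) ^ 3) * 3 := by
      rw [← ENNReal.ofReal_mul (by positivity), mul_assoc, ← Real.rpow_add hθr, mul_comm,
        ENNReal.ofReal_mul (by positivity)]
      norm_num
    rw [← mul_assoc, e, mul_assoc]

lemma lintegral_conv_sq_le {k G : E3 → ℝ≥0∞} (hk : Measurable k) (hG : Measurable G)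
    (h1 : ∫⁻ x, k x = 1) :
    ∫⁻ x, (∫⁻ y, k (x - y) * G y) ^ (2 : ℝ) ≤ ∫⁻ y, G y ^ (2 : ℝ) := by
  have hk1 : ∀ x, ∫⁻ y, k (x - y) = 1 := fun x => by rw [lintegral_sub_left_eq_self k x, h1]
  have key : ∀ x, (∫⁻ y, k (x - y) * G y) ^ (2 : ℝ) ≤ ∫⁻ y, k (x - y) * G y ^ (2 : ℝ) := by
    intro x
    have h := ENNReal.lintegral_mul_norm_pow_le (μ := (volume : Measure E3))
      (f := fun y => k (x - y)) (g := fun y => k (x - y) * G y ^ (2 : ℝ))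
      (hk.comp (measurable_const.sub measurable_id)).aemeasurable
      ((hk.comp (measurable_const.sub measurable_id)).mul (hG.pow_const _)).aemeasurable
      (p := 1 / 2) (q := 1 / 2) (by norm_num) (by norm_num) (by norm_num)
    have e : ∀ y, k (x - y) ^ (1 / 2 : ℝ) * (k (x - y) * G y ^ (2 : ℝ)) ^ (1 / 2 : ℝ) =
        k (x - y) * G y := fun y => by
      rw [ENNReal.mul_rpow_of_nonneg _ _ (by norm_num), ← ENNReal.rpow_mul, ← mul_assoc,
        ← ENNReal.rpow_add_of_nonneg _ _ (by norm_num) (by norm_num)]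
      norm_num
    simp only [e, hk1, ENNReal.one_rpow, one_mul] at h
    calc _ ≤ ((∫⁻ y, k (x - y) * G y ^ (2 : ℝ)) ^ (1 / 2 : ℝ)) ^ (2 : ℝ) :=
          ENNReal.rpow_le_rpow h (by norm_num)
      _ = _ := by rw [← ENNReal.rpow_mul]; norm_num
  calc _ ≤ ∫⁻ x, ∫⁻ y, k (x - y) * G y ^ (2 : ℝ) := lintegral_mono key
    _ = ∫⁻ y, ∫⁻ x, k (x - y) * G y ^ (2 : ℝ) := by
        refine lintegral_lintegral_swap ?_
        refine Measurable.aemeasurable ?_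
        exact (hk.comp (measurable_fst.sub measurable_snd)).mul
          ((hG.comp measurable_snd).pow_const _)
    _ = ∫⁻ y, G y ^ (2 : ℝ) := by
        refine lintegral_congr fun y => ?_
        have hm : Measurable fun x => k (x - y) := hk.comp (measurable_id.sub measurable_const)
        rw [lintegral_mul_const _ hm, lintegral_sub_right_eq_self k y, h1, one_mul]

lemma eLpNorm_conv_two_le {k G : E3 → ℝ} (hk : Measurable k) (hk0 : ∀ x, 0 ≤ k x)
    (h1 : ∫⁻ x, ENNReal.ofReal (k x) = 1) (hG : AEStronglyMeasurable G) :
    eLpNorm (fun x => ∫ y, k (x - y) * G y) 2 volume ≤ eLpNorm G 2 volume := by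
  obtain ⟨G', hG', hGG⟩ := hG
  have e : (fun x => ∫ y, k (x - y) * G y) = fun x => ∫ y, k (x - y) * G' y := by
    funext x
    exact integral_congr_ae (hGG.mono fun y hy => by simp only [hy])
  rw [e, eLpNorm_congr_ae hGG]
  rw [eLpNorm_eq_lintegral_rpow_enorm_toReal (by norm_num) (by norm_num),
    eLpNorm_eq_lintegral_rpow_enorm_toReal (by norm_num) (by norm_num)]
  refine ENNReal.rpow_le_rpow ?_ (by norm_num)
  simp only [ENNReal.toReal_ofNat]
  refine le_trans (lintegral_mono fun x => ENNReal.rpow_le_rpow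
    (enorm_integral_le_lintegral_enorm _) (by norm_num)) ?_
  refine le_trans (le_of_eq ?_) (lintegral_conv_sq_le hk.ennreal_ofReal
    hG'.measurable.enorm h1)
  refine lintegral_congr fun x => ?_
  congr 1
  refine lintegral_congr fun y => ?_
  rw [enorm_mul, Real.enorm_of_nonneg (hk0 _)]

lemma enorm_fderiv_le (b : E3 → ℝ) (x : E3) : ‖fderiv ℝ b x‖ ≤ ∑ j, |pd j b x| := by
  refine ContinuousLinearMap.opNorm_le_bound _ (by positivity) fun v => ?_
  have hv : v = ∑ j, v j • (EuclideanSpace.single j 1 : E3) := by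
    ext i
    simp [Finset.sum_apply, Pi.single_apply]
  conv_lhs => rw [hv]
  rw [map_sum, Finset.sum_mul]
  refine (norm_sum_le _ _).trans (Finset.sum_le_sum fun j _ => ?_)
  rw [map_smul, norm_smul, mul_comm]
  exact mul_le_mul_of_nonneg_left (EuclideanSpace.norm_eq v ▸ by
    rw [← EuclideanSpace.norm_eq]; exact PiLp.norm_apply_le v j) (abs_nonneg _)

lemma exists_gns : ∃ C : ℝ≥0, ∀ b : E3 → ℝ, ContDiff ℝ 1 b → HasCompactSupport b →
    eLpNorm b 6 volume ≤ C * ∑ j, eLpNorm (pd j b) 2 volume := by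
  refine ⟨SNormLESNormFDerivOfEqConst ℝ (volume : Measure E3) 2, fun b hb hbc => ?_⟩
  have h := eLpNorm_le_eLpNorm_fderiv_of_eq (volume : Measure E3) hb hbc (p := 2) (p' := 6)
    (by norm_num) (by simp) (by simp; norm_num)
  refine h.trans (mul_le_mul_right ?_ _)
  have hc : ∀ j, Continuous (pd j b) := fun j =>
    (hb.continuous_fderiv (by norm_num)).clm_apply continuous_const
  calc eLpNorm (fderiv ℝ b) 2 volume ≤ eLpNorm (fun x => ∑ j, |pd j b x|) 2 volume :=
        eLpNorm_mono fun x => by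
          rw [Real.norm_of_nonneg (Finset.sum_nonneg fun j _ => abs_nonneg _)]
          exact enorm_fderiv_le b x
    _ = eLpNorm (∑ j, fun x => |pd j b x|) 2 volume := by
        congr 1
    _ ≤ ∑ j, eLpNorm (fun x => |pd j b x|) 2 volume :=
        eLpNorm_sum_le (fun j _ => (hc j).abs.aestronglyMeasurable) (by norm_num)
    _ = _ := Finset.sum_congr rfl fun j _ => by
        exact eLpNorm_norm (pd j b)

open scoped Convolution in
lemma conv_eq (k h : E3 → ℝ) :
    (k ⋆[ContinuousLinearMap.lsmul ℝ ℝ, volume] h) = fun x => ∫ y, k (x - y) * h y := by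
  funext x
  rw [convolution_eq_swap]
  rfl

/-- The Sobolev inequality `H¹ ⊂ L⁶` for compactly supported functions on `ℝ³`. -/
lemma exists_sobolev_global : ∃ C : ℝ≥0, ∀ (h : E3 → ℝ) (G : Fin 3 → E3 → ℝ),
    Integrable h → HasCompactSupport h → (∀ j, AEStronglyMeasurable (G j)) →
    (∀ j ψ, ContDiff ℝ (⊤ : ℕ∞) ψ → HasCompactSupport ψ →
      ∫ x, h x * pd j ψ x = - ∫ x, G j x * ψ x) →
    eLpNorm h 6 volume ≤ C * ∑ j, eLpNorm (G j) 2 volume := by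
  obtain ⟨C, hC⟩ := exists_gns
  refine ⟨C, fun h G hi hc hG hw => ?_⟩
  let β : ℕ → ContDiffBump (0 : E3) := fun n =>
    ⟨1 / (n + 1) / 2, 1 / (n + 1), by positivity, half_lt_self (by positivity)⟩
  have hlim := ContDiffBump.ae_convolution_tendsto_right_of_locallyIntegrable (μ := volume)
    (φ := β) (l := atTop) (K := 2) (g := h) tendsto_one_div_add_atTop_nhds_zero_nat
    (Eventually.of_forall fun n => by simp only [β]; linarith) hi.locallyIntegrable
  have hsm : ∀ n, ContDiff ℝ (⊤ : ℕ∞) ((β n).normed volume) := fun n => (β n).contDiff_normed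
  have hbound : ∀ n, eLpNorm (fun x => ∫ y, (β n).normed volume (x - y) * h y) 6 volume ≤
      C * ∑ j, eLpNorm (G j) 2 volume := by
    intro n
    have hcs := (β n).hasCompactSupport_normed (μ := (volume : Measure E3))
    have hcd : ContDiff ℝ (⊤ : ℕ∞) (fun x => ∫ y, (β n).normed volume (x - y) * h y) := by
      rw [← conv_eq]
      exact hcs.contDiff_convolution_left _ (hsm n) hi.locallyIntegrable
    have hccs : HasCompactSupport (fun x => ∫ y, (β n).normed volume (x - y) * h y) := by
      rw [← conv_eq]
      exact HasCompactSupport.convolution _ hcs hc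
    have hpd : ∀ j, pd j (fun x => ∫ y, (β n).normed volume (x - y) * h y) =
        fun x => ∫ y, (β n).normed volume (x - y) * G j y := by
      intro j
      funext x
      have h1 := (hcs.hasFDerivAt_convolution_right (ContinuousLinearMap.lsmul ℝ ℝ)
        hi.locallyIntegrable ((hsm n).of_le (by norm_cast)) x).fderiv
      have e0 : convolution h ((β n).normed volume) (ContinuousLinearMap.lsmul ℝ ℝ) volume =
          fun x => ∫ y, (β n).normed volume (x - y) * h y := by
        funext x
        refine integral_congr_ae (Eventually.of_forall fun y => ?_)
        simp [mul_comm]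
      rw [e0] at h1
      simp only [pd]
      rw [h1, convolution_precompR_apply _ hi.locallyIntegrable (hcs.fderiv ℝ)
        ((hsm n).continuous_fderiv (by norm_num))]
      have hψ : ContDiff ℝ (⊤ : ℕ∞) (fun y => (β n).normed volume (x - y)) :=
        (hsm n).comp (contDiff_const.sub contDiff_id)
      have hψc : HasCompactSupport (fun y => (β n).normed volume (x - y)) := by
        exact hcs.comp_homeomorph (Homeomorph.subLeft x)
      have h2 := hw j _ hψ hψc
      rw [pd_comp_const_sub ((hsm n).differentiable (by norm_num))] at h2
      simp only [mul_neg, integral_neg, neg_inj] at h2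
      calc _ = ∫ y, h y * pd j ((β n).normed volume) (x - y) := rfl
        _ = _ := h2
        _ = _ := integral_congr_ae (Eventually.of_forall fun y => mul_comm _ _)
    have h3 := hC _ (hcd.of_le (by norm_cast)) hccs
    refine h3.trans (mul_le_mul_right (Finset.sum_le_sum fun j _ => ?_) _)
    rw [hpd j]
    refine eLpNorm_conv_two_le (hsm n).continuous.measurable (fun x => (β n).nonneg_normed x) ?_
      (hG j)
    rw [← ofReal_integral_eq_lintegral_ofReal (β n).integrable_normed
      (Eventually.of_forall fun x => (β n).nonneg_normed x), (β n).integral_normed,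
      ENNReal.ofReal_one]
  have h6 := Lp.eLpNorm_lim_le_liminf_eLpNorm (p := 6) (μ := (volume : Measure E3))
    (f := fun n x => ∫ y, (β n).normed volume (x - y) * h y) (fun n => ?_) h (by
      filter_upwards [hlim] with x hx
      simpa only [conv_eq] using hx)
  · refine h6.trans ?_
    exact (liminf_le_liminf (Eventually.of_forall hbound)).trans (by simp)
  · rw [← conv_eq]
    exact ((β n).hasCompactSupport_normed.contDiff_convolution_left _ (hsm n)
      hi.locallyIntegrable).continuous.aestronglyMeasurable

/-- A smooth function equal to one on the ball of radius `1/2`, supported in the unit ball. -/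
def unitCut : ContDiffBump (0 : E3) := ⟨1 / 2, 3 / 4, by norm_num, by norm_num⟩

/-- The rescaled cut-off, equal to one on `B_{r/2}(x₀)`, supported in `B_r(x₀)`. -/
def cutAt (x0 : E3) (r : ℝ) (x : E3) : ℝ := unitCut (r⁻¹ • (x - x0))

lemma isTest3_unitCut : IsTest3 (ball3 0 1) (unitCut : E3 → ℝ) := by
  refine ⟨unitCut.contDiff, unitCut.hasCompactSupport, ?_⟩
  rw [unitCut.tsupport_eq]
  exact Metric.closedBall_subset_ball (by norm_num [unitCut])

lemma isTest3_cutAt (x0 : E3) {r : ℝ} (hr : 0 < r) : IsTest3 (ball3 x0 r) (cutAt x0 r) := by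
  have := isTest3_comp_inv_aff isTest3_unitCut x0 hr
  rwa [mul_one] at this

lemma cutAt_nonneg (x0 : E3) (r : ℝ) (x : E3) : 0 ≤ cutAt x0 r x := unitCut.nonneg

lemma cutAt_le_one (x0 : E3) (r : ℝ) (x : E3) : cutAt x0 r x ≤ 1 := unitCut.le_one

lemma cutAt_eq_one {x0 : E3} {r : ℝ} (hr : 0 < r) {x : E3} (hx : x ∈ ball3 x0 (r / 2)) :
    cutAt x0 r x = 1 := by
  refine unitCut.one_of_mem_closedBall ?_
  have : dist x x0 < r / 2 := hx
  rw [dist_eq_norm] at this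
  simp only [mem_closedBall_zero_iff, norm_smul, norm_inv, Real.norm_eq_abs, abs_of_pos hr]
  rw [inv_mul_le_iff₀ hr]
  simp only [unitCut]
  linarith

lemma exists_pd_cutAt_le : ∃ K : ℝ, 0 < K ∧ ∀ (x0 : E3) (r : ℝ), 0 < r → ∀ j x,
    |pd j (cutAt x0 r) x| ≤ K * r⁻¹ := by
  have h : ∀ j, ∃ K : ℝ, ∀ x, |pd j (unitCut : E3 → ℝ) x| ≤ K := fun j => by
    obtain ⟨K, hK⟩ := (contDiff_pd isTest3_unitCut.1 j).continuous.bounded_above_of_compact_support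
      (hasCompactSupport_pd isTest3_unitCut.2.1 j)
    exact ⟨K, hK⟩
  choose K hK using h
  have hK0 : ∀ j, 0 ≤ K j := fun j => (abs_nonneg _).trans (hK j 0)
  refine ⟨1 + ∑ j, K j, by have := Finset.sum_nonneg fun j (_ : j ∈ Finset.univ) => hK0 j; linarith,
    fun x0 r hr j x => ?_⟩
  have e := congrFun (pd_comp_inv_aff (unitCut.contDiff.differentiable (n := 1) (by norm_num))
    x0 r j) x
  unfold cutAt
  rw [e, abs_mul, abs_of_pos (inv_pos.2 hr), mul_comm]
  refine mul_le_mul_of_nonneg_right ((hK j _).trans ?_) (inv_pos.2 hr).le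
  have := Finset.single_le_sum (fun j _ => hK0 j) (Finset.mem_univ j)
  linarith

lemma exists_sobolev_ball : ∃ C : ℝ≥0, ∀ (x0 : E3) (r : ℝ), 0 < r →
    ∀ (f : E3 → ℝ) (g : Fin 3 → E3 → ℝ), MemLp f 2 (volume.restrict (ball3 x0 r)) →
    (∀ j, MemLp (g j) 2 (volume.restrict (ball3 x0 r))) → SliceGrad (ball3 x0 r) f g →
    eLpNorm f 6 (volume.restrict (ball3 x0 (r / 2))) ≤ C *
      (ENNReal.ofReal r⁻¹ * eLpNorm f 2 (volume.restrict (ball3 x0 r)) +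
        ∑ j, eLpNorm (g j) 2 (volume.restrict (ball3 x0 r))) := by
  obtain ⟨C, hC⟩ := exists_sobolev_global
  obtain ⟨K, hK, hKb⟩ := exists_pd_cutAt_le
  refine ⟨C * (1 + 3 * K.toNNReal), fun x0 r hr f g hf hg hw => ?_⟩
  have hB := measurableSet_ball3 x0 r
  have hfin : IsFiniteMeasure (volume.restrict (ball3 x0 r)) :=
    ⟨by rw [Measure.restrict_apply_univ]; exact Metric.isBounded_ball.measure_lt_top⟩
  have hχ := isTest3_cutAt x0 hr
  have hχm := hχ.1.continuous
  have hχ1 : ∀ x, |cutAt x0 r x| ≤ 1 := fun x => by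
    rw [abs_of_nonneg (cutAt_nonneg x0 r x)]
    exact cutAt_le_one x0 r x
  have hpm : ∀ j, Continuous (pd j (cutAt x0 r)) := fun j => (contDiff_pd hχ.1 j).continuous
  set h : E3 → ℝ := (ball3 x0 r).indicator fun x => f x * cutAt x0 r x with hh
  set G : Fin 3 → E3 → ℝ := fun j => (ball3 x0 r).indicator fun x =>
    g j x * cutAt x0 r x + f x * pd j (cutAt x0 r) x with hG
  have hfi : IntegrableOn f (ball3 x0 r) := hf.integrable (by norm_num)
  have hgi : ∀ j, IntegrableOn (g j) (ball3 x0 r) := fun j => (hg j).integrable (by norm_num)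
  have hfb : ∀ (f : E3 → ℝ) (b : E3 → ℝ), IntegrableOn f (ball3 x0 r) → Continuous b →
      HasCompactSupport b → IntegrableOn (fun x => f x * b x) (ball3 x0 r) := by
    intro f b hf hb hbc
    obtain ⟨M, hM⟩ := hb.bounded_above_of_compact_support hbc
    exact Integrable.mul_bdd (c := M) hf hb.aestronglyMeasurable (Eventually.of_forall hM)
  have hGm : ∀ j, AEStronglyMeasurable (fun x => g j x * cutAt x0 r x + f x * pd j (cutAt x0 r) x)
      (volume.restrict (ball3 x0 r)) := fun j =>
    ((hg j).1.mul hχm.aestronglyMeasurable).add (hf.1.mul (hpm j).aestronglyMeasurable)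
  have h6 := hC h G ?_ ?_ ?_ ?_
  · have hle : eLpNorm f 6 (volume.restrict (ball3 x0 (r / 2))) ≤ eLpNorm h 6 volume := by
      have e : eLpNorm f 6 (volume.restrict (ball3 x0 (r / 2))) =
          eLpNorm h 6 (volume.restrict (ball3 x0 (r / 2))) := by
        refine eLpNorm_congr_ae ?_
        filter_upwards [ae_restrict_mem (measurableSet_ball3 x0 (r / 2))] with x hx
        have hx' : x ∈ ball3 x0 r := Metric.ball_subset_ball (by linarith) hx
        simp only [hh, indicator_of_mem hx', cutAt_eq_one hr hx, mul_one]
      rw [e]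
      exact eLpNorm_mono_measure _ Measure.restrict_le_self
    refine (hle.trans h6).trans ?_
    have hGj : ∀ j, eLpNorm (G j) 2 volume ≤ eLpNorm (g j) 2 (volume.restrict (ball3 x0 r)) +
        ENNReal.ofReal (K * r⁻¹) * eLpNorm f 2 (volume.restrict (ball3 x0 r)) := by
      intro j
      rw [hG, eLpNorm_indicator_eq_eLpNorm_restrict hB]
      refine (eLpNorm_add_le ((hg j).1.mul hχm.aestronglyMeasurable)
        (hf.1.mul (hpm j).aestronglyMeasurable) (by norm_num)).trans (add_le_add ?_ ?_)
      · refine eLpNorm_mono fun x => ?_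
        simp only [norm_mul, Real.norm_eq_abs, Pi.mul_apply]
        exact mul_le_of_le_one_right (abs_nonneg _) (hχ1 x)
      · refine eLpNorm_le_mul_eLpNorm_of_ae_le_mul (Eventually.of_forall fun x => ?_) 2
        simp only [norm_mul, Real.norm_eq_abs, Pi.mul_apply]
        rw [mul_comm]
        exact mul_le_mul_of_nonneg_right (hKb x0 r hr j x) (abs_nonneg _)
    have hsum : ∑ j, eLpNorm (G j) 2 volume ≤
        ∑ j, eLpNorm (g j) 2 (volume.restrict (ball3 x0 r)) +
        3 * (ENNReal.ofReal (K * r⁻¹) * eLpNorm f 2 (volume.restrict (ball3 x0 r))) := by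
      refine (Finset.sum_le_sum fun j _ => hGj j).trans (le_of_eq ?_)
      rw [Finset.sum_add_distrib]
      simp
    refine (mul_le_mul_right hsum _).trans ?_
    rw [ENNReal.ofReal_mul hK.le]
    push_cast
    rw [mul_assoc (C : ℝ≥0∞)]
    refine mul_le_mul_right ?_ _
    have : ((K.toNNReal : ℝ≥0) : ℝ≥0∞) = ENNReal.ofReal K := rfl
    rw [this]
    set a := ENNReal.ofReal r⁻¹ * eLpNorm f 2 (volume.restrict (ball3 x0 r))
    set b := ∑ j, eLpNorm (g j) 2 (volume.restrict (ball3 x0 r))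
    calc b + 3 * (ENNReal.ofReal K * ENNReal.ofReal r⁻¹ *
          eLpNorm f 2 (volume.restrict (ball3 x0 r))) = b + 3 * ENNReal.ofReal K * a := by
          simp only [a]; ring
      _ ≤ (b + 3 * ENNReal.ofReal K * a) + (a + 3 * ENNReal.ofReal K * b) := le_self_add
      _ = _ := by ring
  · exact (hfb f _ hfi hχm hχ.2.1).integrable_indicator hB
  · refine HasCompactSupport.intro (isCompact_closedBall x0 r) fun x hx => ?_
    have : x ∉ ball3 x0 r := fun h => hx (Metric.ball_subset_closedBall h)
    simp [hh, this]
  · exact fun j => (aestronglyMeasurable_indicator_iff hB).2 (hGm j)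
  · intro j ψ hψ hψc
    have hb : IsTest3 (ball3 x0 r) (fun x => cutAt x0 r x * ψ x) :=
      ⟨hχ.1.mul hψ, hχ.2.1.mul_right, (tsupport_mul_subset_left).trans hχ.2.2⟩
    have h1 := hw j _ hb
    rw [pd_mul (hχ.1.differentiable (by norm_num)) (hψ.differentiable (by norm_num))] at h1
    have e1 : ∀ x, h x * pd j ψ x =
        (ball3 x0 r).indicator (fun x => f x * (cutAt x0 r x * pd j ψ x)) x := fun x => by
      by_cases hx : x ∈ ball3 x0 r
      · simp [hh, hx, mul_assoc]
      · simp [hh, hx]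
    have e2 : ∀ x, G j x * ψ x = (ball3 x0 r).indicator
        (fun x => g j x * (cutAt x0 r x * ψ x) + f x * (pd j (cutAt x0 r) x * ψ x)) x := fun x => by
      by_cases hx : x ∈ ball3 x0 r
      · simp [hG, hx]
        ring
      · simp [hG, hx]
    simp only [e1, e2]
    rw [integral_indicator hB, integral_indicator hB]
    have hpψ := (contDiff_pd hψ j).continuous
    have j1 : IntegrableOn (fun x => f x * (pd j (cutAt x0 r) x * ψ x)) (ball3 x0 r) :=
      hfb f _ hfi ((hpm j).mul hψ.continuous) (hψc.mul_left)
    have j2 : IntegrableOn (fun x => f x * (cutAt x0 r x * pd j ψ x)) (ball3 x0 r) :=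
      hfb f _ hfi (hχm.mul hpψ) (hχ.2.1.mul_right)
    have j3 : IntegrableOn (fun x => g j x * (cutAt x0 r x * ψ x)) (ball3 x0 r) :=
      hfb (g j) _ (hgi j) (hχm.mul hψ.continuous) (hχ.2.1.mul_right)
    have e3 : ∀ x, f x * (pd j (cutAt x0 r) x * ψ x + cutAt x0 r x * pd j ψ x) =
      f x * (pd j (cutAt x0 r) x * ψ x) + f x * (cutAt x0 r x * pd j ψ x) := fun x => by ring
    simp only [e3] at h1
    rw [integral_add j1 j2] at h1
    rw [integral_add j3 j1]
    linarith

lemma enorm_rpow_two (a : ℝ) : ‖a‖ₑ ^ (2 : ℝ) = ENNReal.ofReal (a ^ 2) := by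
  rw [Real.enorm_eq_ofReal_abs, ENNReal.ofReal_rpow_of_nonneg (abs_nonneg _) (by norm_num),
    Real.rpow_two, sq_abs]

lemma eLpNorm_two_rpow_two (f : E3 → ℝ) (μ : Measure E3) :
    eLpNorm f 2 μ ^ (2 : ℝ) = ∫⁻ x, ENNReal.ofReal (f x ^ 2) ∂μ := by
  rw [eLpNorm_eq_lintegral_rpow_enorm_toReal (by norm_num) (by norm_num), ← ENNReal.rpow_mul]
  simp only [ENNReal.toReal_ofNat, enorm_rpow_two]
  norm_num

lemma eLpNorm_six_rpow_two (f : E3 → ℝ) (μ : Measure E3) :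
    eLpNorm f 6 μ ^ (2 : ℝ) = eLpNorm (fun x => f x ^ 2) 3 μ := by
  rw [eLpNorm_eq_lintegral_rpow_enorm_toReal (by norm_num) (by norm_num), ← ENNReal.rpow_mul,
    eLpNorm_eq_lintegral_rpow_enorm_toReal (by norm_num) (by norm_num)]
  simp only [ENNReal.toReal_ofNat]
  rw [show (1 / 6 * 2 : ℝ) = 1 / 3 by norm_num]
  congr 1
  refine lintegral_congr fun x => ?_
  rw [Real.enorm_of_nonneg (sq_nonneg (f x)), ← enorm_rpow_two, ← ENNReal.rpow_mul]
  norm_num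

/-- The Sobolev inequality on balls for finite families, in terms of the energy densities. -/
lemma exists_sobolev_energy (ι : Type) [Fintype ι] : ∃ C : ℝ≥0, ∀ (x0 : E3) (r : ℝ), 0 < r →
    ∀ (f : ι → E3 → ℝ) (g : ι → Fin 3 → E3 → ℝ),
    (∀ a, MemLp (f a) 2 (volume.restrict (ball3 x0 r))) →
    (∀ a j, MemLp (g a j) 2 (volume.restrict (ball3 x0 r))) →
    (∀ a, SliceGrad (ball3 x0 r) (f a) (g a)) →
    (∫⁻ x in ball3 x0 (r / 2), ENNReal.ofReal (∑ a, f a x ^ 2) ^ (3 : ℝ)) ^ (1 / 3 : ℝ) ≤ C *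
      (ENNReal.ofReal (r⁻¹ ^ 2) * (∫⁻ x in ball3 x0 r, ENNReal.ofReal (∑ a, f a x ^ 2)) +
        ∫⁻ x in ball3 x0 r, ENNReal.ofReal (∑ a, ∑ j, g a j x ^ 2)) := by
  obtain ⟨C, hC⟩ := exists_sobolev_ball
  refine ⟨C ^ 2 * 6, fun x0 r hr f g hf hg hw => ?_⟩
  have hsub : ball3 x0 (r / 2) ⊆ ball3 x0 r := Metric.ball_subset_ball (by linarith)
  have h1 : ∀ a, eLpNorm (fun x => f a x ^ 2) 3 (volume.restrict (ball3 x0 (r / 2))) ≤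
      C ^ 2 * 6 * (ENNReal.ofReal (r⁻¹ ^ 2) * (∫⁻ x in ball3 x0 r, ENNReal.ofReal (f a x ^ 2)) +
        ∑ j, ∫⁻ x in ball3 x0 r, ENNReal.ofReal (g a j x ^ 2)) := by
    intro a
    rw [← eLpNorm_six_rpow_two]
    refine (ENNReal.rpow_le_rpow (hC x0 r hr (f a) (g a) (hf a) (hg a) (hw a))
      (by norm_num)).trans ?_
    rw [ENNReal.mul_rpow_of_nonneg _ _ (by norm_num), mul_assoc]
    have e0 : (C : ℝ≥0∞) ^ (2 : ℝ) = C ^ 2 := by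
      rw [← ENNReal.rpow_natCast]; norm_num
    rw [e0]
    refine mul_le_mul_right ?_ _
    refine (ENNReal.rpow_add_le_mul_rpow_add_rpow _ _ (by norm_num : (1 : ℝ) ≤ 2)).trans ?_
    have e1 : (ENNReal.ofReal r⁻¹ * eLpNorm (f a) 2 (volume.restrict (ball3 x0 r))) ^ (2 : ℝ) =
        ENNReal.ofReal (r⁻¹ ^ 2) * ∫⁻ x in ball3 x0 r, ENNReal.ofReal (f a x ^ 2) := by
      rw [ENNReal.mul_rpow_of_nonneg _ _ (by norm_num), eLpNorm_two_rpow_two,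
        ENNReal.ofReal_rpow_of_nonneg (by positivity) (by norm_num), Real.rpow_two]
    have e2 := ENNReal.rpow_sum_le_const_mul_sum_rpow (Finset.univ : Finset (Fin 3))
      (fun j => eLpNorm (g a j) 2 (volume.restrict (ball3 x0 r))) (p := 2) (by norm_num)
    simp only [eLpNorm_two_rpow_two, Finset.card_univ, Fintype.card_fin] at e2
    norm_num at e2
    rw [e1]
    norm_num
    set A := ENNReal.ofReal ((r ^ 2)⁻¹) * ∫⁻ x in ball3 x0 r, ENNReal.ofReal (f a x ^ 2)
    set B := ∑ j, ∫⁻ x in ball3 x0 r, ENNReal.ofReal (g a j x ^ 2)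
    calc 2 * (A + _) ≤ 2 * (A + 3 * B) := by gcongr
      _ ≤ 2 * (A + 3 * B) + 4 * A := le_self_add
      _ = 6 * (A + B) := by ring
  have h2 : (∫⁻ x in ball3 x0 (r / 2), ENNReal.ofReal (∑ a, f a x ^ 2) ^ (3 : ℝ)) ^ (1 / 3 : ℝ) =
      eLpNorm (∑ a, fun x => f a x ^ 2) 3 (volume.restrict (ball3 x0 (r / 2))) := by
    rw [eLpNorm_eq_lintegral_rpow_enorm_toReal (by norm_num) (by norm_num)]
    simp only [ENNReal.toReal_ofNat]
    congr 1
    refine lintegral_congr fun x => ?_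
    rw [Finset.sum_apply, Real.enorm_of_nonneg (Finset.sum_nonneg fun a _ => sq_nonneg _)]
  rw [h2]
  refine (eLpNorm_sum_le (fun a _ => ((hf a).mono_measure
    (Measure.restrict_mono hsub le_rfl)).1.pow 2) (by norm_num)).trans ?_
  refine (Finset.sum_le_sum fun a _ => h1 a).trans (le_of_eq ?_)
  have m1 : ∀ a, AEMeasurable (fun x => ENNReal.ofReal (f a x ^ 2))
    (volume.restrict (ball3 x0 r)) := fun a => ((hf a).1.aemeasurable.pow_const 2).ennreal_ofReal
  have m2 : ∀ a j, AEMeasurable (fun x => ENNReal.ofReal (g a j x ^ 2))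
    (volume.restrict (ball3 x0 r)) := fun a j =>
      ((hg a j).1.aemeasurable.pow_const 2).ennreal_ofReal
  have e3 : ∀ x, ENNReal.ofReal (∑ a, f a x ^ 2) = ∑ a, ENNReal.ofReal (f a x ^ 2) := fun x =>
    ENNReal.ofReal_sum_of_nonneg fun a _ => sq_nonneg _
  have e4 : ∀ x, ENNReal.ofReal (∑ a, ∑ j, g a j x ^ 2) =
      ∑ a, ∑ j, ENNReal.ofReal (g a j x ^ 2) := fun x => by
    rw [ENNReal.ofReal_sum_of_nonneg fun a _ => Finset.sum_nonneg fun j _ => sq_nonneg _]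
    exact Finset.sum_congr rfl fun a _ => ENNReal.ofReal_sum_of_nonneg fun j _ => sq_nonneg _
  simp only [e3, e4]
  rw [lintegral_finsetSum' _ fun a _ => m1 a, lintegral_finsetSum' _ fun a _ =>
    Finset.aemeasurable_fun_sum _ fun j _ => m2 a j]
  simp only [lintegral_finsetSum' _ fun j _ => m2 _ j]
  rw [Finset.mul_sum, ← Finset.sum_add_distrib, ← Finset.mul_sum]
  push_cast
  rfl

/-- A multiple of the heat kernel, as a function of the (backward) time `σ > 0`. -/
def heatK (x0 : E3) (σ : ℝ) (x : E3) : ℝ :=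
  σ ^ (-(3 / 2) : ℝ) * Real.exp (-(‖x - x0‖ ^ 2 / (4 * σ)))

lemma contDiff_heatK (x0 : E3) (σ : ℝ) : ContDiff ℝ (⊤ : ℕ∞) (heatK x0 σ) := by
  unfold heatK
  exact contDiff_const.mul (((contDiff_id.sub contDiff_const).norm_sq ℝ).div_const _).neg.exp

lemma hasFDerivAt_normSq_sub (x0 x : E3) :
    HasFDerivAt (fun x : E3 => ‖x - x0‖ ^ 2) (2 • (innerSL ℝ (x - x0))) x := by
  have h := (hasStrictFDerivAt_norm_sq (x - x0)).hasFDerivAt.comp x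
    ((hasFDerivAt_id x).sub_const x0)
  simpa [Function.comp_def] using h

lemma pd_heatK (x0 : E3) (σ : ℝ) (j : Fin 3) :
    pd j (heatK x0 σ) = fun x => -((x - x0) j / (2 * σ)) * heatK x0 σ x := by
  funext x
  have h1 : HasFDerivAt (fun x : E3 => -(‖x - x0‖ ^ 2 / (4 * σ)))
      (-((4 * σ)⁻¹ • (2 • (innerSL ℝ (x - x0))))) x := by
    have := ((hasFDerivAt_normSq_sub x0 x).const_mul (4 * σ)⁻¹).neg
    refine this.congr_of_eventuallyEq (Eventually.of_forall fun y => ?_)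
    simp only [Pi.neg_apply]
    rw [div_eq_inv_mul]
  have h2 := (h1.exp.const_mul (σ ^ (-(3 / 2) : ℝ))).fderiv
  have e : heatK x0 σ = fun y => σ ^ (-(3 / 2) : ℝ) * Real.exp (-(‖y - x0‖ ^ 2 / (4 * σ))) := rfl
  have hin : inner ℝ (x - x0) (EuclideanSpace.single j 1 : E3) = (x - x0) j := by
    simp [EuclideanSpace.inner_single_right]
  simp only [pd]
  rw [e, h2]
  simp only [smul_apply, neg_apply, smul_eq_mul,
    innerSL_apply_apply, hin, nsmul_eq_mul]
  push_cast
  by_cases hσ : σ = 0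
  · simp [hσ]
  · field_simp
    ring

lemma laplacian_heatK (x0 : E3) {σ : ℝ} (hσ : 0 < σ) (x : E3) :
    ∑ j, pd j (pd j (heatK x0 σ)) x =
      (-(3 / (2 * σ)) + ‖x - x0‖ ^ 2 / (4 * σ ^ 2)) * heatK x0 σ x := by
  have h : ∀ j, pd j (pd j (heatK x0 σ)) x =
      (-(1 / (2 * σ)) + ((x - x0) j) ^ 2 / (4 * σ ^ 2)) * heatK x0 σ x := by
    intro j
    have hl : HasFDerivAt (fun x : E3 => -((x - x0) j / (2 * σ)))
        (-((2 * σ)⁻¹ • (EuclideanSpace.proj j : E3 →L[ℝ] ℝ))) x := by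
      have := (((hasFDerivAt_coord j x).sub_const (x0 j)).const_mul (2 * σ)⁻¹).neg
      refine this.congr_of_eventuallyEq (Eventually.of_forall fun y => ?_)
      simp only [Pi.neg_apply, PiLp.sub_apply]
      rw [div_eq_inv_mul]
    rw [pd_heatK, pd_mul (f := fun x : E3 => -((x - x0) j / (2 * σ)))
      (by fun_prop) ((contDiff_heatK x0 σ).differentiable (by norm_num))]
    simp only
    rw [pd_heatK]
    have : pd j (fun x : E3 => -((x - x0) j / (2 * σ))) x = -(2 * σ)⁻¹ := by
      simp only [pd]
      rw [hl.fderiv]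
      simp
    rw [this]
    field_simp
    ring
  simp only [h]
  rw [← Finset.sum_mul, EuclideanSpace.norm_sq_eq]
  congr 1
  simp only [Fin.sum_univ_three, Real.norm_eq_abs, sq_abs]
  field_simp
  ring

lemma hasDerivAt_heatK (x0 x : E3) (T : ℝ) {t : ℝ} (ht : 0 < T - t) :
    HasDerivAt (fun s => heatK x0 (T - s) x)
      ((3 / (2 * (T - t)) - ‖x - x0‖ ^ 2 / (4 * (T - t) ^ 2)) * heatK x0 (T - t) x) t := by
  have h0 : HasDerivAt (fun s : ℝ => T - s) (-1) t := by
    simpa using (hasDerivAt_id t).const_sub T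
  have h1 : HasDerivAt (fun s => (T - s) ^ (-(3 / 2) : ℝ))
      (-1 * (-(3 / 2)) * (T - t) ^ (-(3 / 2) - 1 : ℝ)) t :=
    h0.rpow_const (Or.inl ht.ne')
  have h2 : HasDerivAt (fun s => -(‖x - x0‖ ^ 2 / (4 * (T - s))))
      (-(‖x - x0‖ ^ 2 / (4 * (T - t) ^ 2))) t := by
    have := (((h0.const_mul 4).inv (by positivity)).const_mul (‖x - x0‖ ^ 2)).neg
    convert! this using 1
    field_simp
  have h3 := h1.mul h2.exp
  convert! h3 using 1
  unfold heatK
  rw [Real.rpow_sub_one ht.ne']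
  field_simp
  ring

lemma heatK_nonneg (x0 : E3) {σ : ℝ} (hσ : 0 < σ) (x : E3) : 0 ≤ heatK x0 σ x := by
  unfold heatK
  positivity

lemma one_add_cube_le_exp {y : ℝ} (hy : 0 ≤ y) : (1 + y) ^ 3 ≤ 1728 * Real.exp (y / 4) := by
  have h1 : 1 + y ≤ 12 * Real.exp (y / 12) := by
    have := Real.add_one_le_exp (y / 12)
    linarith
  calc (1 + y) ^ 3 ≤ (12 * Real.exp (y / 12)) ^ 3 := by gcongr
    _ = _ := by
      rw [mul_pow, ← Real.exp_nat_mul]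
      have : ((3 : ℕ) : ℝ) * (y / 12) = y / 4 := by push_cast; ring
      rw [this]
      norm_num

/-- Parabolic distance bounds for the heat kernel; `R` is the parabolic distance. -/
lemma heatK_mul_le (x0 : E3) {s R : ℝ} (hs : 0 < s) (hR : 0 < R) (x : E3)
    (hsR : R ^ 2 = ‖x - x0‖ ^ 2 + s ^ 2) :
    heatK x0 (s ^ 2) x ≤ 1728 * (R ^ 3)⁻¹ ∧
      ‖x - x0‖ / s ^ 2 * heatK x0 (s ^ 2) x ≤ 1728 * (R ^ 4)⁻¹ := by
  have hn := norm_nonneg (x - x0)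
  have e1 : heatK x0 (s ^ 2) x = (s ^ 3)⁻¹ * Real.exp (-(‖x - x0‖ ^ 2 / s ^ 2 / 4)) := by
    unfold heatK
    rw [← Real.rpow_natCast s 2, ← Real.rpow_mul hs.le, ← Real.rpow_natCast s 3,
      ← Real.rpow_neg hs.le]
    congr 2
    · norm_num
    · rw [div_div, mul_comm]
  have hu : R = s * (R / s) := by field_simp
  set u := R / s with hudef
  have hu2 : u ^ 2 = 1 + ‖x - x0‖ ^ 2 / s ^ 2 := by
    rw [hudef, div_pow, hsR]; field_simp; ring
  have hu0 : 0 < u := div_pos hR hs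
  have hu1 : 1 ≤ u := by
    have : 0 ≤ ‖x - x0‖ ^ 2 / s ^ 2 := by positivity
    nlinarith
  have hE := one_add_cube_le_exp (y := ‖x - x0‖ ^ 2 / s ^ 2) (by positivity)
  rw [← hu2] at hE
  have hx : ‖x - x0‖ / s ≤ u := by
    refine abs_le_of_sq_le_sq' ?_ hu0.le |>.2
    rw [hu2, div_pow]
    linarith
  have hexp : Real.exp (-(‖x - x0‖ ^ 2 / s ^ 2 / 4)) ≤ 1728 * (u ^ 6)⁻¹ := by
    rw [Real.exp_neg, ← div_eq_mul_inv, le_div_iff₀ (by positivity), inv_mul_le_iff₀ (by positivity)]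
    nlinarith
  have p3 : (u ^ 6)⁻¹ ≤ (u ^ 3)⁻¹ :=
    inv_anti₀ (by positivity) (pow_le_pow_right₀ hu1 (by norm_num))
  have p5 : (u ^ 6)⁻¹ * u ≤ (u ^ 4)⁻¹ := by
    have : (u ^ 6)⁻¹ * u = (u ^ 5)⁻¹ := by field_simp
    rw [this]
    exact inv_anti₀ (by positivity) (pow_le_pow_right₀ hu1 (by norm_num))
  have hs3 : 0 < (s ^ 3)⁻¹ := by positivity
  rw [e1, hu]
  constructor
  · rw [mul_pow, mul_inv]
    calc _ ≤ (s ^ 3)⁻¹ * (1728 * (u ^ 3)⁻¹) :=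
          mul_le_mul_of_nonneg_left (hexp.trans (by linarith)) hs3.le
      _ = _ := by ring
  · have e2 : ‖x - x0‖ / s ^ 2 * ((s ^ 3)⁻¹ * Real.exp (-(‖x - x0‖ ^ 2 / s ^ 2 / 4))) =
        (s ^ 4)⁻¹ * (‖x - x0‖ / s * Real.exp (-(‖x - x0‖ ^ 2 / s ^ 2 / 4))) := by
      field_simp
    rw [e2, mul_pow, mul_inv]
    calc _ ≤ (s ^ 4)⁻¹ * (u * (1728 * (u ^ 6)⁻¹)) := by gcongr
      _ ≤ _ := by
        have : (s ^ 4)⁻¹ * (u * (1728 * (u ^ 6)⁻¹)) = 1728 * (s ^ 4)⁻¹ * ((u ^ 6)⁻¹ * u) := by ring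
        rw [this]
        calc _ ≤ 1728 * (s ^ 4)⁻¹ * (u ^ 4)⁻¹ := by gcongr
          _ = _ := by ring

lemma sderiv_eq_pd {ψ : SpT → ℝ} {x : E3} {t : ℝ} (h : DifferentiableAt ℝ ψ (x, t)) (j : Fin 3) :
    sderiv j ψ (x, t) = pd j (fun y => ψ (y, t)) x := by
  have h2 : HasFDerivAt (fun y : E3 => (y, t)) (ContinuousLinearMap.inl ℝ E3 ℝ) x :=
    hasFDerivAt_prodMk_left x t
  have h3 : HasFDerivAt (fun y : E3 => ψ (y, t)) _ x := h.hasFDerivAt.comp x h2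
  simp only [sderiv, pd, h3.fderiv]
  simp

lemma tderiv_eq_deriv {ψ : SpT → ℝ} {x : E3} {t : ℝ} (h : DifferentiableAt ℝ ψ (x, t)) :
    tderiv ψ (x, t) = deriv (fun s => ψ (x, s)) t := by
  have h2 : HasFDerivAt (fun s : ℝ => (x, s)) (ContinuousLinearMap.inr ℝ E3 ℝ) t :=
    hasFDerivAt_prodMk_right x t
  have h3 : HasFDerivAt (fun s : ℝ => ψ (x, s)) _ t := h.hasFDerivAt.comp t h2
  rw [h3.hasDerivAt.deriv]
  simp [tderiv]

lemma contDiff_sderiv {ψ : SpT → ℝ} (hψ : ContDiff ℝ (⊤ : ℕ∞) ψ) (j : Fin 3) :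
    ContDiff ℝ (⊤ : ℕ∞) (sderiv j ψ) := by
  have : ContDiff ℝ (⊤ : ℕ∞) (fderiv ℝ ψ) := hψ.fderiv_right (by norm_cast)
  exact this.clm_apply contDiff_const

lemma sLap_eq_pd {ψ : SpT → ℝ} (hψ : ContDiff ℝ (⊤ : ℕ∞) ψ) (x : E3) (t : ℝ) :
    sLap ψ (x, t) = ∑ j, pd j (pd j (fun y => ψ (y, t))) x := by
  unfold sLap
  refine Finset.sum_congr rfl fun j _ => ?_
  rw [sderiv_eq_pd ((contDiff_sderiv hψ j).differentiable (by norm_num)).differentiableAt]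
  congr 1
  funext y
  exact sderiv_eq_pd (hψ.differentiable (by norm_num)).differentiableAt j

lemma pd_const_mul (c : ℝ) {f : E3 → ℝ} (hf : Differentiable ℝ f) (j : Fin 3) :
    pd j (fun x => c * f x) = fun x => c * pd j f x := by
  funext x
  simp only [pd]
  rw [((hf x).hasFDerivAt.const_mul c).fderiv]
  simp

lemma pd_cutAt_eq_zero {x0 : E3} {r : ℝ} (hr : 0 < r) {x : E3} (hx : x ∈ ball3 x0 (r / 2))
    (j : Fin 3) : pd j (cutAt x0 r) =ᶠ[nhds x] fun _ => 0 := by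
  have h : cutAt x0 r =ᶠ[nhds x] fun _ => (1 : ℝ) := by
    filter_upwards [Metric.isOpen_ball.mem_nhds hx] with y hy
    exact cutAt_eq_one hr hy
  refine (pd_congr h j).trans (Eventually.of_forall fun y => ?_)
  simp [pd]

lemma exists_deriv_smoothTransition_le : ∃ B : ℝ, 0 ≤ B ∧
    ∀ x, |deriv Real.smoothTransition x| ≤ B := by
  have hc : Continuous (deriv Real.smoothTransition) :=
    (Real.smoothTransition.contDiff (n := 1)).continuous_deriv le_rfl
  obtain ⟨B, hB⟩ := (isCompact_Icc (a := (0 : ℝ)) (b := 1)).exists_bound_of_continuousOn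
    hc.continuousOn
  refine ⟨B, (norm_nonneg _).trans (hB 0 (by simp)), fun x => ?_⟩
  have hB0 := (norm_nonneg _).trans (hB 0 (by simp))
  rcases lt_or_ge x 0 with h | h
  · have : Real.smoothTransition =ᶠ[nhds x] fun _ => 0 := by
      filter_upwards [Iio_mem_nhds h] with y hy
      exact Real.smoothTransition.zero_of_nonpos hy.le
    rw [this.deriv_eq]; simpa using hB0
  rcases lt_or_ge 1 x with h' | h'
  · have : Real.smoothTransition =ᶠ[nhds x] fun _ => 1 := by
      filter_upwards [Ioi_mem_nhds h'] with y hy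
      exact Real.smoothTransition.one_of_one_le hy.le
    rw [this.deriv_eq]; simpa using hB0
  · exact hB x ⟨h, h'⟩

lemma deriv_smoothTransition_eq_zero {x : ℝ} (hx : x < 0 ∨ 1 < x) :
    deriv Real.smoothTransition x = 0 := by
  rcases hx with h | h
  · have : Real.smoothTransition =ᶠ[nhds x] fun _ => 0 := by
      filter_upwards [Iio_mem_nhds h] with y hy
      exact Real.smoothTransition.zero_of_nonpos hy.le
    rw [this.deriv_eq]; simp
  · have : Real.smoothTransition =ᶠ[nhds x] fun _ => 1 := by
      filter_upwards [Ioi_mem_nhds h] with y hy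
      exact Real.smoothTransition.one_of_one_le hy.le
    rw [this.deriv_eq]; simp

/-- The cut-off heat kernel used as a test function in the local energy inequality. -/
def testFn (x0 : E3) (t0 r : ℝ) (z : SpT) : ℝ :=
  cutAt x0 (1 / 2) z.1 * (Real.smoothTransition (16 * (z.2 - t0) + 3) *
    Real.smoothTransition (1 - 2 * (z.2 - t0) / r ^ 2) * heatK x0 (r ^ 2 + t0 - z.2) z.1)

lemma testFn_eq_zero {x0 : E3} {t0 r : ℝ} (hr : 0 < r) {z : SpT}
    (h : z ∉ tsupport (cutAt x0 (1 / 2)) ×ˢ Icc (t0 - 3 / 16) (t0 + r ^ 2 / 2)) :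
    testFn x0 t0 r z = 0 := by
  unfold testFn
  by_cases h1 : z.1 ∈ tsupport (cutAt x0 (1 / 2))
  · have h2 : z.2 ∉ Icc (t0 - 3 / 16) (t0 + r ^ 2 / 2) := fun h2 => h ⟨h1, h2⟩
    rw [mem_Icc, not_and_or, not_le, not_le] at h2
    rcases h2 with h2 | h2
    · rw [Real.smoothTransition.zero_of_nonpos (x := 16 * (z.2 - t0) + 3) (by linarith)]
      simp
    · rw [Real.smoothTransition.zero_of_nonpos (x := 1 - 2 * (z.2 - t0) / r ^ 2)]
      · simp
      · rw [sub_nonpos, le_div_iff₀ (by positivity)]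
        linarith
  · rw [image_eq_zero_of_notMem_tsupport h1, zero_mul]

lemma isCompact_testFn_supp (x0 : E3) (t0 r : ℝ) :
    IsCompact (tsupport (cutAt x0 (1 / 2)) ×ˢ Icc (t0 - 3 / 16) (t0 + r ^ 2 / 2)) :=
  (isTest3_cutAt x0 (by norm_num : (0 : ℝ) < 1 / 2)).2.1.isCompact.prod isCompact_Icc

lemma hasCompactSupport_testFn (x0 : E3) (t0 : ℝ) {r : ℝ} (hr : 0 < r) :
    HasCompactSupport (testFn x0 t0 r) :=
  HasCompactSupport.intro (isCompact_testFn_supp x0 t0 r) fun _ hz => testFn_eq_zero hr hz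

lemma tsupport_testFn (x0 : E3) (t0 : ℝ) {r : ℝ} (hr : 0 < r) :
    tsupport (testFn x0 t0 r) ⊆ ball3 x0 (1 / 2) ×ˢ Ioi (t0 - 1 / 4) := by
  refine (closure_minimal (t := tsupport (cutAt x0 (1 / 2)) ×ˢ
    Icc (t0 - 3 / 16) (t0 + r ^ 2 / 2)) (fun z hz => ?_)
    (isCompact_testFn_supp x0 t0 r).isClosed).trans ?_
  · by_contra h
    exact hz (testFn_eq_zero hr h)
  · refine prod_mono (isTest3_cutAt x0 (by norm_num : (0 : ℝ) < 1 / 2)).2.2 fun t ht => ?_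
    have := ht.1
    simp only [mem_Ioi]
    linarith

lemma contDiff_testFn (x0 : E3) (t0 : ℝ) {r : ℝ} (hr : 0 < r) :
    ContDiff ℝ (⊤ : ℕ∞) (testFn x0 t0 r) := by
  rw [contDiff_iff_contDiffAt]
  intro z
  have hcut := (isTest3_cutAt x0 (by norm_num : (0 : ℝ) < 1 / 2)).1
  by_cases h : z.2 < t0 + r ^ 2
  · unfold testFn heatK
    have hs : ContDiff ℝ (⊤ : ℕ∞) Real.smoothTransition := Real.smoothTransition.contDiff
    have e1 : ContDiffAt ℝ (⊤ : ℕ∞) (fun z : SpT => (r ^ 2 + t0 - z.2)) z := by fun_prop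
    have hne : r ^ 2 + t0 - z.2 ≠ 0 := by linarith
    have e2 := e1.rpow_const_of_ne (p := (-(3 / 2) : ℝ)) hne
    have e3 : ContDiffAt ℝ (⊤ : ℕ∞) (fun z : SpT => ‖z.1 - x0‖ ^ 2) z :=
      (contDiff_fst.sub contDiff_const).norm_sq ℝ |>.contDiffAt
    have e4 := (e3.div (contDiffAt_const.mul e1) (mul_ne_zero four_ne_zero hne)).neg.exp
    have a1 : ContDiff ℝ (⊤ : ℕ∞) (fun z : SpT => Real.smoothTransition (16 * (z.2 - t0) + 3)) :=
      hs.comp (by fun_prop)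
    have a2 : ContDiff ℝ (⊤ : ℕ∞)
        (fun z : SpT => Real.smoothTransition (1 - 2 * (z.2 - t0) / r ^ 2)) :=
      hs.comp (by fun_prop)
    exact (hcut.comp contDiff_fst).contDiffAt.mul
      ((a1.contDiffAt.mul a2.contDiffAt).mul (e2.mul e4))
  · have : testFn x0 t0 r =ᶠ[nhds z] fun _ => 0 := by
      have ho : IsOpen {w : SpT | t0 + r ^ 2 / 2 < w.2} :=
        isOpen_lt continuous_const continuous_snd
      filter_upwards [ho.mem_nhds (by
        have : 0 < r ^ 2 := by positivity
        simp only [mem_ofPred_eq]; linarith)] with w hw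
      refine testFn_eq_zero hr fun hm => ?_
      exact absurd hm.2.2 (not_le.2 hw)
    exact contDiffAt_const.congr_of_eventuallyEq this

lemma testFn_eq_of_lt (x0 : E3) {t0 r : ℝ} (hr : 0 < r) (x : E3) {t : ℝ} (ht : t ≤ t0) :
    testFn x0 t0 r (x, t) = Real.smoothTransition (16 * (t - t0) + 3) *
      (cutAt x0 (1 / 2) x * heatK x0 (r ^ 2 + t0 - t) x) := by
  unfold testFn
  simp only
  rw [Real.smoothTransition.one_of_one_le (x := 1 - 2 * (t - t0) / r ^ 2)]
  · ring
  · rw [le_sub_comm, sub_self]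
    exact div_nonpos_of_nonpos_of_nonneg (by linarith) (by positivity)

lemma sderiv_testFn (x0 : E3) {t0 r : ℝ} (hr : 0 < r) (x : E3) {t : ℝ} (ht : t < t0) (j : Fin 3) :
    sderiv j (testFn x0 t0 r) (x, t) = Real.smoothTransition (16 * (t - t0) + 3) *
      (pd j (cutAt x0 (1 / 2)) x * heatK x0 (r ^ 2 + t0 - t) x +
        cutAt x0 (1 / 2) x * pd j (heatK x0 (r ^ 2 + t0 - t)) x) := by
  have hcut := (isTest3_cutAt x0 (by norm_num : (0 : ℝ) < 1 / 2)).1.differentiable (by norm_num)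
  have hk := (contDiff_heatK x0 (r ^ 2 + t0 - t)).differentiable (by norm_num)
  rw [sderiv_eq_pd ((contDiff_testFn x0 t0 hr).differentiable (by norm_num)).differentiableAt]
  simp only [testFn_eq_of_lt x0 hr _ ht.le]
  have hm : Differentiable ℝ fun y => cutAt x0 (1 / 2) y * heatK x0 (r ^ 2 + t0 - t) y :=
    hcut.mul hk
  rw [pd_const_mul _ hm, pd_mul hcut hk]

lemma heat_testFn (x0 : E3) {t0 r : ℝ} (hr : 0 < r) (x : E3) {t : ℝ} (ht : t < t0) :
    tderiv (testFn x0 t0 r) (x, t) + sLap (testFn x0 t0 r) (x, t) =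
      cutAt x0 (1 / 2) x * (16 * deriv Real.smoothTransition (16 * (t - t0) + 3)) *
          heatK x0 (r ^ 2 + t0 - t) x +
        Real.smoothTransition (16 * (t - t0) + 3) *
          ((∑ j, pd j (pd j (cutAt x0 (1 / 2))) x) * heatK x0 (r ^ 2 + t0 - t) x +
            2 * ∑ j, pd j (cutAt x0 (1 / 2)) x * pd j (heatK x0 (r ^ 2 + t0 - t)) x) := by
  have hcut := (isTest3_cutAt x0 (by norm_num : (0 : ℝ) < 1 / 2)).1
  have hk := contDiff_heatK x0 (r ^ 2 + t0 - t)
  have hcd := hcut.differentiable (n := (⊤ : ℕ∞)) (by norm_num)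
  have hkd := hk.differentiable (n := (⊤ : ℕ∞)) (by norm_num)
  have hσ : 0 < r ^ 2 + t0 - t := by nlinarith
  have hφ := contDiff_testFn x0 t0 hr
  have e1 : sLap (testFn x0 t0 r) (x, t) = Real.smoothTransition (16 * (t - t0) + 3) *
      ∑ j, pd j (pd j (fun y => cutAt x0 (1 / 2) y * heatK x0 (r ^ 2 + t0 - t) y)) x := by
    rw [sLap_eq_pd hφ, Finset.mul_sum]
    simp only [testFn_eq_of_lt x0 hr _ ht.le]
    refine Finset.sum_congr rfl fun j _ => ?_
    have hm : ContDiff ℝ (⊤ : ℕ∞) fun y => cutAt x0 (1 / 2) y * heatK x0 (r ^ 2 + t0 - t) y :=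
      hcut.mul hk
    rw [pd_const_mul _ (hm.differentiable (by norm_num)),
      pd_const_mul _ ((contDiff_pd hm j).differentiable (by norm_num))]
  have e2 : tderiv (testFn x0 t0 r) (x, t) =
      cutAt x0 (1 / 2) x * (16 * deriv Real.smoothTransition (16 * (t - t0) + 3)) *
          heatK x0 (r ^ 2 + t0 - t) x -
      Real.smoothTransition (16 * (t - t0) + 3) * (cutAt x0 (1 / 2) x *
        ∑ j, pd j (pd j (heatK x0 (r ^ 2 + t0 - t))) x) := by
    rw [tderiv_eq_deriv (hφ.differentiable (by norm_num)).differentiableAt]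
    have hev : (fun s => testFn x0 t0 r (x, s)) =ᶠ[nhds t] fun s =>
        Real.smoothTransition (16 * (s - t0) + 3) *
        (cutAt x0 (1 / 2) x * heatK x0 (r ^ 2 + t0 - s) x) := by
      filter_upwards [Iio_mem_nhds ht] with s hs
      exact testFn_eq_of_lt x0 hr x (le_of_lt hs)
    rw [hev.deriv_eq]
    have hs : HasDerivAt (fun s => Real.smoothTransition (16 * (s - t0) + 3))
        (deriv Real.smoothTransition (16 * (t - t0) + 3) * 16) t := by
      have h1 : HasDerivAt (fun s : ℝ => 16 * (s - t0) + 3) 16 t := by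
        simpa using (((hasDerivAt_id t).sub_const t0).const_mul 16).add_const 3
      exact (((Real.smoothTransition.contDiff (n := 1)).differentiable
        (by norm_num)).differentiableAt.hasDerivAt).comp t h1
    have hd := hs.mul ((hasDerivAt_heatK x0 x (r ^ 2 + t0) hσ).const_mul (cutAt x0 (1 / 2) x))
    rw [HasDerivAt.deriv (f := fun s => Real.smoothTransition (16 * (s - t0) + 3) *
        (cutAt x0 (1 / 2) x * heatK x0 (r ^ 2 + t0 - s) x)) hd, laplacian_heatK x0 hσ]
    ring
  rw [e1, e2, laplacian_mul hcut hk]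
  ring

lemma exists_laplacian_cutAt_le : ∃ K : ℝ, 0 ≤ K ∧ ∀ (x0 x : E3),
    |∑ j, pd j (pd j (cutAt x0 (1 / 2))) x| ≤ K := by
  have hd : Differentiable ℝ (unitCut : E3 → ℝ) :=
    unitCut.contDiff.differentiable (n := 1) (by norm_num)
  have h : ∀ j, ∃ K : ℝ, ∀ x, |pd j (pd j (unitCut : E3 → ℝ)) x| ≤ K := fun j => by
    obtain ⟨K, hK⟩ :=
      (contDiff_pd (contDiff_pd isTest3_unitCut.1 j) j).continuous.bounded_above_of_compact_support
      (hasCompactSupport_pd (hasCompactSupport_pd isTest3_unitCut.2.1 j) j)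
    exact ⟨K, hK⟩
  choose K hK using h
  have hK0 : ∀ j, 0 ≤ K j := fun j => (abs_nonneg _).trans (hK j 0)
  refine ⟨∑ j, 4 * K j, Finset.sum_nonneg fun j _ => by have := hK0 j; positivity, fun x0 x => ?_⟩
  refine (Finset.abs_sum_le_sum_abs _ _).trans (Finset.sum_le_sum fun j _ => ?_)
  have e := pd_comp_inv_aff hd x0 (1 / 2) j
  have e' : pd j (cutAt x0 (1 / 2)) = fun x => ((1 / 2 : ℝ))⁻¹ *
      pd j (unitCut : E3 → ℝ) ((1 / 2 : ℝ)⁻¹ • (x - x0)) := e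
  have hd2 : Differentiable ℝ (pd j (unitCut : E3 → ℝ)) :=
    (contDiff_pd isTest3_unitCut.1 j).differentiable (by norm_num)
  have hd3 : Differentiable ℝ fun x => pd j (unitCut : E3 → ℝ) ((1 / 2 : ℝ)⁻¹ • (x - x0)) :=
    hd2.comp (by fun_prop)
  rw [e', pd_const_mul _ hd3, pd_comp_inv_aff hd2]
  simp only
  rw [abs_mul, abs_mul]
  have := hK j ((1 / 2 : ℝ)⁻¹ • (x - x0))
  norm_num at this ⊢
  linarith

lemma abs_coord_le_norm (x : E3) (j : Fin 3) : |x j| ≤ ‖x‖ := by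
  simpa using EuclideanSpace.norm_eq x ▸ Real.abs_le_sqrt
    (Finset.single_le_sum (f := fun i => ‖x i‖ ^ 2) (fun i _ => by positivity) (Finset.mem_univ j)
      |> fun h => by simpa using h)

set_option maxHeartbeats 1000000 in
lemma exists_testFn_bounds : ∃ C : ℝ, 0 < C ∧ ∀ (x0 : E3) (t0 r : ℝ), 0 < r → r ≤ 1 / 4 →
    (∀ z, z.2 < t0 → 0 ≤ testFn x0 t0 r z) ∧
    ∀ (x : E3) (t R : ℝ), t < t0 → 0 < R → R ^ 2 = ‖x - x0‖ ^ 2 + (r ^ 2 + t0 - t) →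
      testFn x0 t0 r (x, t) ≤ C * (R ^ 3)⁻¹ ∧
      (∀ j, |sderiv j (testFn x0 t0 r) (x, t)| ≤ C * (R ^ 4)⁻¹) ∧
      |tderiv (testFn x0 t0 r) (x, t) + sLap (testFn x0 t0 r) (x, t)| ≤ C ∧
      (x ∈ ball3 x0 r → t0 - r ^ 2 < t → (r ^ 3)⁻¹ ≤ C * testFn x0 t0 r (x, t)) := by
  obtain ⟨K1, hK1, hK1b⟩ := exists_pd_cutAt_le
  obtain ⟨K2, hK2, hK2b⟩ := exists_laplacian_cutAt_le
  obtain ⟨B, hB, hBb⟩ := exists_deriv_smoothTransition_le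
  set C : ℝ := 4000 + 4000 * K1 + (16 * B * 110592 + (K2 * 110592 + 2 * (3 * (2 * K1 * 221184))))
    with hC
  have hC1 : 1728 ≤ C ∧ 4 ≤ C ∧ 2 * K1 * 1728 + 864 ≤ C ∧
      16 * B * 110592 + (K2 * 110592 + 2 * (3 * (2 * K1 * 221184))) ≤ C := by
    refine ⟨?_, ?_, ?_, ?_⟩ <;> nlinarith
  clear_value C
  obtain ⟨c1, c2, c3, c4⟩ := hC1
  refine ⟨C, by linarith, fun x0 t0 r hr hr4 => ⟨fun z hz => ?_, fun x t R ht hR hRe => ?_⟩⟩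
  · rw [show z = (z.1, z.2) from rfl, testFn_eq_of_lt x0 hr _ hz.le]
    exact mul_nonneg (Real.smoothTransition.nonneg _)
      (mul_nonneg (cutAt_nonneg _ _ _) (heatK_nonneg _ (by nlinarith) _))
  have hσ : 0 < r ^ 2 + t0 - t := by nlinarith
  set σ := r ^ 2 + t0 - t with hσd
  have hss : (√σ) ^ 2 = σ := Real.sq_sqrt hσ.le
  obtain ⟨b1, b2⟩ := heatK_mul_le x0 (Real.sqrt_pos.2 hσ) hR x (by rw [hss]; exact hRe)
  rw [hss] at b1 b2
  set β := Real.smoothTransition (16 * (t - t0) + 3) with hβ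
  have hβ0 : 0 ≤ β := Real.smoothTransition.nonneg _
  have hβ1 : β ≤ 1 := Real.smoothTransition.le_one _
  set χ := cutAt x0 (1 / 2) x with hχ
  have hχ0 : 0 ≤ χ := cutAt_nonneg _ _ _
  have hχ1 : χ ≤ 1 := cutAt_le_one _ _ _
  set k := heatK x0 σ x with hk
  have hk0 : 0 ≤ k := heatK_nonneg x0 hσ x
  have hpk : ∀ j, |pd j (heatK x0 σ) x| ≤ 864 * (R ^ 4)⁻¹ := fun j => by
    rw [pd_heatK]
    simp only
    rw [abs_mul, abs_neg, abs_div, abs_of_nonneg hk0, abs_of_pos (by positivity : 0 < 2 * σ)]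
    have := abs_coord_le_norm (x - x0) j
    calc |(x - x0) j| / (2 * σ) * k ≤ ‖x - x0‖ / (2 * σ) * k := by gcongr
      _ = (‖x - x0‖ / σ * k) / 2 := by field_simp
      _ ≤ _ := by linarith
  have hpc : ∀ j, |pd j (cutAt x0 (1 / 2)) x| ≤ 2 * K1 := fun j => by
    have := hK1b x0 (1 / 2) (by norm_num) j x
    norm_num at this
    linarith
  have far : 1 / 4 ≤ R → (R ^ 3)⁻¹ ≤ 64 ∧ (R ^ 4)⁻¹ ≤ 256 := fun h => by
    constructor
    · calc (R ^ 3)⁻¹ ≤ ((1 / 4 : ℝ) ^ 3)⁻¹ := inv_anti₀ (by positivity) (by gcongr)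
        _ = _ := by norm_num
    · calc (R ^ 4)⁻¹ ≤ ((1 / 4 : ℝ) ^ 4)⁻¹ := inv_anti₀ (by positivity) (by gcongr)
        _ = _ := by norm_num
  have hnear : x ∈ ball3 x0 (1 / 4) ∨ 1 / 4 ≤ R := by
    by_cases h : x ∈ ball3 x0 (1 / 4)
    · exact Or.inl h
    · right
      have : 1 / 4 ≤ ‖x - x0‖ := by
        rw [← dist_eq_norm]; exact not_lt.1 h
      nlinarith
  refine ⟨?_, fun j => ?_, ?_, fun hx hlt => ?_⟩
  · rw [testFn_eq_of_lt x0 hr _ ht.le]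
    calc β * (χ * k) ≤ 1 * (1 * k) := by gcongr
      _ ≤ 1728 * (R ^ 3)⁻¹ := by linarith
      _ ≤ _ := by gcongr
  · rw [sderiv_testFn x0 hr x ht]
    change |β * (pd j (cutAt x0 (1 / 2)) x * k + χ * pd j (heatK x0 σ) x)| ≤ _
    have hR4 : 0 < (R ^ 4)⁻¹ := by positivity
    have h1 : β * |pd j (cutAt x0 (1 / 2)) x * k| ≤ 2 * K1 * 1728 * (R ^ 4)⁻¹ := by
      by_cases hz : pd j (cutAt x0 (1 / 2)) x = 0
      · rw [hz]; simp; positivity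
      by_cases hz2 : β = 0
      · rw [hz2]; simp; positivity
      have hxs : x ∈ ball3 x0 (1 / 2) := by
        refine (isTest3_cutAt x0 (by norm_num : (0 : ℝ) < 1 / 2)).2.2
          (tsupport_pd_subset _ j (subset_tsupport _ hz))
      have hxn : ‖x - x0‖ < 1 / 2 := by rw [← dist_eq_norm]; exact hxs
      have hts : 0 < 16 * (t - t0) + 3 := by
        by_contra h
        exact hz2 (Real.smoothTransition.zero_of_nonpos (not_lt.1 h))
      have hR1 : R ≤ 1 := by
        have := norm_nonneg (x - x0)
        nlinarith
      have h34 : (R ^ 3)⁻¹ ≤ (R ^ 4)⁻¹ :=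
        inv_anti₀ (by positivity) (pow_le_pow_of_le_one hR.le hR1 (by norm_num))
      rw [abs_mul, abs_of_nonneg hk0]
      calc _ ≤ 1 * (2 * K1 * (1728 * (R ^ 4)⁻¹)) := by
            gcongr
            · exact hpc j
            · linarith
        _ = _ := by ring
    have h2 : β * |χ * pd j (heatK x0 σ) x| ≤ 864 * (R ^ 4)⁻¹ := by
      rw [abs_mul, abs_of_nonneg hχ0]
      calc _ ≤ 1 * (1 * (864 * (R ^ 4)⁻¹)) := by
            gcongr
            exact hpk j
        _ = _ := by ring
    rw [abs_mul, abs_of_nonneg hβ0]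
    calc _ ≤ β * (|pd j (cutAt x0 (1 / 2)) x * k| + |χ * pd j (heatK x0 σ) x|) := by
          gcongr; exact abs_add_le _ _
      _ ≤ (2 * K1 * 1728 + 864) * (R ^ 4)⁻¹ := by linarith
      _ ≤ _ := by gcongr
  · rw [heat_testFn x0 hr x ht]
    change |χ * (16 * deriv Real.smoothTransition (16 * (t - t0) + 3)) * k + β *
      ((∑ j, pd j (pd j (cutAt x0 (1 / 2))) x) * k + 2 * ∑ j, pd j (cutAt x0 (1 / 2)) x *
        pd j (heatK x0 σ) x)| ≤ C
    have h1 : |χ * (16 * deriv Real.smoothTransition (16 * (t - t0) + 3)) * k| ≤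
        16 * B * 110592 := by
      by_cases h : 1 < 16 * (t - t0) + 3
      · rw [deriv_smoothTransition_eq_zero (Or.inr h)]; simp; positivity
      · have : 1 / 4 ≤ R := by nlinarith [sq_nonneg ‖x - x0‖]
        have := (far this).1
        rw [abs_mul, abs_mul, abs_mul, abs_of_nonneg hk0, abs_of_nonneg hχ0,
          abs_of_pos (by norm_num : (0 : ℝ) < 16)]
        calc _ ≤ 1 * (16 * B) * 110592 := by
              gcongr
              · exact hBb _
              · linarith
          _ = _ := by ring
    have h2 : |(∑ j, pd j (pd j (cutAt x0 (1 / 2))) x) * k + 2 * ∑ j, pd j (cutAt x0 (1 / 2)) x *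
        pd j (heatK x0 σ) x| ≤ K2 * 110592 + 2 * (3 * (2 * K1 * 221184)) := by
      rcases hnear with h | h
      · have hz : ∀ j, pd j (cutAt x0 (1 / 2)) =ᶠ[nhds x] fun _ => 0 := fun j =>
          pd_cutAt_eq_zero (by norm_num) (by norm_num; exact h) j
        have hz1 : ∀ j, pd j (cutAt x0 (1 / 2)) x = 0 := fun j => (hz j).self_of_nhds
        have hz2 : ∀ j, pd j (pd j (cutAt x0 (1 / 2))) x = 0 := fun j => by
          rw [(pd_congr (hz j) j).self_of_nhds]
          simp [pd]
        simp only [hz1, hz2]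
        simp
        positivity
      · obtain ⟨f1, f2⟩ := far h
        refine (abs_add_le _ _).trans (add_le_add ?_ ?_)
        · rw [abs_mul, abs_of_nonneg hk0]
          have : k ≤ 110592 := by linarith
          exact mul_le_mul (hK2b x0 x) this hk0 hK2
        · rw [abs_mul, abs_of_pos (by norm_num : (0 : ℝ) < 2)]
          gcongr
          refine (Finset.abs_sum_le_sum_abs _ _).trans ?_
          refine (Finset.sum_le_sum (g := fun _ => 2 * K1 * 221184) fun j _ => ?_).trans (by simp)
          rw [abs_mul]
          have := hpk j
          exact mul_le_mul (hpc j) (by linarith) (abs_nonneg _) (by positivity)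
    refine (abs_add_le _ _).trans (le_trans (add_le_add h1 ?_) c4)
    rw [abs_mul, abs_of_nonneg hβ0]
    calc _ ≤ 1 * (K2 * 110592 + 2 * (3 * (2 * K1 * 221184))) := by gcongr
      _ = _ := one_mul _
  · rw [testFn_eq_of_lt x0 hr _ ht.le]
    change _ ≤ C * (β * (χ * k))
    have hxn : ‖x - x0‖ < r := by rw [← dist_eq_norm]; exact hx
    have e1 : β = 1 := Real.smoothTransition.one_of_one_le (by nlinarith)
    have e2 : χ = 1 := cutAt_eq_one (by norm_num) (Metric.ball_subset_ball (by linarith) hx)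
    rw [e1, e2, one_mul, one_mul]
    have hr2 : r ^ 2 ≤ σ ∧ σ ≤ 2 * r ^ 2 := ⟨by linarith, by linarith⟩
    have hexp : 3 / 4 ≤ Real.exp (-(‖x - x0‖ ^ 2 / (4 * σ))) := by
      have h1 : ‖x - x0‖ ^ 2 / (4 * σ) ≤ 1 / 4 := by
        rw [div_le_iff₀ (by positivity)]
        nlinarith [norm_nonneg (x - x0)]
      have := Real.add_one_le_exp (-(‖x - x0‖ ^ 2 / (4 * σ)))
      linarith
    have hpow : (3 * r ^ 3)⁻¹ ≤ σ ^ (-(3 / 2) : ℝ) := by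
      rw [Real.rpow_neg hσ.le]
      refine inv_anti₀ (by positivity) ?_
      have e : (σ ^ (3 / 2 : ℝ)) ^ 2 = σ ^ 3 := by
        rw [← Real.rpow_natCast, ← Real.rpow_mul hσ.le, ← Real.rpow_natCast σ 3]
        norm_num
      refine le_of_sq_le_sq ?_ (by positivity)
      rw [e]
      calc σ ^ 3 ≤ (2 * r ^ 2) ^ 3 := by gcongr; exact hr2.2
        _ ≤ _ := by
          have : 0 < r ^ 6 := by positivity
          nlinarith
    have hkl : (4 * r ^ 3)⁻¹ ≤ k := by
      calc (4 * r ^ 3)⁻¹ = (3 * r ^ 3)⁻¹ * (3 / 4) := by field_simp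
        _ ≤ k := mul_le_mul hpow hexp (by norm_num) (by positivity)
    calc (r ^ 3)⁻¹ = 4 * (4 * r ^ 3)⁻¹ := by field_simp
      _ ≤ _ := by gcongr

/-- The radii `r_j = θ^j / 2`. -/
def rad (θ : ℝ) (j : ℕ) : ℝ := θ ^ j / 2

lemma rad_pos {θ : ℝ} (hθ : 0 < θ) (j : ℕ) : 0 < rad θ j := by unfold rad; positivity

lemma rad_succ (θ : ℝ) (j : ℕ) : rad θ (j + 1) = θ * rad θ j := by unfold rad; ring

lemma rad_zero (θ : ℝ) : rad θ 0 = 1 / 2 := by simp [rad]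

lemma rad_anti {θ : ℝ} (hθ : 0 < θ) (hθ1 : θ ≤ 1) : Antitone (rad θ) := fun i j h => by
  unfold rad
  have := pow_le_pow_of_le_one hθ.le hθ1 h
  linarith

lemma enorm_setIntegral_press_le {U s : Set E3} (hs : s ⊆ U)
    (hsm : MeasurableSet s)
    {v : E3 → E3} {p : E3 → ℝ} (hv : AEStronglyMeasurable v (volume.restrict U))
    (hvi : IntegrableOn v U)
    (hpv : IntegrableOn (fun x => p x * ‖v x‖) U) (hp : AEStronglyMeasurable p (volume.restrict U))
    (hdiv : SliceDiv U v) {b : E3 → ℝ} (hb : IsTest3 s b) {L : ℝ} (hL : ∀ i x, |pd i b x| ≤ L)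
    (c : ℝ) :
    ‖∫ x in U, p x * ∑ i, v x i * pd i b x‖ₑ ≤
      ENNReal.ofReal (3 * L) * ∫⁻ x in s, ‖p x - c‖ₑ * ‖v x‖ₑ := by
  have hL0 : 0 ≤ L := (abs_nonneg _).trans (hL 0 0)
  have hbU : IsTest3 U b := ⟨hb.1, hb.2.1, hb.2.2.trans hs⟩
  have hvm : ∀ i, AEStronglyMeasurable (fun x => v x i) (volume.restrict U) := fun i =>
    (EuclideanSpace.proj i : E3 →L[ℝ] ℝ).continuous.comp_aestronglyMeasurable hv
  have hpdc : ∀ i, Continuous (pd i b) := fun i => (contDiff_pd hb.1 i).continuous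
  have hwm : AEStronglyMeasurable (fun x => ∑ i, v x i * pd i b x) (volume.restrict U) := by
    have := Finset.aestronglyMeasurable_sum (μ := volume.restrict U) Finset.univ
      (f := fun i x => v x i * pd i b x)
      fun i _ => (hvm i).mul (hpdc i).aestronglyMeasurable
    refine this.congr (Eventually.of_forall fun x => ?_)
    simp
  have hwb : ∀ x, ‖∑ i, v x i * pd i b x‖ ≤ 3 * L * ‖v x‖ := fun x => by
    refine (norm_sum_le _ _).trans ?_
    refine (Finset.sum_le_sum (g := fun _ => ‖v x‖ * L) fun i _ => ?_).trans (by simp; linarith)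
    rw [norm_mul]
    exact mul_le_mul (abs_coord_le_norm (v x) i) (hL i x) (norm_nonneg _) (norm_nonneg _)
  have i1 : IntegrableOn (fun x => p x * ∑ i, v x i * pd i b x) U := by
    refine Integrable.mono' (hpv.norm.const_mul (3 * L)) (hp.mul hwm)
      (Eventually.of_forall fun x => ?_)
    rw [norm_mul, norm_mul, norm_norm]
    calc _ ≤ ‖p x‖ * (3 * L * ‖v x‖) := by gcongr; exact hwb x
      _ = _ := by ring
  have i2 : IntegrableOn (fun x => c * ∑ i, v x i * pd i b x) U := by
    refine Integrable.const_mul ?_ c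
    exact Integrable.mono' (hvi.norm.const_mul (3 * L)) hwm (Eventually.of_forall hwb)
  have e : ∫ x in U, p x * ∑ i, v x i * pd i b x =
      ∫ x in U, (p x - c) * ∑ i, v x i * pd i b x := by
    have : (fun x => (p x - c) * ∑ i, v x i * pd i b x) =
        fun x => p x * ∑ i, v x i * pd i b x - c * ∑ i, v x i * pd i b x := by
      funext x; ring
    rw [this, integral_sub i1 i2, integral_const_mul, hdiv b hbU, mul_zero, sub_zero]
  rw [e]
  refine (enorm_integral_le_lintegral_enorm _).trans ?_
  have hz : ∀ x ∉ s, ‖(p x - c) * ∑ i, v x i * pd i b x‖ₑ = 0 := fun x hx => by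
    have : ∀ i, pd i b x = 0 := fun i => by
      refine image_eq_zero_of_notMem_tsupport fun h => hx (hb.2.2 (tsupport_pd_subset _ i h))
    simp [this]
  calc ∫⁻ x in U, ‖(p x - c) * ∑ i, v x i * pd i b x‖ₑ
      ≤ ∫⁻ x, ‖(p x - c) * ∑ i, v x i * pd i b x‖ₑ := lintegral_mono' Measure.restrict_le_self le_rfl
    _ = ∫⁻ x in s, ‖(p x - c) * ∑ i, v x i * pd i b x‖ₑ := by
        rw [← lintegral_indicator hsm]
        refine lintegral_congr fun x => ?_
        by_cases hx : x ∈ s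
        · rw [indicator_of_mem hx]
        · rw [indicator_of_notMem hx, hz x hx]
    _ ≤ ∫⁻ x in s, ENNReal.ofReal (3 * L) * (‖p x - c‖ₑ * ‖v x‖ₑ) := by
        refine lintegral_mono fun x => ?_
        rw [enorm_mul]
        have : ‖∑ i, v x i * pd i b x‖ₑ ≤ ENNReal.ofReal (3 * L) * ‖v x‖ₑ := by
          rw [← ofReal_norm, ← ofReal_norm (v x), ← ENNReal.ofReal_mul (by positivity)]
          exact ENNReal.ofReal_le_ofReal (hwb x)
        calc _ ≤ ‖p x - c‖ₑ * (ENNReal.ofReal (3 * L) * ‖v x‖ₑ) := by gcongr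
          _ = _ := by ring
    _ = _ := lintegral_const_mul' _ _ ENNReal.ofReal_ne_top

/-- Telescoping cut-offs: `χ_0 = 1`, and `χ_j` is adapted to the ball of radius `r_j`. -/
def telCut (x0 : E3) (θ : ℝ) (j : ℕ) (x : E3) : ℝ :=
  if j = 0 then 1 else cutAt x0 (rad θ j) x

lemma contDiff_telCut (x0 : E3) {θ : ℝ} (hθ : 0 < θ) (j : ℕ) :
    ContDiff ℝ (⊤ : ℕ∞) (telCut x0 θ j) := by
  unfold telCut
  by_cases h : j = 0
  · simp only [h, if_true]; exact contDiff_const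
  · simp only [h, if_false]; exact (isTest3_cutAt x0 (rad_pos hθ j)).1

lemma telCut_eq_one (x0 : E3) {θ : ℝ} (hθ : 0 < θ) (j : ℕ) {x : E3}
    (hx : x ∈ ball3 x0 (rad θ j / 2)) : telCut x0 θ j x = 1 := by
  unfold telCut
  split_ifs
  · rfl
  · exact cutAt_eq_one (rad_pos hθ j) hx

lemma abs_telCut_le (x0 : E3) (θ : ℝ) (j : ℕ) (x : E3) : |telCut x0 θ j x| ≤ 1 := by
  unfold telCut
  split_ifs
  · simp
  · rw [abs_of_nonneg (cutAt_nonneg _ _ _)]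
    exact cutAt_le_one _ _ _

lemma exists_pd_telCut_le : ∃ K : ℝ, 0 < K ∧ ∀ (x0 : E3) (θ : ℝ), 0 < θ → ∀ j i x,
    |pd i (telCut x0 θ j) x| ≤ K * (rad θ j)⁻¹ := by
  obtain ⟨K, hK, hKb⟩ := exists_pd_cutAt_le
  refine ⟨K, hK, fun x0 θ hθ j i x => ?_⟩
  have := rad_pos hθ j
  by_cases h : j = 0
  · have e : telCut x0 θ j = fun _ => 1 := by funext y; simp [telCut, h]
    rw [e]
    simp [pd]
    positivity
  · have e : telCut x0 θ j = cutAt x0 (rad θ j) := by funext y; simp [telCut, h]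
    rw [e]
    exact hKb x0 _ this i x

lemma isTest3_telCut_mul (x0 : E3) {θ : ℝ} (hθ : 0 < θ) (j : ℕ) {Φ : E3 → ℝ}
    (hΦ : IsTest3 (ball3 x0 (1 / 2)) Φ) :
    IsTest3 (ball3 x0 (rad θ j)) fun x => telCut x0 θ j x * Φ x := by
  refine ⟨(contDiff_telCut x0 hθ j).mul hΦ.1, hΦ.2.1.mul_left, ?_⟩
  by_cases h : j = 0
  · rw [h, rad_zero]
    exact (tsupport_mul_subset_right).trans hΦ.2.2
  · refine (tsupport_mul_subset_left).trans ?_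
    have e : telCut x0 θ j = cutAt x0 (rad θ j) := by funext y; simp [telCut, h]
    rw [e]
    exact (isTest3_cutAt x0 (rad_pos hθ j)).2.2

lemma pd_sub_fun {f g : E3 → ℝ} (hf : Differentiable ℝ f) (hg : Differentiable ℝ g) (i : Fin 3) :
    pd i (fun x => f x - g x) = fun x => pd i f x - pd i g x := by
  funext x
  simp only [pd]
  have h : HasFDerivAt (fun x => f x - g x) _ x := (hf x).hasFDerivAt.sub (hg x).hasFDerivAt
  rw [h.fderiv, sub_apply]

lemma IsTest3.sub {U V : Set E3} {f g : E3 → ℝ} (hf : IsTest3 U f) (hg : IsTest3 V g)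
    (hVU : V ⊆ U) : IsTest3 U fun x => f x - g x := by
  refine ⟨hf.1.sub hg.1, hf.2.1.sub hg.2.1, ?_⟩
  exact (tsupport_sub f g).trans (union_subset hf.2.2 (hg.2.2.trans hVU))

/-- The pieces `χ_j Φ` for `j ≤ m`, and zero for `j > m`. -/
def telPiece (x0 : E3) (θ : ℝ) (m : ℕ) (Φ : E3 → ℝ) (j : ℕ) (x : E3) : ℝ :=
  if j ≤ m then telCut x0 θ j x * Φ x else 0

lemma isTest3_telPiece (x0 : E3) {θ : ℝ} (hθ : 0 < θ) (m j : ℕ) {Φ : E3 → ℝ}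
    (hΦ : IsTest3 (ball3 x0 (1 / 2)) Φ) :
    IsTest3 (ball3 x0 (rad θ j)) (telPiece x0 θ m Φ j) := by
  unfold telPiece
  by_cases h : j ≤ m
  · simp only [h, if_true]; exact isTest3_telCut_mul x0 hθ j hΦ
  · simp only [h, if_false]
    exact ⟨contDiff_const, HasCompactSupport.zero, by simp [tsupport]⟩

lemma exists_pd_telPiece_le : ∃ K : ℝ, 0 < K ∧ ∀ (x0 : E3) (θ : ℝ), 0 < θ → θ ≤ 1 / 2 →
    ∀ (m : ℕ) (Φ : E3 → ℝ) (A : ℝ), 0 ≤ A → IsTest3 (ball3 x0 (1 / 2)) Φ →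
    (∀ l ≤ m + 1, ∀ x, (x ∉ ball3 x0 (rad θ l) ∨ l = m + 1) →
      |Φ x| ≤ A * (rad θ l ^ 3)⁻¹ ∧ ∀ i, |pd i Φ x| ≤ A * (rad θ l ^ 4)⁻¹) →
    ∀ j ≤ m, ∀ i x, |pd i (fun x => telPiece x0 θ m Φ j x - telPiece x0 θ m Φ (j + 1) x) x| ≤
      K * A * (θ ^ 8)⁻¹ * (rad θ j ^ 4)⁻¹ := by
  obtain ⟨K, hK, hKb⟩ := exists_pd_telCut_le
  refine ⟨2 * (K + 1), by positivity, fun x0 θ hθ hθ2 m Φ A hA hΦ hb j hj i x => ?_⟩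
  have hr := rad_pos hθ j
  have ht : ∀ l, IsTest3 (ball3 x0 (rad θ l)) (telPiece x0 θ m Φ l) := fun l =>
    isTest3_telPiece x0 hθ m l hΦ
  have hΦd := hΦ.1.differentiable (n := (⊤ : ℕ∞)) (by norm_num)
  by_cases hin : x ∈ ball3 x0 (rad θ (j + 1) / 2) ∧ j + 1 ≤ m
  · have h0 : (fun x => telPiece x0 θ m Φ j x - telPiece x0 θ m Φ (j + 1) x) =ᶠ[nhds x]
        fun _ => 0 := by
      filter_upwards [Metric.isOpen_ball.mem_nhds hin.1] with y hy
      have hy2 : y ∈ ball3 x0 (rad θ j / 2) := by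
        refine Metric.ball_subset_ball ?_ hy
        have := rad_anti hθ (by linarith) (Nat.le_succ j)
        simp only [Nat.succ_eq_add_one] at this
        linarith
      simp only [telPiece, hj, hin.2, if_true, telCut_eq_one x0 hθ j hy2,
        telCut_eq_one x0 hθ (j + 1) hy, sub_self]
    rw [(pd_congr h0 i).self_of_nhds]
    simp only [pd, fderiv_fun_const]
    simp
    positivity
  · obtain ⟨l, hl1, hl2, hl3⟩ : ∃ l ≤ m + 1, (x ∉ ball3 x0 (rad θ l) ∨ l = m + 1) ∧ l ≤ j + 2 := by
      rcases not_and_or.1 hin with h | h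
      · by_cases hjm : j + 1 ≤ m
        · refine ⟨j + 2, by omega, Or.inl fun hx => h (Metric.ball_subset_ball ?_ hx), le_rfl⟩
          rw [rad_succ θ (j + 1)]
          have := rad_pos hθ (j + 1)
          nlinarith
        · exact ⟨m + 1, le_rfl, Or.inr rfl, by omega⟩
      · exact ⟨m + 1, le_rfl, Or.inr rfl, by omega⟩
    obtain ⟨hb1, hb2⟩ := hb l hl1 x hl2
    have hrl : θ ^ 2 * rad θ j ≤ rad θ l := by
      have := rad_anti hθ (by linarith) hl3
      rw [rad_succ, rad_succ] at this
      calc _ = θ * (θ * rad θ j) := by ring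
        _ ≤ _ := this
    have p3 : (rad θ l ^ 3)⁻¹ ≤ (θ ^ 6)⁻¹ * (rad θ j ^ 3)⁻¹ := by
      rw [← mul_inv]
      refine inv_anti₀ (by positivity) ?_
      calc θ ^ 6 * rad θ j ^ 3 = (θ ^ 2 * rad θ j) ^ 3 := by ring
        _ ≤ _ := by gcongr
    have p4 : (rad θ l ^ 4)⁻¹ ≤ (θ ^ 8)⁻¹ * (rad θ j ^ 4)⁻¹ := by
      rw [← mul_inv]
      refine inv_anti₀ (by positivity) ?_
      calc θ ^ 8 * rad θ j ^ 4 = (θ ^ 2 * rad θ j) ^ 4 := by ring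
        _ ≤ _ := by gcongr
    have key : ∀ l', j ≤ l' → l' ≤ j + 1 → |pd i (telPiece x0 θ m Φ l') x| ≤
        (K + 1) * A * (θ ^ 8)⁻¹ * (rad θ j ^ 4)⁻¹ := by
      intro l' h1 h2
      by_cases hlm : l' ≤ m
      · have e : telPiece x0 θ m Φ l' = fun x => telCut x0 θ l' x * Φ x := by
          funext y; simp [telPiece, hlm]
        rw [e, pd_mul ((contDiff_telCut x0 hθ l').differentiable (by norm_num)) hΦd]
        simp only
        have hrl' : (rad θ l')⁻¹ ≤ θ⁻¹ * (rad θ j)⁻¹ := by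
          rw [← mul_inv, ← rad_succ]
          exact inv_anti₀ (rad_pos hθ _) (rad_anti hθ (by linarith) h2)
        have a1 : |pd i (telCut x0 θ l') x * Φ x| ≤
            K * A * (θ ^ 8)⁻¹ * (rad θ j ^ 4)⁻¹ := by
          rw [abs_mul]
          calc _ ≤ (K * (θ⁻¹ * (rad θ j)⁻¹)) * (A * ((θ ^ 6)⁻¹ * (rad θ j ^ 3)⁻¹)) := by
                gcongr
                · exact (hKb x0 θ hθ l' i x).trans (by gcongr)
                · exact hb1.trans (by gcongr)
            _ = K * A * (θ ^ 7)⁻¹ * (rad θ j ^ 4)⁻¹ := by field_simp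
            _ ≤ _ := by
                have h78 : (θ ^ 7)⁻¹ ≤ (θ ^ 8)⁻¹ := inv_anti₀ (by positivity)
                  (pow_le_pow_of_le_one hθ.le (by linarith) (by norm_num))
                exact mul_le_mul_of_nonneg_right
                  (mul_le_mul_of_nonneg_left h78 (by positivity)) (by positivity)
        have a2 : |telCut x0 θ l' x * pd i Φ x| ≤ A * (θ ^ 8)⁻¹ * (rad θ j ^ 4)⁻¹ := by
          rw [abs_mul]
          calc _ ≤ 1 * (A * ((θ ^ 8)⁻¹ * (rad θ j ^ 4)⁻¹)) := by
                gcongr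
                · exact abs_telCut_le _ _ _ _
                · exact (hb2 i).trans (by gcongr)
            _ = _ := by ring
        calc _ ≤ _ := abs_add_le _ _
          _ ≤ _ := add_le_add a1 a2
          _ = _ := by ring
      · have e : telPiece x0 θ m Φ l' = fun _ => 0 := by funext y; simp [telPiece, hlm]
        rw [e]
        simp [pd]
        positivity
    rw [pd_sub_fun ((ht j).1.differentiable (by norm_num))
      ((ht (j + 1)).1.differentiable (by norm_num))]
    simp only
    calc _ ≤ |pd i (telPiece x0 θ m Φ j) x| + |pd i (telPiece x0 θ m Φ (j + 1)) x| := abs_sub _ _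
      _ ≤ _ := add_le_add (key j le_rfl (by omega)) (key (j + 1) (by omega) le_rfl)
      _ = _ := by ring

/-- Telescoping estimate for the pressure term, with one constant per scale. -/
lemma exists_telescope : ∃ K : ℝ, 0 < K ∧ ∀ (x0 : E3) (θ : ℝ), 0 < θ → θ ≤ 1 / 2 →
    ∀ (m : ℕ) (Φ : E3 → ℝ) (A : ℝ), 0 ≤ A → IsTest3 (ball3 x0 (1 / 2)) Φ →
    (∀ l ≤ m + 1, ∀ x, (x ∉ ball3 x0 (rad θ l) ∨ l = m + 1) →
      |Φ x| ≤ A * (rad θ l ^ 3)⁻¹ ∧ ∀ i, |pd i Φ x| ≤ A * (rad θ l ^ 4)⁻¹) →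
    ∀ (v : E3 → E3) (p : E3 → ℝ) (c : ℕ → ℝ) (U : Set E3), ball3 x0 (1 / 2) ⊆ U →
    AEStronglyMeasurable v (volume.restrict U) → IntegrableOn v U →
    IntegrableOn (fun x => p x * ‖v x‖) U → AEStronglyMeasurable p (volume.restrict U) →
    SliceDiv U v →
    ‖∫ x in U, p x * ∑ i, v x i * pd i Φ x‖ₑ ≤
      ∑ j ∈ Finset.range (m + 1), ENNReal.ofReal (K * A * (θ ^ 8)⁻¹ * (rad θ j ^ 4)⁻¹) *
        ∫⁻ x in ball3 x0 (rad θ j), ‖p x - c j‖ₑ * ‖v x‖ₑ := by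
  obtain ⟨K, hK, hKb⟩ := exists_pd_telPiece_le
  refine ⟨3 * K, by positivity, fun x0 θ hθ hθ2 m Φ A hA hΦ hb v p c U hBU hv hvi hpv hp hdiv =>
    ?_⟩
  have ht : ∀ l, IsTest3 (ball3 x0 (rad θ l)) (telPiece x0 θ m Φ l) := fun l =>
    isTest3_telPiece x0 hθ m l hΦ
  have hsub : ∀ j, ball3 x0 (rad θ j) ⊆ U := fun j =>
    (Metric.ball_subset_ball ((rad_anti hθ (by linarith) (Nat.zero_le j)).trans_eq
      (rad_zero θ))).trans hBU
  set D : ℕ → E3 → ℝ := fun j x => telPiece x0 θ m Φ j x - telPiece x0 θ m Φ (j + 1) x with hD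
  have hDt : ∀ j, IsTest3 (ball3 x0 (rad θ j)) (D j) := fun j =>
    (ht j).sub (ht (j + 1)) (Metric.ball_subset_ball (rad_anti hθ (by linarith) (Nat.le_succ j)))
  have hpdΦ : ∀ i x, pd i Φ x = ∑ j ∈ Finset.range (m + 1), pd i (D j) x := by
    intro i x
    have h1 : ∀ j, pd i (D j) x = pd i (telPiece x0 θ m Φ j) x -
        pd i (telPiece x0 θ m Φ (j + 1)) x := fun j =>
      congrFun (pd_sub_fun ((ht j).1.differentiable (by norm_num))
        ((ht (j + 1)).1.differentiable (by norm_num)) i) x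
    simp only [h1]
    rw [Finset.sum_range_sub']
    have e0 : telPiece x0 θ m Φ 0 = Φ := by funext y; simp [telPiece, telCut]
    have e1 : telPiece x0 θ m Φ (m + 1) = fun _ => 0 := by funext y; simp [telPiece]
    rw [e0, e1]
    simp [pd]
  have h_intg : ∀ j, IntegrableOn (fun x => p x * ∑ i, v x i * pd i (D j) x) U := by
    intro j
    have hbd : ∀ i, ∃ L : ℝ, ∀ x, ‖pd i (D j) x‖ ≤ L := fun i =>
      (contDiff_pd (hDt j).1 i).continuous.bounded_above_of_compact_support
        (hasCompactSupport_pd (hDt j).2.1 i)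
    choose L hL using hbd
    have hL0 : ∀ i, 0 ≤ L i := fun i => (norm_nonneg _).trans (hL i 0)
    have e : (fun x => p x * ∑ i, v x i * pd i (D j) x) =
        fun x => ∑ i, p x * (v x i * pd i (D j) x) := by
      funext x; rw [Finset.mul_sum]
    rw [e]
    refine integrable_finsetSum _ fun i _ => ?_
    have hvm : AEStronglyMeasurable (fun x => v x i) (volume.restrict U) :=
      (EuclideanSpace.proj i : E3 →L[ℝ] ℝ).continuous.comp_aestronglyMeasurable hv
    refine Integrable.mono' (hpv.norm.const_mul (L i))
      (hp.mul (hvm.mul (contDiff_pd (hDt j).1 i).continuous.aestronglyMeasurable))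
      (Eventually.of_forall fun x => ?_)
    rw [norm_mul, norm_mul, norm_mul, norm_norm]
    have h1 : ‖v x i‖ ≤ ‖v x‖ := abs_coord_le_norm (v x) i
    calc _ ≤ ‖p x‖ * (‖v x‖ * L i) := by gcongr; exact hL i x
      _ = _ := by ring
  have e : ∫ x in U, p x * ∑ i, v x i * pd i Φ x =
      ∑ j ∈ Finset.range (m + 1), ∫ x in U, p x * ∑ i, v x i * pd i (D j) x := by
    rw [← integral_finsetSum _ fun j _ => h_intg j]
    refine integral_congr_ae (Eventually.of_forall fun x => ?_)
    simp only [hpdΦ, Finset.mul_sum]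
    exact Finset.sum_comm
  rw [e]
  refine (enorm_sum_le _ _).trans (Finset.sum_le_sum fun j hj => ?_)
  have := enorm_setIntegral_press_le (hsub j) (measurableSet_ball3 _ _) hv hvi hpv hp hdiv
    (hDt j) (hKb x0 θ hθ hθ2 m Φ A hA hΦ hb j (by simpa [Nat.lt_succ_iff] using hj)) (c j)
  refine this.trans (le_of_eq ?_)
  congr 2
  ring

/-- The time interval of the backward parabolic cylinder. -/
def tint (t0 r : ℝ) : Set ℝ := Ioo (t0 - r ^ 2) t0

lemma volume_tint (t0 r : ℝ) : volume (tint t0 r) = ENNReal.ofReal (r ^ 2) := by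
  simp [tint, Real.volume_Ioo]

lemma tint_mono (t0 : ℝ) {s r : ℝ} (hs : 0 ≤ s) (h : s ≤ r) : tint t0 s ⊆ tint t0 r :=
  Ioo_subset_Ioo (by nlinarith) le_rfl

lemma lintegral_rpow_le_rpow {α : Type*} [MeasurableSpace α] (μ : Measure α) {f : α → ℝ≥0∞}
    (hf : AEMeasurable f μ) {a : ℝ} (ha0 : 0 ≤ a) (ha1 : a ≤ 1) :
    ∫⁻ x, f x ^ a ∂μ ≤ (∫⁻ x, f x ∂μ) ^ a * (μ univ) ^ (1 - a) := by
  have := ENNReal.lintegral_mul_norm_pow_le (μ := μ) hf (aemeasurable_const (b := (1 : ℝ≥0∞)))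
    ha0 (sub_nonneg.2 ha1) (by ring)
  simpa using this

/-- Interpolation between `L¹` and `L³`. -/
lemma lintegral_rpow_interp {α : Type*} [MeasurableSpace α] {μ : Measure α} {f : α → ℝ≥0∞}
    (hf : AEMeasurable f μ) {m Y : ℝ≥0∞} (hm : ∫⁻ x, f x ∂μ ≤ m)
    (hY : (∫⁻ x, f x ^ (3 : ℝ) ∂μ) ^ (1 / 3 : ℝ) ≤ Y) {a : ℝ} (ha0 : 0 ≤ a) (ha1 : a ≤ 1) :
    ∫⁻ x, f x ^ (a + 3 * (1 - a)) ∂μ ≤ m ^ a * Y ^ (3 * (1 - a)) := by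
  have h := ENNReal.lintegral_mul_norm_pow_le (μ := μ) hf (hf.pow_const (3 : ℝ))
    ha0 (sub_nonneg.2 ha1) (by ring)
  have e : ∀ x, f x ^ (a + 3 * (1 - a)) = f x ^ a * (f x ^ (3 : ℝ)) ^ (1 - a) := fun x => by
    rw [← ENNReal.rpow_mul, ← ENNReal.rpow_add_of_nonneg _ _ ha0 (by linarith)]
  simp only [e]
  refine h.trans ?_
  have h3 : (∫⁻ x, f x ^ (3 : ℝ) ∂μ) ^ (1 - a) ≤ Y ^ (3 * (1 - a)) := by
    rw [ENNReal.rpow_mul]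
    refine ENNReal.rpow_le_rpow ?_ (by linarith)
    have := ENNReal.rpow_le_rpow hY (by norm_num : (0 : ℝ) ≤ 3)
    rwa [← ENNReal.rpow_mul, show (1 / 3 : ℝ) * 3 = 1 by norm_num, ENNReal.rpow_one] at this
  gcongr

/-- Smallness of the scaled energy on the cylinder `Q_r(x₀,t₀)`. -/
def GoodCyl (E G : SpT → ℝ≥0∞) (x0 : E3) (t0 r δ : ℝ) : Prop :=
  (∀ᵐ t ∂(volume.restrict (tint t0 r)), ∫⁻ x in ball3 x0 r, E (x, t) ≤ ENNReal.ofReal (r ^ 3 * δ)) ∧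
    ∫⁻ t in tint t0 r, ∫⁻ x in ball3 x0 r, G (x, t) ≤ ENNReal.ofReal (r ^ 3 * δ)

/-- The energy inequality of Sobolev type on almost every time slice. -/
def SliceSobolev (E G : SpT → ℝ≥0∞) (C : ℝ≥0) (B : Set E3) (J : Set ℝ) : Prop :=
  ∀ᵐ t ∂(volume.restrict J), ∀ (x0 : E3) (r : ℝ), 0 < r → ball3 x0 r ⊆ B →
    (∫⁻ x in ball3 x0 (r / 2), E (x, t) ^ (3 : ℝ)) ^ (1 / 3 : ℝ) ≤
      C * (ENNReal.ofReal (r⁻¹ ^ 2) * (∫⁻ x in ball3 x0 r, E (x, t)) +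
        ∫⁻ x in ball3 x0 r, G (x, t))

lemma ofReal_scale_three_halves {r δ : ℝ} (hr : 0 < r) (hδ : 0 < δ) :
    ENNReal.ofReal (r ^ 3 * δ) ^ (3 / 4 : ℝ) * (ENNReal.ofReal (r ^ 3 * δ) ^ (3 / 4 : ℝ) *
      ENNReal.ofReal (r ^ 2) ^ (1 / 4 : ℝ)) = ENNReal.ofReal (r ^ 5 * δ ^ (3 / 2 : ℝ)) := by
  rw [ENNReal.ofReal_rpow_of_pos (by positivity), ENNReal.ofReal_rpow_of_pos (by positivity),
    ← ENNReal.ofReal_mul (by positivity), ← ENNReal.ofReal_mul (by positivity)]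
  congr 1
  rw [Real.mul_rpow (by positivity) hδ.le, ← Real.rpow_natCast r 3, ← Real.rpow_natCast r 2,
    ← Real.rpow_mul hr.le, ← Real.rpow_mul hr.le, ← Real.rpow_natCast r 5,
    show (3 / 2 : ℝ) = 3 / 4 + 3 / 4 by norm_num, Real.rpow_add hδ,
    show ((5 : ℕ) : ℝ) = ((3 : ℕ) : ℝ) * (3 / 4) + ((3 : ℕ) : ℝ) * (3 / 4) +
      ((2 : ℕ) : ℝ) * (1 / 4) by norm_num,
    Real.rpow_add hr, Real.rpow_add hr]
  ring

lemma ofReal_scale_four_thirds {r δ : ℝ} (hr : 0 < r) (hδ : 0 < δ) :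
    ENNReal.ofReal (r ^ 3 * δ) ^ (1 / 3 : ℝ) * ENNReal.ofReal (r ^ 3 * δ) =
      ENNReal.ofReal (r ^ 4 * δ ^ (4 / 3 : ℝ)) := by
  rw [ENNReal.ofReal_rpow_of_pos (by positivity), ← ENNReal.ofReal_mul (by positivity)]
  congr 1
  rw [Real.mul_rpow (by positivity) hδ.le, ← Real.rpow_natCast r 3, ← Real.rpow_mul hr.le,
    show (4 / 3 : ℝ) = 1 / 3 + 1 by norm_num, Real.rpow_add hδ, Real.rpow_one]
  norm_num
  ring

/-- Consequences of the smallness on `Q_r` for higher integrability on `Q_s`, `s ≤ r/2`. -/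
lemma GoodCyl.higher {E G : SpT → ℝ≥0∞} (hE : Measurable E) (hG : Measurable G) {C : ℝ≥0}
    {B : Set E3} {J : Set ℝ} (hS : SliceSobolev E G C B J) {x0 : E3} {t0 r s δ : ℝ} (hr : 0 < r)
    (hδ : 0 < δ) (hs : 0 < s) (hsr : s ≤ r / 2) (hB : ball3 x0 r ⊆ B) (hJ : tint t0 r ⊆ J)
    (h : GoodCyl E G x0 t0 r δ) :
    (∫⁻ t in tint t0 s, ∫⁻ x in ball3 x0 s, E (x, t) ^ (3 / 2 : ℝ) ≤
      (C * 2) ^ (3 / 4 : ℝ) * ENNReal.ofReal (r ^ 5 * δ ^ (3 / 2 : ℝ))) ∧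
    (∫⁻ t in tint t0 s, (∫⁻ x in ball3 x0 s, E (x, t) ^ (2 : ℝ)) ^ (2 / 3 : ℝ) ≤
      (C * 2) * ENNReal.ofReal (r ^ 4 * δ ^ (4 / 3 : ℝ))) ∧
    ∀ᵐ t ∂(volume.restrict (tint t0 s)), ∫⁻ x in ball3 x0 s, E (x, t) ^ (2 : ℝ) < ∞ := by
  set m := ENNReal.ofReal (r ^ 3 * δ) with hm
  have hsub : tint t0 s ⊆ tint t0 r := tint_mono t0 hs.le (by linarith)
  set X : ℝ → ℝ≥0∞ := fun t => ENNReal.ofReal (r⁻¹ ^ 2) * m + ∫⁻ x in ball3 x0 r, G (x, t) with hX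
  have hXm : Measurable X := measurable_const.add (hG.lintegral_prod_left' (μ := volume.restrict _))
  have hX1 : ∫⁻ t in tint t0 r, X t ≤ 2 * m := by
    rw [hX, lintegral_add_left measurable_const, lintegral_const, Measure.restrict_apply_univ,
      volume_tint, two_mul]
    refine add_le_add (le_of_eq ?_) h.2
    rw [mul_right_comm, ← ENNReal.ofReal_mul (by positivity), inv_pow,
      inv_mul_cancel₀ (by positivity), ENNReal.ofReal_one, one_mul]
  have hslice : ∀ᵐ t ∂(volume.restrict (tint t0 s)),
      (∫⁻ x in ball3 x0 s, E (x, t) ≤ m) ∧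
      (∫⁻ x in ball3 x0 s, E (x, t) ^ (3 : ℝ)) ^ (1 / 3 : ℝ) ≤ C * X t := by
    filter_upwards [ae_restrict_of_ae_restrict_of_subset hsub h.1,
      ae_restrict_of_ae_restrict_of_subset (hsub.trans hJ) hS] with t h1 h2
    refine ⟨(lintegral_mono_set (Metric.ball_subset_ball (by linarith))).trans h1, ?_⟩
    calc _ ≤ (∫⁻ x in ball3 x0 (r / 2), E (x, t) ^ (3 : ℝ)) ^ (1 / 3 : ℝ) :=
          ENNReal.rpow_le_rpow (lintegral_mono_set (Metric.ball_subset_ball hsr)) (by norm_num)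
      _ ≤ _ := h2 x0 r hr hB
      _ ≤ C * (ENNReal.ofReal (r⁻¹ ^ 2) * m + ∫⁻ x in ball3 x0 r, G (x, t)) := by
          have h1' : ∫⁻ x in ball3 x0 r, E (x, t) ≤ m := h1
          gcongr
  have hEt : ∀ t, AEMeasurable (fun x => E (x, t)) (volume.restrict (ball3 x0 s)) := fun t =>
    (hE.comp (measurable_id.prodMk measurable_const)).aemeasurable
  refine ⟨?_, ?_, ?_⟩
  · calc ∫⁻ t in tint t0 s, ∫⁻ x in ball3 x0 s, E (x, t) ^ (3 / 2 : ℝ)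
        ≤ ∫⁻ t in tint t0 s, m ^ (3 / 4 : ℝ) * (C * X t) ^ (3 / 4 : ℝ) := by
          refine lintegral_mono_ae ?_
          filter_upwards [hslice] with t ht
          have := lintegral_rpow_interp (hEt t) ht.1 ht.2 (a := 3 / 4) (by norm_num) (by norm_num)
          norm_num at this ⊢
          exact this
      _ = m ^ (3 / 4 : ℝ) * ∫⁻ t in tint t0 s, (C * X t) ^ (3 / 4 : ℝ) :=
          lintegral_const_mul _ ((hXm.const_mul _).pow_const _)
      _ ≤ m ^ (3 / 4 : ℝ) * ∫⁻ t in tint t0 r, (C * X t) ^ (3 / 4 : ℝ) := by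
          gcongr
      _ ≤ m ^ (3 / 4 : ℝ) * ((C * (2 * m)) ^ (3 / 4 : ℝ) *
            ENNReal.ofReal (r ^ 2) ^ (1 / 4 : ℝ)) := by
          gcongr
          refine (lintegral_rpow_le_rpow _ (hXm.const_mul _).aemeasurable (by norm_num)
            (by norm_num)).trans ?_
          rw [Measure.restrict_apply_univ, volume_tint, lintegral_const_mul _ hXm]
          norm_num
          gcongr
      _ = _ := by
          rw [← mul_assoc (C : ℝ≥0∞), ENNReal.mul_rpow_of_nonneg (C * 2 : ℝ≥0∞) m (by norm_num),
            ← ofReal_scale_three_halves hr hδ]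
          ring
  · calc ∫⁻ t in tint t0 s, (∫⁻ x in ball3 x0 s, E (x, t) ^ (2 : ℝ)) ^ (2 / 3 : ℝ)
        ≤ ∫⁻ t in tint t0 s, m ^ (1 / 3 : ℝ) * (C * X t) := by
          refine lintegral_mono_ae ?_
          filter_upwards [hslice] with t ht
          have := lintegral_rpow_interp (hEt t) ht.1 ht.2 (a := 1 / 2) (by norm_num) (by norm_num)
          have h2 := ENNReal.rpow_le_rpow this (by norm_num : (0 : ℝ) ≤ 2 / 3)
          rw [ENNReal.mul_rpow_of_nonneg _ _ (by norm_num), ← ENNReal.rpow_mul,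
            ← ENNReal.rpow_mul] at h2
          norm_num at h2 ⊢
          exact h2
      _ ≤ ∫⁻ t in tint t0 r, m ^ (1 / 3 : ℝ) * (C * X t) := lintegral_mono_set hsub
      _ = m ^ (1 / 3 : ℝ) * (C * ∫⁻ t in tint t0 r, X t) := by
          rw [lintegral_const_mul _ (hXm.const_mul _), lintegral_const_mul _ hXm]
      _ ≤ m ^ (1 / 3 : ℝ) * (C * (2 * m)) := by gcongr
      _ = _ := by rw [← ofReal_scale_four_thirds hr hδ]; ring
  · have hfin : ∀ᵐ t ∂(volume.restrict (tint t0 r)), X t < ∞ := by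
      refine ae_lt_top hXm (ne_top_of_le_ne_top ?_ hX1)
      rw [hm]; finiteness
    filter_upwards [hslice, ae_restrict_of_ae_restrict_of_subset hsub hfin] with t ht hf
    have := lintegral_rpow_interp (hEt t) ht.1 ht.2 (a := 1 / 2) (by norm_num) (by norm_num)
    norm_num at this ⊢
    refine this.trans_lt ?_
    refine ENNReal.mul_lt_top (ENNReal.rpow_lt_top_of_nonneg (by norm_num) (by rw [hm]; finiteness))
      (ENNReal.rpow_lt_top_of_nonneg (by norm_num) (ENNReal.mul_ne_top (by finiteness) hf.ne))

/-- The energy density `|u|² + |∇d|²`. -/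
def enDen (u : SpT → E3) (Dd : SpT → Fin 3 → Fin 3 → ℝ) (z : SpT) : ℝ≥0∞ :=
  ENNReal.ofReal (‖u z‖ ^ 2 + nsq2 (Dd z))

/-- The dissipation density `|∇u|² + |∇²d|²`. -/
def disDen (Du : SpT → Fin 3 → Fin 3 → ℝ) (D2d : SpT → Fin 3 → Fin 3 → Fin 3 → ℝ) (z : SpT) :
    ℝ≥0∞ :=
  ENNReal.ofReal (nsq2 (Du z) + nsq3 (D2d z))

/-- The density `|d|²|∇d|²`. -/
def dirDen (d : SpT → E3) (Dd : SpT → Fin 3 → Fin 3 → ℝ) (z : SpT) : ℝ≥0∞ :=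
  ENNReal.ofReal (‖d z‖ ^ 2 * nsq2 (Dd z))

lemma nsq2_nonneg (M : Fin 3 → Fin 3 → ℝ) : 0 ≤ nsq2 M :=
  Finset.sum_nonneg fun _ _ => Finset.sum_nonneg fun _ _ => sq_nonneg _

lemma nsq3_nonneg (A : Fin 3 → Fin 3 → Fin 3 → ℝ) : 0 ≤ nsq3 A :=
  Finset.sum_nonneg fun _ _ => Finset.sum_nonneg fun _ _ => Finset.sum_nonneg fun _ _ => sq_nonneg _

lemma measurable_nsq2 : Measurable nsq2 := by
  unfold nsq2; fun_prop

lemma measurable_nsq3 : Measurable nsq3 := by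
  unfold nsq3; fun_prop

lemma measurable_enDen {u : SpT → E3} {Dd : SpT → Fin 3 → Fin 3 → ℝ} (hu : Measurable u)
    (hD : Measurable Dd) : Measurable (enDen u Dd) :=
  ((hu.norm.pow_const 2).add (measurable_nsq2.comp hD)).ennreal_ofReal

lemma measurable_disDen {Du : SpT → Fin 3 → Fin 3 → ℝ} {D2d : SpT → Fin 3 → Fin 3 → Fin 3 → ℝ}
    (hu : Measurable Du) (hD : Measurable D2d) : Measurable (disDen Du D2d) :=
  ((measurable_nsq2.comp hu).add (measurable_nsq3.comp hD)).ennreal_ofReal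

lemma measurable_dirDen {d : SpT → E3} {Dd : SpT → Fin 3 → Fin 3 → ℝ} (hu : Measurable d)
    (hD : Measurable Dd) : Measurable (dirDen d Dd) :=
  ((hu.norm.pow_const 2).mul (measurable_nsq2.comp hD)).ennreal_ofReal

lemma restrict_prod_eq (B : Set E3) (J : Set ℝ) : (volume : Measure SpT).restrict (B ×ˢ J) =
    (volume.restrict B).prod (volume.restrict J) := by
  rw [Measure.prod_restrict]; rfl

lemma lintegral_prod_slice (B : Set E3) (J : Set ℝ) {f : SpT → ℝ≥0∞} (hf : Measurable f) :
    ∫⁻ z in B ×ˢ J, f z = ∫⁻ t in J, ∫⁻ x in B, f (x, t) := by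
  rw [restrict_prod_eq, lintegral_prod_symm' _ hf]

lemma lintegral_E3q_mono {xb : E3} {tb : ℝ} {u d : SpT → E3} {p : SpT → ℝ}
    {Dd : SpT → Fin 3 → Fin 3 → ℝ} {q : ℝ} {f : SpT → ℝ}
    (h : ∀ z, f z ≤ ‖u z‖ ^ 3 + Real.sqrt (nsq2 (Dd z)) ^ 3 +
      |p z| ^ ((3 : ℝ) / 2) + ‖d z‖ ^ q * Real.sqrt (nsq2 (Dd z)) ^ (3 * (1 - q / 6))) :
    ∫⁻ z in ball3 xb 1 ×ˢ Ioo (tb - 1) tb, ENNReal.ofReal (f z) ≤ E3q xb tb u d p Dd q := by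
  unfold E3q
  rw [Qcyl_one]
  exact lintegral_mono fun z => ENNReal.ofReal_le_ofReal (h z)

lemma isFiniteMeasure_Qone (xb : E3) (tb : ℝ) :
    IsFiniteMeasure ((volume : Measure SpT).restrict (ball3 xb 1 ×ˢ Ioo (tb - 1) tb)) :=
  ⟨by rw [Measure.restrict_apply_univ]
      exact (Metric.isBounded_ball.prod (Metric.isBounded_Ioo _ _)).measure_lt_top⟩

lemma integrableOn_normSq {xb : E3} {tb : ℝ} {u d : SpT → E3} {p : SpT → ℝ}
    {Dd : SpT → Fin 3 → Fin 3 → ℝ} {q : ℝ} (hu : Measurable u)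
    (hE : E3q xb tb u d p Dd q < ∞) :
    IntegrableOn (fun z => ‖u z‖ ^ 2) (ball3 xb 1 ×ˢ Ioo (tb - 1) tb) := by
  have := isFiniteMeasure_Qone xb tb
  have h3 : IntegrableOn (fun z => ‖u z‖ ^ 3) (ball3 xb 1 ×ˢ Ioo (tb - 1) tb) := by
    refine ⟨(hu.norm.pow_const 3).aestronglyMeasurable, ?_⟩
    rw [hasFiniteIntegral_iff_ofReal (Eventually.of_forall fun z => by positivity)]
    refine (lintegral_E3q_mono (fun z => ?_)).trans_lt hE
    have := Real.rpow_nonneg (abs_nonneg (p z)) (3 / 2)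
    have h2 : 0 ≤ ‖d z‖ ^ q * Real.sqrt (nsq2 (Dd z)) ^ (3 * (1 - q / 6)) := by positivity
    have h4 : 0 ≤ Real.sqrt (nsq2 (Dd z)) ^ 3 := by positivity
    linarith
  refine Integrable.mono' (h3.add (integrable_const (1 : ℝ)))
    (hu.norm.pow_const 2).aestronglyMeasurable (Eventually.of_forall fun z => ?_)
  rw [Real.norm_of_nonneg (by positivity)]
  have h0 := norm_nonneg (u z)
  simp only [Pi.add_apply]
  nlinarith [sq_nonneg (‖u z‖ - 1), mul_nonneg h0 (sq_nonneg (‖u z‖ - 1))]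

lemma ofReal_norm_pow_three_le {a b : ℝ} (ha : 0 ≤ a) (hb : 0 ≤ b) :
    ENNReal.ofReal (a ^ 3 + Real.sqrt b ^ 3) ≤ 2 * ENNReal.ofReal (a ^ 2 + b) ^ (3 / 2 : ℝ) := by
  rw [ENNReal.ofReal_rpow_of_nonneg (by positivity) (by norm_num),
    show (2 : ℝ≥0∞) = ENNReal.ofReal 2 by simp, ← ENNReal.ofReal_mul (by norm_num)]
  refine ENNReal.ofReal_le_ofReal ?_
  have key : ∀ c : ℝ, 0 ≤ c → c ^ 2 ≤ a ^ 2 + b → c ^ 3 ≤ (a ^ 2 + b) ^ (3 / 2 : ℝ) := by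
    intro c hc h
    have := Real.rpow_le_rpow (by positivity) h (by norm_num : (0 : ℝ) ≤ 3 / 2)
    refine le_trans (le_of_eq ?_) this
    rw [← Real.rpow_natCast c 2, ← Real.rpow_mul hc, ← Real.rpow_natCast c 3]
    norm_num
  have h1 := key a ha (by linarith)
  have h2 := key (Real.sqrt b) (Real.sqrt_nonneg _) (by rw [Real.sq_sqrt hb]; nlinarith)
  linarith

lemma energy_lintegral {xb : E3} {tb Cb ρb : ℝ} (hCb : 0 < Cb) (hρ0 : 0 < ρb) (hρ : ρb ≤ 1)
    {u d : SpT → E3} {p : SpT → ℝ} {Du Dd : SpT → Fin 3 → Fin 3 → ℝ}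
    {D2d : SpT → Fin 3 → Fin 3 → Fin 3 → ℝ} {q : ℝ}
    (hR : QReg xb tb u d p Du Dd D2d) (hL : LocalEnergyQ xb tb Cb ρb u d p Du Dd D2d)
    (hE : E3q xb tb u d p Dd q < ∞) :
    ∀ᵐ s ∂(volume.restrict (Ioo (tb - 1) tb)), ∀ φ : SpT → ℝ,
      ContDiff ℝ (⊤ : ℕ∞) φ → HasCompactSupport φ →
      tsupport φ ⊆ ball3 xb 1 ×ˢ Ioi (tb - 1) → (∀ z, 0 ≤ φ z) →
      (∫⁻ x in ball3 xb 1, enDen u Dd (x, s) * ENNReal.ofReal (φ (x, s))) +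
        (∫⁻ τ in Ioo (tb - 1) s, ∫⁻ x in ball3 xb 1,
          disDen Du D2d (x, τ) * ENNReal.ofReal (φ (x, τ))) ≤
      ENNReal.ofReal Cb * ∫⁻ τ in Ioo (tb - 1) s,
        ((∫⁻ x in ball3 xb 1, (enDen u Dd (x, τ) * ‖tderiv φ (x, τ) + sLap φ (x, τ)‖ₑ +
            2 * enDen u Dd (x, τ) ^ (3 / 2 : ℝ) *
              ENNReal.ofReal (Real.sqrt (∑ j, (sderiv j φ (x, τ)) ^ 2)) +
            dirDen d Dd (x, τ) * ENNReal.ofReal (φ (x, τ)))) +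
          ‖∫ x in ball3 xb 1, p (x, τ) * ∑ j, u (x, τ) j * sderiv j φ (x, τ)‖ₑ) := by
  have hI1 : IntegrableOn (fun z => ‖u z‖ ^ 2 + nsq2 (Dd z)) (ball3 xb 1 ×ˢ Ioo (tb - 1) tb) := by
    have h2 := hR.l2_Dd
    rw [Qcyl_one] at h2
    exact (integrableOn_normSq hR.meas_u hE).add h2
  have hI2 : IntegrableOn (fun z => nsq2 (Du z) + nsq3 (D2d z))
      (ball3 xb 1 ×ˢ Ioo (tb - 1) tb) := by
    have h1 := hR.l2_Du
    have h2 := hR.l2_D2d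
    rw [Qcyl_one] at h1 h2
    exact h1.add h2
  rw [IntegrableOn, restrict_prod_eq] at hI1 hI2
  filter_upwards [hL, hI1.prod_left_ae, ae_restrict_mem measurableSet_Ioo] with s hs hs1 hsJ φ h1 h2 h3 h4
  have hen := hs φ h1 h2 h3 h4
  obtain ⟨M, hM⟩ := h2.exists_bound_of_continuous h1.continuous
  have hφ : ∀ τ, AEStronglyMeasurable (fun x : E3 => φ (x, τ)) (volume.restrict (ball3 xb 1)) :=
    fun τ => (h1.continuous.comp (by fun_prop)).aestronglyMeasurable
  have e1 : ENNReal.ofReal (∫ x in ball3 xb 1, (‖u (x, s)‖ ^ 2 + nsq2 (Dd (x, s))) * φ (x, s)) =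
      ∫⁻ x in ball3 xb 1, enDen u Dd (x, s) * ENNReal.ofReal (φ (x, s)) := by
    rw [ofReal_integral_eq_lintegral_ofReal]
    · refine lintegral_congr fun x => ?_
      rw [ENNReal.ofReal_mul (add_nonneg (sq_nonneg _) (nsq2_nonneg _)), enDen]
    · exact hs1.mul_bdd (c := M) (hφ s) (Eventually.of_forall fun x => hM _)
    · exact Eventually.of_forall fun x =>
        mul_nonneg (add_nonneg (sq_nonneg _) (nsq2_nonneg _)) (h4 _)
  have hsub : Ioo (tb - 1) s ⊆ Ioo (tb - 1) tb := Ioo_subset_Ioo le_rfl hsJ.2.le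
  have hI3 : Integrable (fun z : SpT => (nsq2 (Du z) + nsq3 (D2d z)) * φ z)
      ((volume.restrict (ball3 xb 1)).prod (volume.restrict (Ioo (tb - 1) s))) := by
    refine Integrable.mul_bdd (c := M) ?_ h1.continuous.aestronglyMeasurable
      (Eventually.of_forall fun z => hM _)
    refine hI2.mono_measure ?_
    rw [← restrict_prod_eq, ← restrict_prod_eq]
    exact Measure.restrict_mono (prod_mono le_rfl hsub) le_rfl
  have e2 : ENNReal.ofReal (∫ τ in Ioo (tb - 1) s, ∫ x in ball3 xb 1,
        (nsq2 (Du (x, τ)) + nsq3 (D2d (x, τ))) * φ (x, τ)) =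
      ∫⁻ τ in Ioo (tb - 1) s, ∫⁻ x in ball3 xb 1,
          disDen Du D2d (x, τ) * ENNReal.ofReal (φ (x, τ)) := by
    rw [ofReal_integral_eq_lintegral_ofReal hI3.integral_prod_right
      (Eventually.of_forall fun τ => integral_nonneg fun x =>
        mul_nonneg (add_nonneg (nsq2_nonneg _) (nsq3_nonneg _)) (h4 _))]
    refine lintegral_congr_ae ?_
    filter_upwards [hI3.prod_left_ae] with τ hτ
    rw [ofReal_integral_eq_lintegral_ofReal hτ
      (Eventually.of_forall fun x =>
        mul_nonneg (add_nonneg (nsq2_nonneg _) (nsq3_nonneg _)) (h4 _))]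
    refine lintegral_congr fun x => ?_
    rw [ENNReal.ofReal_mul (add_nonneg (nsq2_nonneg _) (nsq3_nonneg _)), disDen]
  rw [← e1, ← e2, ← ENNReal.ofReal_add]
  · refine (ENNReal.ofReal_le_ofReal hen).trans ?_
    rw [ENNReal.ofReal_mul hCb.le]
    refine mul_le_mul_right ((Real.ofReal_le_enorm _).trans
      ((enorm_integral_le_lintegral_enorm _).trans (lintegral_mono fun τ => ?_))) _
    refine (enorm_add_le _ _).trans (add_le_add ((enorm_integral_le_lintegral_enorm _).trans
      (lintegral_mono fun x => ?_)) ?_)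
    · have hn := nsq2_nonneg (Dd (x, τ))
      refine (enorm_add_le _ _).trans (add_le_add ((enorm_add_le _ _).trans (add_le_add ?_ ?_)) ?_)
      · rw [enorm_mul, enDen, Real.enorm_of_nonneg (by positivity)]
        refine mul_le_mul_right (le_of_eq ?_) _
        rw [Real.enorm_abs]
      · rw [enorm_mul, Real.enorm_of_nonneg (by positivity), Real.enorm_of_nonneg (by positivity)]
        exact mul_le_mul_left (ofReal_norm_pow_three_le (norm_nonneg _) hn) _
      · rw [Real.enorm_of_nonneg (mul_nonneg (by positivity) (h4 _)), dirDen,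
          ← ENNReal.ofReal_mul (by positivity)]
        refine ENNReal.ofReal_le_ofReal (mul_le_mul_of_nonneg_right ?_ (h4 _))
        have : 0 ≤ ‖d (x, τ)‖ ^ 2 * nsq2 (Dd (x, τ)) := by positivity
        nlinarith
    · rw [Real.enorm_abs]
  · exact integral_nonneg fun x => mul_nonneg (add_nonneg (sq_nonneg _) (nsq2_nonneg _)) (h4 _)
  · exact integral_nonneg fun τ => integral_nonneg fun x =>
        mul_nonneg (add_nonneg (nsq2_nonneg _) (nsq3_nonneg _)) (h4 _)

lemma testFn_nonneg (x0 : E3) (t0 : ℝ) {r : ℝ} (hr : 0 < r) (z : SpT) : 0 ≤ testFn x0 t0 r z := by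
  by_cases h : z ∈ tsupport (cutAt x0 (1 / 2)) ×ˢ Icc (t0 - 3 / 16) (t0 + r ^ 2 / 2)
  · have h2 := h.2.2
    have h3 : 0 < r ^ 2 := by positivity
    refine mul_nonneg (cutAt_nonneg _ _ _) (mul_nonneg (mul_nonneg (Real.smoothTransition.nonneg _)
      (Real.smoothTransition.nonneg _)) (heatK_nonneg _ (by linarith) _))
  · rw [testFn_eq_zero hr h]

lemma exists_last_level (k : ℕ) {P : ℕ → Prop} (h0 : P 0) :
    ∃ m ≤ k, P m ∧ (m = k ∨ ¬ P (m + 1)) := by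
  induction k with
  | zero => exact ⟨0, le_rfl, h0, Or.inl rfl⟩
  | succ k ih =>
    obtain ⟨m, hm, hP, h⟩ := ih
    rcases h with rfl | h
    · by_cases h1 : P (m + 1)
      · exact ⟨m + 1, le_rfl, h1, Or.inl rfl⟩
      · exact ⟨m, Nat.le_succ m, hP, Or.inr h1⟩
    · exact ⟨m, hm.trans (Nat.le_succ k), hP, Or.inr h⟩

/-- The parabolic cylinder `B_{r_j}(x₀) × (t₀ - r_j², t₀)`, `r_j = rad θ j`. -/
def cyl (θ : ℝ) (x0 : E3) (t0 : ℝ) (j : ℕ) : Set SpT :=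
  ball3 x0 (rad θ j) ×ˢ tint t0 (rad θ j)

lemma measurableSet_cyl (θ : ℝ) (x0 : E3) (t0 : ℝ) (j : ℕ) : MeasurableSet (cyl θ x0 t0 j) :=
  (measurableSet_ball3 _ _).prod measurableSet_Ioo

/-- Sum over `j ≤ k` of the indicators of the cylinders, weighted by `r_j^{-a}`. -/
def levelSum (θ : ℝ) (x0 : E3) (t0 : ℝ) (a k : ℕ) (z : SpT) : ℝ≥0∞ :=
  ∑ j ∈ Finset.range (k + 1),
    (cyl θ x0 t0 j).indicator (fun _ => ENNReal.ofReal ((rad θ j ^ a)⁻¹)) z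

lemma measurable_levelSum (θ : ℝ) (x0 : E3) (t0 : ℝ) (a k : ℕ) :
    Measurable (levelSum θ x0 t0 a k) :=
  Finset.measurable_fun_sum _ fun j _ => measurable_const.indicator (measurableSet_cyl θ x0 t0 j)

lemma rad_le_of_notMem {θ : ℝ} (hθ : 0 < θ) {x0 x : E3} {t0 t : ℝ} {l : ℕ} {R r : ℝ} (hR : 0 < R)
    (hRe : R ^ 2 = ‖x - x0‖ ^ 2 + (r ^ 2 + t0 - t)) (ht : t < t0)
    (h : x ∉ ball3 x0 (rad θ l) ∨ t ∉ tint t0 (rad θ l) ∨ r = rad θ l) : rad θ l ≤ R := by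
  have hr := rad_pos hθ l
  refine le_of_sq_le_sq ?_ hR.le
  rw [hRe]
  rcases h with h | h | h
  · have : rad θ l ≤ ‖x - x0‖ := by
      rw [← dist_eq_norm]
      exact not_lt.1 fun h' => h (Metric.mem_ball.2 h')
    have := pow_le_pow_left₀ hr.le this 2
    nlinarith [sq_nonneg r]
  · have : t ≤ t0 - rad θ l ^ 2 := not_lt.1 fun h' => h ⟨h', ht⟩
    nlinarith [sq_nonneg r, sq_nonneg ‖x - x0‖]
  · rw [h]; nlinarith [sq_nonneg ‖x - x0‖]

lemma ofReal_le_levelSum {θ : ℝ} (hθ : 0 < θ) {x0 x : E3} {t0 t : ℝ}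
    (hx : (x, t) ∈ cyl θ x0 t0 0) {k : ℕ} {R : ℝ} (hR : 0 < R)
    (hRe : R ^ 2 = ‖x - x0‖ ^ 2 + (rad θ (k + 1) ^ 2 + t0 - t)) {C : ℝ} (hC : 0 ≤ C) (a : ℕ) :
    ENNReal.ofReal (C * (R ^ a)⁻¹) ≤
      ENNReal.ofReal (C * (θ ^ a)⁻¹) * levelSum θ x0 t0 a k (x, t) := by
  have ht : t < t0 := hx.2.2
  obtain ⟨m, hmk, hm, hm'⟩ := exists_last_level k (P := fun l => (x, t) ∈ cyl θ x0 t0 l) hx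
  have hle : rad θ (m + 1) ≤ R := by
    refine rad_le_of_notMem hθ hR hRe ht ?_
    rcases hm' with rfl | h
    · exact Or.inr (Or.inr rfl)
    · simp only [cyl, mem_prod, not_and_or] at h
      tauto
  have hrm := rad_pos hθ m
  have h1 : C * (R ^ a)⁻¹ ≤ C * (θ ^ a)⁻¹ * (rad θ m ^ a)⁻¹ := by
    rw [mul_assoc, ← mul_inv, ← mul_pow, ← rad_succ]
    have := rad_pos hθ (m + 1)
    exact mul_le_mul_of_nonneg_left
      (inv_anti₀ (by positivity) (pow_le_pow_left₀ this.le hle a)) hC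
  refine (ENNReal.ofReal_le_ofReal h1).trans ?_
  rw [ENNReal.ofReal_mul (by positivity)]
  refine mul_le_mul_right ?_ _
  refine le_trans (le_of_eq ?_) (Finset.single_le_sum (fun _ _ => zero_le)
    (Finset.mem_range.2 (Nat.lt_succ_of_le hmk)))
  rw [indicator_of_mem hm]

lemma lintegral_mul_levelSum (θ : ℝ) (x0 : E3) (t0 : ℝ) (a k : ℕ) {f : SpT → ℝ≥0∞}
    (hf : Measurable f) (S : Set SpT) :
    ∫⁻ z in S, f z * levelSum θ x0 t0 a k z ≤
      ∑ j ∈ Finset.range (k + 1), ENNReal.ofReal ((rad θ j ^ a)⁻¹) *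
        ∫⁻ z in cyl θ x0 t0 j, f z := by
  simp only [levelSum, Finset.mul_sum]
  have hm : ∀ j, Measurable fun z => f z *
      (cyl θ x0 t0 j).indicator (fun _ => ENNReal.ofReal ((rad θ j ^ a)⁻¹)) z := fun j =>
    hf.mul (measurable_const.indicator (measurableSet_cyl θ x0 t0 j))
  rw [lintegral_finsetSum _ fun j _ => hm j]
  refine Finset.sum_le_sum fun j _ => ?_
  calc ∫⁻ z in S, f z * (cyl θ x0 t0 j).indicator (fun _ => ENNReal.ofReal ((rad θ j ^ a)⁻¹)) z
      = ∫⁻ z in S, (cyl θ x0 t0 j).indicator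
          (fun z => ENNReal.ofReal ((rad θ j ^ a)⁻¹) * f z) z := by
        refine lintegral_congr fun z => ?_
        by_cases hz : z ∈ cyl θ x0 t0 j
        · simp [hz, mul_comm]
        · simp [hz]
    _ ≤ ∫⁻ z, (cyl θ x0 t0 j).indicator
          (fun z => ENNReal.ofReal ((rad θ j ^ a)⁻¹) * f z) z :=
        lintegral_mono' Measure.restrict_le_self le_rfl
    _ = ∫⁻ z in cyl θ x0 t0 j, ENNReal.ofReal ((rad θ j ^ a)⁻¹) * f z :=
        lintegral_indicator (measurableSet_cyl θ x0 t0 j) _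
    _ = _ := lintegral_const_mul _ hf

lemma exists_testFn_level : ∃ C : ℝ, 0 < C ∧ ∀ (x0 : E3) (t0 θ : ℝ), 0 < θ → θ ≤ 1 / 2 → ∀ k : ℕ,
    (∀ z, z.2 < t0 →
      ENNReal.ofReal (testFn x0 t0 (rad θ (k + 1)) z) ≤
        ENNReal.ofReal (C * (θ ^ 3)⁻¹) * levelSum θ x0 t0 3 k z ∧
      ENNReal.ofReal (Real.sqrt (∑ j, sderiv j (testFn x0 t0 (rad θ (k + 1))) z ^ 2)) ≤
        ENNReal.ofReal (C * (θ ^ 4)⁻¹) * levelSum θ x0 t0 4 k z ∧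
      ‖tderiv (testFn x0 t0 (rad θ (k + 1))) z + sLap (testFn x0 t0 (rad θ (k + 1))) z‖ₑ ≤
        (cyl θ x0 t0 0).indicator (fun _ => ENNReal.ofReal C) z) ∧
    (∀ z, z ∈ cyl θ x0 t0 (k + 1) →
      ENNReal.ofReal ((rad θ (k + 1) ^ 3)⁻¹) ≤
        ENNReal.ofReal C * ENNReal.ofReal (testFn x0 t0 (rad θ (k + 1)) z)) ∧
    (∀ t < t0, ∀ m ≤ k, (m = k ∨ t ∉ tint t0 (rad θ (m + 1))) →
      ∀ l ≤ m + 1, ∀ x, (x ∉ ball3 x0 (rad θ l) ∨ l = m + 1) →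
        |testFn x0 t0 (rad θ (k + 1)) (x, t)| ≤ C * (rad θ l ^ 3)⁻¹ ∧
        ∀ i, |pd i (fun y => testFn x0 t0 (rad θ (k + 1)) (y, t)) x| ≤ C * (rad θ l ^ 4)⁻¹) := by
  obtain ⟨C, hC, H⟩ := exists_testFn_bounds
  refine ⟨3 * C, by positivity, fun x0 t0 θ hθ hθ2 k => ?_⟩
  set r := rad θ (k + 1) with hr
  have hr0 : 0 < r := rad_pos hθ _
  have hr4 : r ≤ 1 / 4 := by
    rw [hr, rad_succ]
    have := rad_anti hθ (by linarith) (Nat.zero_le k)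
    rw [rad_zero] at this
    nlinarith [rad_pos hθ k]
  obtain ⟨H1, H2⟩ := H x0 t0 r hr0 hr4
  have hRex : ∀ x t, t < t0 → ∃ R, 0 < R ∧ R ^ 2 = ‖x - x0‖ ^ 2 + (r ^ 2 + t0 - t) := by
    intro x t ht
    have : 0 < ‖x - x0‖ ^ 2 + (r ^ 2 + t0 - t) := by nlinarith [sq_nonneg ‖x - x0‖, sq_nonneg r]
    exact ⟨√(‖x - x0‖ ^ 2 + (r ^ 2 + t0 - t)), Real.sqrt_pos.2 this, Real.sq_sqrt this.le⟩
  have hd := (contDiff_testFn x0 t0 hr0).differentiable (by norm_num)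
  refine ⟨?_, ?_, ?_⟩
  · rintro ⟨x, t⟩ ht
    by_cases hz : (x, t) ∈ cyl θ x0 t0 0
    · obtain ⟨R, hR, hRe⟩ := hRex x t ht
      obtain ⟨b1, b2, b3, -⟩ := H2 x t R ht hR hRe
      refine ⟨(ENNReal.ofReal_le_ofReal (b1.trans ?_)).trans
        (ofReal_le_levelSum hθ hz hR hRe (by positivity) 3),
        (ENNReal.ofReal_le_ofReal ?_).trans
        (ofReal_le_levelSum hθ hz hR hRe (by positivity) 4), ?_⟩
      · have : 0 < (R ^ 3)⁻¹ := by positivity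
        nlinarith
      · have h0 : 0 < (R ^ 4)⁻¹ := by positivity
        refine Real.sqrt_le_iff.2 ⟨by positivity, ?_⟩
        calc ∑ j, sderiv j (testFn x0 t0 r) (x, t) ^ 2 ≤ ∑ j : Fin 3, (C * (R ^ 4)⁻¹) ^ 2 :=
              Finset.sum_le_sum fun j _ => sq_le_sq' (by linarith [(abs_le.1 (b2 j)).1])
                (abs_le.1 (b2 j)).2
          _ = 3 * (C * (R ^ 4)⁻¹) ^ 2 := by simp
          _ ≤ _ := by nlinarith [sq_nonneg (C * (R ^ 4)⁻¹)]
      · rw [indicator_of_mem hz, ← ofReal_norm]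
        refine ENNReal.ofReal_le_ofReal ?_
        rw [Real.norm_eq_abs]
        linarith
    · have hts : (x, t) ∉ tsupport (testFn x0 t0 r) := fun h => hz (by
        have h' := tsupport_testFn x0 t0 hr0 h
        refine ⟨by rw [rad_zero]; exact h'.1, ?_, ht⟩
        have := h'.2
        simp only [mem_Ioi] at this
        rw [rad_zero]; norm_num; linarith)
      have hsd : ∀ (j : Fin 3) (f : SpT → ℝ), tsupport (sderiv j f) ⊆ tsupport f := fun j f =>
        tsupport_fderiv_apply_subset ℝ _
      have e0 : testFn x0 t0 r (x, t) = 0 := image_eq_zero_of_notMem_tsupport hts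
      have e1 : ∀ j, sderiv j (testFn x0 t0 r) (x, t) = 0 := fun j =>
        image_eq_zero_of_notMem_tsupport fun h => hts (hsd j _ h)
      have e2 : sLap (testFn x0 t0 r) (x, t) = 0 := Finset.sum_eq_zero fun j _ =>
        image_eq_zero_of_notMem_tsupport fun h => hts (hsd j _ (hsd j _ h))
      have e3 : tderiv (testFn x0 t0 r) (x, t) = 0 :=
        image_eq_zero_of_notMem_tsupport fun h => hts
          (tsupport_fderiv_apply_subset ℝ ((0 : E3), (1 : ℝ)) h)
      simp [e0, e1, e2, e3]
  · rintro ⟨x, t⟩ hz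
    obtain ⟨R, hR, hRe⟩ := hRex x t hz.2.2
    obtain ⟨-, -, -, b4⟩ := H2 x t R hz.2.2 hR hRe
    have := b4 hz.1 hz.2.1
    rw [← ENNReal.ofReal_mul (by positivity)]
    refine ENNReal.ofReal_le_ofReal ?_
    have h0 := testFn_nonneg x0 t0 hr0 (x, t)
    nlinarith
  · intro t ht m hmk hm l hl x hx
    obtain ⟨R, hR, hRe⟩ := hRex x t ht
    obtain ⟨b1, b2, -, -⟩ := H2 x t R ht hR hRe
    have hle : rad θ l ≤ R := by
      refine rad_le_of_notMem hθ hR hRe ht ?_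
      rcases hx with hx | rfl
      · exact Or.inl hx
      · rcases hm with rfl | h
        · exact Or.inr (Or.inr rfl)
        · exact Or.inr (Or.inl h)
    have hrl := rad_pos hθ l
    refine ⟨?_, fun i => ?_⟩
    · rw [abs_of_nonneg (testFn_nonneg x0 t0 hr0 _)]
      refine b1.trans (mul_le_mul (by linarith) (inv_anti₀ (by positivity)
        (pow_le_pow_left₀ hrl.le hle 3)) (by positivity) (by positivity))
    · rw [← sderiv_eq_pd (hd (x, t))]
      exact (b2 i).trans (mul_le_mul (by linarith) (inv_anti₀ (by positivity)
        (pow_le_pow_left₀ hrl.le hle 4)) (by positivity) (by positivity))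

/-- The energy inequality at time `s`, with a general pressure term `Π`. -/
def EnergyAt (xb : E3) (tb Cb : ℝ) (E G D : SpT → ℝ≥0∞) (Pr : (SpT → ℝ) → ℝ → ℝ≥0∞) (s : ℝ) :
    Prop :=
  ∀ φ : SpT → ℝ, ContDiff ℝ (⊤ : ℕ∞) φ → HasCompactSupport φ →
    tsupport φ ⊆ ball3 xb 1 ×ˢ Ioi (tb - 1) → (∀ z, 0 ≤ φ z) →
    (∫⁻ x in ball3 xb 1, E (x, s) * ENNReal.ofReal (φ (x, s))) +
      (∫⁻ τ in Ioo (tb - 1) s, ∫⁻ x in ball3 xb 1,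
        G (x, τ) * ENNReal.ofReal (φ (x, τ))) ≤
    ENNReal.ofReal Cb * ∫⁻ τ in Ioo (tb - 1) s,
      ((∫⁻ x in ball3 xb 1, (E (x, τ) * ‖tderiv φ (x, τ) + sLap φ (x, τ)‖ₑ +
          2 * E (x, τ) ^ (3 / 2 : ℝ) *
            ENNReal.ofReal (Real.sqrt (∑ j, (sderiv j φ (x, τ)) ^ 2)) +
          D (x, τ) * ENNReal.ofReal (φ (x, τ)))) + Pr φ τ)

lemma exists_energy_level : ∃ C : ℝ, 0 < C ∧ ∀ (xb : E3) (tb Cb : ℝ) (E G D : SpT → ℝ≥0∞)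
    (Pr : (SpT → ℝ) → ℝ → ℝ≥0∞) (s : ℝ), Measurable E → Measurable D →
    EnergyAt xb tb Cb E G D Pr s → ∀ (x0 : E3) (t0 θ : ℝ) (k : ℕ), 0 < θ → θ ≤ 1 / 2 →
    ball3 x0 (1 / 2) ⊆ ball3 xb 1 → tb - 3 / 4 ≤ t0 → s ∈ tint t0 (rad θ (k + 1)) →
    ENNReal.ofReal ((rad θ (k + 1) ^ 3)⁻¹) * ((∫⁻ x in ball3 x0 (rad θ (k + 1)), E (x, s)) +
      ∫⁻ τ in Ioo (t0 - rad θ (k + 1) ^ 2) s, ∫⁻ x in ball3 x0 (rad θ (k + 1)), G (x, τ)) ≤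
    ENNReal.ofReal C * (ENNReal.ofReal Cb * (
      ENNReal.ofReal C * (∫⁻ z in cyl θ x0 t0 0, E z) +
      2 * ENNReal.ofReal (C * (θ ^ 4)⁻¹) * (∑ j ∈ Finset.range (k + 1),
        ENNReal.ofReal ((rad θ j ^ 4)⁻¹) * ∫⁻ z in cyl θ x0 t0 j, E z ^ (3 / 2 : ℝ)) +
      ENNReal.ofReal (C * (θ ^ 3)⁻¹) * (∑ j ∈ Finset.range (k + 1),
        ENNReal.ofReal ((rad θ j ^ 3)⁻¹) * ∫⁻ z in cyl θ x0 t0 j, D z) +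
      ∫⁻ τ in Ioo (tb - 1) t0, Pr (testFn x0 t0 (rad θ (k + 1))) τ)) := by
  obtain ⟨C, hC, H⟩ := exists_testFn_level
  refine ⟨C, hC, fun xb tb Cb E G D Pr s hE hD hs x0 t0 θ k hθ hθ2 hB ht0 hst => ?_⟩
  obtain ⟨H1, H2, -⟩ := H x0 t0 θ hθ hθ2 k
  set r := rad θ (k + 1) with hr
  have hr0 : 0 < r := rad_pos hθ _
  have hr2 : r ≤ 1 / 2 := by
    have := rad_anti hθ (by linarith) (Nat.zero_le (k + 1))
    rwa [rad_zero] at this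
  set φ := testFn x0 t0 r with hφ
  have hφc : ContDiff ℝ (⊤ : ℕ∞) φ := contDiff_testFn x0 t0 hr0
  have hsub : ball3 x0 r ⊆ ball3 xb 1 := (Metric.ball_subset_ball hr2).trans hB
  have hst0 : s < t0 := hst.2
  have hts : Ioo (t0 - r ^ 2) s ⊆ Ioo (tb - 1) s := Ioo_subset_Ioo (by nlinarith) le_rfl
  have hen := hs φ hφc (hasCompactSupport_testFn x0 t0 hr0)
    ((tsupport_testFn x0 t0 hr0).trans (prod_mono hB (Ioi_subset_Ioi (by linarith))))
    (testFn_nonneg x0 t0 hr0)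
  have hpt : ∀ (f : SpT → ℝ≥0∞), ∀ τ ∈ tint t0 r,
      ENNReal.ofReal ((r ^ 3)⁻¹) * (∫⁻ x in ball3 x0 r, f (x, τ)) ≤
      ENNReal.ofReal C * ∫⁻ x in ball3 xb 1, f (x, τ) * ENNReal.ofReal (φ (x, τ)) := by
    intro f τ hτ
    rw [← lintegral_const_mul' _ _ ENNReal.ofReal_ne_top,
      ← lintegral_const_mul' _ _ ENNReal.ofReal_ne_top]
    refine (setLIntegral_mono' (measurableSet_ball3 _ _) fun x hx => ?_).trans
      (lintegral_mono_set hsub)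
    calc _ ≤ (ENNReal.ofReal C * ENNReal.ofReal (φ (x, τ))) * f (x, τ) :=
          mul_le_mul_left (H2 (x, τ) ⟨hx, hτ⟩) _
      _ = _ := by ring
  have hlhs : ENNReal.ofReal ((r ^ 3)⁻¹) * ((∫⁻ x in ball3 x0 r, E (x, s)) +
      ∫⁻ τ in Ioo (t0 - r ^ 2) s, ∫⁻ x in ball3 x0 r, G (x, τ)) ≤
      ENNReal.ofReal C * ((∫⁻ x in ball3 xb 1, E (x, s) * ENNReal.ofReal (φ (x, s))) +
      (∫⁻ τ in Ioo (tb - 1) s, ∫⁻ x in ball3 xb 1,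
        G (x, τ) * ENNReal.ofReal (φ (x, τ)))) := by
    rw [mul_add, mul_add]
    refine add_le_add (hpt E s hst) ?_
    rw [← lintegral_const_mul' _ _ ENNReal.ofReal_ne_top,
      ← lintegral_const_mul' _ _ ENNReal.ofReal_ne_top]
    exact (setLIntegral_mono' measurableSet_Ioo fun τ hτ => hpt G τ
      ⟨hτ.1, hτ.2.trans hst0⟩).trans (lintegral_mono_set hts)
  refine hlhs.trans (mul_le_mul_right (hen.trans (mul_le_mul_right ?_ _)) _)
  set I : SpT → ℝ≥0∞ := fun z => E z * ‖tderiv φ z + sLap φ z‖ₑ +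
          2 * E z ^ (3 / 2 : ℝ) * ENNReal.ofReal (Real.sqrt (∑ j, (sderiv j φ z) ^ 2)) +
          D z * ENNReal.ofReal (φ z) with hI
  set I' : SpT → ℝ≥0∞ := fun z => E z * (cyl θ x0 t0 0).indicator (fun _ => ENNReal.ofReal C) z +
          2 * E z ^ (3 / 2 : ℝ) * (ENNReal.ofReal (C * (θ ^ 4)⁻¹) * levelSum θ x0 t0 4 k z) +
          D z * (ENNReal.ofReal (C * (θ ^ 3)⁻¹) * levelSum θ x0 t0 3 k z) with hI'
  have m0 : Measurable fun z => E z * (cyl θ x0 t0 0).indicator (fun _ => ENNReal.ofReal C) z :=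
    hE.mul (measurable_const.indicator (measurableSet_cyl θ x0 t0 0))
  have m1 : Measurable fun z => 2 * E z ^ (3 / 2 : ℝ) *
      (ENNReal.ofReal (C * (θ ^ 4)⁻¹) * levelSum θ x0 t0 4 k z) :=
    ((hE.pow_const _).const_mul _).mul ((measurable_levelSum θ x0 t0 4 k).const_mul _)
  have m2 : Measurable fun z => D z * (ENNReal.ofReal (C * (θ ^ 3)⁻¹) * levelSum θ x0 t0 3 k z) :=
    hD.mul ((measurable_levelSum θ x0 t0 3 k).const_mul _)
  have hI'm : Measurable I' := (m0.add m1).add m2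
  have hle : ∀ z : SpT, z.2 < t0 → I z ≤ I' z := fun z hz => by
    obtain ⟨b1, b2, b3⟩ := H1 z hz
    exact add_le_add (add_le_add (mul_le_mul_right b3 _) (mul_le_mul_right b2 _))
      (mul_le_mul_right b1 _)
  calc ∫⁻ τ in Ioo (tb - 1) s, ((∫⁻ x in ball3 xb 1, I (x, τ)) + Pr φ τ)
      ≤ ∫⁻ τ in Ioo (tb - 1) s, ((∫⁻ x in ball3 xb 1, I' (x, τ)) + Pr φ τ) := by
        refine setLIntegral_mono' measurableSet_Ioo fun τ hτ => add_le_add ?_ le_rfl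
        exact lintegral_mono fun x => hle (x, τ) (hτ.2.trans hst0)
    _ ≤ ∫⁻ τ in Ioo (tb - 1) t0, ((∫⁻ x in ball3 xb 1, I' (x, τ)) + Pr φ τ) :=
        lintegral_mono_set (Ioo_subset_Ioo le_rfl hst0.le)
    _ = (∫⁻ z in ball3 xb 1 ×ˢ Ioo (tb - 1) t0, I' z) + ∫⁻ τ in Ioo (tb - 1) t0, Pr φ τ := by
        rw [lintegral_prod_slice _ _ hI'm]
        exact lintegral_add_left (hI'm.lintegral_prod_left' (μ := volume.restrict _)) _
    _ ≤ _ := by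
        refine add_le_add ?_ le_rfl
        have m01 : Measurable fun z => E z * (cyl θ x0 t0 0).indicator (fun _ => ENNReal.ofReal C) z +
            2 * E z ^ (3 / 2 : ℝ) * (ENNReal.ofReal (C * (θ ^ 4)⁻¹) * levelSum θ x0 t0 4 k z) :=
          m0.add m1
        simp only [hI']
        rw [lintegral_add_left m01, lintegral_add_left m0]
        have m3 : Measurable fun z => E z ^ (3 / 2 : ℝ) * levelSum θ x0 t0 4 k z :=
          (hE.pow_const _).mul (measurable_levelSum θ x0 t0 4 k)
        have m4 : Measurable fun z => D z * levelSum θ x0 t0 3 k z :=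
          hD.mul (measurable_levelSum θ x0 t0 3 k)
        refine add_le_add (add_le_add ?_ ?_) ?_
        · rw [← lintegral_const_mul _ hE, ← lintegral_indicator (measurableSet_cyl θ x0 t0 0)]
          refine (lintegral_mono' Measure.restrict_le_self le_rfl).trans (le_of_eq ?_)
          refine lintegral_congr fun z => ?_
          by_cases hz : z ∈ cyl θ x0 t0 0
          · simp [hz, mul_comm]
          · simp [hz]
        · refine le_trans (le_of_eq ?_) (mul_le_mul_right
            (lintegral_mul_levelSum θ x0 t0 4 k (hE.pow_const (3 / 2 : ℝ))
              (ball3 xb 1 ×ˢ Ioo (tb - 1) t0)) _)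
          rw [← lintegral_const_mul _ m3]
          refine lintegral_congr fun z => ?_
          ring
        · refine le_trans (le_of_eq ?_) (mul_le_mul_right
            (lintegral_mul_levelSum θ x0 t0 3 k hD (ball3 xb 1 ×ˢ Ioo (tb - 1) t0)) _)
          rw [← lintegral_const_mul _ m4]
          refine lintegral_congr fun z => ?_
          ring

lemma SlicePress.mono {U V : Set E3} (hU : MeasurableSet U) (h : V ⊆ U)
    {F : Fin 3 → Fin 3 → E3 → ℝ} {p : E3 → ℝ} (hp : SlicePress U F p) : SlicePress V F p := by
  intro b hb
  have hz : ∀ x ∈ U \ V, ∀ i j, pd i (pd j b) x = 0 := fun x hx i j =>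
    image_eq_zero_of_notMem_tsupport fun hx' => hx.2 (((hb.pd j).pd i).2.2 hx')
  have := hp b ⟨hb.1, hb.2.1, hb.2.2.trans h⟩
  rwa [setIntegral_eq_of_subset_of_forall_sdiff_eq_zero hU h (fun x hx => by simp [hz x hx]),
    setIntegral_eq_of_subset_of_forall_sdiff_eq_zero hU h (fun x hx => by simp [hz x hx])] at this

/-- Recursive bounds for the scaled mean oscillation of the pressure on a time slice. -/
def pressSeq (θ C1 C2 : ℝ) (a : ℝ≥0∞) (h : ℕ → ℝ≥0∞) : ℕ → ℝ≥0∞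
  | 0 => a
  | i + 1 => ENNReal.ofReal (C1 * θ) * pressSeq θ C1 C2 a h i +
      ENNReal.ofReal (C2 * (rad θ (i + 2)) ^ (-(3 / 2) : ℝ)) * h i ^ (1 / 2 : ℝ)

lemma exists_pressure_chain : ∃ C1 : ℝ, 0 < C1 ∧ ∀ θ : ℝ, 0 < θ → θ ≤ 1 / 2 → ∃ C2 : ℝ, 0 < C2 ∧
    ∀ (x0 : E3) (F : Fin 3 → Fin 3 → E3 → ℝ) (p : E3 → ℝ),
    (∀ i j, MemLp (F i j) 2 (volume.restrict (ball3 x0 (rad θ 2)))) →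
    IntegrableOn p (ball3 x0 (rad θ 2)) → SlicePress (ball3 x0 (rad θ 2)) F p →
    ∀ i, ∃ c : ℝ, (∫⁻ x in ball3 x0 (rad θ (i + 3)), ‖p x - c‖ₑ ^ (2 : ℝ)) ^ (1 / 2 : ℝ) ≤
      ENNReal.ofReal (rad θ (i + 3) ^ (3 / 2 : ℝ)) * pressSeq θ C1 C2
        (ENNReal.ofReal ((rad θ 2 ^ 3)⁻¹) * ∫⁻ x in ball3 x0 (rad θ 2), ‖p x‖ₑ)
        (fun i => ∫⁻ x in ball3 x0 (rad θ (i + 2)), ENNReal.ofReal (∑ i, ∑ j, F i j x ^ 2))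
        (i + 1) := by
  obtain ⟨C1, hC1, H⟩ := exists_pressure_step
  refine ⟨C1, hC1, fun θ hθ hθ2 => ?_⟩
  obtain ⟨C2, hC2, H⟩ := H θ hθ hθ2
  refine ⟨C2, hC2, fun x0 F p hF hp hpr => ?_⟩
  set A := pressSeq θ C1 C2
        (ENNReal.ofReal ((rad θ 2 ^ 3)⁻¹) * ∫⁻ x in ball3 x0 (rad θ 2), ‖p x‖ₑ)
        (fun i => ∫⁻ x in ball3 x0 (rad θ (i + 2)), ENNReal.ofReal (∑ i, ∑ j, F i j x ^ 2)) with hA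
  have hsub : ∀ i, ball3 x0 (rad θ (i + 2)) ⊆ ball3 x0 (rad θ 2) := fun i =>
    Metric.ball_subset_ball (rad_anti hθ (by linarith) (by omega))
  have step : ∀ i (c : ℝ), ∫⁻ x in ball3 x0 (rad θ (i + 2)), ‖p x - c‖ₑ ≤
      ENNReal.ofReal (rad θ (i + 2) ^ 3) * A i → ∃ c' : ℝ,
      (∫⁻ x in ball3 x0 (rad θ (i + 3)), ‖p x - c'‖ₑ ^ (2 : ℝ)) ^ (1 / 2 : ℝ) ≤
        ENNReal.ofReal (rad θ (i + 3) ^ (3 / 2 : ℝ)) * A (i + 1) ∧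
      ∫⁻ x in ball3 x0 (rad θ (i + 3)), ‖p x - c'‖ₑ ≤
        ENNReal.ofReal (rad θ (i + 3) ^ 3) * A (i + 1) := by
    intro i c hc
    rw [show i + 3 = (i + 2) + 1 by ring, rad_succ]
    exact H x0 (rad θ (i + 2)) (rad_pos hθ _) F p c (A i)
      (fun a b => (hF a b).mono_measure (Measure.restrict_mono (hsub i) le_rfl))
      (hp.mono_set (hsub i))
      (hpr.mono (measurableSet_ball3 _ _) (hsub i)) hc
  have ind : ∀ i, ∃ c : ℝ, ∫⁻ x in ball3 x0 (rad θ (i + 2)), ‖p x - c‖ₑ ≤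
      ENNReal.ofReal (rad θ (i + 2) ^ 3) * A i := by
    intro i
    induction i with
    | zero =>
      refine ⟨0, ?_⟩
      have h3 : 0 < rad θ 2 ^ 3 := pow_pos (rad_pos hθ _) _
      simp only [hA, pressSeq, sub_zero, zero_add]
      rw [← mul_assoc, ← ENNReal.ofReal_mul h3.le, mul_inv_cancel₀ h3.ne', ENNReal.ofReal_one,
        one_mul]
    | succ i ih =>
      obtain ⟨c, hc⟩ := ih
      obtain ⟨c', -, hc'⟩ := step i c hc
      exact ⟨c', hc'⟩
  intro i
  obtain ⟨c, hc⟩ := ind i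
  obtain ⟨c', hc', -⟩ := step i c hc
  exact ⟨c', hc'⟩

lemma isTest3_testFn_slice (x0 : E3) (t0 : ℝ) {r : ℝ} (hr : 0 < r) (t : ℝ) :
    IsTest3 (ball3 x0 (1 / 2)) (fun y => testFn x0 t0 r (y, t)) := by
  have hc := isTest3_cutAt x0 (by norm_num : (0 : ℝ) < 1 / 2)
  have hs : tsupport (fun y => testFn x0 t0 r (y, t)) ⊆ tsupport (cutAt x0 (1 / 2)) := by
    refine closure_minimal (fun y hy => ?_) (isClosed_tsupport _)
    by_contra h
    exact hy (testFn_eq_zero hr fun h' => h h'.1)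
  exact ⟨(contDiff_testFn x0 t0 hr).comp (contDiff_id.prodMk contDiff_const),
    IsCompact.of_isClosed_subset hc.2.1 (isClosed_tsupport _) hs, hs.trans hc.2.2⟩

/-- The bound for the pressure term at level `j` on a time slice. -/
def pressTerm (θ C1 C2 : ℝ) (x0 : E3) (P V : E3 → ℝ≥0∞) (h : ℕ → ℝ≥0∞) (j : ℕ) : ℝ≥0∞ :=
  if j ≤ 2 then ∫⁻ x in ball3 x0 (rad θ j), P x * V x else
    ENNReal.ofReal (rad θ j ^ (3 / 2 : ℝ)) * pressSeq θ C1 C2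
      (ENNReal.ofReal ((rad θ 2 ^ 3)⁻¹) * ∫⁻ x in ball3 x0 (rad θ 2), P x) h (j - 2) *
      (∫⁻ x in ball3 x0 (rad θ j), V x ^ (2 : ℝ)) ^ (1 / 2 : ℝ)

lemma exists_pressure_slice : ∃ C1 : ℝ, 0 < C1 ∧ ∀ θ : ℝ, 0 < θ → θ ≤ 1 / 2 →
    ∃ C2 : ℝ, 0 < C2 ∧ ∃ K : ℝ, 0 < K ∧
    ∀ (x0 : E3) (t0 t : ℝ) (k : ℕ) (F : Fin 3 → Fin 3 → E3 → ℝ) (p : E3 → ℝ) (v : E3 → E3)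
      (U : Set E3), t < t0 → ball3 x0 (1 / 2) ⊆ U →
    AEStronglyMeasurable v (volume.restrict U) → IntegrableOn v U →
    IntegrableOn (fun x => p x * ‖v x‖) U → IntegrableOn p U →
    SliceDiv U v →
    (3 ≤ k → t ∈ tint t0 (rad θ 3) → (SlicePress (ball3 x0 (rad θ 2)) F p ∧
      ∀ i j, MemLp (F i j) 2 (volume.restrict (ball3 x0 (rad θ 2))))) →
    ‖∫ x in U, p x * ∑ j, v x j * sderiv j (testFn x0 t0 (rad θ (k + 1))) (x, t)‖ₑ ≤
      ∑ j ∈ Finset.range (k + 1), ENNReal.ofReal (K * (rad θ j ^ 4)⁻¹) *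
        (tint t0 (rad θ j)).indicator (fun _ => pressTerm θ C1 C2 x0 (fun x => ‖p x‖ₑ)
          (fun x => ‖v x‖ₑ) (fun i => ∫⁻ x in ball3 x0 (rad θ (i + 2)),
            ENNReal.ofReal (∑ i, ∑ j, F i j x ^ 2)) j) t := by
  obtain ⟨C1, hC1, H⟩ := exists_pressure_chain
  obtain ⟨K, hK, HT⟩ := exists_telescope
  obtain ⟨C, hC, HC⟩ := exists_testFn_level
  refine ⟨C1, hC1, fun θ hθ hθ2 => ?_⟩
  obtain ⟨C2, hC2, H⟩ := H θ hθ hθ2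
  refine ⟨C2, hC2, K * C * (θ ^ 8)⁻¹, by positivity, ?_⟩
  intro x0 t0 t k F p v U ht hU hv hvi hpv hp hdiv h3
  have hr : 0 < rad θ (k + 1) := rad_pos hθ _
  have hΦ := isTest3_testFn_slice x0 t0 hr t
  simp only [sderiv_eq_pd (((contDiff_testFn x0 t0 hr).differentiable
    (by norm_num)).differentiableAt)]
  by_cases ht0 : t ∈ tint t0 (rad θ 0)
  swap
  · have hz : (fun y => testFn x0 t0 (rad θ (k + 1)) (y, t)) = 0 := by
      funext y
      refine image_eq_zero_of_notMem_tsupport fun h => ht0 ?_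
      have := (tsupport_testFn x0 t0 hr h).2
      simp only [mem_Ioi] at this
      rw [rad_zero]
      exact ⟨by norm_num; linarith, ht⟩
    rw [hz]
    simp [pd]
  obtain ⟨m, hmk, hm, hm'⟩ := exists_last_level k (P := fun j => t ∈ tint t0 (rad θ j)) ht0
  have hmem : ∀ j ≤ m, t ∈ tint t0 (rad θ j) := fun j hj =>
    tint_mono t0 (rad_pos hθ _).le (rad_anti hθ (by linarith) hj) hm
  have hsubU : ∀ j, ball3 x0 (rad θ j) ⊆ U := fun j => by
    refine (Metric.ball_subset_ball ?_).trans hU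
    have := rad_anti hθ (by linarith) (Nat.zero_le j)
    rwa [rad_zero] at this
  have hc : ∃ c : ℕ → ℝ, ∀ j ≤ m, ∫⁻ x in ball3 x0 (rad θ j), ‖p x - c j‖ₑ * ‖v x‖ₑ ≤
      pressTerm θ C1 C2 x0 (fun x => ‖p x‖ₑ) (fun x => ‖v x‖ₑ)
        (fun i => ∫⁻ x in ball3 x0 (rad θ (i + 2)), ENNReal.ofReal (∑ i, ∑ j, F i j x ^ 2)) j := by
    have hj : ∀ j, ∃ c : ℝ, j ≤ m → ∫⁻ x in ball3 x0 (rad θ j), ‖p x - c‖ₑ * ‖v x‖ₑ ≤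
      pressTerm θ C1 C2 x0 (fun x => ‖p x‖ₑ) (fun x => ‖v x‖ₑ)
        (fun i => ∫⁻ x in ball3 x0 (rad θ (i + 2)), ENNReal.ofReal (∑ i, ∑ j, F i j x ^ 2)) j := by
      intro j
      by_cases hj2 : j ≤ 2
      · refine ⟨0, fun _ => ?_⟩
        simp [pressTerm, hj2]
      by_cases hjm : j ≤ m
      swap
      · exact ⟨0, fun h => absurd h hjm⟩
      obtain ⟨hpr, hF⟩ := h3 (by omega) (hmem 3 (by omega))
      obtain ⟨i, rfl⟩ : ∃ i, j = i + 3 := ⟨j - 3, by omega⟩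
      obtain ⟨c, hc⟩ := H x0 F p hF (hp.mono_set (hsubU 2)) hpr i
      refine ⟨c, fun _ => ?_⟩
      rw [pressTerm, if_neg hj2, show i + 3 - 2 = i + 1 by omega]
      have hm1 : AEMeasurable (fun x => ‖p x - c‖ₑ) (volume.restrict (ball3 x0 (rad θ (i + 3)))) :=
        ((hp.mono_set (hsubU _)).1.sub aestronglyMeasurable_const).enorm
      have hm2 : AEMeasurable (fun x => ‖v x‖ₑ) (volume.restrict (ball3 x0 (rad θ (i + 3)))) :=
        (hvi.mono_set (hsubU _)).1.enorm
      refine (ENNReal.lintegral_mul_le_Lp_mul_Lq _ Real.HolderConjugate.two_two hm1 hm2).trans ?_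
      exact mul_le_mul_left hc _
    choose c hc using hj
    exact ⟨c, hc⟩
  obtain ⟨c, hc⟩ := hc
  have hT := HT x0 θ hθ hθ2 m _ C hC.le hΦ (fun l hl x hx =>
    (HC x0 t0 θ hθ hθ2 k).2.2 t ht m hmk hm' l hl x hx) v p c U hU hv hvi hpv hp.1 hdiv
  refine hT.trans ?_
  refine (Finset.sum_le_sum (g := fun j => ENNReal.ofReal (K * C * (θ ^ 8)⁻¹ * (rad θ j ^ 4)⁻¹) *
        (tint t0 (rad θ j)).indicator (fun _ => pressTerm θ C1 C2 x0 (fun x => ‖p x‖ₑ)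
          (fun x => ‖v x‖ₑ) (fun i => ∫⁻ x in ball3 x0 (rad θ (i + 2)),
            ENNReal.ofReal (∑ i, ∑ j, F i j x ^ 2)) j) t) fun j hj => ?_).trans
    (Finset.sum_le_sum_of_subset (Finset.range_subset_range.2 (by omega)))
  have hjm : j ≤ m := by simpa [Nat.lt_succ_iff] using hj
  rw [indicator_of_mem (hmem j hjm)]
  exact mul_le_mul_right (hc j hjm) _

lemma measurable_pressSeq (θ C1 C2 : ℝ) {a : ℝ → ℝ≥0∞} {h : ℕ → ℝ → ℝ≥0∞} (ha : Measurable a)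
    (hh : ∀ i, Measurable (h i)) (i : ℕ) :
    Measurable fun t => pressSeq θ C1 C2 (a t) (fun i => h i t) i := by
  induction i with
  | zero => exact ha
  | succ i ih => exact (ih.const_mul _).add (((hh i).pow_const _).const_mul _)

lemma lintegral_pressSeq_rpow {θ C1 C2 : ℝ} (hθ : 0 < θ) (hθ1 : θ ≤ 1) (hC1 : 0 < C1) (hC2 : 0 < C2)
    (hsmall : 2 ^ (1 / 3 : ℝ) * (C1 * θ) ^ (4 / 3 : ℝ) ≤ θ / 2) {a : ℝ → ℝ≥0∞}
    {h : ℕ → ℝ → ℝ≥0∞} (ha : Measurable a) (hh : ∀ i, Measurable (h i)) {t0 M η : ℝ} (hM : 0 < M)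
    (hη : 0 < η) {n : ℕ}
    (h0 : ∫⁻ t in tint t0 (rad θ 2), a t ^ (4 / 3 : ℝ) ≤ ENNReal.ofReal (M * η))
    (hi : ∀ i < n, ∫⁻ t in tint t0 (rad θ (i + 2)), h i t ^ (2 / 3 : ℝ) ≤
      ENNReal.ofReal (M * rad θ (i + 2) ^ 4 * η)) :
    ∀ i ≤ n, ∫⁻ t in tint t0 (rad θ (i + 2)),
        pressSeq θ C1 C2 (a t) (fun i => h i t) i ^ (4 / 3 : ℝ) ≤
      ENNReal.ofReal ((M * (rad θ 2)⁻¹ + 2 * 2 ^ (1 / 3 : ℝ) * C2 ^ (4 / 3 : ℝ) * M * θ⁻¹) *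
        rad θ (i + 2) * η) := by
  set L := M * (rad θ 2)⁻¹ + 2 * 2 ^ (1 / 3 : ℝ) * C2 ^ (4 / 3 : ℝ) * M * θ⁻¹ with hL
  have hr2 := rad_pos hθ 2
  have hL0 : 0 < L := by positivity
  intro i
  induction i with
  | zero =>
    intro _
    refine h0.trans (ENNReal.ofReal_le_ofReal (mul_le_mul_of_nonneg_right ?_ hη.le))
    rw [hL, add_mul, mul_assoc, zero_add, inv_mul_cancel₀ hr2.ne', mul_one]
    exact le_add_of_nonneg_right (by positivity)
  | succ i ih =>
    intro hin
    have ih := ih (by omega)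
    have hi := hi i (by omega)
    set r := rad θ (i + 2) with hr
    have hr0 : 0 < r := rad_pos hθ _
    have hr1 : r ≤ 1 := by
      have := rad_anti hθ hθ1 (Nat.zero_le (i + 2))
      rw [rad_zero] at this
      linarith
    have hr' : rad θ (i + 1 + 2) = θ * r := rad_succ θ (i + 2)
    rw [hr']
    set A : ℝ → ℝ≥0∞ := fun t => pressSeq θ C1 C2 (a t) (fun i => h i t) i with hA
    have hAm : Measurable A := measurable_pressSeq θ C1 C2 ha hh i
    set c1 : ℝ := 2 ^ (1 / 3 : ℝ) * (C1 * θ) ^ (4 / 3 : ℝ) with hc1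
    set c2 : ℝ := 2 ^ (1 / 3 : ℝ) * (C2 ^ (4 / 3 : ℝ) * (r ^ 2)⁻¹) with hc2
    have hpt : ∀ t, pressSeq θ C1 C2 (a t) (fun i => h i t) (i + 1) ^ (4 / 3 : ℝ) ≤
        ENNReal.ofReal c1 * A t ^ (4 / 3 : ℝ) + ENNReal.ofReal c2 * h i t ^ (2 / 3 : ℝ) := by
      intro t
      refine (ENNReal.rpow_add_le_mul_rpow_add_rpow _ _ (by norm_num : (1 : ℝ) ≤ 4 / 3)).trans ?_
      rw [ENNReal.mul_rpow_of_nonneg _ _ (by norm_num), ENNReal.mul_rpow_of_nonneg _ _ (by norm_num),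
        ENNReal.ofReal_rpow_of_pos (by positivity), ENNReal.ofReal_rpow_of_pos (by positivity),
        ← ENNReal.rpow_mul, hc1, hc2, ENNReal.ofReal_mul (p := 2 ^ (1 / 3 : ℝ)) (by positivity),
        ENNReal.ofReal_mul (p := 2 ^ (1 / 3 : ℝ)) (by positivity)]
      have e2 : (2 : ℝ≥0∞) ^ (4 / 3 - 1 : ℝ) = ENNReal.ofReal (2 ^ (1 / 3 : ℝ)) := by
        rw [← ENNReal.ofReal_rpow_of_pos (by norm_num)]
        norm_num
      have e3 : (C2 * r ^ (-(3 / 2) : ℝ)) ^ (4 / 3 : ℝ) = C2 ^ (4 / 3 : ℝ) * (r ^ 2)⁻¹ := by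
        rw [Real.mul_rpow hC2.le (by positivity), ← Real.rpow_mul hr0.le, ← Real.rpow_natCast r 2,
          ← Real.rpow_neg hr0.le]
        norm_num
      rw [e2, e3, show (1 / 2 * (4 / 3) : ℝ) = 2 / 3 by norm_num, mul_add, mul_assoc, mul_assoc]
    calc _ ≤ ∫⁻ t in tint t0 r, (ENNReal.ofReal c1 * A t ^ (4 / 3 : ℝ) +
            ENNReal.ofReal c2 * h i t ^ (2 / 3 : ℝ)) :=
          (lintegral_mono fun t => hpt t).trans
            (lintegral_mono_set (tint_mono t0 (by positivity) (by nlinarith)))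
      _ = ENNReal.ofReal c1 * (∫⁻ t in tint t0 r, A t ^ (4 / 3 : ℝ)) +
            ENNReal.ofReal c2 * ∫⁻ t in tint t0 r, h i t ^ (2 / 3 : ℝ) := by
          rw [lintegral_add_left ((hAm.pow_const _).const_mul _),
            lintegral_const_mul _ (hAm.pow_const _), lintegral_const_mul _ ((hh i).pow_const _)]
      _ ≤ ENNReal.ofReal c1 * ENNReal.ofReal (L * r * η) +
            ENNReal.ofReal c2 * ENNReal.ofReal (M * r ^ 4 * η) := by gcongr
      _ = ENNReal.ofReal (c1 * (L * r * η) + c2 * (M * r ^ 4 * η)) := by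
          rw [← ENNReal.ofReal_mul (by positivity), ← ENNReal.ofReal_mul (by positivity),
            ← ENNReal.ofReal_add (by positivity) (by positivity)]
      _ ≤ _ := by
          refine ENNReal.ofReal_le_ofReal ?_
          have e1 : c1 * (L * r * η) ≤ θ / 2 * (L * r * η) :=
            mul_le_mul_of_nonneg_right hsmall (by positivity)
          have e2 : c2 * (M * r ^ 4 * η) =
              (2 ^ (1 / 3 : ℝ) * C2 ^ (4 / 3 : ℝ) * M) * r ^ 2 * η := by
            rw [hc2]; field_simp
          have e3 : 2 ^ (1 / 3 : ℝ) * C2 ^ (4 / 3 : ℝ) * M ≤ L * θ / 2 := by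
            rw [hL, add_mul, mul_assoc _ θ⁻¹, inv_mul_cancel₀ hθ.ne']
            have : 0 ≤ M * (rad θ 2)⁻¹ * θ := by positivity
            linarith
          have e4 : (2 ^ (1 / 3 : ℝ) * C2 ^ (4 / 3 : ℝ) * M) * r ^ 2 * η ≤ (L * θ / 2) * r * η := by
            have : r ^ 2 ≤ r := by nlinarith
            gcongr
          nlinarith

lemma lintegral_pressSeq {θ C1 C2 : ℝ} (hθ : 0 < θ) {a : ℝ → ℝ≥0∞}
    {h : ℕ → ℝ → ℝ≥0∞} (ha : Measurable a) (hh : ∀ i, Measurable (h i)) {t0 L δ : ℝ} (hL : 0 < L)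
    (hδ : 0 < δ) {i : ℕ} (hi : ∫⁻ t in tint t0 (rad θ (i + 2)),
        pressSeq θ C1 C2 (a t) (fun i => h i t) i ^ (4 / 3 : ℝ) ≤
      ENNReal.ofReal (L * rad θ (i + 2) * δ ^ (4 / 3 : ℝ))) :
    ∫⁻ t in tint t0 (rad θ (i + 2)), pressSeq θ C1 C2 (a t) (fun i => h i t) i ≤
      ENNReal.ofReal (L ^ (3 / 4 : ℝ) * rad θ (i + 2) ^ (5 / 4 : ℝ) * δ) := by
  have hr : 0 < rad θ (i + 2) := rad_pos hθ _
  have h1 := lintegral_rpow_le_rpow (volume.restrict (tint t0 (rad θ (i + 2))))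
    ((measurable_pressSeq θ C1 C2 ha hh i).pow_const (4 / 3 : ℝ)).aemeasurable
    (by norm_num : (0 : ℝ) ≤ 3 / 4) (by norm_num)
  simp only [← ENNReal.rpow_mul, show (4 / 3 * (3 / 4) : ℝ) = 1 by norm_num, ENNReal.rpow_one,
    Measure.restrict_apply_univ, volume_tint] at h1
  refine h1.trans ((mul_le_mul_left (ENNReal.rpow_le_rpow hi (by norm_num)) _).trans
    (le_of_eq ?_))
  rw [ENNReal.ofReal_rpow_of_pos (by positivity), ENNReal.ofReal_rpow_of_pos (by positivity),
    ← ENNReal.ofReal_mul (by positivity)]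
  congr 1
  rw [Real.mul_rpow (by positivity) (by positivity), Real.mul_rpow (by positivity) (by positivity),
    ← Real.rpow_mul hδ.le, ← Real.rpow_natCast (rad θ (i + 2)) 2, ← Real.rpow_mul hr.le,
    show (5 / 4 : ℝ) = 3 / 4 + ((2 : ℕ) : ℝ) * (1 - 3 / 4) by norm_num, Real.rpow_add hr,
    show (4 / 3 * (3 / 4) : ℝ) = 1 by norm_num, Real.rpow_one]
  ring

lemma SliceGrad.mono {U V : Set E3} (hU : MeasurableSet U) (h : V ⊆ U)
    {f : E3 → ℝ} {g : Fin 3 → E3 → ℝ} (hp : SliceGrad U f g) : SliceGrad V f g := by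
  intro j b hb
  have hz : ∀ x ∈ U \ V, pd j b x = 0 := fun x hx =>
    image_eq_zero_of_notMem_tsupport fun hx' => hx.2 ((hb.pd j).2.2 hx')
  have hz' : ∀ x ∈ U \ V, b x = 0 := fun x hx =>
    image_eq_zero_of_notMem_tsupport fun hx' => hx.2 (hb.2.2 hx')
  have := hp j b ⟨hb.1, hb.2.1, hb.2.2.trans h⟩
  rwa [setIntegral_eq_of_subset_of_forall_sdiff_eq_zero hU h (fun x hx => by simp [hz x hx]),
    setIntegral_eq_of_subset_of_forall_sdiff_eq_zero hU h (fun x hx => by simp [hz' x hx])] at this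

lemma integrable_of_sq_le {α : Type*} [MeasurableSpace α] {μ : Measure α} [IsFiniteMeasure μ]
    {f e : α → ℝ} (hf : Measurable f) (he : Integrable e μ) (h : ∀ z, f z ^ 2 ≤ e z) :
    Integrable f μ := by
  refine Integrable.mono' (he.add (integrable_const (1 : ℝ))) hf.aestronglyMeasurable
    (Eventually.of_forall fun z => ?_)
  simp only [Pi.add_apply, Real.norm_eq_abs]
  nlinarith [h z, sq_nonneg (|f z| - 1), sq_abs (f z), abs_nonneg (f z)]

lemma memLp_two_of_sq_le {α : Type*} [MeasurableSpace α] {μ : Measure α}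
    {f e : α → ℝ} (hf : Measurable f) (he : Integrable e μ) (h : ∀ z, f z ^ 2 ≤ e z) :
    MemLp f 2 μ := by
  rw [memLp_two_iff_integrable_sq hf.aestronglyMeasurable]
  exact Integrable.mono' he (hf.pow_const 2).aestronglyMeasurable
    (Eventually.of_forall fun z => by rw [Real.norm_of_nonneg (sq_nonneg _)]; exact h z)

lemma sq_le_nsq2 (M : Fin 3 → Fin 3 → ℝ) (i j : Fin 3) : M i j ^ 2 ≤ nsq2 M :=
  (Finset.single_le_sum (f := fun j => M i j ^ 2) (fun _ _ => sq_nonneg _)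
    (Finset.mem_univ j)).trans
    (Finset.single_le_sum (f := fun i => ∑ j, M i j ^ 2)
      (fun _ _ => Finset.sum_nonneg fun _ _ => sq_nonneg _) (Finset.mem_univ i))

lemma sq_le_nsq3 (A : Fin 3 → Fin 3 → Fin 3 → ℝ) (i j k : Fin 3) : A i j k ^ 2 ≤ nsq3 A :=
  (sq_le_nsq2 (A i) j k).trans
    (Finset.single_le_sum (f := fun i => nsq2 (A i)) (fun _ _ => nsq2_nonneg _)
      (Finset.mem_univ i))

lemma norm_sq_eq_sum (x : E3) : ‖x‖ ^ 2 = ∑ j, x j ^ 2 := by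
  rw [EuclideanSpace.norm_sq_eq]
  simp

lemma coord_sq_le (x : E3) (i : Fin 3) : x i ^ 2 ≤ ‖x‖ ^ 2 := by
  rw [norm_sq_eq_sum]
  exact Finset.single_le_sum (f := fun j => x j ^ 2) (fun _ _ => sq_nonneg _) (Finset.mem_univ i)

lemma exists_sliceSobolev : ∃ C : ℝ≥0, ∀ {xb : E3} {tb : ℝ}
    {u d : SpT → E3} {p : SpT → ℝ} {Du Dd : SpT → Fin 3 → Fin 3 → ℝ}
    {D2d : SpT → Fin 3 → Fin 3 → Fin 3 → ℝ} {q : ℝ},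
    QReg xb tb u d p Du Dd D2d → E3q xb tb u d p Dd q < ∞ →
    SliceSobolev (enDen u Dd) (disDen Du D2d) C (ball3 xb 1) (Ioo (tb - 1) tb) := by
  obtain ⟨C, hC⟩ := exists_sobolev_energy (Fin 3 ⊕ Fin 3 × Fin 3)
  refine ⟨C, fun {xb tb u d p Du Dd D2d q} hR hE => ?_⟩
  have := isFiniteMeasure_Qone xb tb
  have i1 := integrableOn_normSq hR.meas_u hE
  have i2 := hR.l2_Dd
  have i3 := hR.l2_Du
  have i4 := hR.l2_D2d
  have mu : ∀ i, Measurable fun z => u z i := fun i => by have := hR.meas_u; fun_prop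
  have mD : ∀ i k, Measurable fun z => Dd z i k := fun i k => by have := hR.meas_Dd; fun_prop
  have mDu : ∀ i k, Measurable fun z => Du z i k := fun i k => by have := hR.meas_Du; fun_prop
  have mD2 : ∀ i j k, Measurable fun z => D2d z i j k := fun i j k => by
    have := hR.meas_D2d; fun_prop
  have g1 := hR.grad_u
  have g2 := hR.grad_Dd
  rw [Qcyl_one] at i2 i3 i4
  have s1 : ∀ i, ∀ᵐ t ∂(volume.restrict (Ioo (tb - 1) tb)),
      SliceGrad (ball3 xb 1) (fun x => u (x, t) i) (fun j x => Du (x, t) i j) := fun i => by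
    refine ae_sliceGrad ?_ ?_ (g1 i)
    · rw [Qcyl_one]; exact integrable_of_sq_le (mu i) i1 fun z => coord_sq_le _ _
    · intro j; rw [Qcyl_one]; exact integrable_of_sq_le (mDu i j) i3 fun z => sq_le_nsq2 _ _ _
  have s2 : ∀ i k, ∀ᵐ t ∂(volume.restrict (Ioo (tb - 1) tb)),
      SliceGrad (ball3 xb 1) (fun x => Dd (x, t) i k) (fun j x => D2d (x, t) i j k) := fun i k => by
    refine ae_sliceGrad ?_ ?_ (g2 i k)
    · rw [Qcyl_one]; exact integrable_of_sq_le (mD i k) i2 fun z => sq_le_nsq2 _ _ _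
    · intro j; rw [Qcyl_one]; exact integrable_of_sq_le (mD2 i j k) i4 fun z => sq_le_nsq3 _ _ _ _
  rw [IntegrableOn, restrict_prod_eq] at i1 i2 i3 i4
  filter_upwards [i1.prod_left_ae, i2.prod_left_ae, i3.prod_left_ae, i4.prod_left_ae,
    ae_all_iff.2 s1, ae_all_iff.2 fun i => ae_all_iff.2 (s2 i)] with t h1 h2 h3 h4 h5 h6 x0 r hr hB
  have sl : ∀ {f : SpT → ℝ}, Measurable f → Measurable fun x => f (x, t) := fun hf =>
    hf.comp (measurable_id.prodMk measurable_const)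
  have hm : volume.restrict (ball3 x0 r) ≤ volume.restrict (ball3 xb 1) :=
    Measure.restrict_mono hB le_rfl
  have := hC x0 r hr
    (fun a x => a.elim (fun i => u (x, t) i) fun b => Dd (x, t) b.1 b.2)
    (fun a j x => a.elim (fun i => Du (x, t) i j) fun b => D2d (x, t) b.1 j b.2)
    (by
      rintro (i | ⟨i, k⟩)
      · exact (memLp_two_of_sq_le (sl (mu i)) h1 fun x => coord_sq_le _ _).mono_measure hm
      · exact (memLp_two_of_sq_le (sl (mD i k)) h2 fun x => sq_le_nsq2 _ _ _).mono_measure hm)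
    (by
      rintro (i | ⟨i, k⟩) j
      · exact (memLp_two_of_sq_le (sl (mDu i j)) h3 fun x => sq_le_nsq2 _ _ _).mono_measure hm
      · exact (memLp_two_of_sq_le (sl (mD2 i j k)) h4 fun x => sq_le_nsq3 _ _ _ _).mono_measure hm)
    (by
      rintro (i | ⟨i, k⟩)
      · exact (h5 i).mono (measurableSet_ball3 _ _) hB
      · exact (h6 i k).mono (measurableSet_ball3 _ _) hB)
  have e1 : ∀ x, enDen u Dd (x, t) = ENNReal.ofReal (∑ a : Fin 3 ⊕ Fin 3 × Fin 3,
      (a.elim (fun i => u (x, t) i) fun b => Dd (x, t) b.1 b.2) ^ 2) := fun x => by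
    rw [enDen, norm_sq_eq_sum, nsq2, Fintype.sum_sum_type, Fintype.sum_prod_type]
    simp
  have e2 : ∀ x, disDen Du D2d (x, t) = ENNReal.ofReal (∑ a : Fin 3 ⊕ Fin 3 × Fin 3,
      ∑ j, (a.elim (fun i => Du (x, t) i j) fun b => D2d (x, t) b.1 j b.2) ^ 2) := fun x => by
    rw [disDen, nsq2, nsq3, Fintype.sum_sum_type, Fintype.sum_prod_type]
    simp only [Sum.elim_inl, Sum.elim_inr]
    congr 2
    exact Finset.sum_congr rfl fun i _ => Finset.sum_comm
  simp only [e1, e2]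
  exact this

/-- The integrand of `E3q`. -/
def e3Re (u d : SpT → E3) (p : SpT → ℝ) (Dd : SpT → Fin 3 → Fin 3 → ℝ) (q : ℝ) (z : SpT) : ℝ :=
  ‖u z‖ ^ 3 + Real.sqrt (nsq2 (Dd z)) ^ 3 +
    |p z| ^ ((3 : ℝ) / 2) + ‖d z‖ ^ q * Real.sqrt (nsq2 (Dd z)) ^ (3 * (1 - q / 6))

/-- The extended nonnegative integrand of `E3q`. -/
def e3Den (u d : SpT → E3) (p : SpT → ℝ) (Dd : SpT → Fin 3 → Fin 3 → ℝ) (q : ℝ) (z : SpT) :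
    ℝ≥0∞ := ENNReal.ofReal (e3Re u d p Dd q z)

lemma measurable_e3Re {u d : SpT → E3} {p : SpT → ℝ} {Dd : SpT → Fin 3 → Fin 3 → ℝ} (q : ℝ)
    (hu : Measurable u) (hd : Measurable d) (hp : Measurable p) (hD : Measurable Dd) :
    Measurable (e3Re u d p Dd q) := by
  have := measurable_nsq2.comp hD
  unfold e3Re
  exact (((hu.norm.pow_const 3).add (this.sqrt.pow_const 3)).add (hp.abs.pow_const _)).add
    ((hd.norm.pow_const _).mul (this.sqrt.pow_const _))

lemma E3q_eq (xb : E3) (tb : ℝ) (u d : SpT → E3) (p : SpT → ℝ) (Dd : SpT → Fin 3 → Fin 3 → ℝ)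
    (q : ℝ) : E3q xb tb u d p Dd q = ∫⁻ z in ball3 xb 1 ×ˢ Ioo (tb - 1) tb, e3Den u d p Dd q z := by
  rw [E3q, Qcyl_one]; rfl

lemma le_e3Re (u d : SpT → E3) (p : SpT → ℝ) (Dd : SpT → Fin 3 → Fin 3 → ℝ) (q : ℝ) (z : SpT) :
    ‖u z‖ ^ 3 + |p z| ^ ((3 : ℝ) / 2) ≤ e3Re u d p Dd q z ∧
    ‖u z‖ ^ 3 + Real.sqrt (nsq2 (Dd z)) ^ 3 ≤ e3Re u d p Dd q z ∧
    ‖d z‖ ^ q * Real.sqrt (nsq2 (Dd z)) ^ (3 * (1 - q / 6)) ≤ e3Re u d p Dd q z := by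
  have h0 : 0 ≤ ‖u z‖ ^ 3 := by positivity
  have h1 := Real.rpow_nonneg (abs_nonneg (p z)) (3 / 2)
  have h2 : 0 ≤ ‖d z‖ ^ q * Real.sqrt (nsq2 (Dd z)) ^ (3 * (1 - q / 6)) := by positivity
  have h4 : 0 ≤ Real.sqrt (nsq2 (Dd z)) ^ 3 := by positivity
  unfold e3Re
  refine ⟨?_, ?_, ?_⟩ <;> linarith

lemma mul_le_rpow_add_pow {a b : ℝ} (ha : 0 ≤ a) (hb : 0 ≤ b) :
    a * b ≤ a ^ (3 / 2 : ℝ) + b ^ 3 := by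
  have h1 := Real.rpow_nonneg ha (3 / 2)
  rcases le_total (b ^ 2) a with h | h
  · have : b ≤ a ^ (1 / 2 : ℝ) := by
      rw [← Real.sqrt_eq_rpow]
      exact Real.le_sqrt_of_sq_le h
    have h2 : a * b ≤ a * a ^ (1 / 2 : ℝ) := mul_le_mul_of_nonneg_left this ha
    have h3 : a * a ^ (1 / 2 : ℝ) = a ^ (3 / 2 : ℝ) := by
      rcases ha.eq_or_lt with rfl | ha
      · norm_num
      · rw [show (3 / 2 : ℝ) = 1 + 1 / 2 by norm_num, Real.rpow_add ha, Real.rpow_one]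
    have : 0 ≤ b ^ 3 := by positivity
    linarith
  · nlinarith [mul_le_mul_of_nonneg_right h hb]

lemma integrableOn_of_le_e3Re {xb : E3} {tb : ℝ} {u d : SpT → E3} {p : SpT → ℝ}
    {Dd : SpT → Fin 3 → Fin 3 → ℝ} {q : ℝ} (hu : Measurable u) (hd : Measurable d)
    (hp : Measurable p) (hD : Measurable Dd) (hE : E3q xb tb u d p Dd q < ∞) {f : SpT → ℝ}
    (hf : Measurable f) (h : ∀ z, |f z| ≤ 1 + e3Re u d p Dd q z) :
    IntegrableOn f (ball3 xb 1 ×ˢ Ioo (tb - 1) tb) := by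
  have := isFiniteMeasure_Qone xb tb
  have h3 : IntegrableOn (e3Re u d p Dd q) (ball3 xb 1 ×ˢ Ioo (tb - 1) tb) := by
    refine ⟨(measurable_e3Re q hu hd hp hD).aestronglyMeasurable, ?_⟩
    rw [hasFiniteIntegral_iff_ofReal (Eventually.of_forall fun z =>
      le_trans (by positivity) (le_e3Re u d p Dd q z).1)]
    rwa [E3q_eq] at hE
  exact Integrable.mono' ((integrable_const (1 : ℝ)).add h3) hf.aestronglyMeasurable
    (Eventually.of_forall h)

lemma abs_stress_le (v : E3) (M : Fin 3 → Fin 3 → ℝ) (i j : Fin 3) :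
    |v i * v j + ∑ k, M k i * M k j| ≤ ‖v‖ ^ 2 + nsq2 M := by
  have e : ‖v‖ ^ 2 + nsq2 M = (v 0 ^ 2 + v 1 ^ 2 + v 2 ^ 2) +
      ∑ k, (M k 0 ^ 2 + M k 1 ^ 2 + M k 2 ^ 2) := by
    rw [norm_sq_eq_sum, nsq2]
    simp only [Fin.sum_univ_three]
  have key : ∀ w : Fin 3 → ℝ, |w i * w j| ≤ w 0 ^ 2 + w 1 ^ 2 + w 2 ^ 2 := by
    intro w
    have hs : ∀ l, w l ^ 2 ≤ w 0 ^ 2 + w 1 ^ 2 + w 2 ^ 2 := by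
      intro l
      fin_cases l <;> simp <;> nlinarith [sq_nonneg (w 0), sq_nonneg (w 1), sq_nonneg (w 2)]
    rw [abs_mul]
    nlinarith [hs i, hs j, sq_nonneg (|w i| - |w j|), sq_abs (w i), sq_abs (w j)]
  rw [e]
  refine (abs_add_le _ _).trans (add_le_add (key fun l => v l) ?_)
  exact (Finset.abs_sum_le_sum_abs _ _).trans (Finset.sum_le_sum fun k _ => key (M k))

lemma pressSeq_mono {θ C1 C2 : ℝ} {a : ℝ≥0∞} {h h' : ℕ → ℝ≥0∞} (hh : ∀ i, h i ≤ h' i) (i : ℕ) :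
    pressSeq θ C1 C2 a h i ≤ pressSeq θ C1 C2 a h' i := by
  induction i with
  | zero => exact le_rfl
  | succ i ih =>
    exact add_le_add (mul_le_mul_right ih _)
      (mul_le_mul_right (ENNReal.rpow_le_rpow (hh i) (by norm_num)) _)

/-- Measurable majorant for the scaled pressure oscillation. -/
def oscBd (θ C1 C2 : ℝ) (x0 : E3) (P E : SpT → ℝ≥0∞) (i : ℕ) (t : ℝ) : ℝ≥0∞ :=
  pressSeq θ C1 C2 (ENNReal.ofReal ((rad θ 2 ^ 3)⁻¹) * ∫⁻ x in ball3 x0 (rad θ 2), P (x, t))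
    (fun i => 9 * ∫⁻ x in ball3 x0 (rad θ (i + 2)), E (x, t) ^ (2 : ℝ)) i

/-- Measurable majorant for the pressure term at level `j`. -/
def pressBd (θ C1 C2 : ℝ) (x0 : E3) (N P E : SpT → ℝ≥0∞) (j : ℕ) (t : ℝ) : ℝ≥0∞ :=
  if j ≤ 2 then ∫⁻ x in ball3 x0 (rad θ j), N (x, t) else
    ENNReal.ofReal (rad θ j ^ (3 / 2 : ℝ)) * oscBd θ C1 C2 x0 P E (j - 2) t *
      (∫⁻ x in ball3 x0 (rad θ j), E (x, t)) ^ (1 / 2 : ℝ)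

lemma exists_pressure_time : ∃ C1 : ℝ, 0 < C1 ∧ ∀ θ : ℝ, 0 < θ → θ ≤ 1 / 2 →
    ∃ C2 : ℝ, 0 < C2 ∧ ∃ K : ℝ, 0 < K ∧ ∀ {xb : E3} {tb : ℝ}
    {u d : SpT → E3} {p : SpT → ℝ} {Du Dd : SpT → Fin 3 → Fin 3 → ℝ}
    {D2d : SpT → Fin 3 → Fin 3 → Fin 3 → ℝ} {q : ℝ},
    QReg xb tb u d p Du Dd D2d → DivFreeOn (Qcyl (xb, tb) 1) u →
    PressureEqOn (Qcyl (xb, tb) 1) u p Dd → E3q xb tb u d p Dd q < ∞ →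
    ∀ᵐ t ∂(volume.restrict (Ioo (tb - 1) tb)), ∀ (x0 : E3) (t0 : ℝ) (k : ℕ), t < t0 →
      ball3 x0 (1 / 2) ⊆ ball3 xb 1 →
      (3 ≤ k → t ∈ tint t0 (rad θ 3) →
        ∫⁻ x in ball3 x0 (rad θ 2), enDen u Dd (x, t) ^ (2 : ℝ) < ∞) →
      ‖∫ x in ball3 xb 1, p (x, t) *
          ∑ j, u (x, t) j * sderiv j (testFn x0 t0 (rad θ (k + 1))) (x, t)‖ₑ ≤
        ∑ j ∈ Finset.range (k + 1), ENNReal.ofReal (K * (rad θ j ^ 4)⁻¹) *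
          (tint t0 (rad θ j)).indicator (pressBd θ C1 C2 x0 (e3Den u d p Dd q) (fun z => ‖p z‖ₑ)
            (enDen u Dd) j) t := by
  obtain ⟨C1, hC1, H⟩ := exists_pressure_slice
  refine ⟨C1, hC1, fun θ hθ hθ2 => ?_⟩
  obtain ⟨C2, hC2, K, hK, H⟩ := H θ hθ hθ2
  refine ⟨C2, hC2, K, hK, fun {xb tb u d p Du Dd D2d q} hR hdiv hpr hE => ?_⟩
  have := isFiniteMeasure_Qone xb tb
  have hu := hR.meas_u
  have hp := hR.meas_p
  have hD := hR.meas_Dd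
  have mu : ∀ i, Measurable fun z => u z i := fun i => by fun_prop
  have mF : ∀ i j, Measurable fun z => u z i * u z j + ∑ k, Dd z k i * Dd z k j := fun i j => by
    fun_prop
  have i1 := integrableOn_normSq hR.meas_u hE
  have i2 := hR.l2_Dd
  rw [Qcyl_one] at i2
  have iF : ∀ i j, IntegrableOn (fun z => u z i * u z j + ∑ k, Dd z k i * Dd z k j)
      (ball3 xb 1 ×ˢ Ioo (tb - 1) tb) := fun i j =>
    Integrable.mono' (i1.add i2) (mF i j).aestronglyMeasurable
      (Eventually.of_forall fun z => abs_stress_le _ _ _ _)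
  have ip : IntegrableOn p (ball3 xb 1 ×ˢ Ioo (tb - 1) tb) := by
    refine integrableOn_of_le_e3Re hu hR.meas_d hp hD hE hp fun z => ?_
    have h1 := mul_le_rpow_add_pow (abs_nonneg (p z)) (zero_le_one' ℝ)
    have h2 := (le_e3Re u d p Dd q z).1
    have : 0 ≤ ‖u z‖ ^ 3 := by positivity
    linarith
  have ipu : IntegrableOn (fun z => p z * ‖u z‖) (ball3 xb 1 ×ˢ Ioo (tb - 1) tb) := by
    refine integrableOn_of_le_e3Re hu hR.meas_d hp hD hE (hp.mul hu.norm) fun z => ?_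
    have h1 := mul_le_rpow_add_pow (abs_nonneg (p z)) (norm_nonneg (u z))
    have h2 := (le_e3Re u d p Dd q z).1
    rw [abs_mul, abs_norm]
    linarith
  have iu : IntegrableOn u (ball3 xb 1 ×ˢ Ioo (tb - 1) tb) := by
    have : IntegrableOn (fun z => ‖u z‖) (ball3 xb 1 ×ˢ Ioo (tb - 1) tb) :=
      integrable_of_sq_le hu.norm i1 fun z => le_rfl
    exact (integrable_norm_iff hu.aestronglyMeasurable).1 this
  have s1 := ae_sliceDiv (xb := xb) (tb := tb) (u := u) (fun j => by
    rw [Qcyl_one]; exact integrable_of_sq_le (mu j) i1 fun z => coord_sq_le _ _) hdiv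
  have s2 := ae_slicePress (xb := xb) (tb := tb) (by rwa [Qcyl_one]) (fun i j => by
    rw [Qcyl_one]; exact iF i j) hpr
  rw [IntegrableOn, restrict_prod_eq] at ip ipu iu
  filter_upwards [s1, s2, ip.prod_left_ae, ipu.prod_left_ae, iu.prod_left_ae] with t h1 h2 h3 h4 h5
    x0 t0 k ht hB hfin
  have sl : ∀ {f : SpT → ℝ}, Measurable f → Measurable fun x => f (x, t) := fun hf =>
    hf.comp (measurable_id.prodMk measurable_const)
  have hBj : ∀ j, ball3 x0 (rad θ j) ⊆ ball3 xb 1 := fun j => by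
    refine (Metric.ball_subset_ball ?_).trans hB
    have := rad_anti hθ (by linarith) (Nat.zero_le j)
    rwa [rad_zero] at this
  have hFE : ∀ x, ENNReal.ofReal (∑ i, ∑ j,
      (u (x, t) i * u (x, t) j + ∑ k, Dd (x, t) k i * Dd (x, t) k j) ^ 2) ≤
      9 * enDen u Dd (x, t) ^ (2 : ℝ) := by
    intro x
    have hn := nsq2_nonneg (Dd (x, t))
    rw [enDen, ENNReal.ofReal_rpow_of_nonneg (by positivity) (by norm_num),
      show (9 : ℝ≥0∞) = ENNReal.ofReal 9 by simp, ← ENNReal.ofReal_mul (by norm_num)]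
    refine ENNReal.ofReal_le_ofReal ?_
    have hk := fun i j => sq_le_sq' (neg_le_of_abs_le (abs_stress_le (u (x, t)) (Dd (x, t)) i j))
      (le_of_abs_le (abs_stress_le (u (x, t)) (Dd (x, t)) i j))
    refine (Finset.sum_le_sum fun i _ => Finset.sum_le_sum fun j _ => hk i j).trans ?_
    simp
    linarith
  have := H x0 t0 t k (fun i j x => u (x, t) i * u (x, t) j + ∑ k, Dd (x, t) k i * Dd (x, t) k j)
    (fun x => p (x, t)) (fun x => u (x, t)) (ball3 xb 1) ht hB h5.1 h5 h4 h3 h1 (fun hk htk => by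
      refine ⟨h2.mono (measurableSet_ball3 _ _) (hBj 2), fun i j => ?_⟩
      have hf := hfin hk htk
      rw [memLp_two_iff_integrable_sq (sl (mF i j)).aestronglyMeasurable]
      refine ⟨((sl (mF i j)).pow_const 2).aestronglyMeasurable, ?_⟩
      rw [hasFiniteIntegral_iff_ofReal (Eventually.of_forall fun _ => sq_nonneg _)]
      have hm : Measurable fun x => enDen u Dd (x, t) ^ (2 : ℝ) :=
        ((measurable_enDen hu hD).comp (measurable_id.prodMk measurable_const)).pow_const _
      refine lt_of_le_of_lt (b := ∫⁻ x in ball3 x0 (rad θ 2), 9 * enDen u Dd (x, t) ^ (2 : ℝ))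
        (lintegral_mono fun x => (ENNReal.ofReal_le_ofReal (sq_le_nsq2 (fun i j =>
          u (x, t) i * u (x, t) j + ∑ k, Dd (x, t) k i * Dd (x, t) k j) i j)).trans (hFE x)) ?_
      rw [lintegral_const_mul _ hm]
      exact ENNReal.mul_lt_top (by simp) hf)
  refine this.trans (Finset.sum_le_sum fun j _ => mul_le_mul_right ?_ _)
  by_cases hj : t ∈ tint t0 (rad θ j)
  swap
  · simp [hj]
  rw [indicator_of_mem hj, indicator_of_mem hj, pressTerm, pressBd]
  split_ifs with hj2
  · refine lintegral_mono fun x => ?_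
    rw [← ofReal_norm, ← ofReal_norm, ← ENNReal.ofReal_mul (norm_nonneg _), e3Den]
    refine ENNReal.ofReal_le_ofReal ?_
    have h1 := mul_le_rpow_add_pow (abs_nonneg (p (x, t))) (norm_nonneg (u (x, t)))
    have h2 := (le_e3Re u d p Dd q (x, t)).1
    rw [Real.norm_eq_abs]
    linarith
  · refine mul_le_mul' (mul_le_mul_right (pressSeq_mono (fun i => ?_) _) _)
      (ENNReal.rpow_le_rpow (lintegral_mono fun x => ?_) (by norm_num))
    · have hm : Measurable fun x => enDen u Dd (x, t) ^ (2 : ℝ) :=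
        ((measurable_enDen hu hD).comp (measurable_id.prodMk measurable_const)).pow_const _
      rw [← lintegral_const_mul _ hm]
      exact lintegral_mono hFE
    · rw [enDen, ← ofReal_norm, ENNReal.ofReal_rpow_of_nonneg (norm_nonneg _) (by norm_num)]
      refine ENNReal.ofReal_le_ofReal ?_
      have hn := nsq2_nonneg (Dd (x, t))
      rw [Real.rpow_two]
      linarith

lemma measurable_slice_lintegral (B : Set E3) {f : SpT → ℝ≥0∞} (hf : Measurable f) :
    Measurable fun t => ∫⁻ x in B, f (x, t) :=
  hf.lintegral_prod_left' (μ := volume.restrict _)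

lemma measurable_oscBd (θ C1 C2 : ℝ) (x0 : E3) {P E : SpT → ℝ≥0∞} (hP : Measurable P)
    (hE : Measurable E) (i : ℕ) : Measurable (oscBd θ C1 C2 x0 P E i) :=
  measurable_pressSeq θ C1 C2 ((measurable_slice_lintegral _ hP).const_mul _)
    (h := fun i t => 9 * ∫⁻ x in ball3 x0 (rad θ (i + 2)), E (x, t) ^ (2 : ℝ))
    (fun _ => (measurable_slice_lintegral _ (hE.pow_const (2 : ℝ))).const_mul _) i

lemma measurable_pressBd (θ C1 C2 : ℝ) (x0 : E3) {N P E : SpT → ℝ≥0∞} (hN : Measurable N)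
    (hP : Measurable P) (hE : Measurable E) (j : ℕ) : Measurable (pressBd θ C1 C2 x0 N P E j) := by
  unfold pressBd
  split_ifs
  · exact measurable_slice_lintegral _ hN
  · exact ((measurable_oscBd θ C1 C2 x0 hP hE _).const_mul _).mul
      ((measurable_slice_lintegral _ hE).pow_const _)

lemma rad_le_half {θ : ℝ} (hθ : 0 < θ) (hθ2 : θ ≤ 1 / 2) (j : ℕ) : rad θ j ≤ 1 / 2 := by
  have := rad_anti hθ (by linarith) (Nat.zero_le j)
  rwa [rad_zero] at this

lemma lintegral_pressure_start {θ : ℝ} (hθ : 0 < θ) (hθ2 : θ ≤ 1 / 2) {x0 : E3} {t0 δ : ℝ}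
    (hδ : 0 < δ) (hδ1 : δ ≤ 1) {N P : SpT → ℝ≥0∞} (hP : Measurable P)
    (hPN : ∀ z, P z ^ (3 / 2 : ℝ) ≤ N z)
    (hNδ : ∫⁻ t in tint t0 (rad θ 0), ∫⁻ x in ball3 x0 (rad θ 0), N (x, t) ≤
      ENNReal.ofReal (δ ^ 2)) :
    ∫⁻ t in tint t0 (rad θ 2), (ENNReal.ofReal ((rad θ 2 ^ 3)⁻¹) *
        ∫⁻ x in ball3 x0 (rad θ 2), P (x, t)) ^ (4 / 3 : ℝ) ≤
      ENNReal.ofReal ((rad θ 2 ^ 4)⁻¹ * δ ^ (4 / 3 : ℝ)) := by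
  have hr := rad_pos hθ 2
  have hr2 : rad θ 2 ≤ 1 / 8 := by
    rw [rad]; nlinarith
  have hvol : volume (ball3 x0 (rad θ 2)) ≤ 1 := by
    refine (volume_ball3_le x0 hr.le).trans ?_
    rw [← ENNReal.ofReal_one]
    refine ENNReal.ofReal_le_ofReal ?_
    have : rad θ 2 ^ 3 ≤ (1 / 8) ^ 3 := by gcongr
    linarith
  have hvt : volume (tint t0 (rad θ 2)) ≤ 1 := by
    rw [volume_tint, ← ENNReal.ofReal_one]
    exact ENNReal.ofReal_le_ofReal (by nlinarith)
  have hPm : ∀ t, Measurable fun x => P (x, t) := fun t =>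
    hP.comp (measurable_id.prodMk measurable_const)
  have hP32 : Measurable fun z => P z ^ (3 / 2 : ℝ) := hP.pow_const _
  have h1 : ∀ t, (∫⁻ x in ball3 x0 (rad θ 2), P (x, t)) ^ (4 / 3 : ℝ) ≤
      (∫⁻ x in ball3 x0 (rad θ 2), P (x, t) ^ (3 / 2 : ℝ)) ^ (8 / 9 : ℝ) := by
    intro t
    have := lintegral_rpow_le_rpow (volume.restrict (ball3 x0 (rad θ 2)))
      ((hPm t).pow_const (3 / 2 : ℝ)).aemeasurable (a := 2 / 3) (by norm_num) (by norm_num)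
    simp only [← ENNReal.rpow_mul, show (3 / 2 * (2 / 3) : ℝ) = 1 by norm_num, ENNReal.rpow_one,
      Measure.restrict_apply_univ] at this
    have h2 := this.trans (mul_le_mul_right (ENNReal.rpow_le_one hvol (by norm_num)) _)
    rw [mul_one] at h2
    refine (ENNReal.rpow_le_rpow h2 (by norm_num : (0 : ℝ) ≤ 4 / 3)).trans (le_of_eq ?_)
    rw [← ENNReal.rpow_mul]; norm_num
  have h2 := lintegral_rpow_le_rpow (volume.restrict (tint t0 (rad θ 2)))
    (measurable_slice_lintegral (ball3 x0 (rad θ 2)) hP32).aemeasurable (a := 8 / 9)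
    (by norm_num) (by norm_num)
  rw [Measure.restrict_apply_univ] at h2
  have h3 := h2.trans (mul_le_mul_right (ENNReal.rpow_le_one hvt (by norm_num)) _)
  rw [mul_one] at h3
  have h4 : ∫⁻ t in tint t0 (rad θ 2), ∫⁻ x in ball3 x0 (rad θ 2), P (x, t) ^ (3 / 2 : ℝ) ≤
      ENNReal.ofReal (δ ^ 2) := by
    have ha := rad_anti hθ (by linarith) (Nat.zero_le 2)
    refine le_trans ?_ hNδ
    refine (lintegral_mono_set (tint_mono t0 hr.le ha)).trans (lintegral_mono fun t => ?_)
    exact (lintegral_mono_set (Metric.ball_subset_ball ha)).trans (lintegral_mono fun x => hPN _)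
  calc _ = ∫⁻ t in tint t0 (rad θ 2), ENNReal.ofReal ((rad θ 2 ^ 4)⁻¹) *
        (∫⁻ x in ball3 x0 (rad θ 2), P (x, t)) ^ (4 / 3 : ℝ) := by
        refine lintegral_congr fun t => ?_
        rw [ENNReal.mul_rpow_of_nonneg _ _ (by norm_num), ENNReal.ofReal_rpow_of_pos (by positivity)]
        congr 2
        rw [← inv_pow, ← inv_pow, ← Real.rpow_natCast, ← Real.rpow_mul (by positivity),
          ← Real.rpow_natCast]
        norm_num
    _ ≤ ENNReal.ofReal ((rad θ 2 ^ 4)⁻¹) * ENNReal.ofReal (δ ^ 2) ^ (8 / 9 : ℝ) := by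
        rw [lintegral_const_mul' _ _ ENNReal.ofReal_ne_top]
        exact mul_le_mul_right ((lintegral_mono h1).trans (h3.trans
          (ENNReal.rpow_le_rpow h4 (by norm_num)))) _
    _ ≤ _ := by
        rw [ENNReal.ofReal_rpow_of_pos (by positivity), ← ENNReal.ofReal_mul (by positivity)]
        refine ENNReal.ofReal_le_ofReal (mul_le_mul_of_nonneg_left ?_ (by positivity))
        rw [← Real.rpow_natCast, ← Real.rpow_mul hδ.le]
        exact Real.rpow_le_rpow_of_exponent_ge hδ hδ1 (by norm_num)

lemma exists_lintegral_pressBd_le {θ C1 C2 K : ℝ} (hθ : 0 < θ) (hθ2 : θ ≤ 1 / 2) (hC1 : 0 < C1)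
    (hC2 : 0 < C2) (hK : 0 < K) (hsmall : 2 ^ (1 / 3 : ℝ) * (C1 * θ) ^ (4 / 3 : ℝ) ≤ θ / 2)
    (CS : ℝ≥0) : ∃ A : ℝ, 0 < A ∧ ∀ {x0 : E3} {t0 δ : ℝ} {E G N P : SpT → ℝ≥0∞} {B : Set E3}
    {J : Set ℝ} {k : ℕ}, 0 < δ → δ ≤ 1 → Measurable E → Measurable G → Measurable P →
    (∀ z, P z ^ (3 / 2 : ℝ) ≤ N z) →
    ∫⁻ t in tint t0 (rad θ 0), ∫⁻ x in ball3 x0 (rad θ 0), N (x, t) ≤ ENNReal.ofReal (δ ^ 2) →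
    SliceSobolev E G CS B J → ball3 x0 (1 / 2) ⊆ B → tint t0 (1 / 2) ⊆ J →
    (∀ j, 1 ≤ j → j ≤ k → GoodCyl E G x0 t0 (rad θ j) δ) → ∀ j ≤ k,
    ENNReal.ofReal (K * (rad θ j ^ 4)⁻¹) *
        ∫⁻ t in tint t0 (rad θ j), pressBd θ C1 C2 x0 N P E j t ≤
      ENNReal.ofReal (A * rad θ j ^ (1 / 4 : ℝ) * δ ^ (4 / 3 : ℝ)) := by
  have hr := fun j => rad_pos hθ j
  have hr2 := hr 2
  set M : ℝ := (rad θ 2 ^ 4)⁻¹ + 18 * CS * (θ ^ 4)⁻¹ with hM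
  have hM0 : 0 < M := by positivity
  set L := M * (rad θ 2)⁻¹ + 2 * 2 ^ (1 / 3 : ℝ) * C2 ^ (4 / 3 : ℝ) * M * θ⁻¹ with hL
  have hL0 : 0 < L := by positivity
  refine ⟨K * (rad θ 2 ^ 4)⁻¹ * (rad θ 2 ^ (1 / 4 : ℝ))⁻¹ + K * L ^ (3 / 4 : ℝ), by positivity,
    fun {x0 t0 δ E G N P B J k} hδ hδ1 hE hG hP hPN hNδ hS hB hJ hgood j hj => ?_⟩
  by_cases hj2 : j ≤ 2
  · have ha := rad_anti hθ (by linarith : θ ≤ 1) (Nat.zero_le j)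
    have hb := rad_anti hθ (by linarith : θ ≤ 1) hj2
    have h1 : ∫⁻ t in tint t0 (rad θ j), pressBd θ C1 C2 x0 N P E j t ≤ ENNReal.ofReal (δ ^ 2) := by
      refine le_trans ?_ hNδ
      simp only [pressBd, if_pos hj2]
      refine (lintegral_mono_set (tint_mono t0 (hr j).le ha)).trans (lintegral_mono fun t => ?_)
      exact lintegral_mono_set (Metric.ball_subset_ball ha)
    refine (mul_le_mul_right h1 _).trans ?_
    have := hr j
    rw [← ENNReal.ofReal_mul (by positivity)]
    refine ENNReal.ofReal_le_ofReal ?_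
    have e1 : δ ^ 2 ≤ δ ^ (4 / 3 : ℝ) := by
      rw [← Real.rpow_natCast]
      exact Real.rpow_le_rpow_of_exponent_ge hδ hδ1 (by norm_num)
    have e2 : (rad θ j ^ 4)⁻¹ ≤ (rad θ 2 ^ 4)⁻¹ := by gcongr
    have e3 : 1 ≤ (rad θ 2 ^ (1 / 4 : ℝ))⁻¹ * rad θ j ^ (1 / 4 : ℝ) := by
      rw [inv_mul_eq_div, one_le_div (by positivity)]
      gcongr
    calc K * (rad θ j ^ 4)⁻¹ * δ ^ 2 ≤ K * (rad θ 2 ^ 4)⁻¹ * 1 * δ ^ (4 / 3 : ℝ) := by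
          rw [mul_one]; gcongr
      _ ≤ K * (rad θ 2 ^ 4)⁻¹ * ((rad θ 2 ^ (1 / 4 : ℝ))⁻¹ * rad θ j ^ (1 / 4 : ℝ)) *
          δ ^ (4 / 3 : ℝ) := by gcongr
      _ ≤ _ := by
          have : 0 ≤ K * L ^ (3 / 4 : ℝ) * rad θ j ^ (1 / 4 : ℝ) * δ ^ (4 / 3 : ℝ) := by positivity
          linarith
  · obtain ⟨i, rfl⟩ : ∃ i, j = i + 2 := ⟨j - 2, by omega⟩
    have hsub : ∀ j, ball3 x0 (rad θ j) ⊆ B := fun j =>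
      (Metric.ball_subset_ball (rad_le_half hθ hθ2 j)).trans hB
    have hsubJ : ∀ j, tint t0 (rad θ j) ⊆ J := fun j =>
      (tint_mono t0 (hr j).le (rad_le_half hθ hθ2 j)).trans hJ
    have hh : ∀ l < i, ∫⁻ t in tint t0 (rad θ (l + 2)),
        (9 * ∫⁻ x in ball3 x0 (rad θ (l + 2)), E (x, t) ^ (2 : ℝ)) ^ (2 / 3 : ℝ) ≤
        ENNReal.ofReal (M * rad θ (l + 2) ^ 4 * δ ^ (4 / 3 : ℝ)) := by
      intro l hl
      have h1 := ((hgood (l + 1) (by omega) (by omega)).higher hE hG hS (hr _) hδ (hr (l + 2))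
        (by rw [rad_succ θ (l + 1)]; nlinarith [hr (l + 1)]) (hsub _) (hsubJ _)).2.1
      have h9 : (9 : ℝ≥0∞) ^ (2 / 3 : ℝ) ≤ 9 := by
        conv_rhs => rw [← ENNReal.rpow_one 9]
        exact ENNReal.rpow_le_rpow_of_exponent_le (by norm_num) (by norm_num)
      simp only [ENNReal.mul_rpow_of_nonneg _ _ (by norm_num : (0 : ℝ) ≤ 2 / 3)]
      rw [lintegral_const_mul' _ _ (ne_top_of_le_ne_top (by simp) h9)]
      refine (mul_le_mul' h9 h1).trans ?_
      have e9 : (9 : ℝ≥0∞) * (CS * 2) = ENNReal.ofReal (9 * (CS * 2)) := by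
        rw [ENNReal.ofReal_mul (by norm_num), ENNReal.ofReal_mul (by positivity)]
        simp
      rw [← mul_assoc, e9, ← ENNReal.ofReal_mul (by positivity)]
      refine ENNReal.ofReal_le_ofReal ?_
      rw [rad_succ θ (l + 1), mul_pow]
      have : 0 ≤ (rad θ 2 ^ 4)⁻¹ * (θ ^ 4 * rad θ (l + 1) ^ 4) * δ ^ (4 / 3 : ℝ) := by
        have := hr (l + 1)
        positivity
      rw [hM, add_mul, add_mul]
      refine le_trans (le_of_eq ?_) (le_add_of_nonneg_left this)
      field_simp
      ring
    have h0 := lintegral_pressure_start (t0 := t0) hθ hθ2 hδ hδ1 hP hPN hNδ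
    have h0' := h0.trans (ENNReal.ofReal_le_ofReal (q := M * δ ^ (4 / 3 : ℝ)) (by
      gcongr
      rw [hM]
      exact le_add_of_nonneg_right (by positivity)))
    have ma : Measurable fun t => ENNReal.ofReal ((rad θ 2 ^ 3)⁻¹) *
        ∫⁻ x in ball3 x0 (rad θ 2), P (x, t) := (measurable_slice_lintegral _ hP).const_mul _
    have mh : ∀ l : ℕ, Measurable
        ((fun (l : ℕ) t => 9 * ∫⁻ x in ball3 x0 (rad θ (l + 2)), E (x, t) ^ (2 : ℝ)) l) :=
      fun l => (measurable_slice_lintegral _ (hE.pow_const (2 : ℝ))).const_mul _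
    have h1 := lintegral_pressSeq_rpow hθ (by linarith) hC1 hC2 hsmall ma mh hM0
      (by positivity : 0 < δ ^ (4 / 3 : ℝ)) h0' hh i le_rfl
    have h2 := lintegral_pressSeq hθ ma mh hL0 hδ h1
    have hg := (hgood (i + 2) (by omega) hj).1
    set r := rad θ (i + 2) with hrr
    have hr0 : 0 < r := hr _
    have h3 : ∫⁻ t in tint t0 r, pressBd θ C1 C2 x0 N P E (i + 2) t ≤
        ∫⁻ t in tint t0 r, ENNReal.ofReal (r ^ 3 * δ ^ (1 / 2 : ℝ)) *
          oscBd θ C1 C2 x0 P E i t := by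
      refine lintegral_mono_ae ?_
      filter_upwards [hg] with t ht
      rw [pressBd, if_neg hj2, Nat.add_sub_cancel]
      refine (mul_le_mul_right (ENNReal.rpow_le_rpow ht (by norm_num)) _).trans (le_of_eq ?_)
      rw [ENNReal.ofReal_rpow_of_pos (by positivity), mul_right_comm,
        ← ENNReal.ofReal_mul (by positivity)]
      congr 2
      rw [Real.mul_rpow (by positivity) hδ.le, ← mul_assoc, ← hrr]
      congr 1
      rw [← Real.rpow_natCast r 3, ← Real.rpow_mul hr0.le, ← Real.rpow_add hr0]
      norm_num
    rw [lintegral_const_mul' _ _ ENNReal.ofReal_ne_top] at h3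
    refine (mul_le_mul_right (h3.trans (mul_le_mul_right h2 _)) _).trans ?_
    rw [← ENNReal.ofReal_mul (by positivity), ← ENNReal.ofReal_mul (by positivity)]
    refine ENNReal.ofReal_le_ofReal ?_
    have e1 : r ^ (5 / 4 : ℝ) = r * r ^ (1 / 4 : ℝ) := by
      rw [show (5 / 4 : ℝ) = 1 + 1 / 4 by norm_num, Real.rpow_add hr0, Real.rpow_one]
    have e2 : δ ^ (1 / 2 : ℝ) * δ ≤ δ ^ (4 / 3 : ℝ) := by
      conv_lhs => rw [← Real.rpow_one δ, ← Real.rpow_mul hδ.le, one_mul, ← Real.rpow_add hδ]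
      exact Real.rpow_le_rpow_of_exponent_ge hδ hδ1 (by norm_num)
    calc K * (r ^ 4)⁻¹ * (r ^ 3 * δ ^ (1 / 2 : ℝ) * (L ^ (3 / 4 : ℝ) * r ^ (5 / 4 : ℝ) * δ))
        = K * L ^ (3 / 4 : ℝ) * r ^ (1 / 4 : ℝ) * (δ ^ (1 / 2 : ℝ) * δ) := by
          rw [e1]; field_simp
      _ ≤ K * L ^ (3 / 4 : ℝ) * r ^ (1 / 4 : ℝ) * δ ^ (4 / 3 : ℝ) := by gcongr
      _ ≤ _ := by
          have : 0 ≤ K * (rad θ 2 ^ 4)⁻¹ * (rad θ 2 ^ (1 / 4 : ℝ))⁻¹ * r ^ (1 / 4 : ℝ) *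
            δ ^ (4 / 3 : ℝ) := by positivity
          linarith

lemma cyl_subset {θ : ℝ} (hθ : 0 < θ) (hθ1 : θ ≤ 1) (x0 : E3) (t0 : ℝ) (j : ℕ) :
    cyl θ x0 t0 j ⊆ cyl θ x0 t0 0 := by
  have h := rad_anti hθ hθ1 (Nat.zero_le j)
  exact prod_mono (Metric.ball_subset_ball h) (tint_mono t0 (rad_pos hθ j).le h)

lemma exists_lintegral_cubic_le {θ : ℝ} (hθ : 0 < θ) (hθ2 : θ ≤ 1 / 2) (CS : ℝ≥0) :
    ∃ A : ℝ, 0 < A ∧ ∀ {x0 : E3} {t0 δ : ℝ} {E G N : SpT → ℝ≥0∞} {B : Set E3}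
    {J : Set ℝ} {k : ℕ}, 0 < δ → δ ≤ 1 → Measurable E → Measurable G → Measurable N →
    (∀ z, E z ^ (3 / 2 : ℝ) ≤ 2 * N z) →
    ∫⁻ z in cyl θ x0 t0 0, N z ≤ ENNReal.ofReal (δ ^ 2) →
    SliceSobolev E G CS B J → ball3 x0 (1 / 2) ⊆ B → tint t0 (1 / 2) ⊆ J →
    (∀ j, 1 ≤ j → j ≤ k → GoodCyl E G x0 t0 (rad θ j) δ) → ∀ j ≤ k,
    ∫⁻ z in cyl θ x0 t0 j, E z ^ (3 / 2 : ℝ) ≤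
      ENNReal.ofReal (A * rad θ j ^ 5 * δ ^ (3 / 2 : ℝ)) := by
  have hr := fun j => rad_pos hθ j
  have hr1 := hr 1
  refine ⟨2 * (rad θ 1 ^ 5)⁻¹ + (CS * 2) ^ (3 / 4 : ℝ) * (θ ^ 5)⁻¹, by positivity,
    fun {x0 t0 δ E G N B J k} hδ hδ1 hE hG hN hEN hNδ hS hB hJ hgood j hj => ?_⟩
  have hrj := hr j
  by_cases hj2 : j ≤ 1
  · have hb := rad_anti hθ (by linarith : θ ≤ 1) hj2
    have h1 : ∫⁻ z in cyl θ x0 t0 j, E z ^ (3 / 2 : ℝ) ≤ ENNReal.ofReal (2 * δ ^ 2) := by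
      refine (lintegral_mono_set (cyl_subset hθ (by linarith) x0 t0 j)).trans ?_
      refine (lintegral_mono hEN).trans ?_
      rw [lintegral_const_mul _ hN, ENNReal.ofReal_mul (by norm_num)]
      exact mul_le_mul' (by simp) hNδ
    refine h1.trans (ENNReal.ofReal_le_ofReal ?_)
    have e1 : δ ^ 2 ≤ δ ^ (3 / 2 : ℝ) := by
      rw [← Real.rpow_natCast]
      exact Real.rpow_le_rpow_of_exponent_ge hδ hδ1 (by norm_num)
    have e3 : 1 ≤ (rad θ 1 ^ 5)⁻¹ * rad θ j ^ 5 := by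
      rw [inv_mul_eq_div, one_le_div (by positivity)]
      gcongr
    calc 2 * δ ^ 2 ≤ 2 * 1 * δ ^ (3 / 2 : ℝ) := by rw [mul_one]; gcongr
      _ ≤ 2 * ((rad θ 1 ^ 5)⁻¹ * rad θ j ^ 5) * δ ^ (3 / 2 : ℝ) := by gcongr
      _ ≤ _ := by
        have : 0 ≤ (CS * 2) ^ (3 / 4 : ℝ) * (θ ^ 5)⁻¹ * rad θ j ^ 5 * δ ^ (3 / 2 : ℝ) := by
          positivity
        linarith
  · obtain ⟨i, rfl⟩ : ∃ i, j = i + 2 := ⟨j - 2, by omega⟩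
    have hri := hr (i + 1)
    have h1 := ((hgood (i + 1) (by omega) (by omega)).higher hE hG hS (hr _) hδ (hr (i + 2))
        (by rw [rad_succ θ (i + 1)]; nlinarith)
        ((Metric.ball_subset_ball (rad_le_half hθ hθ2 _)).trans hB)
        ((tint_mono t0 hri.le (rad_le_half hθ hθ2 _)).trans hJ)).1
    rw [cyl, lintegral_prod_slice _ _ (hE.pow_const _)]
    refine h1.trans ?_
    have e9 : (CS * 2 : ℝ≥0∞) ^ (3 / 4 : ℝ) = ENNReal.ofReal ((CS * 2) ^ (3 / 4 : ℝ)) := by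
      rw [← ENNReal.ofReal_rpow_of_nonneg (by positivity) (by norm_num),
        ENNReal.ofReal_mul (by positivity)]
      simp
    rw [e9, ← ENNReal.ofReal_mul (by positivity)]
    refine ENNReal.ofReal_le_ofReal ?_
    rw [rad_succ θ (i + 1)]
    have : 0 ≤ 2 * (rad θ 1 ^ 5)⁻¹ * (θ * rad θ (i + 1)) ^ 5 * δ ^ (3 / 2 : ℝ) := by positivity
    rw [add_mul, add_mul]
    refine le_trans (le_of_eq ?_) (le_add_of_nonneg_left this)
    field_simp

lemma lintegral_coupling_le {θ q A δ : ℝ} (hθ : 0 < θ) (hθ2 : θ ≤ 1 / 2) (hq : 2 ≤ q) (hA : 0 < A)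
    (hδ : 0 < δ) (hδ1 : δ ≤ 1) {x0 : E3} {t0 : ℝ} {j : ℕ} {E N D : SpT → ℝ≥0∞}
    (hE : Measurable E) (hN : Measurable N)
    (hD : ∀ z, D z ≤ N z ^ (2 / q) * (E z ^ (3 / 2 : ℝ)) ^ (1 - 2 / q))
    (hNδ : ∫⁻ z in cyl θ x0 t0 0, N z ≤ ENNReal.ofReal (δ ^ 2))
    (hEδ : ∫⁻ z in cyl θ x0 t0 j, E z ^ (3 / 2 : ℝ) ≤
      ENNReal.ofReal (A * rad θ j ^ 5 * δ ^ (3 / 2 : ℝ))) :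
    ENNReal.ofReal ((rad θ j ^ 3)⁻¹) * ∫⁻ z in cyl θ x0 t0 j, D z ≤
      ENNReal.ofReal (A ^ (1 - 2 / q) * rad θ j ^ (2 - 10 / q) * δ ^ (4 / 3 : ℝ)) := by
  have hr := rad_pos hθ j
  have hq0 : 0 < q := by linarith
  have hq1 : 0 ≤ 2 / q := by positivity
  have hq2 : 0 ≤ 1 - 2 / q := by rw [sub_nonneg, div_le_one hq0]; exact hq
  have h1 := ENNReal.lintegral_mul_norm_pow_le (μ := volume.restrict (cyl θ x0 t0 j))
    hN.aemeasurable (hE.pow_const (3 / 2 : ℝ)).aemeasurable hq1 hq2 (by ring)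
  have hN' := (lintegral_mono_set (cyl_subset hθ (by linarith) x0 t0 j)).trans hNδ
  have h2 := (lintegral_mono hD).trans (h1.trans (mul_le_mul' (ENNReal.rpow_le_rpow hN' hq1)
    (ENNReal.rpow_le_rpow hEδ hq2)))
  refine (mul_le_mul_right h2 _).trans ?_
  rw [ENNReal.ofReal_rpow_of_pos (by positivity), ENNReal.ofReal_rpow_of_pos (by positivity),
    ← ENNReal.ofReal_mul (by positivity), ← ENNReal.ofReal_mul (by positivity)]
  refine ENNReal.ofReal_le_ofReal ?_
  have e1 : (rad θ j ^ 3)⁻¹ * (rad θ j ^ 5) ^ (1 - 2 / q) = rad θ j ^ (2 - 10 / q) := by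
    rw [← Real.rpow_natCast, ← Real.rpow_natCast, ← Real.rpow_neg hr.le, ← Real.rpow_mul hr.le,
      ← Real.rpow_add hr]
    congr 1
    push_cast
    ring
  have e2 : (δ ^ 2) ^ (2 / q) * (δ ^ (3 / 2 : ℝ)) ^ (1 - 2 / q) ≤ δ ^ (4 / 3 : ℝ) := by
    rw [← Real.rpow_natCast, ← Real.rpow_mul hδ.le, ← Real.rpow_mul hδ.le, ← Real.rpow_add hδ]
    refine Real.rpow_le_rpow_of_exponent_ge hδ hδ1 ?_
    have : 2 / q = 2 * (1 / q) := by ring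
    push_cast
    linarith
  rw [Real.mul_rpow (by positivity) (by positivity), Real.mul_rpow hA.le (by positivity)]
  calc _ = A ^ (1 - 2 / q) * ((rad θ j ^ 3)⁻¹ * (rad θ j ^ 5) ^ (1 - 2 / q)) *
        ((δ ^ 2) ^ (2 / q) * (δ ^ (3 / 2 : ℝ)) ^ (1 - 2 / q)) := by ring
    _ ≤ _ := by rw [e1]; gcongr

lemma lintegral_cyl_zero_le {θ δ : ℝ} (hδ : 0 < δ) {x0 : E3} {t0 : ℝ} {E N : SpT → ℝ≥0∞}
    (hE : Measurable E) (hN : Measurable N) (hEN : ∀ z, E z ^ (3 / 2 : ℝ) ≤ 2 * N z)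
    (hNδ : ∫⁻ z in cyl θ x0 t0 0, N z ≤ ENNReal.ofReal (δ ^ 2)) :
    ∫⁻ z in cyl θ x0 t0 0, E z ≤ ENNReal.ofReal (2 * δ ^ (4 / 3 : ℝ)) := by
  have hv : volume (cyl θ x0 t0 0) ≤ 1 := by
    rw [cyl, Measure.volume_eq_prod, Measure.prod_prod, volume_tint, rad_zero]
    refine (mul_le_mul_left (volume_ball3_le x0 (by norm_num)) _).trans ?_
    rw [← ENNReal.ofReal_mul (by norm_num), ← ENNReal.ofReal_one]
    exact ENNReal.ofReal_le_ofReal (by norm_num)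
  have := lintegral_rpow_le_rpow (volume.restrict (cyl θ x0 t0 0))
    (hE.pow_const (3 / 2 : ℝ)).aemeasurable (a := 2 / 3) (by norm_num) (by norm_num)
  simp only [← ENNReal.rpow_mul, show (3 / 2 * (2 / 3) : ℝ) = 1 by norm_num, ENNReal.rpow_one,
    Measure.restrict_apply_univ] at this
  have h2 := this.trans (mul_le_mul_right (ENNReal.rpow_le_one hv (by norm_num)) _)
  rw [mul_one] at h2
  have h3 : ∫⁻ z in cyl θ x0 t0 0, E z ^ (3 / 2 : ℝ) ≤ ENNReal.ofReal (2 * δ ^ 2) := by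
    refine (lintegral_mono hEN).trans ?_
    rw [lintegral_const_mul _ hN, ENNReal.ofReal_mul (by norm_num)]
    exact mul_le_mul' (by simp) hNδ
  refine h2.trans ((ENNReal.rpow_le_rpow h3 (by norm_num)).trans ?_)
  rw [ENNReal.ofReal_rpow_of_pos (by positivity)]
  refine ENNReal.ofReal_le_ofReal ?_
  rw [Real.mul_rpow (by norm_num) (by positivity), ← Real.rpow_natCast δ 2, ← Real.rpow_mul hδ.le]
  have : (2 : ℝ) ^ (2 / 3 : ℝ) ≤ 2 := by
    conv_rhs => rw [← Real.rpow_one 2]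
    exact Real.rpow_le_rpow_of_exponent_le (by norm_num) (by norm_num)
  norm_num at this ⊢
  gcongr

lemma sum_rad_rpow_le {θ κ : ℝ} (hθ : 0 < θ) (hθ2 : θ ≤ 1 / 2) (hκ : 0 < κ) (n : ℕ) :
    ∑ j ∈ Finset.range n, rad θ j ^ κ ≤ (1 - θ ^ κ)⁻¹ := by
  have h1 : θ ^ κ < 1 := Real.rpow_lt_one hθ.le (by linarith) hκ
  have h0 : 0 ≤ θ ^ κ := by positivity
  calc ∑ j ∈ Finset.range n, rad θ j ^ κ ≤ ∑ j ∈ Finset.range n, (θ ^ κ) ^ j := by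
        refine Finset.sum_le_sum fun j _ => ?_
        rw [← Real.rpow_natCast, ← Real.rpow_mul hθ.le, mul_comm κ, Real.rpow_mul hθ.le,
          Real.rpow_natCast, rad]
        have := pow_pos hθ j
        exact Real.rpow_le_rpow (by positivity) (by linarith) hκ.le
    _ ≤ ∑' j, (θ ^ κ) ^ j :=
        (summable_geometric_of_lt_one h0 h1).sum_le_tsum _ fun _ _ => by positivity
    _ = _ := tsum_geometric_of_lt_one h0 h1

lemma sum_ofReal_rad_le {θ κ A X : ℝ} (hθ : 0 < θ) (hθ2 : θ ≤ 1 / 2) (hκ : 0 < κ) (hA : 0 ≤ A)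
    (hX : 0 ≤ X) {n : ℕ} {F : ℕ → ℝ≥0∞}
    (hF : ∀ j < n, F j ≤ ENNReal.ofReal (A * rad θ j ^ κ * X)) :
    ∑ j ∈ Finset.range n, F j ≤ ENNReal.ofReal (A * (1 - θ ^ κ)⁻¹ * X) := by
  refine (Finset.sum_le_sum fun j hj => hF j (Finset.mem_range.1 hj)).trans ?_
  rw [← ENNReal.ofReal_sum_of_nonneg fun j _ => by have := rad_pos hθ j; positivity]
  refine ENNReal.ofReal_le_ofReal ?_
  rw [← Finset.sum_mul, ← Finset.mul_sum]
  gcongr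
  exact sum_rad_rpow_le hθ hθ2 hκ n

lemma setLIntegral_Ioo_le_of_ae {f : ℝ → ℝ≥0∞} {a b : ℝ} (hab : a < b) {M : ℝ≥0∞}
    (h : ∀ᵐ s ∂(volume.restrict (Ioo a b)), ∫⁻ t in Ioo a s, f t ≤ M) :
    ∫⁻ t in Ioo a b, f t ≤ M := by
  have hex : ∀ n : ℕ, ∃ s, max a (b - 1 / (n + 1)) < s ∧ s < b ∧ ∫⁻ t in Ioo a s, f t ≤ M := by
    intro n
    have hlt : max a (b - 1 / ((n : ℝ) + 1)) < b :=
      max_lt hab (by have : (0 : ℝ) < 1 / (n + 1) := by positivity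
                     linarith)
    have h' := ae_restrict_of_ae_restrict_of_subset
      (Ioo_subset_Ioo_left (le_max_left a (b - 1 / ((n : ℝ) + 1)))) h
    have : (volume.restrict (Ioo (max a (b - 1 / ((n : ℝ) + 1))) b)) ≠ 0 := by
      rw [Ne, Measure.restrict_eq_zero, Real.volume_Ioo, ENNReal.ofReal_eq_zero]
      linarith
    have : NeBot (ae (volume.restrict (Ioo (max a (b - 1 / ((n : ℝ) + 1))) b))) := ae_neBot.2 this
    obtain ⟨s, hs, hm⟩ := (h'.and (ae_restrict_mem measurableSet_Ioo)).exists
    exact ⟨s, hm.1, hm.2, hs⟩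
  choose s hs1 hs2 hs3 using hex
  have hU : Ioo a b = ⋃ n, Ioo a (s n) := by
    ext t
    simp only [mem_Ioo, mem_iUnion]
    refine ⟨fun ⟨h1, h2⟩ => ?_, fun ⟨n, h1, h2⟩ => ⟨h1, h2.trans (hs2 n)⟩⟩
    obtain ⟨n, hn⟩ := exists_nat_one_div_lt (sub_pos.2 h2)
    refine ⟨n, h1, ?_⟩
    have := (le_max_right _ _).trans_lt (hs1 n)
    linarith
  rw [hU, setLIntegral_iUnion_of_directed]
  · exact iSup_le hs3
  · intro n m
    rcases le_total (s n) (s m) with h | h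
    · exact ⟨m, Ioo_subset_Ioo_right h, le_rfl⟩
    · exact ⟨n, le_rfl, Ioo_subset_Ioo_right h⟩

/-- Bound for the pressure functional applied to the level test functions, a.e. in time. -/
def PressAt (θ C1 C2 K : ℝ) (xb : E3) (N P E : SpT → ℝ≥0∞) (Pr : (SpT → ℝ) → ℝ → ℝ≥0∞)
    (t : ℝ) : Prop :=
  ∀ (x0 : E3) (t0 : ℝ) (k : ℕ), t < t0 → ball3 x0 (1 / 2) ⊆ ball3 xb 1 →
    (3 ≤ k → t ∈ tint t0 (rad θ 3) → ∫⁻ x in ball3 x0 (rad θ 2), E (x, t) ^ (2 : ℝ) < ∞) →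
    Pr (testFn x0 t0 (rad θ (k + 1))) t ≤
      ∑ j ∈ Finset.range (k + 1), ENNReal.ofReal (K * (rad θ j ^ 4)⁻¹) *
        (tint t0 (rad θ j)).indicator (pressBd θ C1 C2 x0 N P E j) t

lemma lintegral_pressAt_le {θ C1 C2 K : ℝ} (hθ : 0 < θ) (hθ2 : θ ≤ 1 / 2) {xb : E3} {tb : ℝ}
    {E G N P : SpT → ℝ≥0∞} {Pr : (SpT → ℝ) → ℝ → ℝ≥0∞} {CS : ℝ≥0} (hE : Measurable E)
    (hG : Measurable G) (hN : Measurable N) (hP : Measurable P)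
    (hPr : ∀ᵐ t ∂(volume.restrict (Ioo (tb - 1) tb)), PressAt θ C1 C2 K xb N P E Pr t)
    (hS : SliceSobolev E G CS (ball3 xb 1) (Ioo (tb - 1) tb)) {x0 : E3} {t0 δ : ℝ} (hδ : 0 < δ)
    {k : ℕ} (hB : ball3 x0 (1 / 2) ⊆ ball3 xb 1) (ht0 : tb - 3 / 4 ≤ t0) (ht1 : t0 ≤ tb)
    (hgood : ∀ j, 1 ≤ j → j ≤ k → GoodCyl E G x0 t0 (rad θ j) δ) :
    ∫⁻ t in Ioo (tb - 1) t0, Pr (testFn x0 t0 (rad θ (k + 1))) t ≤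
      ∑ j ∈ Finset.range (k + 1), ENNReal.ofReal (K * (rad θ j ^ 4)⁻¹) *
        ∫⁻ t in tint t0 (rad θ j), pressBd θ C1 C2 x0 N P E j t := by
  have hr := fun j => rad_pos hθ j
  have hJ : tint t0 (1 / 2) ⊆ Ioo (tb - 1) tb := Ioo_subset_Ioo (by norm_num; linarith) ht1
  have hfin : ∀ᵐ t : ℝ, 3 ≤ k → t ∈ tint t0 (rad θ 3) →
      ∫⁻ x in ball3 x0 (rad θ 2), E (x, t) ^ (2 : ℝ) < ∞ := by
    by_cases hk : 3 ≤ k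
    · have h := ((hgood 1 le_rfl (by omega)).higher hE hG hS (hr 1) hδ (hr 2)
        (by rw [rad_succ θ 1]; nlinarith [hr 1])
        ((Metric.ball_subset_ball (rad_le_half hθ hθ2 _)).trans hB)
        ((tint_mono t0 (hr 1).le (rad_le_half hθ hθ2 _)).trans hJ)).2.2
      rw [ae_restrict_iff' (show MeasurableSet (tint t0 (rad θ 2)) from measurableSet_Ioo)] at h
      filter_upwards [h] with t ht _ h3
      exact ht (tint_mono t0 (hr 3).le (rad_anti hθ (by linarith) (by norm_num)) h3)
    · exact Eventually.of_forall fun t h => absurd h hk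
  have hm : ∀ j, Measurable fun t => ENNReal.ofReal (K * (rad θ j ^ 4)⁻¹) *
        (tint t0 (rad θ j)).indicator (pressBd θ C1 C2 x0 N P E j) t := fun j =>
    ((measurable_pressBd θ C1 C2 x0 hN hP hE j).indicator measurableSet_Ioo).const_mul _
  have h1 : ∀ᵐ t ∂(volume.restrict (Ioo (tb - 1) t0)), Pr (testFn x0 t0 (rad θ (k + 1))) t ≤
      ∑ j ∈ Finset.range (k + 1), ENNReal.ofReal (K * (rad θ j ^ 4)⁻¹) *
        (tint t0 (rad θ j)).indicator (pressBd θ C1 C2 x0 N P E j) t := by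
    filter_upwards [ae_restrict_of_ae_restrict_of_subset (Ioo_subset_Ioo_right ht1) hPr,
      ae_restrict_of_ae hfin, ae_restrict_mem measurableSet_Ioo] with t h1 h2 h3
    exact h1 x0 t0 k h3.2 hB h2
  refine (lintegral_mono_ae h1).trans ?_
  rw [lintegral_finsetSum _ fun j _ => hm j]
  refine Finset.sum_le_sum fun j _ => ?_
  rw [lintegral_const_mul' _ _ ENNReal.ofReal_ne_top]
  refine mul_le_mul_right ?_ _
  refine (lintegral_mono' Measure.restrict_le_self le_rfl).trans (le_of_eq ?_)
  exact lintegral_indicator measurableSet_Ioo _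

lemma exists_level_bound {q Cb θ C1 C2 K : ℝ} (hq : 5 < q) (hCb : 0 < Cb) (hθ : 0 < θ)
    (hθ2 : θ ≤ 1 / 2) (hC1 : 0 < C1) (hC2 : 0 < C2) (hK : 0 < K)
    (hsmall : 2 ^ (1 / 3 : ℝ) * (C1 * θ) ^ (4 / 3 : ℝ) ≤ θ / 2) (CS : ℝ≥0) :
    ∃ T : ℝ, 0 < T ∧ ∀ {xb : E3} {tb δ : ℝ} {E G N P D : SpT → ℝ≥0∞}
    {Pr : (SpT → ℝ) → ℝ → ℝ≥0∞}, 0 < δ → δ ≤ 1 → Measurable E → Measurable G → Measurable N →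
    Measurable P → Measurable D →
    (∀ z, E z ^ (3 / 2 : ℝ) ≤ 2 * N z) → (∀ z, P z ^ (3 / 2 : ℝ) ≤ N z) →
    (∀ z, D z ≤ N z ^ (2 / q) * (E z ^ (3 / 2 : ℝ)) ^ (1 - 2 / q)) →
    ∫⁻ z in ball3 xb 1 ×ˢ Ioo (tb - 1) tb, N z ≤ ENNReal.ofReal (δ ^ 2) →
    SliceSobolev E G CS (ball3 xb 1) (Ioo (tb - 1) tb) →
    (∀ᵐ t ∂(volume.restrict (Ioo (tb - 1) tb)), PressAt θ C1 C2 K xb N P E Pr t) →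
    (∀ᵐ t ∂(volume.restrict (Ioo (tb - 1) tb)), EnergyAt xb tb Cb E G D Pr t) →
    ∀ (x0 : E3) (t0 : ℝ) (k : ℕ), ball3 x0 (1 / 2) ⊆ ball3 xb 1 → tb - 3 / 4 ≤ t0 → t0 ≤ tb →
    (∀ j, 1 ≤ j → j ≤ k → GoodCyl E G x0 t0 (rad θ j) δ) →
    ∀ᵐ s ∂(volume.restrict (tint t0 (rad θ (k + 1)))),
    ENNReal.ofReal ((rad θ (k + 1) ^ 3)⁻¹) * ((∫⁻ x in ball3 x0 (rad θ (k + 1)), E (x, s)) +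
      ∫⁻ τ in Ioo (t0 - rad θ (k + 1) ^ 2) s, ∫⁻ x in ball3 x0 (rad θ (k + 1)), G (x, τ)) ≤
    ENNReal.ofReal (T * δ ^ (4 / 3 : ℝ)) := by
  obtain ⟨CE, hCE, HE⟩ := exists_energy_level
  obtain ⟨A1, hA1, H1⟩ := exists_lintegral_pressBd_le hθ hθ2 hC1 hC2 hK hsmall CS
  obtain ⟨A2, hA2, H2⟩ := exists_lintegral_cubic_le hθ hθ2 CS
  have hκ : 0 < 2 - 10 / q := by
    rw [sub_pos, div_lt_iff₀ (by linarith)]; linarith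
  have hS0 : ∀ {a : ℝ}, 0 < a → 0 < (1 - θ ^ a)⁻¹ := fun {a} ha => by
    have := Real.rpow_lt_one hθ.le (by linarith) ha
    exact inv_pos.2 (by linarith)
  have s1 := hS0 one_pos
  have s2 := hS0 hκ
  have s3 := hS0 (by norm_num : (0 : ℝ) < 1 / 4)
  set S1 := A2 * (1 - θ ^ (1 : ℝ))⁻¹ with hS1
  set S2 := A2 ^ (1 - 2 / q) * (1 - θ ^ (2 - 10 / q))⁻¹ with hS2
  set S3 := A1 * (1 - θ ^ (1 / 4 : ℝ))⁻¹ with hS3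
  have p1 : 0 < S1 := by positivity
  have p2 : 0 < S2 := by positivity
  have p3 : 0 < S3 := by positivity
  refine ⟨CE * (Cb * (CE * 2 + 2 * (CE * (θ ^ 4)⁻¹) * S1 + CE * (θ ^ 3)⁻¹ * S2 + S3)),
    by positivity, fun {xb tb δ E G N P D Pr} hδ hδ1 hE hG hN hP hD hEN hPN hDN hNδ hS hPr hen
      x0 t0 k hB ht0 ht1 hgood => ?_⟩
  have hr := fun j => rad_pos hθ j
  have hJ : tint t0 (1 / 2) ⊆ Ioo (tb - 1) tb := Ioo_subset_Ioo (by norm_num; linarith) ht1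
  have hNc : ∫⁻ z in cyl θ x0 t0 0, N z ≤ ENNReal.ofReal (δ ^ 2) := by
    refine (lintegral_mono_set ?_).trans hNδ
    rw [cyl, rad_zero]
    exact prod_mono hB hJ
  have hNc' : ∫⁻ t in tint t0 (rad θ 0), ∫⁻ x in ball3 x0 (rad θ 0), N (x, t) ≤
      ENNReal.ofReal (δ ^ 2) := by
    rw [cyl, lintegral_prod_slice _ _ hN] at hNc
    exact hNc
  have b1 := H1 hδ hδ1 hE hG hP hPN hNc' hS hB hJ hgood
  have b2 := H2 hδ hδ1 hE hG hN hEN hNc hS hB hJ hgood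
  set X := δ ^ (4 / 3 : ℝ) with hX
  have hX0 : 0 < X := by positivity
  have q0 := lintegral_cyl_zero_le (θ := θ) (x0 := x0) (t0 := t0) hδ hE hN hEN hNc
  have q1 : ∑ j ∈ Finset.range (k + 1), ENNReal.ofReal ((rad θ j ^ 4)⁻¹) *
      ∫⁻ z in cyl θ x0 t0 j, E z ^ (3 / 2 : ℝ) ≤ ENNReal.ofReal (S1 * X) := by
    refine sum_ofReal_rad_le hθ hθ2 one_pos hA2.le hX0.le fun j hj => ?_
    refine (mul_le_mul_right (b2 j (by omega)) _).trans ?_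
    have := hr j
    rw [← ENNReal.ofReal_mul (by positivity), Real.rpow_one]
    refine ENNReal.ofReal_le_ofReal ?_
    have e : δ ^ (3 / 2 : ℝ) ≤ X := Real.rpow_le_rpow_of_exponent_ge hδ hδ1 (by norm_num)
    calc _ = A2 * rad θ j * δ ^ (3 / 2 : ℝ) := by field_simp
      _ ≤ _ := by gcongr
  have q2 : ∑ j ∈ Finset.range (k + 1), ENNReal.ofReal ((rad θ j ^ 3)⁻¹) *
      ∫⁻ z in cyl θ x0 t0 j, D z ≤ ENNReal.ofReal (S2 * X) :=
    sum_ofReal_rad_le hθ hθ2 hκ (by positivity) hX0.le fun j hj =>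
      lintegral_coupling_le hθ hθ2 (by linarith) hA2 hδ hδ1 hE hN hDN hNc (b2 j (by omega))
  have q3 := (lintegral_pressAt_le hθ hθ2 hE hG hN hP hPr hS hδ hB ht0 ht1 hgood).trans
    (sum_ofReal_rad_le hθ hθ2 (by norm_num : (0 : ℝ) < 1 / 4) hA1.le hX0.le fun j hj =>
      b1 j (by omega))
  rw [← hS3] at q3
  filter_upwards [ae_restrict_of_ae_restrict_of_subset
    ((tint_mono t0 (hr (k + 1)).le (rad_le_half hθ hθ2 _)).trans hJ) hen,
    ae_restrict_mem measurableSet_Ioo] with s hs hsm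
  refine (HE xb tb Cb E G D Pr s hE hD hs x0 t0 θ k hθ hθ2 hB ht0 hsm).trans ?_
  refine (mul_le_mul_right (mul_le_mul_right (add_le_add (add_le_add (add_le_add
    (mul_le_mul_right q0 _) (mul_le_mul_right q1 _)) (mul_le_mul_right q2 _)) q3) _) _).trans
    (le_of_eq ?_)
  rw [show (2 : ℝ≥0∞) = ENNReal.ofReal 2 by simp]
  rw [← ENNReal.ofReal_mul (by positivity), ← ENNReal.ofReal_mul (by positivity),
    ← ENNReal.ofReal_mul (by positivity), ← ENNReal.ofReal_mul (by positivity),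
    ← ENNReal.ofReal_add (by positivity) (by positivity),
    ← ENNReal.ofReal_add (by positivity) (by positivity),
    ← ENNReal.ofReal_add (by positivity) (by positivity),
    ← ENNReal.ofReal_mul (by positivity), ← ENNReal.ofReal_mul (by positivity)]
  congr 1
  ring

lemma goodCyl_of_level_bound {E G : SpT → ℝ≥0∞} {x0 : E3} {t0 r T δ : ℝ} (hr : 0 < r) (hT : 0 < T)
    (hδ : 0 < δ) (hδT : δ ≤ (T⁻¹) ^ 3)
    (h : ∀ᵐ s ∂(volume.restrict (tint t0 r)), ENNReal.ofReal ((r ^ 3)⁻¹) *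
      ((∫⁻ x in ball3 x0 r, E (x, s)) +
        ∫⁻ τ in Ioo (t0 - r ^ 2) s, ∫⁻ x in ball3 x0 r, G (x, τ)) ≤
      ENNReal.ofReal (T * δ ^ (4 / 3 : ℝ))) : GoodCyl E G x0 t0 r δ := by
  have hTδ : T * δ ^ (4 / 3 : ℝ) ≤ δ := by
    have h1 : δ ^ (1 / 3 : ℝ) ≤ T⁻¹ := by
      refine (Real.rpow_le_rpow hδ.le hδT (by norm_num)).trans (le_of_eq ?_)
      rw [← Real.rpow_natCast, ← Real.rpow_mul (by positivity)]
      norm_num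
    rw [show (4 / 3 : ℝ) = 1 + 1 / 3 by norm_num, Real.rpow_add hδ, Real.rpow_one]
    calc T * (δ * δ ^ (1 / 3 : ℝ)) ≤ T * (δ * T⁻¹) := by gcongr
      _ = δ := by field_simp
  have h' : ∀ᵐ s ∂(volume.restrict (tint t0 r)), (∫⁻ x in ball3 x0 r, E (x, s)) +
        ∫⁻ τ in Ioo (t0 - r ^ 2) s, ∫⁻ x in ball3 x0 r, G (x, τ) ≤ ENNReal.ofReal (r ^ 3 * δ) := by
    filter_upwards [h] with s hs
    have h2 := mul_le_mul_right (hs.trans (ENNReal.ofReal_le_ofReal hTδ)) (ENNReal.ofReal (r ^ 3))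
    rwa [← mul_assoc, ← ENNReal.ofReal_mul (by positivity), mul_inv_cancel₀ (by positivity),
      ENNReal.ofReal_one, one_mul, ← ENNReal.ofReal_mul (by positivity)] at h2
  refine ⟨?_, ?_⟩
  · filter_upwards [h'] with s hs using le_self_add.trans hs
  · refine setLIntegral_Ioo_le_of_ae (by nlinarith [sq_pos_of_pos hr]) ?_
    filter_upwards [h'] with s hs using le_add_self.trans hs

lemma enDen_rpow_le (u d : SpT → E3) (p : SpT → ℝ) (Dd : SpT → Fin 3 → Fin 3 → ℝ) (q : ℝ)
    (z : SpT) : enDen u Dd z ^ (3 / 2 : ℝ) ≤ 2 * e3Den u d p Dd q z := by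
  have hn := nsq2_nonneg (Dd z)
  set b := Real.sqrt (nsq2 (Dd z)) with hb
  have hb2 : nsq2 (Dd z) = b ^ 2 := (Real.sq_sqrt hn).symm
  have hb0 : 0 ≤ b := Real.sqrt_nonneg _
  have h := ENNReal.rpow_add_le_mul_rpow_add_rpow (ENNReal.ofReal (‖u z‖ ^ 2))
    (ENNReal.ofReal (b ^ 2)) (by norm_num : (1 : ℝ) ≤ 3 / 2)
  have e : ∀ {a : ℝ}, 0 ≤ a → (ENNReal.ofReal (a ^ 2)) ^ (3 / 2 : ℝ) = ENNReal.ofReal (a ^ 3) := by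
    intro a ha
    rw [ENNReal.ofReal_rpow_of_nonneg (by positivity) (by norm_num)]
    congr 1
    rw [← Real.rpow_natCast, ← Real.rpow_natCast, ← Real.rpow_mul ha]
    norm_num
  rw [e (norm_nonneg _), e hb0, ← ENNReal.ofReal_add (by positivity) (by positivity),
    ← ENNReal.ofReal_add (by positivity) (by positivity), ← hb2] at h
  refine h.trans (mul_le_mul' ?_ (ENNReal.ofReal_le_ofReal (le_e3Re u d p Dd q z).2.1))
  conv_rhs => rw [← ENNReal.rpow_one 2]
  exact ENNReal.rpow_le_rpow_of_exponent_le (by norm_num) (by norm_num)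

lemma enorm_rpow_le (u d : SpT → E3) (p : SpT → ℝ) (Dd : SpT → Fin 3 → Fin 3 → ℝ) (q : ℝ)
    (z : SpT) : ‖p z‖ₑ ^ (3 / 2 : ℝ) ≤ e3Den u d p Dd q z := by
  rw [← ofReal_norm, ENNReal.ofReal_rpow_of_nonneg (norm_nonneg _) (by norm_num), Real.norm_eq_abs]
  refine ENNReal.ofReal_le_ofReal ?_
  have h := (le_e3Re u d p Dd q z).1
  have : 0 ≤ ‖u z‖ ^ 3 := by positivity
  linarith

lemma dirDen_le (u d : SpT → E3) (p : SpT → ℝ) (Dd : SpT → Fin 3 → Fin 3 → ℝ) {q : ℝ} (hq : 2 ≤ q)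
    (z : SpT) : dirDen d Dd z ≤
      e3Den u d p Dd q z ^ (2 / q) * (enDen u Dd z ^ (3 / 2 : ℝ)) ^ (1 - 2 / q) := by
  have hn := nsq2_nonneg (Dd z)
  set b := Real.sqrt (nsq2 (Dd z)) with hb
  have hb2 : nsq2 (Dd z) = b ^ 2 := (Real.sq_sqrt hn).symm
  have hb0 : 0 ≤ b := Real.sqrt_nonneg _
  rcases hb0.eq_or_lt with h0 | h0
  · simp [dirDen, hb2, ← h0]
  have hq0 : 0 < q := by linarith
  have hq1 : 0 ≤ 2 / q := by positivity
  have hq2 : 0 ≤ 1 - 2 / q := by rw [sub_nonneg, div_le_one hq0]; exact hq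
  have h1 : ENNReal.ofReal (‖d z‖ ^ q * b ^ (3 * (1 - q / 6))) ≤ e3Den u d p Dd q z :=
    ENNReal.ofReal_le_ofReal (le_e3Re u d p Dd q z).2.2
  have h2 : ENNReal.ofReal (b ^ 2) ≤ enDen u Dd z :=
    ENNReal.ofReal_le_ofReal (by rw [hb2]; exact le_add_of_nonneg_left (by positivity))
  refine le_trans (le_of_eq ?_) (mul_le_mul' (ENNReal.rpow_le_rpow h1 hq1)
    (ENNReal.rpow_le_rpow (ENNReal.rpow_le_rpow h2 (by norm_num)) hq2))
  rw [ENNReal.ofReal_rpow_of_nonneg (by positivity) hq1,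
    ENNReal.ofReal_rpow_of_nonneg (by positivity) (by norm_num),
    ENNReal.ofReal_rpow_of_nonneg (by positivity) hq2, ← ENNReal.ofReal_mul (by positivity), dirDen,
    hb2, Real.mul_rpow (by positivity) (by positivity), ← Real.rpow_mul (norm_nonneg _),
    ← Real.rpow_mul hb0, ← Real.rpow_natCast b, ← Real.rpow_mul hb0, ← Real.rpow_mul hb0, mul_assoc,
    ← Real.rpow_add h0, mul_div_cancel₀ _ hq0.ne', Real.rpow_two]
  congr 3
  push_cast
  field_simp
  ring

lemma exists_ratio {C1 : ℝ} (hC1 : 0 < C1) : ∃ θ : ℝ, 0 < θ ∧ θ ≤ 1 / 2 ∧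
    2 ^ (1 / 3 : ℝ) * (C1 * θ) ^ (4 / 3 : ℝ) ≤ θ / 2 := by
  set a := 2 * 2 ^ (1 / 3 : ℝ) * C1 ^ (4 / 3 : ℝ) with ha
  have ha0 : 0 < a := by positivity
  refine ⟨min (1 / 2) ((a⁻¹) ^ 3), by positivity, min_le_left _ _, ?_⟩
  set θ := min (1 / 2) ((a⁻¹) ^ 3) with hθ
  have hθ0 : 0 < θ := by positivity
  have h1 : θ ^ (1 / 3 : ℝ) ≤ a⁻¹ := by
    refine (Real.rpow_le_rpow hθ0.le (min_le_right _ _) (by norm_num)).trans (le_of_eq ?_)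
    rw [← Real.rpow_natCast, ← Real.rpow_mul (by positivity)]
    norm_num
  rw [Real.mul_rpow hC1.le hθ0.le]
  have e : θ ^ (4 / 3 : ℝ) = θ * θ ^ (1 / 3 : ℝ) := by
    rw [show (4 / 3 : ℝ) = 1 + 1 / 3 by norm_num, Real.rpow_add hθ0, Real.rpow_one]
  rw [e]
  calc 2 ^ (1 / 3 : ℝ) * (C1 ^ (4 / 3 : ℝ) * (θ * θ ^ (1 / 3 : ℝ))) =
      a * θ ^ (1 / 3 : ℝ) * (θ / 2) := by rw [ha]; ring
    _ ≤ a * a⁻¹ * (θ / 2) := by gcongr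
    _ = θ / 2 := by rw [mul_inv_cancel₀ ha0.ne', one_mul]

lemma exists_goodCyl {q Cb : ℝ} (hq : 5 < q) (hCb : 0 < Cb) :
    ∃ θ : ℝ, 0 < θ ∧ θ ≤ 1 / 2 ∧ ∃ δ0 : ℝ, 0 < δ0 ∧ ∀ δ : ℝ, 0 < δ → δ ≤ δ0 →
    ∀ {xb : E3} {tb ρb : ℝ} {u d : SpT → E3} {p : SpT → ℝ} {Du Dd : SpT → Fin 3 → Fin 3 → ℝ}
      {D2d : SpT → Fin 3 → Fin 3 → Fin 3 → ℝ}, ρb ∈ Ioc (0 : ℝ) 1 →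
    QReg xb tb u d p Du Dd D2d → DivFreeOn (Qcyl (xb, tb) 1) u →
    PressureEqOn (Qcyl (xb, tb) 1) u p Dd → LocalEnergyQ xb tb Cb ρb u d p Du Dd D2d →
    E3q xb tb u d p Dd q ≤ ENNReal.ofReal (δ ^ 2) →
    ∀ (x0 : E3) (t0 : ℝ), ball3 x0 (1 / 2) ⊆ ball3 xb 1 → tb - 3 / 4 ≤ t0 → t0 ≤ tb →
    ∀ k, 1 ≤ k → GoodCyl (enDen u Dd) (disDen Du D2d) x0 t0 (rad θ k) δ := by
  obtain ⟨C1, hC1, HP⟩ := exists_pressure_time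
  obtain ⟨CS, HS⟩ := exists_sliceSobolev
  obtain ⟨θ, hθ, hθ2, hsmall⟩ := exists_ratio hC1
  obtain ⟨C2, hC2, K, hK, HP⟩ := HP θ hθ hθ2
  obtain ⟨T, hT, HT⟩ := exists_level_bound hq hCb hθ hθ2 hC1 hC2 hK hsmall CS
  refine ⟨θ, hθ, hθ2, min 1 ((T⁻¹) ^ 3), by positivity, fun δ hδ hδ0 {xb tb ρb u d p Du Dd D2d}
    hρ hR hdiv hpr hL hE x0 t0 hB ht0 ht1 => ?_⟩
  have hfin : E3q xb tb u d p Dd q < ∞ := hE.trans_lt ENNReal.ofReal_lt_top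
  have hE' := hE
  rw [E3q_eq] at hE'
  have step := HT (xb := xb) (tb := tb) (G := disDen Du D2d) (P := fun z => ‖p z‖ₑ)
    (Pr := fun φ τ => ‖∫ x in ball3 xb 1, p (x, τ) * ∑ j, u (x, τ) j * sderiv j φ (x, τ)‖ₑ)
    hδ (hδ0.trans (min_le_left _ _)) (measurable_enDen hR.meas_u hR.meas_Dd)
    (measurable_disDen hR.meas_Du hR.meas_D2d)
    (measurable_e3Re q hR.meas_u hR.meas_d hR.meas_p hR.meas_Dd).ennreal_ofReal hR.meas_p.enorm
    (measurable_dirDen hR.meas_d hR.meas_Dd) (enDen_rpow_le u d p Dd q) (enorm_rpow_le u d p Dd q)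
    (dirDen_le u d p Dd (by linarith)) hE' (HS hR hfin) (HP hR hdiv hpr hfin)
    (energy_lintegral hCb hρ.1 hρ.2 hR hL hfin) x0 t0
  have ind : ∀ k, ∀ j, 1 ≤ j → j ≤ k → GoodCyl (enDen u Dd) (disDen Du D2d) x0 t0 (rad θ j) δ := by
    intro k
    induction k with
    | zero => intro j h1 h2; omega
    | succ k ih =>
      intro j h1 h2
      rcases Nat.lt_or_ge k j with h | h
      · obtain rfl : j = k + 1 := by omega
        exact goodCyl_of_level_bound (rad_pos hθ _) hT hδ (hδ0.trans (min_le_right _ _))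
          (step k hB ht0 ht1 ih)
      · exact ih j h1 h
  exact fun k hk => ind k k hk le_rfl

lemma rad_tendsto {θ : ℝ} (hθ : 0 < θ) (hθ2 : θ ≤ 1 / 2) :
    Tendsto (fun k => rad θ (k + 1)) atTop (nhds 0) := by
  have h := (tendsto_pow_atTop_nhds_zero_of_lt_one hθ.le (by linarith : θ < 1)).div_const 2
  rw [zero_div] at h
  exact (tendsto_add_atTop_iff_nat 1).2 h

lemma ae_le_of_ball_bound {f : E3 → ℝ} (hf : Integrable f) (hf0 : ∀ x, 0 ≤ f x) {xb : E3} {ρ δ : ℝ}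
    (hδ : 0 ≤ δ) {S : Set E3} (hS : Dense S) {r : ℕ → ℝ} (hr : ∀ k, 0 < r k)
    (hr0 : Tendsto r atTop (nhds 0))
    (h : ∀ w ∈ S, w ∈ ball3 xb ρ → ∀ k,
      ∫⁻ x in ball3 w (r k), ENNReal.ofReal (f x) ≤ ENNReal.ofReal (r k ^ 3 * δ)) :
    ∀ᵐ x ∂(volume.restrict (ball3 xb ρ)), f x ≤ 2 * δ := by
  filter_upwards [ae_restrict_of_ae (IsUnifLocDoublingMeasure.ae_tendsto_average (volume : Measure E3)
    hf.locallyIntegrable 1), ae_restrict_mem (measurableSet_ball3 xb ρ)] with x hx hxm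
  have hw : ∀ k, ∃ w ∈ S, w ∈ ball3 xb ρ ∧ dist x w < r k / 2 := by
    intro k
    obtain ⟨w, hw1, hw2⟩ := hS.inter_open_nonempty (ball3 xb ρ ∩ Metric.ball x (r k / 2))
      (Metric.isOpen_ball.inter Metric.isOpen_ball)
      ⟨x, hxm, Metric.mem_ball_self (by have := hr k; positivity)⟩
    exact ⟨w, hw2, hw1.1, by rw [dist_comm]; exact hw1.2⟩
  choose w hwS hwB hwd using hw
  have ht : Tendsto (fun k => r k / 2) atTop (nhdsWithin 0 (Ioi 0)) := by
    refine tendsto_nhdsWithin_iff.2 ⟨by simpa using hr0.div_const 2, Eventually.of_forall fun k => ?_⟩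
    exact half_pos (hr k)
  have hlim := hx w (fun k => r k / 2) ht (Eventually.of_forall fun k => by
    rw [Metric.mem_closedBall, one_mul]; exact (hwd k).le)
  refine le_of_tendsto hlim (Eventually.of_forall fun k => ?_)
  have hrk := hr k
  have hv : r k ^ 3 / 2 ≤ volume.real (Metric.closedBall (w k) (r k / 2)) := by
    rw [Measure.real, EuclideanSpace.volume_closedBall_fin_three, ENNReal.toReal_mul,
      ENNReal.toReal_pow, ENNReal.toReal_ofReal (by positivity),
      ENNReal.toReal_ofReal (by positivity)]
    have h3 := Real.pi_gt_three
    have : 0 < r k ^ 3 := by positivity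
    nlinarith
  have hi : ∫ y in Metric.closedBall (w k) (r k / 2), f y ≤ r k ^ 3 * δ := by
    rw [integral_eq_lintegral_of_nonneg_ae (Eventually.of_forall hf0)
      hf.aestronglyMeasurable.restrict]
    refine ENNReal.toReal_le_of_le_ofReal (by positivity) (le_trans (lintegral_mono_set ?_)
      (h (w k) (hwS k) (hwB k) k))
    exact Metric.closedBall_subset_ball (by linarith)
  rw [setAverage_eq, smul_eq_mul]
  have hv0 : 0 < r k ^ 3 / 2 := by positivity
  calc (volume.real (Metric.closedBall (w k) (r k / 2)))⁻¹ *
        ∫ y in Metric.closedBall (w k) (r k / 2), f y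
      ≤ (r k ^ 3 / 2)⁻¹ * (r k ^ 3 * δ) := by
        refine mul_le_mul (inv_anti₀ hv0 hv) hi (integral_nonneg hf0) (by positivity)
    _ = 2 * δ := by field_simp

lemma ae_prod_of_ae_ae {B : Set E3} {J : Set ℝ} {s : Set SpT} (hs : MeasurableSet s)
    (h : ∀ᵐ t ∂(volume.restrict J), ∀ᵐ x ∂(volume.restrict B), (x, t) ∈ s) :
    ∀ᵐ z ∂(volume.restrict (B ×ˢ J)), z ∈ s := by
  have hm : Measurable (sᶜ.indicator (fun _ => (1 : ℝ≥0∞)) : SpT → ℝ≥0∞) :=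
    measurable_const.indicator hs.compl
  have h0 : ∫⁻ z in B ×ˢ J, sᶜ.indicator (fun _ => (1 : ℝ≥0∞)) z = 0 := by
    rw [lintegral_prod_slice B J hm]
    refine (lintegral_congr_ae ?_).trans lintegral_zero
    filter_upwards [h] with t ht
    refine (lintegral_congr_ae ?_).trans lintegral_zero
    filter_upwards [ht] with x hx
    have hc : (x, t) ∉ sᶜ := fun hc => hc hx
    exact indicator_of_notMem hc _
  rw [lintegral_eq_zero_iff hm] at h0
  filter_upwards [h0] with z hz
  by_contra hc
  simp [hc] at hz

lemma ae_enDen_le {xb : E3} {tb θ δ : ℝ} (hθ : 0 < θ) (hθ2 : θ ≤ 1 / 2) (hδ : 0 < δ)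
    {u : SpT → E3} {Dd : SpT → Fin 3 → Fin 3 → ℝ} {G : SpT → ℝ≥0∞} (hu : Measurable u)
    (hD : Measurable Dd)
    (hi : IntegrableOn (fun z => ‖u z‖ ^ 2 + nsq2 (Dd z)) (ball3 xb 1 ×ˢ Ioo (tb - 1) tb))
    (h : ∀ (x0 : E3) (t0 : ℝ), ball3 x0 (1 / 2) ⊆ ball3 xb 1 → tb - 3 / 4 ≤ t0 → t0 ≤ tb →
      ∀ k, 1 ≤ k → GoodCyl (enDen u Dd) G x0 t0 (rad θ k) δ) :
    ∀ᵐ z ∂(volume.restrict (Qcyl (xb, tb) (1 / 2))), ‖u z‖ ^ 2 + nsq2 (Dd z) ≤ 2 * δ := by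
  have hm : Measurable fun z => ‖u z‖ ^ 2 + nsq2 (Dd z) :=
    (hu.norm.pow_const 2).add (measurable_nsq2.comp hD)
  rw [Qcyl]
  refine ae_prod_of_ae_ae (s := {z | ‖u z‖ ^ 2 + nsq2 (Dd z) ≤ 2 * δ})
    (measurableSet_le hm measurable_const) ?_
  have hball : ∀ w ∈ ball3 xb (1 / 2), ball3 w (1 / 2) ⊆ ball3 xb 1 := fun w hw =>
    Metric.ball_subset_ball' (by have := Metric.mem_ball.1 hw; linarith)
  obtain ⟨S, hSc, hSd⟩ := TopologicalSpace.exists_countable_dense E3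
  have hA : ∀ᵐ t : ℝ, ∀ w ∈ S, ∀ (a : ℚ) (k : ℕ), w ∈ ball3 xb (1 / 2) → tb - 3 / 4 ≤ a →
      (a : ℝ) ≤ tb → t ∈ tint a (rad θ (k + 1)) →
      ∫⁻ x in ball3 w (rad θ (k + 1)), enDen u Dd (x, t) ≤
        ENNReal.ofReal (rad θ (k + 1) ^ 3 * δ) := by
    refine (ae_ball_iff hSc).2 fun w _ => ae_all_iff.2 fun a => ae_all_iff.2 fun k => ?_
    by_cases hc : w ∈ ball3 xb (1 / 2) ∧ tb - 3 / 4 ≤ a ∧ (a : ℝ) ≤ tb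
    · have := (h w a (hball w hc.1) hc.2.1 hc.2.2 (k + 1) (by omega)).1
      rw [ae_restrict_iff' (show MeasurableSet (tint a (rad θ (k + 1))) from measurableSet_Ioo)]
        at this
      filter_upwards [this] with t ht _ _ _ hmem using ht hmem
    · exact Eventually.of_forall fun t h1 h2 h3 _ => absurd ⟨h1, h2, h3⟩ hc
  have hi' := hi
  rw [IntegrableOn, restrict_prod_eq] at hi'
  have hB := hi'.prod_left_ae
  have hsub : Ioo (tb - (1 / 2) ^ 2) tb ⊆ Ioo (tb - 1) tb := Ioo_subset_Ioo_left (by norm_num; linarith)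
  filter_upwards [ae_restrict_of_ae hA, ae_restrict_of_ae_restrict_of_subset hsub hB,
    ae_restrict_mem measurableSet_Ioo] with t h1 h2 ht
  have key := ae_le_of_ball_bound (xb := xb) (ρ := 1 / 2)
    (f := (ball3 xb 1).indicator fun x => ‖u (x, t)‖ ^ 2 + nsq2 (Dd (x, t)))
    ((integrable_indicator_iff (measurableSet_ball3 xb 1)).2 h2)
    (fun x => indicator_nonneg (fun x _ => add_nonneg (sq_nonneg _) (nsq2_nonneg _)) x) hδ.le hSd
    (fun k => rad_pos hθ (k + 1)) (rad_tendsto hθ hθ2) (fun w hwS hwB k => by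
      have hr := rad_pos hθ (k + 1)
      obtain ⟨a, ha1, ha2⟩ := exists_rat_btwn (show t < min tb (t + rad θ (k + 1) ^ 2) from
        lt_min ht.2 (by have := pow_pos hr 2; linarith))
      have ha3 := ha2.trans_le (min_le_left _ _)
      have ha4 := ha2.trans_le (min_le_right _ _)
      have ht1 : tb - 1 / 4 < t := by have := ht.1; norm_num at this ⊢; linarith
      refine le_trans (lintegral_mono fun x => ENNReal.ofReal_le_ofReal ?_) (h1 w hwS a k hwB
        (by linarith) ha3.le ⟨by linarith, ha1⟩)
      exact indicator_le_self' (fun _ _ => add_nonneg (sq_nonneg _) (nsq2_nonneg _)) x)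
  filter_upwards [key, ae_restrict_mem (measurableSet_ball3 xb (1 / 2))] with x hx hxm
  have hx1 : x ∈ ball3 xb 1 := Metric.ball_subset_ball (by norm_num) hxm
  rwa [indicator_of_mem hx1] at hx

/-- `L³` ε-regularity (Lemma `thma`): for each `q ∈ (5,6]` and `C̄ > 0` there is
`ε̄_q ∈ (0,1)` such that `E_{3,q} ≤ ε̄_q` implies `‖u‖_∞, ‖∇d‖_∞ ≤ ε̄_q^{2/9}` on `Q_{1/2}(z̄)`,
uniformly in `z̄` and `ρ̄ ∈ (0,1]`. -/
theorem stmt2 (q : ℝ) (hq : q ∈ Ioc (5 : ℝ) 6) (Cb : ℝ) (hCb : 0 < Cb) :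
    ∃ ε : ℝ, ε ∈ Ioo (0 : ℝ) 1 ∧
      ∀ (xb : E3) (tb ρb : ℝ), ρb ∈ Ioc (0 : ℝ) 1 →
      ∀ (u d : SpT → E3) (p : SpT → ℝ) (Du Dd : SpT → Fin 3 → Fin 3 → ℝ)
        (D2d : SpT → Fin 3 → Fin 3 → Fin 3 → ℝ),
      QReg xb tb u d p Du Dd D2d →
      DivFreeOn (Qcyl (xb, tb) 1) u →
      PressureEqOn (Qcyl (xb, tb) 1) u p Dd →
      LocalEnergyQ xb tb Cb ρb u d p Du Dd D2d →
      E3q xb tb u d p Dd q ≤ ENNReal.ofReal ε →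
      ∀ᵐ z ∂(volume.restrict (Qcyl (xb, tb) (1 / 2))),
        ‖u z‖ ≤ ε ^ ((2 : ℝ) / 9) ∧ Real.sqrt (nsq2 (Dd z)) ≤ ε ^ ((2 : ℝ) / 9) := by
  obtain ⟨θ, hθ, hθ2, δ0, hδ0, H⟩ := exists_goodCyl hq.1 hCb
  set δ := min δ0 ((1 / 2) ^ 9) with hδdef
  have hδ : 0 < δ := by positivity
  have hδ9 : δ ≤ (1 / 2) ^ 9 := min_le_right _ _
  have hδ1 : δ < 1 := hδ9.trans_lt (by norm_num)
  refine ⟨δ ^ 2, ⟨by positivity, by nlinarith⟩, fun xb tb ρb hρ u d p Du Dd D2d hR hdiv hpr hL hE =>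
    ?_⟩
  have hfin : E3q xb tb u d p Dd q < ∞ := hE.trans_lt ENNReal.ofReal_lt_top
  have hi2 := hR.l2_Dd
  rw [Qcyl_one] at hi2
  have hb : 2 * δ ≤ ((δ ^ 2) ^ ((2 : ℝ) / 9)) ^ 2 := by
    have e : ((δ ^ 2) ^ ((2 : ℝ) / 9)) ^ 2 = δ ^ (8 / 9 : ℝ) := by
      rw [← Real.rpow_natCast, ← Real.rpow_natCast, ← Real.rpow_mul hδ.le, ← Real.rpow_mul hδ.le]
      norm_num
    have h1 : δ ^ (1 / 9 : ℝ) ≤ 1 / 2 := by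
      refine (Real.rpow_le_rpow hδ.le hδ9 (by norm_num)).trans (le_of_eq ?_)
      rw [← Real.rpow_natCast, ← Real.rpow_mul (by norm_num)]
      norm_num
    have h2 : δ = δ ^ (8 / 9 : ℝ) * δ ^ (1 / 9 : ℝ) := by
      rw [← Real.rpow_add hδ]; norm_num
    rw [e]
    calc 2 * δ = 2 * (δ ^ (8 / 9 : ℝ) * δ ^ (1 / 9 : ℝ)) := by rw [← h2]
      _ ≤ 2 * (δ ^ (8 / 9 : ℝ) * (1 / 2)) := by gcongr
      _ = _ := by ring
  filter_upwards [ae_enDen_le hθ hθ2 hδ hR.meas_u hR.meas_Dd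
    ((integrableOn_normSq hR.meas_u hfin).add hi2)
    (H δ hδ (min_le_left _ _) hρ hR hdiv hpr hL hE)] with z hz
  have hn := nsq2_nonneg (Dd z)
  have hε : 0 ≤ (δ ^ 2) ^ ((2 : ℝ) / 9) := by positivity
  refine ⟨?_, ?_⟩
  · exact (sq_le_sq₀ (norm_nonneg _) hε).1 (by linarith)
  · exact (Real.sqrt_le_sqrt (by nlinarith [sq_nonneg ‖u z‖])).trans (Real.sqrt_sq hε).le
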